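/- Let 1 ≤ m ≤ d be integers and let f : S^d → ℝ^m be a continuous map from the standard unit d-sphere. Then there exists a point z ∈ ℝ^m such that for every ε > 0, the d-dimensional volume of the ε-neighborhood of f^{−1}(z) in S^d is at least the d-dimensional volume of the ε-neighborhood of the equatorial subsphere S^{d−m} in S^d. -/

import Mathlib

open MeasureTheory
open scoped RealInnerProductSpace

/-- The closed geodesic `ε`-neighborhood in the unit sphere `S^d ⊆ ℝ^(d+1)` of a
subset `A` of the sphere: points of the sphere at geodesic distance (the angle
`arccos ⟪x, y⟫`) at most `ε` from some point of `A`. -/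
def geodesicNbhd {d : ℕ} (A : Set (EuclideanSpace ℝ (Fin (d + 1)))) (ε : ℝ) :
    Set (EuclideanSpace ℝ (Fin (d + 1))) :=
  {y | y ∈ Metric.sphere (0 : EuclideanSpace ℝ (Fin (d + 1))) 1 ∧
    ∃ x ∈ A, Real.arccos ⟪x, y⟫ ≤ ε}

/-- The equatorial `(d-m)`-dimensional subsphere
`S^(d-m) = S^d ∩ (ℝ^(d-m+1) × {0}^m)` of the unit sphere in `ℝ^(d+1)`:
points of the sphere whose last `m` coordinates vanish. -/
def equatorialSubsphere (d m : ℕ) : Set (EuclideanSpace ℝ (Fin (d + 1))) :=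
  {x | x ∈ Metric.sphere (0 : EuclideanSpace ℝ (Fin (d + 1))) 1 ∧
    ∀ i : Fin (d + 1), d - m + 1 ≤ (i : ℕ) → x i = 0}

/-- `0` is a nontrivial nonnegative combination of the vectors `p i`. -/
def ZeroInHull {ι W : Type*} [Fintype ι] [AddCommGroup W] [Module ℝ W] (p : ι → W) : Prop :=
  ∃ l : ι → ℝ, (∀ i, 0 ≤ l i) ∧ l ≠ 0 ∧ ∑ i, l i • p i = 0

/-- `0` is a nontrivial nonnegative combination of the vectors `p j` with `j ≠ i`. -/
def ZeroInFace {ι W : Type*} [Fintype ι] [AddCommGroup W] [Module ℝ W] (p : ι → W) (i : ι) : Prop :=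
  ∃ l : ι → ℝ, (∀ j, 0 ≤ l j) ∧ l ≠ 0 ∧ l i = 0 ∧ ∑ j, l j • p j = 0

section Parity

variable {ι W : Type*} [Fintype ι] [AddCommGroup W] [Module ℝ W]

open Classical in
theorem eq_zero_of_two_zeros {D : ℕ} (hι : Fintype.card ι = D + 2) (p : ι → W)
    (hp : ∀ s : Finset ι, s.card ≤ D → LinearIndepOn ℝ p (s : Set ι))
    (l : ι → ℝ) (hl : ∑ j, l j • p j = 0) {a b : ι} (hab : a ≠ b) (ha : l a = 0) (hb : l b = 0) :
    l = 0 := by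
  have hs := hp (Finset.univ \ {a, b}) (by
    rw [Finset.card_sdiff_of_subset (Finset.subset_univ _), Finset.card_pair hab,
      Finset.card_univ, hι]; omega)
  rw [linearIndepOn_finset_iff] at hs
  have h0 : ∑ j ∈ Finset.univ \ {a, b}, l j • p j = 0 := by
    rw [← hl]
    apply Finset.sum_subset (Finset.subset_univ _)
    intro x _ hx
    have : x = a ∨ x = b := by
      by_contra h
      simp only [Finset.mem_sdiff, Finset.mem_univ, true_and, Finset.mem_insert,
        Finset.mem_singleton, not_not] at hx
      exact h hx
    rcases this with rfl | rfl <;> simp [*]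
  funext j
  by_cases hj : j = a ∨ j = b
  · rcases hj with rfl | rfl <;> simp [*]
  · exact hs l h0 j (by simpa using hj)

theorem exists_kernel_vector [FiniteDimensional ℝ W] {D : ℕ} (hι : Fintype.card ι = D + 2)
    (hW : Module.finrank ℝ W = D) (p : ι → W) (a : ι) :
    ∃ l : ι → ℝ, l ≠ 0 ∧ l a = 0 ∧ ∑ j, l j • p j = 0 := by
  let f : (ι → ℝ) →ₗ[ℝ] W × ℝ :=
    (Fintype.linearCombination ℝ p).prod (LinearMap.proj a)
  have hf : ¬ Function.Injective f := by
    intro hinj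
    have := LinearMap.finrank_le_finrank_of_injective hinj
    rw [Module.finrank_prod, hW, Module.finrank_self, Module.finrank_fintype_fun_eq_card, hι] at this
    omega
  rw [← LinearMap.ker_eq_bot, ← ne_eq, Submodule.ne_bot_iff] at hf
  obtain ⟨l, hl, hl0⟩ := hf
  refine ⟨l, hl0, ?_, ?_⟩
  · have := congrArg Prod.snd (LinearMap.mem_ker.1 hl)
    simpa [f] using this
  · have := congrArg Prod.fst (LinearMap.mem_ker.1 hl)
    simpa [f, Fintype.linearCombination_apply] using this

open Classical in
theorem even_card_zeroInFace [FiniteDimensional ℝ W] {D : ℕ} (hι : Fintype.card ι = D + 2)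
    (hW : Module.finrank ℝ W = D) (p : ι → W)
    (hp : ∀ s : Finset ι, s.card ≤ D → LinearIndepOn ℝ p (s : Set ι)) :
    Even (Finset.univ.filter (fun i => ZeroInFace p i)).card := by
  by_cases hne : ∃ i, ZeroInFace p i
  swap
  · push Not at hne
    simp [hne]
  obtain ⟨i, l, hl0, hln, hli, hls⟩ := hne
  have two := fun l hl => @eq_zero_of_two_zeros ι W _ _ _ D hι p hp l hl
  have hlpos : ∀ j, j ≠ i → 0 < l j := fun j hj => lt_of_le_of_ne (hl0 j) fun h =>
    hln (two l hls hj h.symm hli)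
  have : Nontrivial ι := Fintype.one_lt_card_iff_nontrivial.1 (by omega)
  obtain ⟨j0, hj0⟩ := exists_ne i
  obtain ⟨m, hmi, hms⟩ : ∃ m : ι → ℝ, 0 < m i ∧ ∑ j, m j • p j = 0 := by
    obtain ⟨m, hm0, hmj, hms⟩ := exists_kernel_vector hι hW p j0
    have hmi : m i ≠ 0 := fun h => hm0 (two m hms hj0 hmj h)
    rcases lt_or_gt_of_ne hmi with h | h
    · refine ⟨-m, by simpa using h, ?_⟩
      simp [hms]
    · exact ⟨m, h, hms⟩
  obtain ⟨i', hi', hmin⟩ := Finset.exists_min_image (Finset.univ.erase i) (fun j => m j / l j)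
    ⟨j0, by simp [hj0]⟩
  have hi'i : i' ≠ i := by simpa using hi'
  have hmin' : ∀ j, j ≠ i → m i' / l i' ≤ m j / l j := fun j hj => hmin j (by simp [hj])
  have hZ : Finset.univ.filter (fun i => ZeroInFace p i) = {i, i'} := by
    ext j
    simp only [Finset.mem_filter, Finset.mem_univ, true_and, Finset.mem_insert,
      Finset.mem_singleton]
    constructor
    · rintro ⟨l', hl'0, hl'n, hl'j, hl's⟩
      by_contra hcon
      push Not at hcon
      obtain ⟨hji, hji'⟩ := hcon
      have hl'pos : ∀ k, k ≠ j → 0 < l' k := fun k hk => lt_of_le_of_ne (hl'0 k) fun h =>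
        hl'n (two l' hl's hk h.symm hl'j)
      have key := two (fun k => (l' k * m i - l' i * m k) * l j + (l' i * m j) * l k) (by
        have : ∀ k, ((l' k * m i - l' i * m k) * l j + (l' i * m j) * l k) • p k
            = (m i * l j) • (l' k • p k) - (l' i * l j) • (m k • p k)
              + (l' i * m j) • (l k • p k) := by
          intro k; module
        simp only [this, Finset.sum_add_distrib, Finset.sum_sub_distrib, ← Finset.smul_sum]
        rw [hl's, hms, hls]; simp) hji
        (by simp only [hl'j]; ring) (by simp only [hli]; ring)
      have k1 := congrFun key i'
      simp only [Pi.zero_apply] at k1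
      have h1 := hmin' j hji
      rw [div_le_div_iff₀ (hlpos _ hi'i) (hlpos _ hji)] at h1
      have h2 := hl'pos i hji.symm
      have h3 := hl'pos i' hji'.symm
      have h4 := hlpos j hji
      have h5 : 0 < l' i' * m i * l j := by positivity
      nlinarith [mul_le_mul_of_nonneg_left h1 h2.le]
    · rintro (rfl | rfl)
      · exact ⟨l, hl0, hln, hli, hls⟩
      · refine ⟨fun k => m k - m j / l j * l k, ?_, ?_, ?_, ?_⟩
        · intro k
          by_cases hk : k = i
          · subst hk; simp [hli, hmi.le]
          · have := hmin' k hk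
            have hp := hlpos k hk
            rw [le_div_iff₀ hp] at this
            simpa using this
        · intro h
          have := congrFun h i
          simp [hli] at this
          exact hmi.ne' this
        · have := hlpos j hi'i
          field_simp
          ring
        · simp only [sub_smul, Finset.sum_sub_distrib, hms, mul_smul,
            ← Finset.smul_sum, hls, smul_zero, sub_zero]
  rw [hZ, Finset.card_pair hi'i.symm]
  exact even_two

end Parity

section ZeroInHullTopology

variable {ι W : Type*} [Fintype ι] [NormedAddCommGroup W] [NormedSpace ℝ W]

theorem zeroInHull_iff_stdSimplex (p : ι → W) :
    ZeroInHull p ↔ ∃ l ∈ stdSimplex ℝ ι, ∑ i, l i • p i = 0 := by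
  constructor
  · rintro ⟨l, hl0, hln, hls⟩
    have hpos : 0 < ∑ i, l i := by
      refine lt_of_le_of_ne (Finset.sum_nonneg fun i _ => hl0 i) fun h => hln ?_
      funext i
      exact (Finset.sum_eq_zero_iff_of_nonneg fun i _ => hl0 i).1 h.symm i (Finset.mem_univ _)
    refine ⟨fun i => (∑ i, l i)⁻¹ * l i, ⟨fun i => ?_, ?_⟩, ?_⟩
    · have := hl0 i; positivity
    · rw [← Finset.mul_sum, inv_mul_cancel₀ hpos.ne']
    · simp only [mul_smul, ← Finset.smul_sum, hls, smul_zero]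
  · rintro ⟨l, ⟨hl0, hl1⟩, hls⟩
    refine ⟨l, hl0, ?_, hls⟩
    rintro rfl
    simp at hl1

theorem isClosed_zeroInHull : IsClosed {p : ι → W | ZeroInHull p} := by
  have h : IsClosed {x : stdSimplex ℝ ι × (ι → W) | ∑ i, x.1.1 i • x.2 i = 0} :=
    isClosed_eq (continuous_finsetSum _ fun i _ => ((continuous_apply i).comp
      (continuous_subtype_val.comp continuous_fst)).smul ((continuous_apply i).comp continuous_snd))
      continuous_const
  convert isClosedMap_snd_of_compactSpace _ h using 1
  ext p
  simp only [Set.mem_ofPred_eq, zeroInHull_iff_stdSimplex, Set.mem_image, Prod.exists,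
    Subtype.exists, exists_and_right, exists_eq_right, exists_prop]

theorem eventually_zeroInHull [FiniteDimensional ℝ W] (p₀ : ι → W) (l : ι → ℝ)
    (hl : ∀ i, 0 < l i) (hl0 : ∑ i, l i • p₀ i = 0) (hι : Nonempty ι)
    (hspan : Submodule.span ℝ (Set.range p₀) = ⊤) : ∀ᶠ p in nhds p₀, ZeroInHull p := by
  have hsurj : Function.Surjective (Fintype.linearCombination ℝ p₀) := by
    rw [← LinearMap.range_eq_top, ← hspan, Fintype.range_linearCombination]
  obtain ⟨B, hB⟩ := (Fintype.linearCombination ℝ p₀).exists_rightInverse_of_surjective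
    (LinearMap.range_eq_top.2 hsurj)
  let Bc : W →L[ℝ] (ι → ℝ) := LinearMap.toContinuousLinearMap B
  let A : (ι → W) → (ι → ℝ) →L[ℝ] W := fun p =>
    ∑ i, (ContinuousLinearMap.proj (R := ℝ) (φ := fun _ : ι => ℝ) i).smulRight (p i)
  have hA : ∀ p x, A p x = ∑ i, x i • p i := fun p x => by
    simp [A]
  have hAc : Continuous A := by
    refine continuous_finsetSum _ fun i _ => ?_
    exact ((ContinuousLinearMap.smulRightL ℝ (ι → ℝ) W
      (ContinuousLinearMap.proj (R := ℝ) (φ := fun _ : ι => ℝ) i)).continuous).comp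
        (continuous_apply i)
  let M : (ι → W) → W →L[ℝ] W := fun p => (A p).comp Bc
  have hMc : Continuous M := hAc.clm_comp continuous_const
  have hM0 : M p₀ = 1 := by
    ext w
    have := LinearMap.congr_fun hB w
    simpa [M, hA, Bc, Fintype.linearCombination_apply] using this
  let x : (ι → W) → ι → ℝ := fun p => l - Bc (Ring.inverse (M p) (A p l))
  have hinv : ContinuousAt (fun p => Ring.inverse (M p)) p₀ := by
    have h1 := NormedRing.inverse_continuousAt (1 : (W →L[ℝ] W)ˣ)
    refine ContinuousAt.comp (g := Ring.inverse) ?_ hMc.continuousAt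
    rw [hM0]; exact h1
  have hxc : ContinuousAt x p₀ := by
    refine continuousAt_const.sub (Bc.continuous.continuousAt.comp ?_)
    exact hinv.clm_apply (hAc.continuousAt.clm_apply continuousAt_const)
  have hAl : A p₀ l = 0 := by rw [hA, hl0]
  have hx0 : x p₀ = l := by simp only [x, hAl, map_zero, sub_zero]
  have hpos : ∀ᶠ p in nhds p₀, ∀ i, 0 < x p i := by
    rw [Filter.eventually_all]
    intro i
    have : ContinuousAt (fun p => x p i) p₀ := (continuous_apply i).continuousAt.comp hxc
    exact this.eventually (lt_mem_nhds (show 0 < x p₀ i by rw [hx0]; exact hl i))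
  have hunit : ∀ᶠ p in nhds p₀, IsUnit (M p) :=
    hMc.continuousAt.eventually (Units.isOpen.mem_nhds (by rw [hM0]; exact isUnit_one))
  filter_upwards [hpos, hunit] with p hp hu
  refine ⟨x p, fun i => (hp i).le, ?_, ?_⟩
  · intro h
    obtain ⟨i⟩ := hι
    have := hp i
    simp [h] at this
  · rw [← hA]
    have : M p (Ring.inverse (M p) (A p l)) = A p l := by
      rw [← mul_apply_eq_comp, Ring.mul_inverse_cancel _ hu]; simp
    simp only [x, map_sub]
    rw [sub_eq_zero]
    exact this.symm

end ZeroInHullTopology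

/-- In a finite-dimensional space an open set is not covered by finitely many proper subspaces. -/
theorem exists_mem_isOpen_forall_notMem {α W : Type*} [NormedAddCommGroup W] [NormedSpace ℝ W]
    [FiniteDimensional ℝ W] (s : Set α) (hs : s.Finite) (V : α → Submodule ℝ W)
    (hV : ∀ a ∈ s, V a ≠ ⊤) (U : Set W) (hU : IsOpen U) (hne : U.Nonempty) :
    ∃ w ∈ U, ∀ a ∈ s, w ∉ V a := by
  have hd : Dense (⋂ a ∈ s, ((V a : Set W))ᶜ) := by
    refine dense_biInter_of_isOpen (fun a _ => ?_) hs.countable fun a ha => ?_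
    · exact (Submodule.closed_of_finiteDimensional _).isOpen_compl
    · rw [← interior_eq_empty_iff_dense_compl]
      by_contra h
      exact hV a ha (Submodule.eq_top_of_nonempty_interior' _ (Set.nonempty_iff_ne_empty.2 h))
  obtain ⟨w, hwU, hw⟩ := hd.inter_open_nonempty U hU hne
  exact ⟨w, hwU, fun a ha => by simpa using Set.mem_iInter₂.1 hw a ha⟩

/-- A pseudomanifold with a free group action, presented by its facets: each facet `c` has vertices
`vert c i`, and `adj i c` is the other facet containing all vertices of `c` except the `i`-th. -/
structure ChamberSystem (G Ch P ι : Type*) [Group G] [MulAction G Ch] [MulAction G P] where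
  vert : Ch → ι → P
  adj : ι → Ch → Ch
  adj_adj : ∀ k c, adj k (adj k c) = c
  adj_smul : ∀ k (g : G) c, adj k (g • c) = g • adj k c
  adj_ne : ∀ k (g : G) c, adj k c ≠ g • c
  vert_adj : ∀ k c j, j ≠ k → vert (adj k c) j = vert c j
  vert_smul : ∀ (g : G) c j, vert (g • c) j = g • vert c j
  vert_orbit : ∀ c i j (g : G), vert c i = g • vert c j → i = j

section OrbitParity

variable (G : Type*) {Ch : Type*} [Group G] [MulAction G Ch] [Fintype Ch]

open Classical in
/-- The parity of the number of `G`-orbits satisfying a predicate. -/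
noncomputable def orbitParity (Q : Ch → Prop) : ZMod 2 :=
  ∑ q : MulAction.orbitRel.Quotient G Ch, if Q q.out then 1 else 0

variable {G}

theorem exists_smul_out (c : Ch) :
    ∃ g : G, (Quotient.mk (MulAction.orbitRel G Ch) c).out = g • c := by
  obtain ⟨g, hg⟩ := MulAction.orbitRel_apply.1 (Quotient.mk_out (s := MulAction.orbitRel G Ch) c)
  exact ⟨g, hg.symm⟩

theorem orbitParity_eq_zero (Q : Ch → Prop) (hQ : ∀ (g : G) c, Q (g • c) ↔ Q c) (τ : Ch → Ch)
    (h1 : ∀ c, τ (τ c) = c) (h2 : ∀ (g : G) c, τ (g • c) = g • τ c)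
    (h3 : ∀ (g : G) c, τ c ≠ g • c) (h4 : ∀ c, Q (τ c) ↔ Q c) : orbitParity G Q = 0 := by
  classical
  refine Finset.sum_involution (fun q _ => (Quotient.mk (MulAction.orbitRel G Ch) (τ q.out) :
    MulAction.orbitRel.Quotient G Ch)) ?_ ?_ (fun _ _ => Finset.mem_univ _) ?_
  · intro q _
    obtain ⟨g, hg⟩ := exists_smul_out (G := G) (τ q.out)
    have : Q (Quotient.mk (MulAction.orbitRel G Ch) (τ q.out)).out ↔ Q q.out := by
      rw [hg, hQ, h4]
    simp only [this]
    split_ifs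
    · rfl
    · rfl
  · intro q _ _ h
    obtain ⟨g, hg⟩ := exists_smul_out (G := G) (τ q.out)
    rw [h] at hg
    exact h3 g⁻¹ q.out (by rw [eq_inv_smul_iff]; exact hg.symm)
  · intro q _
    obtain ⟨g, hg⟩ := exists_smul_out (G := G) (τ q.out)
    have : τ (Quotient.mk (MulAction.orbitRel G Ch) (τ q.out)).out = g • q.out := by
      rw [hg, h2, h1]
    simp only [this]
    conv_rhs => rw [← Quotient.out_eq q]
    exact Quotient.sound (MulAction.orbitRel_apply.2 ⟨g, rfl⟩)

theorem orbitParity_eq_one (Q : Ch → Prop) (hQ : ∀ (g : G) c, Q (g • c) ↔ Q c) (c₀ : Ch)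
    (h : ∀ c, Q c ↔ c ∈ MulAction.orbit G c₀) : orbitParity G Q = 1 := by
  classical
  unfold orbitParity
  rw [Finset.sum_eq_single (Quotient.mk (MulAction.orbitRel G Ch) c₀)]
  · obtain ⟨g, hg⟩ := exists_smul_out (G := G) c₀
    rw [if_pos]
    rw [hg, hQ, h]
    exact MulAction.mem_orbit_self _
  · intro q _ hq
    rw [if_neg]
    rw [h]
    intro hmem
    apply hq
    rw [← Quotient.out_eq q]
    exact Quotient.sound (MulAction.orbitRel_apply.2 hmem)
  · intro h; exact absurd (Finset.mem_univ _) h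

end OrbitParity

section Invariance

variable {ι W : Type*} [Fintype ι] [AddCommGroup W] [Module ℝ W]

theorem zeroInHull_map (e : W ≃ₗ[ℝ] W) (p : ι → W) :
    ZeroInHull (fun i => e (p i)) ↔ ZeroInHull p := by
  simp only [ZeroInHull, ← map_smul, ← map_sum, EmbeddingLike.map_eq_zero_iff]

theorem zeroInFace_map (e : W ≃ₗ[ℝ] W) (p : ι → W) (i : ι) :
    ZeroInFace (fun i => e (p i)) i ↔ ZeroInFace p i := by
  simp only [ZeroInFace, ← map_smul, ← map_sum, EmbeddingLike.map_eq_zero_iff]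

theorem zeroInFace_congr (p q : ι → W) (i : ι) (h : ∀ j, j ≠ i → p j = q j) :
    ZeroInFace p i ↔ ZeroInFace q i := by
  have : ∀ l : ι → ℝ, l i = 0 → ∑ j, l j • p j = ∑ j, l j • q j := by
    intro l hl
    refine Finset.sum_congr rfl fun j _ => ?_
    by_cases hj : j = i
    · subst hj; simp [hl]
    · rw [h j hj]
  constructor
  · rintro ⟨l, a, b, c, d⟩
    exact ⟨l, a, b, c, by rw [← this l c]; exact d⟩
  · rintro ⟨l, a, b, c, d⟩
    exact ⟨l, a, b, c, by rw [this l c]; exact d⟩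

theorem zeroInFace_none (p : Option ι → W) :
    ZeroInFace p none ↔ ZeroInHull (fun i => p (some i)) := by
  constructor
  · rintro ⟨l, a, b, c, d⟩
    refine ⟨fun i => l (some i), fun i => a _, fun h => b ?_, ?_⟩
    · funext i
      cases i with
      | none => exact c
      | some i => exact congrFun h i
    · simpa [Fintype.sum_option, c] using d
  · rintro ⟨l, a, b, d⟩
    refine ⟨fun i => i.elim 0 l, fun i => ?_, fun h => b ?_, rfl, ?_⟩
    · cases i with
      | none => exact le_rfl
      | some i => exact a i
    · funext i
      exact congrFun h (some i)
    · simpa [Fintype.sum_option] using d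

open Classical in
theorem zeroInFace_some (p : Option ι → W) (k : ι) :
    ZeroInFace p (some k) ↔ ZeroInHull (Function.update (fun i => p (some i)) k (p none)) := by
  let e : Equiv.Perm (Option ι) := Equiv.swap none (some k)
  have h : ZeroInFace p (some k) ↔ ZeroInFace (fun i => p (e i)) none := by
    have key : ∀ (p : Option ι → W) (i : Option ι), ZeroInFace p i →
        ZeroInFace (fun i => p (e i)) (e i) := by
      rintro p i ⟨l, a, b, c, d⟩
      refine ⟨fun j => l (e j), fun j => a _, fun h => b ?_, by simpa [e] using c, ?_⟩
      · funext j
        have := congrFun h (e j)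
        simpa [e] using this
      · rw [← d]
        exact Equiv.sum_comp e (fun j => l j • p j)
    constructor
    · intro h
      simpa [e] using key p _ h
    · intro h
      simpa [e] using key _ _ h
  rw [h, zeroInFace_none]
  have : (fun i => p (e (some i))) = Function.update (fun i => p (some i)) k (p none) := by
    funext i
    by_cases hi : i = k
    · subst hi; simp [e]
    · rw [Function.update_of_ne hi]
      congr 1
      exact Equiv.swap_apply_of_ne_of_ne (by simp) (by simpa using hi)
  rw [this]

end Invariance

namespace ChamberSystem

variable {G Ch P ι W : Type*} [Group G] [MulAction G Ch] [MulAction G P]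
  [Fintype Ch] [Fintype ι] [NormedAddCommGroup W] [NormedSpace ℝ W] [FiniteDimensional ℝ W]

open Classical in
theorem orbitParity_step (S : ChamberSystem G Ch P ι) (ρ : G →* (W ≃L[ℝ] W))
    (hι : Fintype.card ι = Module.finrank ℝ W + 1) (F F' : Ch → ι → W)
    (hF : ∀ k c j, j ≠ k → F (S.adj k c) j = F c j)
    (hF' : ∀ k c j, j ≠ k → F' (S.adj k c) j = F' c j)
    (hG : ∀ g c, F (g • c) = fun i => ρ g (F c i))
    (hG' : ∀ g c, F' (g • c) = fun i => ρ g (F' c i)) (k : ι)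
    (hk : ∀ c, Function.update (F c) k (F' c k) = F' c)
    (hgen : ∀ c, ∀ s : Finset (Option ι), s.card ≤ Module.finrank ℝ W →
      LinearIndepOn ℝ (fun i : Option ι => i.elim (F' c k) (F c)) (s : Set (Option ι))) :
    orbitParity G (fun c => ZeroInHull (F c)) = orbitParity G (fun c => ZeroInHull (F' c)) := by
  have hp1 : ∀ c, ∑ i, (if ZeroInFace (fun i : Option ι => i.elim (F' c k) (F c)) i
      then 1 else 0 : ZMod 2) = 0 := by
    intro c
    have := even_card_zeroInFace (by simp [hι]) rfl _ (hgen c)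
    rw [Finset.sum_boole]
    exact (ZMod.natCast_eq_zero_iff_even).2 this
  have hsum : ∑ i, orbitParity G
      (fun c => ZeroInFace (fun i : Option ι => i.elim (F' c k) (F c)) i) = 0 := by
    unfold orbitParity
    rw [Finset.sum_comm]
    exact Finset.sum_eq_zero fun q _ => hp1 q.out
  rw [Fintype.sum_option, Finset.sum_eq_single k] at hsum
  · have e1 : (fun c => ZeroInFace (fun i : Option ι => i.elim (F' c k) (F c)) none)
        = fun c => ZeroInHull (F c) := by
      funext c
      exact propext (zeroInFace_none _)
    have e2 : (fun c => ZeroInFace (fun i : Option ι => i.elim (F' c k) (F c)) (some k))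
        = fun c => ZeroInHull (F' c) := by
      funext c
      rw [zeroInFace_some]
      exact congrArg ZeroInHull (hk c)
    rw [e1, e2] at hsum
    rw [← sub_eq_zero, CharTwo.sub_eq_add]
    exact hsum
  · intro i _ hik
    refine orbitParity_eq_zero _ ?_ (S.adj i) (S.adj_adj i) (S.adj_smul i) (S.adj_ne i) ?_
    · intro g c
      rw [← zeroInFace_map (ρ g).toLinearEquiv (fun i : Option ι => i.elim (F' c k) (F c))]
      apply Eq.to_iff
      congr 1
      funext j
      cases j with
      | none => simp [hG']
      | some j => simp [hG]
    · intro c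
      refine zeroInFace_congr _ _ _ fun j hj => ?_
      cases j with
      | none => exact hF' i c k hik.symm
      | some j => exact hF i c j (by simpa using hj)
  · intro h; exact absurd (Finset.mem_univ _) h

open Classical in
theorem orbitParity_eq (S : ChamberSystem G Ch P ι) (ρ : G →* (W ≃L[ℝ] W))
    (hι : Fintype.card ι = Module.finrank ℝ W + 1) (F F' : P → W)
    (hG : ∀ g x, F (g • x) = ρ g (F x)) (hG' : ∀ g x, F' (g • x) = ρ g (F' x))
    (hgen : ∀ c, ∀ s : Finset (ι ⊕ ι), s.card ≤ Module.finrank ℝ W →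
      LinearIndepOn ℝ (Sum.elim (fun i => F (S.vert c i)) (fun i => F' (S.vert c i)))
        (s : Set (ι ⊕ ι))) :
    orbitParity G (fun c => ZeroInHull (fun i => F (S.vert c i))) =
      orbitParity G (fun c => ZeroInHull (fun i => F' (S.vert c i))) := by
  let E : Finset ι → Ch → ι → W := fun s c i => if i ∈ s then F' (S.vert c i) else F (S.vert c i)
  have hadj : ∀ s k c j, j ≠ k → E s (S.adj k c) j = E s c j := fun s k c j hj => by
    simp only [E, S.vert_adj k c j hj]
  have hsm : ∀ s g c, E s (g • c) = fun i => ρ g (E s c i) := fun s g c => by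
    funext i
    simp only [E, S.vert_smul, hG, hG']
    split_ifs <;> rfl
  have key : ∀ s : Finset ι, orbitParity G (fun c => ZeroInHull (E ∅ c)) =
      orbitParity G (fun c => ZeroInHull (E s c)) := by
    intro s
    induction s using Finset.induction_on with
    | empty => rfl
    | insert k s hks ih =>
      rw [ih]
      refine S.orbitParity_step ρ hι (E s) (E (insert k s)) (hadj _) (hadj _) (hsm _) (hsm _) k
        ?_ ?_
      · intro c
        funext i
        by_cases hi : i = k
        · subst hi; simp
        · simp [E, hi]
      · intro c t ht
        let φ : Option ι → ι ⊕ ι := fun i => i.elim (Sum.inr k)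
          (fun j => if j ∈ s then Sum.inr j else Sum.inl j)
        have hφ : Function.Injective φ := by
          rintro (_ | i) (_ | j) h
          · rfl
          · by_cases hj : j ∈ s
            · simp only [φ, Option.elim, if_pos hj, Sum.inr.injEq] at h
              exact absurd (h ▸ hj) hks
            · simp [φ, hj] at h
          · by_cases hj : i ∈ s
            · simp only [φ, Option.elim, if_pos hj, Sum.inr.injEq] at h
              exact absurd (h ▸ hj) hks
            · simp [φ, hj] at h
          · by_cases hj : i ∈ s <;> by_cases hj' : j ∈ s <;> simp_all [φ]
        have h1 := hgen c (t.image φ) (Finset.card_image_le.trans ht)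
        rw [Finset.coe_image] at h1
        have h2 := h1.comp_of_image (hφ.injOn)
        convert h2 using 1
        funext i
        cases i with
        | none => simp [φ, E]
        | some i => by_cases hi : i ∈ s <;> simp [φ, E, hi]
  have := key Finset.univ
  simpa [E] using this

end ChamberSystem

section Generic

variable {G Y W : Type*} [Group G] [MulAction G Y] [Finite Y]
  [NormedAddCommGroup W] [NormedSpace ℝ W] [FiniteDimensional ℝ W]

/-- Equivariant perturbation into general position. -/
theorem exists_equivariant_generic (ρ : G →* (W ≃L[ℝ] W))
    (hfree : ∀ (g : G) (y : Y), g • y = y → g = 1) (T : Y → W)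
    (hT : ∀ (g : G) y, T (g • y) = ρ g (T y)) (U : Set (Y → W)) (hU : U ∈ nhds T) :
    ∃ F ∈ U, (∀ (g : G) y, F (g • y) = ρ g (F y)) ∧
      ∀ s : Finset Y, s.card ≤ Module.finrank ℝ W →
        (∀ x ∈ s, ∀ y ∈ s, ∀ g : G, x = g • y → x = y) → LinearIndepOn ℝ F (s : Set Y) := by
  classical
  have key : ∀ A : Set (MulAction.orbitRel.Quotient G Y), A.Finite →
      ∃ F ∈ U, (∀ (g : G) y, F (g • y) = ρ g (F y)) ∧ U ∈ nhds F ∧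
      ∀ s : Finset Y, s.card ≤ Module.finrank ℝ W →
        (∀ y ∈ s, (Quotient.mk (MulAction.orbitRel G Y) y) ∈ A) →
        (∀ x ∈ s, ∀ y ∈ s, ∀ g : G, x = g • y → x = y) → LinearIndepOn ℝ F (s : Set Y) := by
    obtain ⟨U', hU'U, hU'o, hTU'⟩ := mem_nhds_iff.1 hU
    suffices H : ∀ A : Set (MulAction.orbitRel.Quotient G Y), A.Finite →
      ∃ F ∈ U', (∀ (g : G) y, F (g • y) = ρ g (F y)) ∧
      ∀ s : Finset Y, s.card ≤ Module.finrank ℝ W →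
        (∀ y ∈ s, (Quotient.mk (MulAction.orbitRel G Y) y) ∈ A) →
        (∀ x ∈ s, ∀ y ∈ s, ∀ g : G, x = g • y → x = y) → LinearIndepOn ℝ F (s : Set Y) by
      intro A hA
      obtain ⟨F, h1, h2, h3⟩ := H A hA
      exact ⟨F, hU'U h1, h2, Filter.mem_of_superset (hU'o.mem_nhds h1) hU'U, h3⟩
    intro A hA
    induction A, hA using Set.Finite.induction_on with
    | empty =>
      refine ⟨T, hTU', hT, fun s _ hs _ => ?_⟩
      have : s = ∅ := Finset.eq_empty_of_forall_notMem fun y hy => by simpa using hs y hy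
      subst this
      simp
    | @insert o A hoA _ ih =>
      obtain ⟨F, hFU, hFG, hFs⟩ := ih
      let y₀ : Y := o.out
      have ho : ∀ y, Quotient.mk (MulAction.orbitRel G Y) y = o → ∃ g : G, y = g • y₀ := by
        rintro y rfl
        obtain ⟨g, hg⟩ := MulAction.orbitRel_apply.1
          (Quotient.mk_out (s := MulAction.orbitRel G Y) y)
        exact ⟨g⁻¹, by rw [eq_inv_smul_iff]; exact hg⟩
      have hmk : ∀ (g : G) y, Quotient.mk (MulAction.orbitRel G Y) (g • y) = Quotient.mk _ y :=
        fun g y => Quotient.sound (MulAction.orbitRel_apply.2 ⟨g, rfl⟩)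
      have hmk0 : ∀ g : G, Quotient.mk (MulAction.orbitRel G Y) (g • y₀) = o := fun g => by
        rw [hmk]; exact Quotient.out_eq o
      choose! γ hγ using ho
      let N : W → Y → W := fun w y =>
        if Quotient.mk (MulAction.orbitRel G Y) y = o then ρ (γ y) w else F y
      have hNc : Continuous N := by
        refine continuous_pi fun y => ?_
        by_cases hy : Quotient.mk (MulAction.orbitRel G Y) y = o
        · simpa only [N, if_pos hy] using (ρ (γ y)).continuous
        · simpa only [N, if_neg hy] using continuous_const
      have hγg : ∀ g : G, γ (g • y₀) = g := fun g => by
        have := hγ (g • y₀) (hmk0 g)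
        have h2 := hfree (g⁻¹ * γ (g • y₀)) y₀ (by rw [mul_smul, ← this, inv_smul_smul])
        exact (inv_mul_eq_one.1 h2).symm
      have hNF : N (F y₀) = F := by
        funext y
        by_cases hy : Quotient.mk (MulAction.orbitRel G Y) y = o
        · simp only [N, if_pos hy]
          rw [← hFG, ← hγ y hy]
        · simp only [N, if_neg hy]
      obtain ⟨w, hwU, hw⟩ := exists_mem_isOpen_forall_notMem
        {s : Finset Y | s.card < Module.finrank ℝ W} (Set.toFinite _)
        (fun s => Submodule.span ℝ (F '' (s : Set Y))) (by
          intro s hs h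
          have h1 := finrank_span_finset_le_card (R := ℝ) (s.image F)
          rw [Finset.coe_image, Set.finrank, h, finrank_top] at h1
          have := Finset.card_image_le (s := s) (f := F)
          simp only [Set.mem_ofPred_eq] at hs
          omega)
        (N ⁻¹' U') (hU'o.preimage hNc) ⟨F y₀, by simpa only [Set.mem_preimage, hNF] using hFU⟩
      have hNo : ∀ g : G, N w (g • y₀) = ρ g w := fun g => by
        simp only [N, if_pos (hmk0 g), hγg]
      have hNG : ∀ (g : G) y, N w (g • y) = ρ g (N w y) := by
        intro g y
        by_cases hy : Quotient.mk (MulAction.orbitRel G Y) y = o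
        · rw [hγ y hy, hNo, smul_smul, hNo, map_mul]; rfl
        · simp only [N, if_neg hy, hmk, hFG]
      refine ⟨N w, hwU, hNG, fun s hs hsA hsi => ?_⟩
      by_cases hex : ∃ y ∈ s, Quotient.mk (MulAction.orbitRel G Y) y = o
      · obtain ⟨y, hys, hyo⟩ := hex
        have hne : ∀ x ∈ s.erase y, Quotient.mk (MulAction.orbitRel G Y) x ≠ o := by
          intro x hx hxo
          obtain ⟨hxy, hxs⟩ := Finset.mem_erase.1 hx
          refine hxy (hsi x hxs y hys (γ x * (γ y)⁻¹) ?_)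
          have e : (γ y)⁻¹ • y = y₀ := by rw [inv_smul_eq_iff]; exact hγ y hyo
          rw [mul_smul, e]
          exact hγ x hxo
        have hEq : ∀ x ∈ s.erase y, N w x = F x := fun x hx => by
          simp only [N, if_neg (hne x hx)]
        have hcard : (s.erase y).card < Module.finrank ℝ W := by
          rw [Finset.card_erase_of_mem hys]
          have := Finset.card_pos.2 ⟨y, hys⟩
          omega
        have hind : LinearIndepOn ℝ F ((s.erase y : Finset Y) : Set Y) := by
          refine hFs _ hcard.le (fun x hx => ?_) (fun x hx z hz => ?_)
          · have := hsA x (Finset.mem_of_mem_erase hx)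
            exact (Set.mem_insert_iff.1 this).resolve_left (hne x hx)
          · exact hsi x (Finset.mem_of_mem_erase hx) z (Finset.mem_of_mem_erase hz)
        have hind' : LinearIndepOn ℝ (N w) ((s.erase y : Finset Y) : Set Y) :=
          (linearIndepOn_congr fun x hx => hEq x hx).2 hind
        rw [← Finset.insert_erase hys, Finset.coe_insert]
        refine hind'.insert ?_
        intro hmem
        have himg : N w '' ((s.erase y : Finset Y) : Set Y) = F '' ((s.erase y : Finset Y) : Set Y) :=
          Set.image_congr fun x hx => hEq x hx
        have hNy : N w y = ρ (γ y) w := by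
          conv_lhs => rw [hγ y hyo]
          exact hNo _
        rw [himg, hNy] at hmem
        have hw' := hw ((s.erase y).image (fun x => (γ y)⁻¹ • x))
          (by simpa only [Set.mem_ofPred_eq] using Finset.card_image_le.trans_lt hcard)
        apply hw'
        have h2 := Submodule.mem_map_of_mem (f := ((ρ (γ y)⁻¹).toLinearEquiv : W →ₗ[ℝ] W)) hmem
        rw [Submodule.map_span, ← Set.image_comp] at h2
        have h3 : ((ρ (γ y)⁻¹).toLinearEquiv : W →ₗ[ℝ] W) ((ρ (γ y)) w) = w := by
          change (ρ (γ y)⁻¹ * ρ (γ y)) w = w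
          rw [← map_mul, inv_mul_cancel, map_one]; rfl
        rw [h3] at h2
        convert h2 using 2
        rw [Finset.coe_image, ← Set.image_comp]
        refine Set.image_congr fun x _ => ?_
        exact hFG _ _
      · push Not at hex
        refine (linearIndepOn_congr fun x hx => ?_).2 (hFs s hs (fun x hx => ?_) hsi)
        · simp only [N, if_neg (hex x hx)]
        · exact (Set.mem_insert_iff.1 (hsA x hx)).resolve_left (hex x hx)
  obtain ⟨F, h1, h2, -, h3⟩ := key Set.univ Set.finite_univ
  exact ⟨F, h1, h2, fun s hs hi => h3 s hs (fun _ _ => Set.mem_univ _) hi⟩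

end Generic

namespace ChamberSystem

variable {G Ch P ι W : Type*} [Group G] [MulAction G Ch] [MulAction G P]
  [Fintype Ch] [Finite P] [Fintype ι] [NormedAddCommGroup W] [NormedSpace ℝ W]
  [FiniteDimensional ℝ W]

/-- If some equivariant labelling has `0` in exactly one orbit of facets, and there in the interior,
then every equivariant labelling has `0` in some facet. -/
theorem exists_zeroInHull (S : ChamberSystem G Ch P ι) (ρ : G →* (W ≃L[ℝ] W))
    (hι : Fintype.card ι = Module.finrank ℝ W + 1)
    (hfree : ∀ (g : G) (y : P), g • y = y → g = 1)
    (T T₀ : P → W) (hT : ∀ (g : G) y, T (g • y) = ρ g (T y))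
    (hT₀ : ∀ (g : G) y, T₀ (g • y) = ρ g (T₀ y)) (c₀ : Ch)
    (l : ι → ℝ) (hl : ∀ i, 0 < l i) (hl0 : ∑ i, l i • T₀ (S.vert c₀ i) = 0)
    (hspan : Submodule.span ℝ (Set.range fun i => T₀ (S.vert c₀ i)) = ⊤)
    (huniq : ∀ c, ZeroInHull (fun i => T₀ (S.vert c i)) → c ∈ MulAction.orbit G c₀) :
    ∃ c, ZeroInHull (fun i => T (S.vert c i)) := by
  classical
  by_contra! hno
  have hιne : Nonempty ι := Fintype.card_pos_iff.1 (by omega)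
  let φ : Ch → (P ⊕ P → W) → (ι → W) := fun c F i => F (Sum.inl (S.vert c i))
  let ψ : Ch → (P ⊕ P → W) → (ι → W) := fun c F i => F (Sum.inr (S.vert c i))
  have hφ : ∀ c, Continuous (φ c) := fun c => by fun_prop
  have hψ : ∀ c, Continuous (ψ c) := fun c => by fun_prop
  have h1 : ∀ᶠ F in nhds (Sum.elim T T₀), ∀ c, ¬ ZeroInHull (φ c F) := by
    rw [Filter.eventually_all]
    intro c
    exact (hφ c).continuousAt.eventually (isClosed_zeroInHull.isOpen_compl.mem_nhds
      (show φ c (Sum.elim T T₀) ∈ {p | ZeroInHull p}ᶜ from hno c))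
  have h2 : ∀ᶠ F in nhds (Sum.elim T T₀), ∀ c, c ∉ MulAction.orbit G c₀ →
      ¬ ZeroInHull (ψ c F) := by
    rw [Filter.eventually_all]
    intro c
    by_cases hc : c ∈ MulAction.orbit G c₀
    · simp [hc]
    · filter_upwards [(hψ c).continuousAt.eventually (isClosed_zeroInHull.isOpen_compl.mem_nhds
        (show ψ c (Sum.elim T T₀) ∈ {p | ZeroInHull p}ᶜ from fun h => hc (huniq c h)))] with F hF _ using hF
  have h3 : ∀ᶠ F in nhds (Sum.elim T T₀), ZeroInHull (ψ c₀ F) :=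
    (hψ c₀).continuousAt.eventually (eventually_zeroInHull _ l hl hl0 hιne hspan)
  let _ : MulAction G (P ⊕ P) :=
    { smul := fun g x => Sum.map (g • ·) (g • ·) x
      one_smul := by rintro (x | x) <;> simp [HSMul.hSMul] <;> exact one_smul _ _
      mul_smul := by
        rintro a b (x | x) <;> simp only [HSMul.hSMul, Sum.map_inl, Sum.map_inr] <;>
          congr 1 <;> exact mul_smul _ _ _ }
  have hsl : ∀ (g : G) (x : P), g • (Sum.inl x : P ⊕ P) = Sum.inl (g • x) := fun _ _ => rfl
  have hsr : ∀ (g : G) (x : P), g • (Sum.inr x : P ⊕ P) = Sum.inr (g • x) := fun _ _ => rfl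
  obtain ⟨F, hF, hFG, hFgen⟩ := exists_equivariant_generic (Y := P ⊕ P) ρ
    (by rintro g (x | x) h
        · exact hfree g x (Sum.inl_injective h)
        · exact hfree g x (Sum.inr_injective h))
    (Sum.elim T T₀)
    (by rintro g (x | x)
        · exact hT g x
        · exact hT₀ g x) _ (Filter.inter_mem h1 (Filter.inter_mem h2 h3))
  obtain ⟨hF1, hF2, hF3⟩ := hF
  have hpar := S.orbitParity_eq ρ hι (fun x => F (Sum.inl x)) (fun x => F (Sum.inr x))
    (fun g x => hFG g (Sum.inl x)) (fun g x => hFG g (Sum.inr x)) (by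
      intro c s hs
      let θ : ι ⊕ ι → P ⊕ P := Sum.map (S.vert c) (S.vert c)
      have hinj : Function.Injective (S.vert c) := fun i j h =>
        S.vert_orbit c i j 1 (by rw [h, one_smul])
      have hθ : Function.Injective θ := Sum.map_injective.2 ⟨hinj, hinj⟩
      have := hFgen (s.image θ) (Finset.card_image_le.trans hs) (by
        intro x hx y hy g hxy
        obtain ⟨i, -, rfl⟩ := Finset.mem_image.1 hx
        obtain ⟨j, -, rfl⟩ := Finset.mem_image.1 hy
        rcases i with i | i <;> rcases j with j | j
        · rw [S.vert_orbit c i j g (Sum.inl_injective hxy)]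
        · exact absurd hxy (by simp [θ, hsr])
        · exact absurd hxy (by simp [θ, hsl])
        · rw [S.vert_orbit c i j g (Sum.inr_injective hxy)])
      rw [Finset.coe_image] at this
      convert this.comp_of_image hθ.injOn using 1
      funext i
      rcases i with i | i <;> rfl)
  rw [orbitParity_eq_one (G := G) (fun c => ZeroInHull fun i => F (Sum.inr (S.vert c i))) _ c₀ _,
    orbitParity] at hpar
  · rw [Finset.sum_eq_zero] at hpar
    · exact zero_ne_one hpar
    · intro q _
      exact if_neg (hF1 q.out)
  · intro g c
    rw [← zeroInHull_map (ρ g).toLinearEquiv (fun i => F (Sum.inr (S.vert c i)))]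
    apply Eq.to_iff
    congr 1
    funext i
    rw [S.vert_smul]
    exact hFG g (Sum.inr _)
  · intro c
    constructor
    · intro h
      by_contra hc
      exact (hF2 : ∀ c, c ∉ MulAction.orbit G c₀ → ¬ ZeroInHull (ψ c F)) c hc h
    · rintro ⟨g, rfl⟩
      have hF3' : ZeroInHull (ψ c₀ F) := hF3
      rw [← zeroInHull_map (ρ g).toLinearEquiv] at hF3'
      convert hF3' using 1
      funext i
      simp only [S.vert_smul]
      exact hFG g (Sum.inr _)

end ChamberSystem

/-- Signs twisting a permutation action so that `G` acts simply transitively on sign patterns. -/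
class SignCocycle (G N : Type*) [Group G] [MulAction G N] where
  sgn : G → N → ℤˣ
  sgn_mul : ∀ g k v, sgn (g * k) v = sgn g v * sgn k (g⁻¹ • v)
  bijective_sgn : Function.Bijective sgn
  free : ∀ g, g ≠ 1 → ∃ v, g • v = v ∧ sgn g v = -1

namespace SignCocycle

variable {G N : Type*} [Group G] [MulAction G N] [SignCocycle G N]

theorem sgn_one (v : N) : sgn (1 : G) v = 1 := by
  have := sgn_mul (1 : G) 1 v
  simpa using this

/-- The signed permutation action on functions. -/
def act {X : Type*} [AddCommGroup X] (g : G) (x : N → X) : N → X :=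
  fun v => sgn g v • x (g⁻¹ • v)

variable {X : Type*} [AddCommGroup X]

theorem act_one (x : N → X) : act (1 : G) x = x := by
  funext v; simp [act, sgn_one]

theorem act_mul (g k : G) (x : N → X) : act (g * k) x = act g (act k x) := by
  funext v; simp [act, sgn_mul, mul_smul]

theorem eq_one_of_act_eq (g : G) (x : N → X) (h : act g x = x)
    (hx : ∀ v, x v ≠ -x v) : g = 1 := by
  by_contra hg
  obtain ⟨v, hv, hs⟩ := free (N := N) g hg
  have h1 := congrFun h v
  have h2 : g⁻¹ • v = v := by rw [inv_smul_eq_iff, hv]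
  simp only [act, hs, h2] at h1
  have h3 : (-1 : ℤˣ) • x v = -x v := by rw [Units.smul_def]; simp
  exact hx v (h1.symm.trans h3)

theorem act_act_inv (g : G) (x : N → X) : act g (act g⁻¹ x) = x := by
  rw [← act_mul, mul_inv_cancel, act_one]

theorem act_inv_act (g : G) (x : N → X) : act g⁻¹ (act g x) = x := by
  rw [← act_mul, inv_mul_cancel, act_one]

/-- The signed permutation representation. -/
noncomputable def rep (W : Type*) [Finite N] [NormedAddCommGroup W] [NormedSpace ℝ W]
    [FiniteDimensional ℝ W] : G →* ((N → W) ≃L[ℝ] (N → W)) where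
  toFun g := LinearEquiv.toContinuousLinearEquiv
    { toFun := act g
      invFun := act g⁻¹
      map_add' := fun x y => by funext v; simp [act]
      map_smul' := fun r x => by
        funext v
        rcases Int.units_eq_one_or (sgn g v) with h | h <;> simp [act, h]
      left_inv := fun x => act_inv_act g x
      right_inv := fun x => act_act_inv g x }
  map_one' := by
    ext x v
    exact congrFun (act_one x) v
  map_mul' g k := by
    ext x v
    exact congrFun (act_mul g k x) v

theorem rep_apply (W : Type*) [Finite N] [NormedAddCommGroup W] [NormedSpace ℝ W]
    [FiniteDimensional ℝ W] (g : G) (x : N → W) : rep W g x = act g x := by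
  ext v; simp [rep]

end SignCocycle

/-- Integer points in a product of boundaries of cubes `[-M, M]^q`. -/
def GridPoint (N : Type*) (q : ℕ) (M : ℤ) : Type _ :=
  {x : N → Fin q → ℤ // (∀ v i, |x v i| ≤ M) ∧ ∀ v, ∃ i, |x v i| = M}

/-- A facet of the barycentric subdivision of a product of boundaries of cubes, given by an even
point `x` (its lowest vertex), an odd point `y` in its highest cell, and an ordering of the free
coordinates; the remaining coordinates are labelled by `N`. -/
structure GridFacet (N : Type*) (q D : ℕ) (M : ℤ) where
  x : N × Fin q → ℤ
  y : N × Fin q → ℤ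
  a : Fin D ⊕ N ≃ N × Fin q
  even_x : ∀ p, Even (x p)
  dist_xy : ∀ p, |y p - x p| = 1
  x_le : ∀ p, |x p| ≤ M
  y_le : ∀ p, |y p| ≤ M
  a_fst : ∀ v, (a (Sum.inr v)).1 = v
  x_eq : ∀ v, |x (a (Sum.inr v))| = M

namespace GridFacet

variable {N : Type*} {q D : ℕ} {M : ℤ}

theorem ext' {c c' : GridFacet N q D M} (hx : c.x = c'.x) (hy : c.y = c'.y) (ha : c.a = c'.a) :
    c = c' := by
  cases c; cases c'; simp_all

/-- The position of a coordinate in the ordering; the remaining coordinates come last. -/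
def rank (D : ℕ) : Fin D ⊕ N → ℕ := Sum.elim (fun l => (l : ℕ)) (fun _ => D)

/-- The `k`-th vertex of a facet. -/
def vertFun (c : GridFacet N q D M) (k : Fin (D + 1)) (p : N × Fin q) : ℤ :=
  if rank D (c.a.symm p) < k then c.y p else c.x p

theorem a_inr (c : GridFacet N q D M) (v : N) :
    c.a (Sum.inr v) = (v, (c.a (Sum.inr v)).2) := Prod.ext (c.a_fst v) rfl

theorem vertFun_inr (c : GridFacet N q D M) (k : Fin (D + 1)) (v : N) :
    c.vertFun k (c.a (Sum.inr v)) = c.x (c.a (Sum.inr v)) := by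
  have := k.2
  simp only [vertFun, Equiv.symm_apply_apply, rank, Sum.elim_inr]
  rw [if_neg (by omega)]

/-- The vertices of a facet as grid points. -/
def vert (c : GridFacet N q D M) (k : Fin (D + 1)) : GridPoint N q M :=
  ⟨fun v i => c.vertFun k (v, i), fun v i => by
    simp only [vertFun]; split_ifs; exacts [c.y_le _, c.x_le _], fun v =>
    ⟨(c.a (Sum.inr v)).2, by
      have := c.vertFun_inr k v
      rw [a_inr] at this
      simp only [this]
      rw [← a_inr]
      exact c.x_eq v⟩⟩

theorem odd_y (c : GridFacet N q D M) (p) : Odd (c.y p) := by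
  have h1 := c.dist_xy p
  obtain ⟨z, hz⟩ := c.even_x p
  rcases (abs_eq zero_le_one).1 h1 with h | h
  · exact ⟨z, by omega⟩
  · exact ⟨z - 1, by omega⟩

variable [DecidableEq N]

/-- Reflect the lowest vertex along the first coordinate. -/
def adjFirst (hM : Even M) (p : Fin D) (c : GridFacet N q D M) : GridFacet N q D M where
  x := Function.update c.x (c.a (Sum.inl p)) (2 * c.y (c.a (Sum.inl p)) - c.x (c.a (Sum.inl p)))
  y := c.y
  a := c.a
  even_x p' := by
    by_cases h : p' = c.a (Sum.inl p)
    · subst h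
      rw [Function.update_self]
      exact (even_two_mul _).sub (c.even_x _)
    · rw [Function.update_of_ne h]; exact c.even_x _
  dist_xy p' := by
    by_cases h : p' = c.a (Sum.inl p)
    · subst h
      rw [Function.update_self, ← c.dist_xy (c.a (Sum.inl p)), abs_sub_comm]
      congr 1; ring
    · rw [Function.update_of_ne h]; exact c.dist_xy _
  x_le p' := by
    by_cases h : p' = c.a (Sum.inl p)
    · subst h
      rw [Function.update_self]
      have h1 := c.dist_xy (c.a (Sum.inl p))
      have h2 := c.y_le (c.a (Sum.inl p))
      obtain ⟨z, hz⟩ := c.odd_y (c.a (Sum.inl p))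
      obtain ⟨w, hw⟩ := hM
      rw [abs_le] at h2 ⊢
      rcases (abs_eq zero_le_one).1 h1 with h | h <;> omega
    · rw [Function.update_of_ne h]; exact c.x_le _
  y_le := c.y_le
  a_fst := c.a_fst
  x_eq v := by
    rw [Function.update_of_ne (by simp)]
    exact c.x_eq v

/-- Reflect the highest cell along a coordinate. -/
def adjFlip (p : Fin D) (c : GridFacet N q D M) (h : |c.x (c.a (Sum.inl p))| ≠ M) :
    GridFacet N q D M where
  x := c.x
  y := Function.update c.y (c.a (Sum.inl p)) (2 * c.x (c.a (Sum.inl p)) - c.y (c.a (Sum.inl p)))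
  a := c.a
  even_x := c.even_x
  dist_xy p' := by
    by_cases h : p' = c.a (Sum.inl p)
    · subst h
      rw [Function.update_self, ← c.dist_xy (c.a (Sum.inl p)), abs_sub_comm]
      congr 1; ring
    · rw [Function.update_of_ne h]; exact c.dist_xy _
  x_le := c.x_le
  y_le p' := by
    by_cases h' : p' = c.a (Sum.inl p)
    · subst h'
      rw [Function.update_self]
      have h1 := c.dist_xy (c.a (Sum.inl p))
      have h2 := lt_of_le_of_ne (c.x_le (c.a (Sum.inl p))) h
      rw [abs_lt] at h2
      rw [abs_le]
      rcases (abs_eq zero_le_one).1 h1 with h | h <;> omega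
    · rw [Function.update_of_ne h']; exact c.y_le _
  a_fst := c.a_fst
  x_eq := c.x_eq

/-- Exchange two free coordinates in the ordering. -/
def adjSwap (p p' : Fin D) (c : GridFacet N q D M) : GridFacet N q D M :=
  { c with
    a := (Equiv.swap (Sum.inl p) (Sum.inl p')).trans c.a
    a_fst := fun v => by
      rw [Equiv.trans_apply, Equiv.swap_apply_of_ne_of_ne (by simp) (by simp)]; exact c.a_fst v
    x_eq := fun v => by
      rw [Equiv.trans_apply, Equiv.swap_apply_of_ne_of_ne (by simp) (by simp)]; exact c.x_eq v }

/-- Exchange a free coordinate and the corresponding remaining coordinate. -/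
def adjTurn (p : Fin D) (c : GridFacet N q D M) (h : |c.x (c.a (Sum.inl p))| = M) :
    GridFacet N q D M :=
  { c with
    a := (Equiv.swap (Sum.inl p) (Sum.inr (c.a (Sum.inl p)).1)).trans c.a
    a_fst := fun v => by
      rw [Equiv.trans_apply]
      by_cases hv : v = (c.a (Sum.inl p)).1
      · subst hv; simp
      · rw [Equiv.swap_apply_of_ne_of_ne (by simp) (by simpa using hv)]; exact c.a_fst v
    x_eq := fun v => by
      rw [Equiv.trans_apply]
      by_cases hv : v = (c.a (Sum.inl p)).1
      · subst hv; simpa using h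
      · rw [Equiv.swap_apply_of_ne_of_ne (by simp) (by simpa using hv)]; exact c.x_eq v }

open Classical in
/-- The facet adjacent to `c` across the face opposite to the last vertex. -/
noncomputable def adjLast (hM : Even M) (p : Fin D) (c : GridFacet N q D M) : GridFacet N q D M :=
  if h : |c.x (c.a (Sum.inl p))| = M then c.adjTurn p h else c.adjFlip p h

theorem adjFirst_adjFirst (hM : Even M) (p : Fin D) (c : GridFacet N q D M) :
    (c.adjFirst hM p).adjFirst hM p = c := by
  refine ext' ?_ rfl rfl
  simp [adjFirst]

theorem adjSwap_adjSwap (p p' : Fin D) (c : GridFacet N q D M) :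
    (c.adjSwap p p').adjSwap p p' = c := by
  refine ext' rfl rfl ?_
  ext1 t
  simp [adjSwap]

theorem adjLast_adjLast (hM : Even M) (p : Fin D) (c : GridFacet N q D M) :
    (c.adjLast hM p).adjLast hM p = c := by
  by_cases h : |c.x (c.a (Sum.inl p))| = M
  · have h1 : c.adjLast hM p = c.adjTurn p h := dif_pos h
    have h2 : |(c.adjTurn p h).x ((c.adjTurn p h).a (Sum.inl p))| = M := by
      simpa [adjTurn] using c.x_eq _
    rw [h1, adjLast, dif_pos h2]
    refine ext' rfl rfl ?_
    ext1 t
    have := c.a_fst (c.a (Sum.inl p)).1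
    simp [adjTurn, this]
  · have h1 : c.adjLast hM p = c.adjFlip p h := dif_neg h
    rw [h1, adjLast, dif_neg (show ¬ |(c.adjFlip p h).x ((c.adjFlip p h).a (Sum.inl p))| = M
      from h)]
    refine ext' rfl ?_ rfl
    simp [adjFlip]

theorem adjFirst_ne (hM : Even M) (p : Fin D) (c : GridFacet N q D M) : c.adjFirst hM p ≠ c := by
  intro h
  have := congrFun (congrArg GridFacet.x h) (c.a (Sum.inl p))
  simp only [adjFirst, Function.update_self] at this
  have h1 := c.dist_xy (c.a (Sum.inl p))
  have : c.y (c.a (Sum.inl p)) - c.x (c.a (Sum.inl p)) = 0 := by omega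
  rw [this] at h1
  simp at h1

theorem adjSwap_ne (p p' : Fin D) (hp : p ≠ p') (c : GridFacet N q D M) : c.adjSwap p p' ≠ c := by
  intro h
  have := DFunLike.congr_fun (congrArg GridFacet.a h) (Sum.inl p)
  simp [adjSwap] at this
  exact hp this.symm

theorem adjLast_ne (hM : Even M) (p : Fin D) (c : GridFacet N q D M) : c.adjLast hM p ≠ c := by
  by_cases h : |c.x (c.a (Sum.inl p))| = M
  · rw [adjLast, dif_pos h]
    intro h
    have := DFunLike.congr_fun (congrArg GridFacet.a h) (Sum.inl p)
    simp [adjTurn] at this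
  · rw [adjLast, dif_neg h]
    intro h
    have := congrFun (congrArg GridFacet.y h) (c.a (Sum.inl p))
    simp only [adjFlip, Function.update_self] at this
    have h1 := c.dist_xy (c.a (Sum.inl p))
    have : c.y (c.a (Sum.inl p)) - c.x (c.a (Sum.inl p)) = 0 := by omega
    rw [this] at h1
    simp at h1

end GridFacet

namespace GridFacet

open SignCocycle

variable {N : Type*} {q D : ℕ} {M : ℤ}

theorem vertFun_eq (c : GridFacet N q D M) (k : Fin (D + 1)) (t : Fin D ⊕ N) (p : N × Fin q)
    (h : c.a t = p) : c.vertFun k p = if rank D t < k then c.y p else c.x p := by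
  subst h
  simp [vertFun]

section Adjacent

variable [DecidableEq N]

theorem vertFun_adjFirst (hM : Even M) (hD : 0 < D) (c : GridFacet N q D M) (k : Fin (D + 1))
    (hk : k ≠ 0) : (c.adjFirst hM ⟨0, hD⟩).vertFun k = c.vertFun k := by
  funext p
  obtain ⟨t, rfl⟩ := c.a.surjective p
  rw [c.vertFun_eq k t _ rfl, vertFun_eq (c.adjFirst hM ⟨0, hD⟩) k t (c.a t) rfl]
  simp only [adjFirst]
  by_cases h : t = Sum.inl ⟨0, hD⟩
  · subst h
    have : 0 < (k : ℕ) := Nat.pos_of_ne_zero fun h => hk (Fin.ext h)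
    simp [rank, this]
  · rw [Function.update_of_ne (by simpa using h)]

theorem vertFun_adjSwap (p p' : Fin D) (hp : (p' : ℕ) = p + 1) (c : GridFacet N q D M)
    (k : Fin (D + 1)) (hk : (k : ℕ) ≠ p') : (c.adjSwap p p').vertFun k = c.vertFun k := by
  funext z
  obtain ⟨t, rfl⟩ := c.a.surjective z
  rw [c.vertFun_eq k t _ rfl, vertFun_eq (c.adjSwap p p') k
    (Equiv.swap (Sum.inl p) (Sum.inl p') t) _ (by simp [adjSwap])]
  refine if_congr ?_ rfl rfl
  by_cases h1 : t = Sum.inl p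
  · subst h1; simp only [Equiv.swap_apply_left, rank, Sum.elim_inl]; omega
  by_cases h2 : t = Sum.inl p'
  · subst h2; simp only [Equiv.swap_apply_right, rank, Sum.elim_inl]; omega
  rw [Equiv.swap_apply_of_ne_of_ne h1 h2]

theorem vertFun_adjLast (hM : Even M) (p : Fin D) (hp : (p : ℕ) + 1 = D) (c : GridFacet N q D M)
    (k : Fin (D + 1)) (hk : (k : ℕ) ≠ D) : (c.adjLast hM p).vertFun k = c.vertFun k := by
  have hk2 := k.2
  funext z
  obtain ⟨t, rfl⟩ := c.a.surjective z
  by_cases h : |c.x (c.a (Sum.inl p))| = M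
  · rw [adjLast, dif_pos h, c.vertFun_eq k t _ rfl, vertFun_eq (c.adjTurn p h) k
      (Equiv.swap (Sum.inl p) (Sum.inr (c.a (Sum.inl p)).1) t) _ (by simp [adjTurn])]
    refine if_congr ?_ rfl rfl
    by_cases h1 : t = Sum.inl p
    · subst h1; simp only [Equiv.swap_apply_left, rank, Sum.elim_inl, Sum.elim_inr]; omega
    by_cases h2 : t = Sum.inr (c.a (Sum.inl p)).1
    · rw [h2]; simp only [Equiv.swap_apply_right, rank, Sum.elim_inl, Sum.elim_inr]; omega
    rw [Equiv.swap_apply_of_ne_of_ne h1 h2]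
  · rw [adjLast, dif_neg h, c.vertFun_eq k t _ rfl, vertFun_eq (c.adjFlip p h) k t (c.a t) rfl]
    simp only [adjFlip]
    by_cases h : t = Sum.inl p
    · subst h
      have : ¬ ((p : ℕ) < k) := by omega
      simp [rank, this]
    · rw [Function.update_of_ne (by simpa using h)]

/-- The facet adjacent to `c` across the face opposite to the `k`-th vertex. -/
noncomputable def adj (hM : Even M) (hD : 0 < D) (k : Fin (D + 1)) (c : GridFacet N q D M) :
    GridFacet N q D M :=
  if h0 : (k : ℕ) = 0 then c.adjFirst hM ⟨0, hD⟩
  else if h1 : (k : ℕ) = D then c.adjLast hM ⟨D - 1, by omega⟩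
  else c.adjSwap ⟨k - 1, by omega⟩ ⟨k, by omega⟩

theorem vert_adj (hM : Even M) (hD : 0 < D) (k : Fin (D + 1)) (c : GridFacet N q D M)
    (j : Fin (D + 1)) (hj : j ≠ k) : (c.adj hM hD k).vert j = c.vert j := by
  suffices h : (c.adj hM hD k).vertFun j = c.vertFun j from
    Subtype.ext (by funext v i; exact congrFun h (v, i))
  have hj' : (j : ℕ) ≠ k := fun h => hj (Fin.ext h)
  unfold adj
  split_ifs with h0 h1
  · exact vertFun_adjFirst hM hD c j fun h => hj' (by rw [h, h0]; rfl)
  · exact vertFun_adjLast hM _ (by simp only; omega) c j (by omega)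
  · exact vertFun_adjSwap _ _ (by simp only; omega) c j hj'

theorem adj_adj (hM : Even M) (hD : 0 < D) (k : Fin (D + 1)) (c : GridFacet N q D M) :
    (c.adj hM hD k).adj hM hD k = c := by
  unfold adj
  split_ifs
  · exact adjFirst_adjFirst hM _ c
  · exact adjLast_adjLast hM _ c
  · exact adjSwap_adjSwap _ _ c

theorem adj_ne (hM : Even M) (hD : 0 < D) (k : Fin (D + 1)) (c : GridFacet N q D M) :
    c.adj hM hD k ≠ c := by
  unfold adj
  split_ifs
  · exact adjFirst_ne hM _ c
  · exact adjLast_ne hM _ c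
  · exact adjSwap_ne _ _ (fun h => by have := congrArg Fin.val h; simp only at this; omega) c

end Adjacent

theorem odd_vertFun_iff (c : GridFacet N q D M) (k : Fin (D + 1)) (p : N × Fin q) :
    Odd (c.vertFun k p) ↔ rank D (c.a.symm p) < k := by
  unfold vertFun
  split_ifs with h
  · simp [h, c.odd_y]
  · simp [h, c.even_x]

section Action

variable {G : Type*} [Group G] [MulAction G N] [SignCocycle G N]

theorem abs_units_mul (u : ℤˣ) (z : ℤ) : |(u : ℤ) * z| = |z| := by
  rcases Int.units_eq_one_or u with h | h <;> simp [h]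

theorem sgn_mul_smul (g k : G) (v : N) :
    ((sgn (g * k) v : ℤˣ) : ℤ) = (sgn g v : ℤˣ) * (sgn k (g⁻¹ • v) : ℤˣ) := by
  rw [sgn_mul]; rfl

instance : MulAction G (GridFacet N q D M) where
  smul g c :=
    { x := fun p => (sgn g p.1 : ℤˣ) * c.x (g⁻¹ • p.1, p.2)
      y := fun p => (sgn g p.1 : ℤˣ) * c.y (g⁻¹ • p.1, p.2)
      a := (Equiv.sumCongr (Equiv.refl _) (MulAction.toPerm g⁻¹)).trans
        (c.a.trans (Equiv.prodCongr (MulAction.toPerm g) (Equiv.refl _)))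
      even_x := fun p => (c.even_x _).mul_left _
      dist_xy := fun p => by rw [← mul_sub, abs_units_mul]; exact c.dist_xy _
      x_le := fun p => by rw [abs_units_mul]; exact c.x_le _
      y_le := fun p => by rw [abs_units_mul]; exact c.y_le _
      a_fst := fun v => by simp [c.a_fst]
      x_eq := fun v => by rw [abs_units_mul]; simpa using c.x_eq _ }
  one_smul c := by
    refine ext' ?_ ?_ ?_
    · funext p
      change ((sgn (1 : G) p.1 : ℤˣ) : ℤ) * c.x ((1 : G)⁻¹ • p.1, p.2) = c.x p
      simp [sgn_one]
    · funext p
      change ((sgn (1 : G) p.1 : ℤˣ) : ℤ) * c.y ((1 : G)⁻¹ • p.1, p.2) = c.y p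
      simp [sgn_one]
    · ext1 t
      change Prod.map ((1 : G) • ·) id (c.a (Sum.map id ((1 : G)⁻¹ • ·) t)) = c.a t
      rcases t with t | t <;> simp <;> rfl
  mul_smul g k c := by
    refine ext' ?_ ?_ ?_
    · funext p
      change ((sgn (g * k) p.1 : ℤˣ) : ℤ) * c.x ((g * k)⁻¹ • p.1, p.2) =
        (sgn g p.1 : ℤˣ) * ((sgn k (g⁻¹ • p.1) : ℤˣ) * c.x (k⁻¹ • g⁻¹ • p.1, p.2))
      rw [sgn_mul_smul, mul_inv_rev, mul_smul, mul_assoc]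
    · funext p
      change ((sgn (g * k) p.1 : ℤˣ) : ℤ) * c.y ((g * k)⁻¹ • p.1, p.2) =
        (sgn g p.1 : ℤˣ) * ((sgn k (g⁻¹ • p.1) : ℤˣ) * c.y (k⁻¹ • g⁻¹ • p.1, p.2))
      rw [sgn_mul_smul, mul_inv_rev, mul_smul, mul_assoc]
    · ext1 t
      change Prod.map ((g * k) • ·) id (c.a (Sum.map id ((g * k)⁻¹ • ·) t)) =
        Prod.map (g • ·) id (Prod.map (k • ·) id
          (c.a (Sum.map id (k⁻¹ • ·) (Sum.map id (g⁻¹ • ·) t))))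
      rcases t with t | t <;> simp [mul_smul, Prod.map]

theorem smul_x (g : G) (c : GridFacet N q D M) (p) :
    (g • c).x p = (sgn g p.1 : ℤˣ) * c.x (g⁻¹ • p.1, p.2) := rfl

theorem smul_y (g : G) (c : GridFacet N q D M) (p) :
    (g • c).y p = (sgn g p.1 : ℤˣ) * c.y (g⁻¹ • p.1, p.2) := rfl

theorem smul_a_inl (g : G) (c : GridFacet N q D M) (t) :
    (g • c).a (Sum.inl t) = (g • (c.a (Sum.inl t)).1, (c.a (Sum.inl t)).2) := rfl

theorem smul_a_inr (g : G) (c : GridFacet N q D M) (v) :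
    (g • c).a (Sum.inr v) = (g • (c.a (Sum.inr (g⁻¹ • v))).1, (c.a (Sum.inr (g⁻¹ • v))).2) := rfl

theorem rank_smul (g : G) (c : GridFacet N q D M) (p) :
    rank D ((g • c).a.symm p) = rank D (c.a.symm (g⁻¹ • p.1, p.2)) := by
  obtain ⟨t, rfl⟩ := (g • c).a.surjective p
  rw [Equiv.symm_apply_apply]
  rcases t with t | t
  · rw [smul_a_inl]; simp
  · rw [smul_a_inr]; simp [rank]

theorem vertFun_smul (g : G) (c : GridFacet N q D M) (k : Fin (D + 1)) (p) :
    (g • c).vertFun k p = (sgn g p.1 : ℤˣ) * c.vertFun k (g⁻¹ • p.1, p.2) := by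
  simp only [vertFun, rank_smul, smul_x, smul_y]
  split_ifs <;> rfl

end Action

end GridFacet

namespace GridPoint

open SignCocycle

variable {N G : Type*} {q : ℕ} {M : ℤ} [Group G] [MulAction G N] [SignCocycle G N]

theorem act_apply (g : G) (x : N → Fin q → ℤ) (v : N) (i : Fin q) :
    act g x v i = (sgn g v : ℤˣ) * x (g⁻¹ • v) i := by
  simp [act, Units.smul_def]

instance : MulAction G (GridPoint N q M) where
  smul g x := ⟨act g x.1, fun v i => by
      rw [act_apply, GridFacet.abs_units_mul]; exact x.2.1 _ _, fun v => by
      obtain ⟨i, hi⟩ := x.2.2 (g⁻¹ • v)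
      exact ⟨i, by rw [act_apply, GridFacet.abs_units_mul, hi]⟩⟩
  one_smul x := Subtype.ext (act_one x.1)
  mul_smul g k x := Subtype.ext (act_mul g k x.1)

theorem smul_val (g : G) (x : GridPoint N q M) : (g • x).1 = act g x.1 := rfl

theorem eq_one_of_smul_eq (hM : 0 < M) (g : G) (x : GridPoint N q M) (h : g • x = x) : g = 1 := by
  refine eq_one_of_act_eq g x.1 (congrArg Subtype.val h) fun v hv => ?_
  obtain ⟨i, hi⟩ := x.2.2 v
  have := congrFun hv i
  simp only [Pi.neg_apply] at this
  have h0 : x.1 v i = 0 := by omega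
  rw [h0] at hi
  simp at hi
  omega

instance [Finite N] : Finite (GridPoint N q M) := by
  let F : GridPoint N q M → (N → Fin q → Set.Icc (-M) M) := fun x v i =>
    ⟨x.1 v i, abs_le.1 (x.2.1 v i)⟩
  refine Finite.of_injective F fun x y h => Subtype.ext ?_
  funext v i
  exact congrArg Subtype.val (congrFun (congrFun h v) i)

end GridPoint

namespace GridFacet

open SignCocycle

variable {N : Type*} {q D : ℕ} {M : ℤ}

instance [Finite N] : Finite (GridFacet N q D M) := by
  let F : GridFacet N q D M → (N × Fin q → Set.Icc (-M) M) × (N × Fin q → Set.Icc (-M) M) ×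
      (Fin D ⊕ N → N × Fin q) := fun c =>
    (fun p => ⟨c.x p, abs_le.1 (c.x_le p)⟩, fun p => ⟨c.y p, abs_le.1 (c.y_le p)⟩, c.a)
  refine Finite.of_injective F fun c c' h => ext' ?_ ?_ ?_
  · funext p
    exact congrArg Subtype.val (congrFun (congrArg Prod.fst h) p)
  · funext p
    exact congrArg Subtype.val (congrFun (congrArg (fun z => z.2.1) h) p)
  · exact DFunLike.coe_injective (congrArg (fun z => z.2.2) h)

variable {G : Type*} [Group G] [MulAction G N] [SignCocycle G N]

theorem vert_smul (g : G) (c : GridFacet N q D M) (k : Fin (D + 1)) :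
    (g • c).vert k = g • c.vert k := by
  refine Subtype.ext ?_
  funext v i
  rw [GridPoint.smul_val, GridPoint.act_apply]
  exact vertFun_smul g c k (v, i)

section

variable [DecidableEq N]

theorem update_smul (g : G) (s : N → ℤˣ) (x : N × Fin q → ℤ) (a : N × Fin q) (w : ℤ) :
    Function.update (fun p : N × Fin q => ((s p.1 : ℤˣ) : ℤ) * x (g⁻¹ • p.1, p.2)) (g • a.1, a.2)
      (s (g • a.1) * w) = fun p => (s p.1 : ℤˣ) * Function.update x a w (g⁻¹ • p.1, p.2) := by
  funext p
  by_cases h : p = (g • a.1, a.2)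
  · subst h; simp
  · rw [Function.update_of_ne h, Function.update_of_ne]
    intro h'
    apply h
    rw [← h']
    simp

theorem adjFirst_smul (hM : Even M) (p : Fin D) (g : G) (c : GridFacet N q D M) :
    (g • c).adjFirst hM p = g • c.adjFirst hM p := by
  refine ext' ?_ rfl rfl
  refine Eq.trans ?_ (update_smul g (sgn g) c.x (c.a (Sum.inl p)) _)
  change Function.update (g • c).x ((g • c).a (Sum.inl p)) _ = _
  congr 1
  rw [smul_a_inl, smul_x, smul_y]
  simp only [inv_smul_smul, Prod.mk.eta]
  ring

theorem adjSwap_smul (p p' : Fin D) (g : G) (c : GridFacet N q D M) :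
    (g • c).adjSwap p p' = g • c.adjSwap p p' := by
  refine ext' rfl rfl ?_
  ext1 t
  rcases t with t | t
  · rw [smul_a_inl]
    simp only [adjSwap, Equiv.trans_apply]
    by_cases h1 : t = p
    · subst h1; simp [smul_a_inl]
    by_cases h2 : t = p'
    · subst h2; simp [smul_a_inl]
    rw [Equiv.swap_apply_of_ne_of_ne (by simpa) (by simpa), smul_a_inl]
  · rw [smul_a_inr]
    simp only [adjSwap, Equiv.trans_apply]
    rw [Equiv.swap_apply_of_ne_of_ne (by simp) (by simp), smul_a_inr,
      Equiv.swap_apply_of_ne_of_ne (by simp) (by simp)]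

theorem abs_smul_x (g : G) (c : GridFacet N q D M) (p : Fin D) :
    |(g • c).x ((g • c).a (Sum.inl p))| = |c.x (c.a (Sum.inl p))| := by
  rw [smul_a_inl, smul_x, abs_units_mul]; simp

theorem adjLast_smul (hM : Even M) (p : Fin D) (g : G) (c : GridFacet N q D M) :
    (g • c).adjLast hM p = g • c.adjLast hM p := by
  by_cases h : |c.x (c.a (Sum.inl p))| = M
  · have h' := (abs_smul_x g c p).trans h
    rw [adjLast, adjLast, dif_pos h, dif_pos h']
    refine ext' rfl rfl ?_
    ext1 t
    rcases t with t | t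
    · rw [smul_a_inl]
      simp only [adjTurn, Equiv.trans_apply]
      by_cases h1 : t = p
      · subst h1; simp [smul_a_inl, smul_a_inr]
      rw [Equiv.swap_apply_of_ne_of_ne (by simpa) (by simp), smul_a_inl,
        Equiv.swap_apply_of_ne_of_ne (by simpa) (by simp)]
    · rw [smul_a_inr]
      simp only [adjTurn, Equiv.trans_apply]
      by_cases h1 : t = g • (c.a (Sum.inl p)).1
      · subst h1; simp [smul_a_inl]
      rw [Equiv.swap_apply_of_ne_of_ne (by simp) (by simpa [smul_a_inl]), smul_a_inr,
        Equiv.swap_apply_of_ne_of_ne (by simp) (by simpa [inv_smul_eq_iff])]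
  · have h' : |(g • c).x ((g • c).a (Sum.inl p))| ≠ M := by rwa [abs_smul_x]
    rw [adjLast, adjLast, dif_neg h, dif_neg h']
    refine ext' rfl ?_ rfl
    refine Eq.trans ?_ (update_smul g (sgn g) c.y (c.a (Sum.inl p)) _)
    change Function.update (g • c).y ((g • c).a (Sum.inl p)) _ = _
    congr 1
    rw [smul_a_inl, smul_x, smul_y]
    simp only [inv_smul_smul, Prod.mk.eta]
    ring

theorem adj_smul (hM : Even M) (hD : 0 < D) (k : Fin (D + 1)) (g : G) (c : GridFacet N q D M) :
    (g • c).adj hM hD k = g • c.adj hM hD k := by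
  unfold adj
  split_ifs
  · exact adjFirst_smul hM _ g c
  · exact adjLast_smul hM _ g c
  · exact adjSwap_smul _ _ g c

end

theorem card_odd_vert [Fintype N] (c : GridFacet N q D M) (k : Fin (D + 1)) :
    Nat.card {p : N × Fin q // Odd (c.vertFun k p)} = k := by
  classical
  have e : {p : N × Fin q // Odd (c.vertFun k p)} ≃ Fin k := by
    refine (c.a.symm.subtypeEquiv (q := fun t => rank D t < k)
      fun p => c.odd_vertFun_iff k p).trans ?_
    refine ⟨fun t => ⟨rank D t.1, t.2⟩, fun l => ⟨Sum.inl ⟨l, by omega⟩, l.2⟩, ?_, ?_⟩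
    · rintro ⟨t | t, ht⟩
      · rfl
      · simp only [rank, Sum.elim_inr] at ht; omega
    · intro l; rfl
  rw [Nat.card_congr e, Nat.card_eq_fintype_card, Fintype.card_fin]

theorem vert_orbit [Fintype N] (c : GridFacet N q D M) (i j : Fin (D + 1)) (g : G)
    (h : c.vert i = g • c.vert j) : i = j := by
  rw [← vert_smul] at h
  have h' : c.vertFun i = (g • c).vertFun j := by
    funext p
    exact congrFun (congrFun (congrArg Subtype.val h) p.1) p.2
  have h1 := card_odd_vert c i
  rw [h', card_odd_vert] at h1
  exact Fin.ext h1.symm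

/-- The boundary of a product of cubes as a chamber system. -/
noncomputable def chamberSystem [DecidableEq N] [Fintype N] (hM : Even M) (hM0 : 0 < M)
    (hD : 0 < D) :
    ChamberSystem G (GridFacet N q D M) (GridPoint N q M) (Fin (D + 1)) where
  vert := vert
  adj := adj hM hD
  adj_adj := adj_adj hM hD
  adj_smul := adj_smul hM hD
  adj_ne k g c h := by
    obtain ⟨j, hj⟩ : ∃ j : Fin (D + 1), j ≠ k := by
      have : Nontrivial (Fin (D + 1)) := Fin.nontrivial_iff_two_le.2 (by omega)
      exact exists_ne k
    have h1 := vert_adj hM hD k c j hj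
    rw [h, vert_smul] at h1
    have := GridPoint.eq_one_of_smul_eq hM0 g _ h1
    subst this
    rw [one_smul] at h
    exact adj_ne hM hD k c h
  vert_adj k c j hj := vert_adj hM hD k c j hj
  vert_smul := vert_smul
  vert_orbit := vert_orbit

end GridFacet

namespace GridPoint

open SignCocycle

variable {N G : Type*} {n D : ℕ} {M : ℤ} [Group G] [MulAction G N] [SignCocycle G N]

/-- All last coordinates are extremal. -/
def IsFull (x : GridPoint N (n + 1) M) : Prop := ∀ v, |x.1 v (Fin.last n)| = M

/-- The signs of the last coordinates. -/
noncomputable def lastSign (x : GridPoint N (n + 1) M) (v : N) : ℤˣ :=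
  if 0 < x.1 v (Fin.last n) then 1 else -1

variable (G) in
/-- The group element determined by the signs of the last coordinates. -/
noncomputable def signElem (x : GridPoint N (n + 1) M) : G :=
  (Equiv.ofBijective _ (bijective_sgn (G := G) (N := N))).symm x.lastSign

theorem sgn_signElem (x : GridPoint N (n + 1) M) : sgn (signElem G x) = x.lastSign :=
  (Equiv.ofBijective _ (bijective_sgn (G := G) (N := N))).apply_symm_apply x.lastSign

theorem isFull_smul (g : G) (x : GridPoint N (n + 1) M) : (g • x).IsFull ↔ x.IsFull := by
  have h : ∀ (g : G) (x : GridPoint N (n + 1) M), x.IsFull → (g • x).IsFull := fun g x hx v => by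
    rw [smul_val, act_apply, GridFacet.abs_units_mul]; exact hx _
  exact ⟨fun hx => by simpa using h g⁻¹ _ hx, h g x⟩

theorem signElem_smul (hM : 0 < M) (g : G) (x : GridPoint N (n + 1) M) (hx : x.IsFull) :
    signElem G (g • x) = g * signElem G x := by
  apply (bijective_sgn (G := G) (N := N)).1
  rw [sgn_signElem]
  funext v
  rw [sgn_mul, sgn_signElem, lastSign, lastSign, smul_val, act_apply]
  have h0 : x.1 (g⁻¹ • v) (Fin.last n) ≠ 0 := fun h => by
    have := hx (g⁻¹ • v)
    rw [h] at this; simp at this; omega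
  rcases Int.units_eq_one_or (sgn g v) with h | h
  · simp [h]
  · rw [h]
    rcases lt_or_gt_of_ne h0 with h1 | h1
    · simp [h1, h1.le]
    · simp [h1, h1.le]

variable (G) in
open Classical in
/-- Drop the last coordinates, with a shift on the points all of whose last coordinates are
extremal. -/
noncomputable def shiftedProj (s : N → Fin n → ℝ) (x : GridPoint N (n + 1) M) : N → Fin n → ℝ :=
  (fun v i => (x.1 v i.castSucc : ℝ)) - if x.IsFull then act (signElem G x) s else 0

theorem shiftedProj_smul (hM : 0 < M) (s : N → Fin n → ℝ) (g : G) (x : GridPoint N (n + 1) M) :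
    shiftedProj G s (g • x) = act g (shiftedProj G s x) := by
  have h1 : (fun v i => ((g • x).1 v (Fin.castSucc i) : ℝ)) =
      act g (fun v i => (x.1 v (Fin.castSucc i) : ℝ)) := by
    funext v i
    rw [smul_val, act_apply]
    simp only [act, Units.smul_def, Pi.smul_apply, zsmul_eq_mul, Int.cast_mul]
  have h2 : ∀ y z : N → Fin n → ℝ, act g (y - z) = act g y - act g z := fun y z => by
    funext v; simp [act, smul_sub]
  rw [shiftedProj, shiftedProj, h2, h1]
  congr 1
  by_cases h : x.IsFull
  · rw [if_pos h, if_pos ((isFull_smul g x).2 h), signElem_smul hM g x h, act_mul]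
  · rw [if_neg h, if_neg (fun h' => h ((isFull_smul g x).1 h'))]
    funext v; simp [act]

end GridPoint

namespace GridFacet

open SignCocycle GridPoint

variable {N G : Type*} {n D : ℕ} {M : ℤ} [Group G] [MulAction G N] [SignCocycle G N]

/-- The ordering that puts the last coordinates in the end. -/
def baseOrder (e : Fin D ≃ N × Fin n) : Fin D ⊕ N ≃ N × Fin (n + 1) where
  toFun := Sum.elim (fun l => ((e l).1, (e l).2.castSucc)) (fun v => (v, Fin.last n))
  invFun p := Fin.lastCases (motive := fun _ => Fin D ⊕ N) (Sum.inr p.1)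
    (fun i => Sum.inl (e.symm (p.1, i))) p.2
  left_inv t := by rcases t with t | t <;> simp
  right_inv p := by
    obtain ⟨v, i⟩ := p
    induction i using Fin.lastCases <;> simp

/-- The facet of the special labelling containing `0`. -/
def base (e : Fin D ≃ N × Fin n) (hM : Even M) (hM0 : 0 < M) : GridFacet N (n + 1) D M where
  x p := if p.2 = Fin.last n then M else 0
  y p := if p.2 = Fin.last n then M - 1 else 1
  a := baseOrder e
  even_x p := by split_ifs <;> simp [hM]
  dist_xy p := by split_ifs <;> simp
  x_le p := by split_ifs <;> simp [abs_of_pos hM0, hM0.le]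
  y_le p := by split_ifs <;> rw [abs_le] <;> omega
  a_fst v := rfl
  x_eq v := by simp [baseOrder, abs_of_pos hM0]

/-- The barycentric shift. -/
noncomputable def shift (e : Fin D ≃ N × Fin n) (v : N) (i : Fin n) : ℝ :=
  1 - ((e.symm (v, i) : ℕ) + 1 : ℝ) / (D + 1)

theorem shift_pos (e : Fin D ≃ N × Fin n) (v : N) (i : Fin n) : 0 < shift e v i := by
  rw [shift, sub_pos, div_lt_one (by positivity)]
  have := (e.symm (v, i)).2
  exact_mod_cast Nat.succ_lt_succ this

theorem shift_lt_one (e : Fin D ≃ N × Fin n) (v : N) (i : Fin n) : shift e v i < 1 := by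
  rw [shift, sub_lt_self_iff]; positivity

theorem base_vert_castSucc (e : Fin D ≃ N × Fin n) (hM : Even M) (hM0 : 0 < M) (k : Fin (D + 1))
    (v : N) (i : Fin n) :
    ((base e hM hM0).vert k).1 v i.castSucc = if (e.symm (v, i) : ℕ) < k then 1 else 0 := by
  change (base e hM hM0).vertFun k (v, i.castSucc) = _
  rw [vertFun_eq (base e hM hM0) k (Sum.inl (e.symm (v, i))) (v, i.castSucc)
    (by simp [base, baseOrder])]
  simp [base, rank]

theorem base_vert_last (e : Fin D ≃ N × Fin n) (hM : Even M) (hM0 : 0 < M) (k : Fin (D + 1))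
    (v : N) : ((base e hM hM0).vert k).1 v (Fin.last n) = M := by
  have := (base e hM hM0).vertFun_inr k v
  change (base e hM hM0).vertFun k (v, Fin.last n) = M
  simpa [base, baseOrder] using this

theorem signElem_eq_one (hM0 : 0 < M) (x : GridPoint N (n + 1) M)
    (hx : ∀ v, x.1 v (Fin.last n) = M) : signElem G x = 1 := by
  apply (bijective_sgn (G := G) (N := N)).1
  rw [sgn_signElem]
  funext v
  rw [sgn_one, lastSign, hx, if_pos hM0]

theorem shiftedProj_of_last (hM0 : 0 < M) (s : N → Fin n → ℝ) (x : GridPoint N (n + 1) M)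
    (hx : ∀ v, x.1 v (Fin.last n) = M) :
    shiftedProj G s x = (fun v i => (x.1 v i.castSucc : ℝ)) - s := by
  rw [shiftedProj, if_pos (show x.IsFull from fun v => by rw [hx, abs_of_pos hM0]), signElem_eq_one hM0 x hx, act_one]

theorem shiftedProj_base (e : Fin D ≃ N × Fin n) (hM : Even M) (hM0 : 0 < M) (k : Fin (D + 1)) :
    shiftedProj G (shift e) ((base e hM hM0).vert k) =
      (fun v i => if (e.symm (v, i) : ℕ) < k then (1 : ℝ) else 0) - shift e := by
  rw [shiftedProj_of_last hM0 _ _ (base_vert_last e hM hM0 k)]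
  simp only [base_vert_castSucc]
  congr 1
  funext v i
  split_ifs <;> simp

theorem sum_shiftedProj_base (e : Fin D ≃ N × Fin n) (hM : Even M) (hM0 : 0 < M) :
    ∑ k : Fin (D + 1), (1 / (D + 1) : ℝ) • shiftedProj G (shift e) ((base e hM hM0).vert k) = 0 := by
  funext v i
  simp only [shiftedProj_base, Finset.sum_apply, Pi.smul_apply, Pi.sub_apply, Pi.zero_apply,
    smul_eq_mul]
  rw [← Finset.mul_sum, Finset.sum_sub_distrib]
  set t := e.symm (v, i)
  have h1 : (∑ k : Fin (D + 1), if (t : ℕ) < k then (1 : ℝ) else 0) = D - t := by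
    rw [Fin.sum_univ_eq_sum_range (fun k => if (t : ℕ) < k then (1 : ℝ) else 0), Finset.sum_boole]
    have : (Finset.range (D + 1)).filter (fun k => (t : ℕ) < k) = Finset.Ioc (t : ℕ) D := by
      ext k; simp; omega
    rw [this, Nat.card_Ioc, Nat.cast_sub t.2.le]
  rw [h1]
  simp only [Finset.sum_const, Finset.card_univ, Fintype.card_fin, nsmul_eq_mul, shift]
  have : (D + 1 : ℝ) ≠ 0 := by positivity
  push_cast
  field_simp
  simp [t]

theorem span_shiftedProj_base [Finite N] (e : Fin D ≃ N × Fin n) (hM : Even M) (hM0 : 0 < M) :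
    Submodule.span ℝ (Set.range fun k : Fin (D + 1) =>
      shiftedProj G (shift e) ((base e hM hM0).vert k)) = ⊤ := by
  classical
  rw [eq_top_iff]
  intro x _
  have h : x = ∑ l : Fin D, x (e l).1 (e l).2 •
      (shiftedProj G (shift e) ((base e hM hM0).vert l.succ) -
        shiftedProj G (shift e) ((base e hM hM0).vert l.castSucc)) := by
    funext v i
    simp only [shiftedProj_base, Finset.sum_apply, Pi.smul_apply, Pi.sub_apply, smul_eq_mul]
    rw [Finset.sum_eq_single (e.symm (v, i))]
    · simp
    · intro l _ hl
      have hl' : (e.symm (v, i) : ℕ) ≠ l := fun h => hl (Fin.ext h.symm)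
      have : ((e.symm (v, i) : ℕ) < l + 1) ↔ ((e.symm (v, i) : ℕ) < l) := by omega
      simp [this]
    · simp
  rw [h]
  refine Submodule.sum_mem _ fun l _ => Submodule.smul_mem _ _ (Submodule.sub_mem _ ?_ ?_)
  · exact Submodule.subset_span ⟨_, rfl⟩
  · exact Submodule.subset_span ⟨_, rfl⟩

end GridFacet

namespace GridFacet

open SignCocycle GridPoint

variable {N G : Type*} {n D : ℕ} {M : ℤ} [Group G] [MulAction G N] [SignCocycle G N]

theorem vertFun_real (c : GridFacet N n D M) (k : Fin (D + 1)) (p) : (c.vertFun k p : ℝ) =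
    c.x p + (c.y p - c.x p) * if rank D (c.a.symm p) < k then 1 else 0 := by
  unfold vertFun; split_ifs <;> simp

theorem sum_vertFun (c : GridFacet N n D M) (l : Fin (D + 1) → ℝ) (hl : ∑ k, l k = 1) (p) :
    ∑ k, l k * (c.vertFun k p : ℝ) = c.x p + (c.y p - c.x p) *
      ∑ k : Fin (D + 1), if rank D (c.a.symm p) < k then l k else 0 := by
  simp only [vertFun_real, mul_add, Finset.sum_add_distrib, ← Finset.sum_mul, hl, one_mul,
    Finset.mul_sum]
  congr 1
  refine Finset.sum_congr rfl fun k _ => ?_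
  split_ifs <;> ring

theorem eq_base (e : Fin D ≃ N × Fin n) (hM : Even M) (hM0 : 0 < M) (c : GridFacet N (n + 1) D M)
    (hlast : ∀ v, (c.a (Sum.inr v)).2 = Fin.last n) (hx : ∀ v, c.x (v, Fin.last n) = M)
    (l : Fin (D + 1) → ℝ) (hl0 : ∀ k, 0 ≤ l k) (hl1 : ∑ k, l k = 1)
    (hs : ∀ v i, ∑ k, l k * (c.vertFun k (v, Fin.castSucc i) : ℝ) = shift e v i) :
    c = base e hM hM0 := by
  have hmu0 : ∀ r : ℕ, 0 ≤ ∑ k : Fin (D + 1), if r < (k : ℕ) then l k else 0 := fun r =>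
    Finset.sum_nonneg fun k _ => by split_ifs; exacts [hl0 k, le_rfl]
  have hmu1 : ∀ r : ℕ, (∑ k : Fin (D + 1), if r < (k : ℕ) then l k else 0) ≤ 1 := fun r => by
    rw [← hl1]
    exact Finset.sum_le_sum fun k _ => by split_ifs; exacts [le_rfl, hl0 k]
  have hmua : ∀ r r' : ℕ, r ≤ r' → (∑ k : Fin (D + 1), if r' < (k : ℕ) then l k else 0) ≤
      ∑ k : Fin (D + 1), if r < (k : ℕ) then l k else 0 := fun r r' hr =>
    Finset.sum_le_sum fun k _ => by
      by_cases h : r' < (k : ℕ)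
      · rw [if_pos h, if_pos (hr.trans_lt h)]
      · rw [if_neg h]; split_ifs; exacts [hl0 k, le_rfl]
  have hp : ∀ v i, c.x (v, Fin.castSucc i) = 0 ∧ c.y (v, Fin.castSucc i) = 1 ∧
      (∑ k : Fin (D + 1), if rank D (c.a.symm (v, Fin.castSucc i)) < (k : ℕ) then l k else 0) =
        shift e v i := by
    intro v i
    have h1 := hs v i
    rw [sum_vertFun c l hl1] at h1
    have h2 := hmu0 (rank D (c.a.symm (v, Fin.castSucc i)))
    have h3 := hmu1 (rank D (c.a.symm (v, Fin.castSucc i)))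
    set μ := ∑ k : Fin (D + 1), if rank D (c.a.symm (v, Fin.castSucc i)) < (k : ℕ) then l k else 0
    have h4 := shift_pos e v i
    have h5 := shift_lt_one e v i
    have h6 := c.dist_xy (v, Fin.castSucc i)
    obtain ⟨z, hz⟩ := c.even_x (v, Fin.castSucc i)
    have hxz : (c.x (v, Fin.castSucc i) : ℝ) = z + z := by rw [hz]; push_cast; rfl
    rcases (abs_eq zero_le_one).1 h6 with h | h
    · have hy : (c.y (v, Fin.castSucc i) : ℝ) - c.x (v, Fin.castSucc i) = 1 := by exact_mod_cast h
      rw [hy, hxz] at h1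
      have hz0 : z = 0 := by
        have ha : (z : ℝ) < 1 := by linarith
        have hb : (-1 : ℝ) < z := by linarith
        have ha' : z < 1 := by exact_mod_cast ha
        have hb' : -1 < z := by exact_mod_cast hb
        omega
      subst hz0
      refine ⟨by omega, by omega, ?_⟩
      simpa using h1
    · have hy : (c.y (v, Fin.castSucc i) : ℝ) - c.x (v, Fin.castSucc i) = -1 := by exact_mod_cast h
      rw [hy, hxz] at h1
      exfalso
      have ha : (z : ℝ) < 1 := by linarith
      have hb : (0 : ℝ) < z := by linarith
      have ha' : z < 1 := by exact_mod_cast ha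
      have hb' : 0 < z := by exact_mod_cast hb
      omega
  have hyl : ∀ v, c.y (v, Fin.last n) = M - 1 := fun v => by
    have h1 := c.dist_xy (v, Fin.last n)
    have h2 := (abs_le.1 (c.y_le (v, Fin.last n))).2
    rw [hx] at h1
    rcases (abs_eq zero_le_one).1 h1 with h | h <;> omega
  have hinr : ∀ v, c.a (Sum.inr v) = (v, Fin.last n) := fun v =>
    Prod.ext (c.a_fst v) (hlast v)
  have hinl : ∀ t : Fin D, ∃ s : Fin D, c.a (Sum.inl t) = ((e s).1, (e s).2.castSucc) := by
    intro t
    obtain ⟨⟨v, i⟩, hvi⟩ : ∃ p, p = c.a (Sum.inl t) := ⟨_, rfl⟩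
    induction i using Fin.lastCases with
    | last =>
      rw [← hinr] at hvi
      exact absurd (c.a.injective hvi) (by simp)
    | cast i => exact ⟨e.symm (v, i), by rw [← hvi]; simp⟩
  choose s hs' using hinl
  have hsinj : Function.Injective s := fun t t' h => by
    have := (hs' t).trans ((congrArg (fun s => ((e s).1, (e s).2.castSucc)) h).trans (hs' t').symm)
    simpa using c.a.injective this
  have hsmono : Monotone s := by
    intro t t' htt
    have h1 := (hp (e (s t)).1 (e (s t)).2).2.2
    have h2 := (hp (e (s t')).1 (e (s t')).2).2.2
    rw [← hs', Equiv.symm_apply_apply] at h1 h2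
    have h3 := hmua (rank D (Sum.inl t : Fin D ⊕ N)) (rank D (Sum.inl t' : Fin D ⊕ N)) htt
    rw [h1, h2] at h3
    simp only [shift, Prod.mk.eta, Equiv.symm_apply_apply] at h3
    rw [sub_le_sub_iff_left, div_le_div_iff_of_pos_right (by positivity)] at h3
    have : ((s t : ℕ) : ℝ) ≤ (s t' : ℕ) := by linarith
    exact_mod_cast this
  have hsid : s = id := by
    have h1 := Subsingleton.elim (StrictMono.orderIsoOfSurjective s
      (hsmono.strictMono_of_injective hsinj) (Finite.injective_iff_surjective.1 hsinj))
      (OrderIso.refl (Fin D))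
    exact congrArg DFunLike.coe h1
  subst hsid
  refine ext' ?_ ?_ ?_
  · funext ⟨v, i⟩
    induction i using Fin.lastCases with
    | last => simp [base, hx]
    | cast i => simp [base, hp]
  · funext ⟨v, i⟩
    induction i using Fin.lastCases with
    | last => simp [base, hyl]
    | cast i => simp [base, hp]
  · ext1 t
    rcases t with t | t
    · rw [hs']; rfl
    · rw [hinr]; rfl

theorem eq_or_dist_vertFun (c : GridFacet N n D M) (j k : Fin (D + 1)) (p) :
    |c.vertFun j p - c.vertFun k p| ≤ 1 := by
  have := c.dist_xy p
  unfold vertFun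
  split_ifs
  · simp
  · rw [this]
  · rw [abs_sub_comm, this]
  · simp

theorem mem_orbit_base [Fintype N] (e : Fin D ≃ N × Fin n) (hM : Even M) (hM0 : 0 < M)
    (c : GridFacet N (n + 1) D M)
    (h : ZeroInHull fun k => shiftedProj G (shift e) (c.vert k)) :
    c ∈ MulAction.orbit G (base e hM hM0) := by
  have hM2 : 2 ≤ M := by obtain ⟨z, hz⟩ := hM; omega
  have key : ∀ c : GridFacet N (n + 1) D M,
      (ZeroInHull fun k => shiftedProj G (shift e) (c.vert k)) →
      ∀ v, (c.a (Sum.inr v)).2 = Fin.last n := by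
    intro c h v
    obtain ⟨l, hl, hl0⟩ := (zeroInHull_iff_stdSimplex _).1 h
    by_contra hne
    obtain ⟨i, hi⟩ := Fin.exists_castSucc_eq.2 hne
    have h1 := congrFun (congrFun hl0 v) i
    simp only [Finset.sum_apply, Pi.smul_apply, shiftedProj, Pi.sub_apply, smul_eq_mul, mul_sub,
      Finset.sum_sub_distrib, Pi.zero_apply] at h1
    have h2 : ∀ k : Fin (D + 1), (c.vert k).1 v i.castSucc = c.x (c.a (Sum.inr v)) := by
      intro k
      rw [← vertFun_inr c k v, a_inr, ← hi]
      rfl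
    simp only [h2, ← Finset.sum_mul, hl.2, one_mul] at h1
    have h3 : |(c.x (c.a (Sum.inr v)) : ℝ)| = M := by exact_mod_cast c.x_eq v
    rw [sub_eq_zero.1 h1] at h3
    have h4 : (M : ℝ) ≤ ∑ k : Fin (D + 1), l k := by
      rw [← h3]
      refine (Finset.abs_sum_le_sum_abs _ _).trans (Finset.sum_le_sum fun k _ => ?_)
      rw [abs_mul, abs_of_nonneg (hl.1 k)]
      refine mul_le_of_le_one_right (hl.1 k) ?_
      split_ifs
      · simp only [act]
        have hs : |shift e ((signElem G (c.vert k))⁻¹ • v) i| ≤ 1 := by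
          rw [abs_of_pos (shift_pos e _ _)]; exact (shift_lt_one e _ _).le
        rcases Int.units_eq_one_or (sgn (signElem G (c.vert k)) v) with h | h <;>
          simpa [h] using hs
      · simp
    rw [hl.2] at h4
    have : M ≤ 1 := by exact_mod_cast h4
    omega
  have hsm : ∀ g : G, ZeroInHull fun k => shiftedProj G (shift e) ((g • c).vert k) := by
    intro g
    have : (fun k => shiftedProj G (shift e) ((g • c).vert k)) = fun k =>
        (rep (Fin n → ℝ) g).toLinearEquiv (shiftedProj G (shift e) (c.vert k)) := by
      funext k
      rw [vert_smul, shiftedProj_smul hM0]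
      exact (rep_apply (Fin n → ℝ) g _).symm
    rw [this, zeroInHull_map]
    exact h
  set g := signElem G (c.vert 0) with hg
  have hinr : ∀ v, c.a (Sum.inr v) = (v, Fin.last n) := fun v =>
    Prod.ext (c.a_fst v) (key c h v)
  have hxM : ∀ v, |c.x (v, Fin.last n)| = M := fun v => by rw [← hinr]; exact c.x_eq v
  have hc0 : ∀ v, (c.vert 0).1 v (Fin.last n) = c.x (v, Fin.last n) := fun v => by
    have := vertFun_inr c 0 v
    rw [hinr] at this
    exact this
  have hx' : ∀ v, (g⁻¹ • c).x (v, Fin.last n) = M := by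
    intro v
    have h1 : sgn g (g • v) = sgn g⁻¹ v := by
      have := sgn_mul g⁻¹ g v
      rw [inv_mul_cancel, sgn_one, inv_inv] at this
      rcases Int.units_eq_one_or (sgn g (g • v)) with h | h <;>
        rcases Int.units_eq_one_or (sgn g⁻¹ v) with h' | h' <;> rw [h, h'] at this ⊢ <;>
        simp at this
    rw [smul_x, inv_inv, ← h1, hg, sgn_signElem, ← hg, lastSign, hc0]
    have := hxM (g • v)
    split_ifs with h
    · rw [abs_of_pos h] at this; simpa using this
    · rw [abs_of_nonpos (not_lt.1 h)] at this; simpa using this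
  have hl' := key _ (hsm g⁻¹)
  have hinr' : ∀ v, (g⁻¹ • c).a (Sum.inr v) = (v, Fin.last n) := fun v =>
    Prod.ext ((g⁻¹ • c).a_fst v) (hl' v)
  have hv' : ∀ k v, ((g⁻¹ • c).vert k).1 v (Fin.last n) = M := fun k v => by
    have := vertFun_inr (g⁻¹ • c) k v
    rw [hinr'] at this
    exact this.trans (hx' v)
  obtain ⟨l, hl, hl0⟩ := (zeroInHull_iff_stdSimplex _).1 (hsm g⁻¹)
  refine ⟨g, ?_⟩
  change g • base e hM hM0 = c
  rw [← eq_base e hM hM0 (g⁻¹ • c) hl' hx' l hl.1 hl.2, smul_inv_smul]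
  intro v i
  have h1 := congrFun (congrFun hl0 v) i
  simp only [shiftedProj_of_last hM0 _ _ (hv' _), Finset.sum_apply, Pi.smul_apply, Pi.sub_apply,
    smul_eq_mul, mul_sub, Finset.sum_sub_distrib, Pi.zero_apply, ← Finset.sum_mul, hl.2, one_mul]
    at h1
  exact sub_eq_zero.1 h1

/-- The discrete Borsuk-Ulam theorem for a product of boundaries of cubes. -/
theorem exists_zeroInHull [Fintype N] [DecidableEq N] (hM : Even M) (hM0 : 0 < M) (hD : 0 < D)
    (e : Fin D ≃ N × Fin n) (T : GridPoint N (n + 1) M → N → Fin n → ℝ)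
    (hT : ∀ (g : G) y, T (g • y) = act g (T y)) :
    ∃ c : GridFacet N (n + 1) D M, ZeroInHull fun k => T (c.vert k) := by
  have := Fintype.ofFinite (GridFacet N (n + 1) D M)
  refine (chamberSystem (G := G) (q := n + 1) (N := N) hM hM0 hD).exists_zeroInHull
    (rep (Fin n → ℝ)) ?_ (eq_one_of_smul_eq hM0) T (shiftedProj G (shift e))
    (fun g y => (hT g y).trans (rep_apply _ g _).symm)
    (fun g y => (shiftedProj_smul hM0 _ g y).trans (rep_apply _ g _).symm) (base e hM hM0)
    (fun _ => 1 / (D + 1)) (fun _ => by positivity) (sum_shiftedProj_base e hM hM0)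
    (span_shiftedProj_base e hM hM0) (mem_orbit_base e hM hM0)
  have := Fintype.card_congr e
  simp only [Fintype.card_fin, Fintype.card_prod] at this
  simp [Module.finrank_pi_fintype, this]

end GridFacet

namespace SignCocycle

variable {N : Type*} (G : Type*) [Group G] [MulAction G N] [SignCocycle G N] [Fintype N]

/-- The product of unit spheres of the sup norm. -/
def cubeSpheres (N : Type*) (q : ℕ) : Set (N → Fin q → ℝ) := {x | ∀ v, ‖x v‖ = 1}

theorem isCompact_cubeSpheres (q : ℕ) : IsCompact (cubeSpheres N q) := by
  refine Metric.isCompact_of_isClosed_isBounded ?_ ?_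
  · have : cubeSpheres N q = ⋂ v, {x | ‖x v‖ = 1} := by ext x; simp [cubeSpheres]
    rw [this]
    exact isClosed_iInter fun v => isClosed_eq (by fun_prop) continuous_const
  · refine (Metric.isBounded_closedBall (x := (0 : N → Fin q → ℝ)) (r := 1)).subset fun x hx => ?_
    rw [mem_closedBall_zero_iff, pi_norm_le_iff_of_nonneg zero_le_one]
    exact fun v => (hx v).le

/-- A grid point scaled to the unit cube. -/
noncomputable def scaled {q : ℕ} {M : ℤ} (x : GridPoint N q M) : N → Fin q → ℝ :=
  fun v i => (x.1 v i : ℝ) / M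

theorem scaled_mem {q : ℕ} {M : ℤ} (hM : 0 < M) (x : GridPoint N q M) :
    scaled x ∈ cubeSpheres N q := by
  intro v
  have hM' : (0 : ℝ) < M := by exact_mod_cast hM
  have h1 : ∀ i, ‖scaled x v i‖ = |x.1 v i| / M := fun i => by
    rw [Real.norm_eq_abs, scaled, abs_div, abs_of_pos hM']; push_cast; rfl
  apply le_antisymm
  · rw [pi_norm_le_iff_of_nonneg zero_le_one]
    intro i
    rw [h1, div_le_one hM']
    exact_mod_cast x.2.1 v i
  · obtain ⟨i, hi⟩ := x.2.2 v
    refine le_trans (le_of_eq ?_) (norm_le_pi_norm (scaled x v) i)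
    rw [h1, hi, div_self hM'.ne']

theorem scaled_smul {q : ℕ} {M : ℤ} (g : G) (x : GridPoint N q M) :
    scaled (g • x) = act g (scaled x) := by
  funext v i
  rw [scaled, GridPoint.smul_val, GridPoint.act_apply]
  simp only [act, Units.smul_def, Pi.smul_apply, zsmul_eq_mul, Int.cast_mul, scaled]
  ring

/-- The Borsuk-Ulam theorem for products of spheres with a group acting simply transitively on
signs. -/
theorem exists_zero {n : ℕ} (F : (N → Fin (n + 1) → ℝ) → N → Fin n → ℝ)
    (hF : ContinuousOn F (cubeSpheres N (n + 1)))
    (hFe : ∀ (g : G), ∀ x ∈ cubeSpheres N (n + 1), F (act g x) = act g (F x)) :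
    ∃ x ∈ cubeSpheres N (n + 1), F x = 0 := by
  classical
  have hne : (fun _ _ => 1 : N → Fin (n + 1) → ℝ) ∈ cubeSpheres N (n + 1) := fun v => by
    simp [pi_norm_const (1 : ℝ)]
  by_contra! h0
  have e := (Fintype.equivFin (N × Fin n)).symm
  set D := Fintype.card (N × Fin n)
  rcases Nat.eq_zero_or_pos D with hD | hD
  · refine h0 _ hne ?_
    funext v i
    exact ((Fintype.card_eq_zero_iff.1 hD).false (v, i)).elim
  obtain ⟨x₀, hx₀, hmin⟩ := (isCompact_cubeSpheres (N := N) (n + 1)).exists_isMinOn ⟨_, hne⟩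
    hF.norm
  have hη : 0 < ‖F x₀‖ := norm_pos_iff.2 (h0 x₀ hx₀)
  have hu := (isCompact_cubeSpheres (N := N) (n + 1)).uniformContinuousOn_of_continuous hF
  obtain ⟨δ, hδ, hu⟩ := Metric.uniformContinuousOn_iff.1 hu _ hη
  obtain ⟨j, hj⟩ := exists_nat_gt (1 / δ)
  set M : ℤ := 2 * (j + 1)
  have hM : Even M := even_two_mul _
  have hM0 : 0 < M := by positivity
  have hM' : (0 : ℝ) < M := by exact_mod_cast hM0
  have hMδ : 1 / (M : ℝ) < δ := by
    rw [div_lt_iff₀ hM']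
    rw [div_lt_iff₀ hδ] at hj
    have : (j : ℝ) ≤ M := by simp only [M]; push_cast; linarith [j.cast_nonneg (α := ℝ)]
    nlinarith
  obtain ⟨c, hc⟩ := GridFacet.exists_zeroInHull (G := G) hM hM0 hD e (fun y => F (scaled y))
    (fun g y => by rw [scaled_smul]; exact hFe g _ (scaled_mem hM0 y))
  obtain ⟨l, hl, hl0⟩ := (zeroInHull_iff_stdSimplex _).1 hc
  have hclose : ∀ k, ‖F (scaled (c.vert 0)) - F (scaled (c.vert k))‖ < ‖F x₀‖ := by
    intro k
    rw [← dist_eq_norm]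
    refine hu _ (scaled_mem hM0 _) _ (scaled_mem hM0 _) (lt_of_le_of_lt ?_ hMδ)
    rw [dist_pi_le_iff (by positivity)]
    intro v
    rw [dist_pi_le_iff (by positivity)]
    intro i
    rw [Real.dist_eq, scaled, scaled, ← sub_div, abs_div, abs_of_pos hM']
    gcongr
    exact_mod_cast c.eq_or_dist_vertFun 0 k (v, i)
  have h1 : F (scaled (c.vert 0)) =
      ∑ k, l k • (F (scaled (c.vert 0)) - F (scaled (c.vert k))) := by
    simp only [smul_sub, Finset.sum_sub_distrib, ← Finset.sum_smul, hl.2, one_smul, hl0, sub_zero]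
  have h2 : ‖F x₀‖ ≤ ‖F (scaled (c.vert 0))‖ := hmin (scaled_mem hM0 _)
  have h3 : ‖F (scaled (c.vert 0))‖ < ‖F x₀‖ := by
    rw [h1]
    refine (norm_sum_le _ _).trans_lt ?_
    have h4 : ‖F x₀‖ = ∑ k, l k * ‖F x₀‖ := by rw [← Finset.sum_mul, hl.2, one_mul]
    conv_rhs => rw [h4]
    obtain ⟨k, hk⟩ : ∃ k, 0 < l k := by
      by_contra! hneg
      have := Finset.sum_nonpos fun k (_ : k ∈ Finset.univ) => hneg k
      linarith [hl.2]
    refine Finset.sum_lt_sum (fun k _ => ?_) ⟨k, Finset.mem_univ _, ?_⟩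
    · rw [norm_smul, Real.norm_of_nonneg (hl.1 k)]
      exact mul_le_mul_of_nonneg_left (hclose k).le (hl.1 k)
    · rw [norm_smul, Real.norm_of_nonneg (hl.1 k)]
      exact mul_lt_mul_of_pos_left (hclose k) hk
  linarith

end SignCocycle

/-- Sign labellings of the nodes of a binary tree of depth `i`; a node is the word of left/right
choices leading to it, most recent choice first. -/
def TreeSign (i : ℕ) : Type := {s : List ℤˣ → ℤˣ // ∀ v, i ≤ v.length → s v = 1}

/-- The nodes of a binary tree of depth `i`. -/
abbrev TreeNode (i : ℕ) : Type := {v : List ℤˣ // v.length < i}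

/-- Swap the two subtrees below each node with a negative sign. -/
def flipWord (s : List ℤˣ → ℤˣ) : List ℤˣ → List ℤˣ
  | [] => []
  | b :: t => (b * s t) :: flipWord s t

/-- The inverse of `flipWord s`. -/
def unflipWord (s : List ℤˣ → ℤˣ) : List ℤˣ → List ℤˣ
  | [] => []
  | b :: t => (b * s (unflipWord s t)) :: unflipWord s t

@[simp] theorem length_flipWord (s : List ℤˣ → ℤˣ) (v : List ℤˣ) :
    (flipWord s v).length = v.length := by
  induction v with
  | nil => rfl
  | cons b t ih => simp [flipWord, ih]

@[simp] theorem length_unflipWord (s : List ℤˣ → ℤˣ) (v : List ℤˣ) :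
    (unflipWord s v).length = v.length := by
  induction v with
  | nil => rfl
  | cons b t ih => simp [unflipWord, ih]

theorem flipWord_eq_self (s : List ℤˣ → ℤˣ) (v : List ℤˣ)
    (h : ∀ w, w.length < v.length → s w = 1) : flipWord s v = v := by
  induction v with
  | nil => rfl
  | cons b t ih =>
    rw [flipWord, h t (by simp), ih fun w hw => h w (by simp; omega), mul_one]

namespace TreeSign

variable {i : ℕ}

theorem ext' {s t : TreeSign i} (h : ∀ v, s.1 v = t.1 v) : s = t := Subtype.ext (funext h)

instance : Mul (TreeSign i) :=
  ⟨fun s t => ⟨fun v => s.1 v * t.1 (flipWord s.1 v), fun v hv => by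
    beta_reduce; rw [s.2 v hv, t.2 _ (by simpa using hv), one_mul]⟩⟩

instance : One (TreeSign i) := ⟨⟨fun _ => 1, fun _ _ => rfl⟩⟩

instance : Inv (TreeSign i) :=
  ⟨fun s => ⟨fun v => s.1 (unflipWord s.1 v), fun v hv => s.2 _ (by simpa using hv)⟩⟩

theorem mul_val (s t : TreeSign i) (v) : (s * t).1 v = s.1 v * t.1 (flipWord s.1 v) := rfl

theorem one_val (v) : (1 : TreeSign i).1 v = 1 := rfl

theorem inv_val (s : TreeSign i) (v) : (s⁻¹).1 v = s.1 (unflipWord s.1 v) := rfl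

theorem flipWord_mul (s t : TreeSign i) (v) :
    flipWord (s * t).1 v = flipWord t.1 (flipWord s.1 v) := by
  induction v with
  | nil => rfl
  | cons b w ih => simp only [flipWord, ih, mul_val, mul_assoc]

theorem flipWord_one (v) : flipWord (1 : TreeSign i).1 v = v :=
  flipWord_eq_self _ _ fun _ _ => rfl

theorem flipWord_inv (s : TreeSign i) (v) : flipWord (s⁻¹).1 v = unflipWord s.1 v := by
  induction v with
  | nil => rfl
  | cons b w ih => simp only [flipWord, unflipWord, ih, inv_val]

instance : Group (TreeSign i) :=
  Group.ofLeftAxioms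
    (fun a b c => ext' fun v => by simp only [mul_val, flipWord_mul, mul_assoc])
    (fun a => ext' fun v => by simp only [mul_val, one_val, flipWord_one, one_mul])
    (fun a => ext' fun v => by
      rw [mul_val, one_val, inv_val, flipWord_inv]
      exact Int.units_mul_self _)

instance : MulAction (TreeSign i) (TreeNode i) where
  smul s v := ⟨flipWord (s⁻¹).1 v.1, by simpa using v.2⟩
  one_smul v := Subtype.ext (by
    change flipWord ((1 : TreeSign i)⁻¹).1 v.1 = v.1
    rw [inv_one, flipWord_one])
  mul_smul s t v := Subtype.ext (by
    change flipWord ((s * t)⁻¹).1 v.1 = flipWord (s⁻¹).1 (flipWord (t⁻¹).1 v.1)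
    rw [mul_inv_rev, flipWord_mul])

theorem inv_smul_val (s : TreeSign i) (v : TreeNode i) : (s⁻¹ • v).1 = flipWord s.1 v.1 := by
  change flipWord (s⁻¹⁻¹).1 v.1 = _
  rw [inv_inv]

instance : SignCocycle (TreeSign i) (TreeNode i) where
  sgn s v := s.1 v.1
  sgn_mul s t v := by rw [mul_val, inv_smul_val]
  bijective_sgn := by
    constructor
    · intro s t h
      refine ext' fun v => ?_
      by_cases hv : v.length < i
      · exact congrFun h ⟨v, hv⟩
      · rw [s.2 v (not_lt.1 hv), t.2 v (not_lt.1 hv)]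
    · intro s
      refine ⟨⟨fun v => if h : v.length < i then s ⟨v, h⟩ else 1, fun v hv => ?_⟩, ?_⟩
      · exact dif_neg (not_lt.2 hv)
      · funext v
        exact dif_pos v.2
  free s hs := by
    have hex : ∃ k, ∃ v : List ℤˣ, v.length = k ∧ s.1 v ≠ 1 := by
      by_contra! h
      exact hs (ext' fun v => h _ v rfl)
    classical
    obtain ⟨v, hv, hsv⟩ := Nat.find_spec hex
    have hvi : v.length < i := by
      by_contra h
      exact hsv (s.2 v (not_lt.1 h))
    refine ⟨⟨v, hvi⟩, ?_, ?_⟩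
    · rw [eq_comm, ← inv_smul_eq_iff]
      refine Subtype.ext ?_
      rw [inv_smul_val]
      refine flipWord_eq_self _ _ fun w hw => ?_
      by_contra hne
      exact Nat.find_min hex (hv ▸ hw) ⟨w, rfl, hne⟩
    · exact (Int.units_eq_one_or _).resolve_left hsv

theorem sgn_def (s : TreeSign i) (v : TreeNode i) : SignCocycle.sgn s v = s.1 v.1 := rfl

end TreeSign

instance (i : ℕ) : Finite (TreeNode i) := by
  have : Finite (Σ k : Fin i, List.Vector ℤˣ k) := inferInstance
  refine Finite.of_injective
    (fun v : TreeNode i => (⟨⟨v.1.length, v.2⟩, ⟨v.1, rfl⟩⟩ : Σ k : Fin i, List.Vector ℤˣ k)) ?_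
  intro v w h
  have h1 : ∀ u : TreeNode i, u.1 = (⟨⟨u.1.length, u.2⟩, ⟨u.1, rfl⟩⟩ :
    Σ k : Fin i, List.Vector ℤˣ k).2.toList := fun u => rfl
  refine Subtype.ext ?_
  rw [h1 v, h1 w]
  exact congrArg (fun z : Σ k : Fin i, List.Vector ℤˣ k => z.2.toList) h

noncomputable instance (i : ℕ) : Fintype (TreeNode i) := Fintype.ofFinite _

/-- Sums over the words obtained from `v` by `r` further choices. -/
def subtreeSum {X : Type*} [AddCommGroup X] (g : List ℤˣ → X) : ℕ → List ℤˣ → X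
  | 0, v => g v
  | r + 1, v => subtreeSum g r (1 :: v) + subtreeSum g r (-1 :: v)

theorem subtreeSum_flip {X : Type*} [AddCommGroup X] (g g' : List ℤˣ → X) (s : List ℤˣ → ℤˣ)
    (j : ℕ) (h : ∀ v, v.length = j → g' v = g (flipWord s v)) (r : ℕ) (v : List ℤˣ)
    (hv : v.length + r = j) : subtreeSum g' r v = subtreeSum g r (flipWord s v) := by
  induction r generalizing v with
  | zero => exact h v hv
  | succ r ih =>
    rw [subtreeSum, subtreeSum, ih _ (by simp; omega), ih _ (by simp; omega), flipWord, flipWord]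
    rcases Int.units_eq_one_or (s v) with h | h <;> simp [h, add_comm]

/-- A continuous family of values at the leaves of a binary tree of depth `i`, depending on
a unit vector at each node in such a way that changing a sign swaps two subtrees, is balanced for
some choice of unit vectors. -/
theorem exists_balanced (i n : ℕ)
    (g : (TreeNode i → Fin (n + 1) → ℝ) → List ℤˣ → Fin n → ℝ)
    (hg : ∀ v : List ℤˣ, v.length = i →
      ContinuousOn (fun x => g x v) (SignCocycle.cubeSpheres (TreeNode i) (n + 1)))
    (hge : ∀ (s : TreeSign i), ∀ x ∈ SignCocycle.cubeSpheres (TreeNode i) (n + 1),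
      ∀ v : List ℤˣ, v.length = i → g (SignCocycle.act s x) v = g x (flipWord s.1 v)) :
    ∃ x ∈ SignCocycle.cubeSpheres (TreeNode i) (n + 1), ∀ v : List ℤˣ, ∀ r, v.length + r = i →
      (2 : ℝ) ^ v.length • subtreeSum (g x) r v = subtreeSum (g x) i [] := by
  have hc : ∀ r (v : List ℤˣ), v.length + r = i → ContinuousOn (fun x => subtreeSum (g x) r v)
      (SignCocycle.cubeSpheres (TreeNode i) (n + 1)) := by
    intro r
    induction r with
    | zero => exact fun v hv => hg v hv
    | succ r ih =>
      intro v hv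
      exact (ih _ (by simp; omega)).add (ih _ (by simp; omega))
  have hF : ContinuousOn (fun (x : TreeNode i → Fin (n + 1) → ℝ) (v : TreeNode i) =>
      subtreeSum (g x) (i - 1 - v.1.length) (1 :: v.1) -
      subtreeSum (g x) (i - 1 - v.1.length) (-1 :: v.1))
      (SignCocycle.cubeSpheres (TreeNode i) (n + 1)) := by
    refine continuousOn_pi.2 fun v => ?_
    have := v.2
    exact (hc _ _ (by simp; omega)).sub (hc _ _ (by simp; omega))
  obtain ⟨x, hx, h0⟩ := SignCocycle.exists_zero (TreeSign i) _ hF fun s x hx => by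
    funext v
    have := v.2
    simp only [SignCocycle.act, TreeSign.sgn_def, TreeSign.inv_smul_val, length_flipWord]
    rw [subtreeSum_flip (g x) _ s.1 i (hge s x hx) _ _ (by simp; omega),
      subtreeSum_flip (g x) _ s.1 i (hge s x hx) _ _ (by simp; omega), flipWord, flipWord]
    rcases Int.units_eq_one_or (s.1 v.1) with h | h <;> simp [h]
  refine ⟨x, hx, fun v => ?_⟩
  induction v with
  | nil => intro r hr; simp at hr; simp [hr]
  | cons b t ih =>
    intro r hr
    simp only [List.length_cons] at hr
    have h1 := congrFun h0 ⟨t, by omega⟩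
    simp only [Pi.zero_apply, sub_eq_zero, show i - 1 - t.length = r by omega] at h1
    have h2 : subtreeSum (g x) r (b :: t) = subtreeSum (g x) r (1 :: t) := by
      rcases Int.units_eq_one_or b with h | h
      · rw [h]
      · rw [h, h1]
    rw [← ih (r + 1) (by omega), subtreeSum, ← h1, h2, List.length_cons, pow_succ, mul_smul,
      two_smul]

section BrunnMinkowski

open scoped ENNReal

theorem volume_add_le_of_isCompact {A B C : Set ℝ} (hA : IsCompact A) (hB : IsCompact B)
    (hA0 : A.Nonempty) (hB0 : B.Nonempty) (hC : ∀ a ∈ A, ∀ b ∈ B, a + b ∈ C) :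
    volume A + volume B ≤ volume C := by
  obtain ⟨k, hk, hk'⟩ := hA.exists_isGreatest hA0
  obtain ⟨l, hl, hl'⟩ := hB.exists_isLeast hB0
  have h1 : volume ((fun x => x + l) '' A ∪ (fun x => k + x) '' B) =
      volume A + volume B := by
    rw [measure_union₀]
    · rw [Set.image_add_right, Set.image_add_left, measure_preimage_add_right,
        measure_preimage_add]
    · exact (hB.image (by fun_prop)).measurableSet.nullMeasurableSet
    · refine measure_mono_null (t := {k + l}) ?_ (by simp)
      rintro _ ⟨⟨a, ha, rfl⟩, ⟨b, hb, hab⟩⟩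
      have h1 := hk' ha
      have h2 := hl' hb
      simp only [Set.mem_singleton_iff] at *
      linarith
  rw [← h1]
  refine measure_mono ?_
  rintro _ (⟨a, ha, rfl⟩ | ⟨b, hb, rfl⟩)
  exacts [hC a ha l hl, hC k hk b hb]

theorem volume_add_le {A B C : Set ℝ} (hA : MeasurableSet A) (hB : MeasurableSet B)
    (hA0 : A.Nonempty) (hB0 : B.Nonempty) (hC : ∀ a ∈ A, ∀ b ∈ B, a + b ∈ C) :
    volume A + volume B ≤ volume C := by
  obtain ⟨a, ha⟩ := hA0
  obtain ⟨b, hb⟩ := hB0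
  rw [hA.measure_eq_iSup_isCompact, hB.measure_eq_iSup_isCompact]
  simp only [iSup_and']
  refine ENNReal.biSup_add_biSup_le' (p := fun K => K ⊆ A ∧ IsCompact K)
    (q := fun K => K ⊆ B ∧ IsCompact K) ⟨∅, by simp⟩ ⟨∅, by simp⟩ ?_
  intro K hK L hL
  have h1 := volume_add_le_of_isCompact (A := insert a K) (B := insert b L) (C := C)
    (hK.2.insert a) (hL.2.insert b) (Set.insert_nonempty _ _) (Set.insert_nonempty _ _)
    fun x hx y hy => hC x (Set.insert_subset ha hK.1 hx) y (Set.insert_subset hb hL.1 hy)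
  exact (add_le_add (measure_mono (Set.subset_insert _ _))
    (measure_mono (Set.subset_insert _ _))).trans h1

theorem lintegral_convex_comb_le {t : ℝ} (ht0 : 0 < t) (ht1 : t < 1) {f g h : ℝ → ℝ}
    (hf : Measurable f) (hg : Measurable g) (hh : Measurable h) (hf0 : ∀ x, 0 ≤ f x)
    (hg0 : ∀ x, 0 ≤ g x) (hh0 : ∀ x, 0 ≤ h x) (hf1 : ∀ x, f x ≤ 1) (hg1 : ∀ x, g x ≤ 1)
    (hfs : ∀ s < 1, ∃ x, s < f x) (hgs : ∀ s < 1, ∃ x, s < g x)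
    (H : ∀ x y, min (f x) (g y) ≤ h ((1 - t) * x + t * y)) :
    ENNReal.ofReal (1 - t) * (∫⁻ x, ENNReal.ofReal (f x)) +
      ENNReal.ofReal t * (∫⁻ x, ENNReal.ofReal (g x)) ≤ ∫⁻ x, ENNReal.ofReal (h x) := by
  rw [lintegral_eq_lintegral_meas_lt _ (.of_forall hf0) hf.aemeasurable,
    lintegral_eq_lintegral_meas_lt _ (.of_forall hg0) hg.aemeasurable,
    lintegral_eq_lintegral_meas_lt _ (.of_forall hh0) hh.aemeasurable,
    ← lintegral_const_mul' _ _ ENNReal.ofReal_ne_top,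
    ← lintegral_const_mul' _ _ ENNReal.ofReal_ne_top, ← lintegral_add_left]
  swap
  · refine Measurable.const_mul (Antitone.measurable fun s s' hs => measure_mono ?_) _
    exact fun x hx => lt_of_le_of_lt hs hx
  refine lintegral_mono fun s => ?_
  rcases lt_or_ge s 1 with hs | hs
  · have h1 : ENNReal.ofReal (1 - t) * volume {a | s < f a} =
        volume ((fun x => (1 - t) * x) '' {a | s < f a}) := by
      have := Measure.addHaar_smul (volume : Measure ℝ) (1 - t) {a | s < f a}
      simp only [Module.finrank_self, pow_one, abs_of_pos (sub_pos.2 ht1)] at this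
      exact this.symm
    have h2 : ENNReal.ofReal t * volume {a | s < g a} =
        volume ((fun x => t * x) '' {a | s < g a}) := by
      have := Measure.addHaar_smul (volume : Measure ℝ) t {a | s < g a}
      simp only [Module.finrank_self, pow_one, abs_of_pos ht0] at this
      exact this.symm
    rw [h1, h2]
    refine volume_add_le ?_ ?_ ?_ ?_ ?_
    · exact (measurableEmbedding_mulLeft₀ (sub_pos.2 ht1).ne').measurableSet_image.2
        (measurableSet_lt measurable_const hf)
    · exact (measurableEmbedding_mulLeft₀ ht0.ne').measurableSet_image.2
        (measurableSet_lt measurable_const hg)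
    · obtain ⟨x, hx⟩ := hfs s hs; exact ⟨_, x, hx, rfl⟩
    · obtain ⟨x, hx⟩ := hgs s hs; exact ⟨_, x, hx, rfl⟩
    · rintro _ ⟨a, ha, rfl⟩ _ ⟨b, hb, rfl⟩
      exact (lt_min ha hb).trans_le (H a b)
  · have h1 : {a | s < f a} = ∅ := Set.eq_empty_of_forall_notMem fun a ha =>
      absurd (lt_of_le_of_lt hs ha) (not_lt.2 (hf1 a))
    have h2 : {a | s < g a} = ∅ := Set.eq_empty_of_forall_notMem fun a ha =>
      absurd (lt_of_le_of_lt hs ha) (not_lt.2 (hg1 a))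
    simp [h1, h2]

end BrunnMinkowski

namespace BrunnMinkowski
open scoped ENNReal NNReal

theorem lintegral_convex_comb_le_ennreal {t : ℝ} (ht0 : 0 < t) (ht1 : t < 1)
    {f g h : ℝ → ℝ≥0∞} (hf : Measurable f) (hg : Measurable g) (hh : Measurable h)
    (hfs : ⨆ x, f x = 1) (hgs : ⨆ x, g x = 1)
    (H : ∀ x y, min (f x) (g y) ≤ h ((1 - t) * x + t * y)) :
    ENNReal.ofReal (1 - t) * (∫⁻ x, f x) + ENNReal.ofReal t * (∫⁻ x, g x) ≤ ∫⁻ x, h x := by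
  have key : ∀ {k : ℝ → ℝ≥0∞}, (⨆ x, k x = 1) → (∀ x, k x ≤ 1) := fun hk x =>
    hk ▸ le_iSup _ x
  have key2 : ∀ {k : ℝ → ℝ≥0∞}, (⨆ x, k x = 1) → ∀ s < (1 : ℝ), ∃ x, s < (k x).toReal := by
    intro k hk s hs
    rcases lt_or_ge s 0 with hs0 | hs0
    · exact ⟨0, hs0.trans_le ENNReal.toReal_nonneg⟩
    have h1 : ENNReal.ofReal s < ⨆ x, k x := by
      rw [hk]; exact ENNReal.ofReal_lt_one.2 hs
    obtain ⟨x, hx⟩ := lt_iSup_iff.1 h1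
    exact ⟨x, (ENNReal.ofReal_lt_iff_lt_toReal hs0
      (ne_top_of_le_ne_top ENNReal.one_ne_top (key hk x))).1 hx⟩
  have key3 : ∀ {a : ℝ≥0∞}, a ≤ 1 → a.toReal ≤ 1 := fun ha => by
    simpa using ENNReal.toReal_mono ENNReal.one_ne_top ha
  have := lintegral_convex_comb_le ht0 ht1 (f := fun x => (f x).toReal)
    (g := fun x => (g x).toReal) (h := fun x => (min (h x) 1).toReal) hf.ennreal_toReal
    hg.ennreal_toReal (hh.min measurable_const).ennreal_toReal (fun _ => ENNReal.toReal_nonneg)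
    (fun _ => ENNReal.toReal_nonneg) (fun _ => ENNReal.toReal_nonneg)
    (fun x => key3 (key hfs x)) (fun x => key3 (key hgs x)) (key2 hfs) (key2 hgs) (by
      intro x y
      rw [← ENNReal.toReal_min (ne_top_of_le_ne_top ENNReal.one_ne_top (key hfs x))
        (ne_top_of_le_ne_top ENNReal.one_ne_top (key hgs y))]
      refine ENNReal.toReal_mono (by simp) (le_min (H x y) ?_)
      exact (min_le_left _ _).trans (key hfs x))
  simp only [ENNReal.ofReal_toReal (ne_top_of_le_ne_top ENNReal.one_ne_top (key hfs _)),
    ENNReal.ofReal_toReal (ne_top_of_le_ne_top ENNReal.one_ne_top (key hgs _)),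
    ENNReal.ofReal_toReal (ne_top_of_le_ne_top ENNReal.one_ne_top (min_le_right _ _))] at this
  exact this.trans (lintegral_mono fun x => min_le_left _ _)

theorem geom_mean_le_arith_mean_ennreal {t : ℝ} (ht0 : 0 < t) (ht1 : t < 1) (a b : ℝ≥0∞) :
    a ^ (1 - t) * b ^ t ≤ ENNReal.ofReal (1 - t) * a + ENNReal.ofReal t * b := by
  have h1 : 0 < 1 - t := sub_pos.2 ht1
  by_cases ha : a = ⊤
  · subst ha; rw [ENNReal.mul_top (by simpa using ht1)]; simp
  by_cases hb : b = ⊤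
  · subst hb; rw [ENNReal.mul_top (by simpa using ht0)]; simp
  lift a to ℝ≥0 using ha
  lift b to ℝ≥0 using hb
  have := NNReal.geom_mean_le_arith_mean2_weighted (Real.toNNReal (1 - t)) (Real.toNNReal t) a b
    (by rw [← Real.toNNReal_add h1.le ht0.le]; simp)
  rw [Real.coe_toNNReal _ h1.le, Real.coe_toNNReal _ ht0.le] at this
  rw [ENNReal.ofReal, ENNReal.ofReal, ← ENNReal.coe_rpow_of_nonneg _ h1.le,
    ← ENNReal.coe_rpow_of_nonneg _ ht0.le]
  exact_mod_cast this

theorem prekopa_leindler_one_bdd {t : ℝ} (ht0 : 0 < t) (ht1 : t < 1)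
    {f g h : ℝ → ℝ≥0∞} (hf : Measurable f) (hg : Measurable g) (hh : Measurable h)
    (hfs : ⨆ x, f x ≠ ⊤) (hgs : ⨆ x, g x ≠ ⊤)
    (H : ∀ x y, f x ^ (1 - t) * g y ^ t ≤ h ((1 - t) * x + t * y)) :
    (∫⁻ x, f x) ^ (1 - t) * (∫⁻ x, g x) ^ t ≤ ∫⁻ x, h x := by
  have h1 : 0 < 1 - t := sub_pos.2 ht1
  by_cases hf0 : ⨆ x, f x = 0
  · have : ∀ x, f x = 0 := by simpa using hf0
    simp [this, h1]
  by_cases hg0 : ⨆ x, g x = 0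
  · have : ∀ x, g x = 0 := by simpa using hg0
    simp [this, ht0]
  set F := ⨆ x, f x with hF
  set G := ⨆ x, g x with hG
  have hFp0 : F ^ (1 - t) ≠ 0 := by simp [hf0, hfs]
  have hGp0 : G ^ t ≠ 0 := by simp [hg0, hgs]
  have hFpt : F ^ (1 - t) ≠ ⊤ := ENNReal.rpow_ne_top_of_nonneg h1.le hfs
  have hGpt : G ^ t ≠ ⊤ := ENNReal.rpow_ne_top_of_nonneg ht0.le hgs
  have hmain := lintegral_convex_comb_le_ennreal ht0 ht1 (f := fun x => F⁻¹ * f x)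
    (g := fun x => G⁻¹ * g x) (h := fun x => (F ^ (1 - t) * G ^ t)⁻¹ * h x)
    (hf.const_mul _) (hg.const_mul _) (hh.const_mul _)
    (by rw [← ENNReal.mul_iSup, ENNReal.inv_mul_cancel hf0 hfs])
    (by rw [← ENNReal.mul_iSup, ENNReal.inv_mul_cancel hg0 hgs]) (by
      intro x y
      calc min (F⁻¹ * f x) (G⁻¹ * g y)
          = (min (F⁻¹ * f x) (G⁻¹ * g y)) ^ (1 - t) * (min (F⁻¹ * f x) (G⁻¹ * g y)) ^ t := by
            rw [← ENNReal.rpow_add_of_nonneg _ _ h1.le ht0.le]; simp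
        _ ≤ (F⁻¹ * f x) ^ (1 - t) * (G⁻¹ * g y) ^ t := by
            gcongr
            · exact min_le_left _ _
            · exact min_le_right _ _
        _ = (F ^ (1 - t) * G ^ t)⁻¹ * (f x ^ (1 - t) * g y ^ t) := by
            rw [ENNReal.mul_rpow_of_nonneg _ _ h1.le, ENNReal.mul_rpow_of_nonneg _ _ ht0.le,
              ENNReal.inv_rpow, ENNReal.inv_rpow, ENNReal.mul_inv (.inl hFp0) (.inl hFpt)]
            ring
        _ ≤ _ := by gcongr; exact H x y)
  rw [lintegral_const_mul _ hf, lintegral_const_mul _ hg, lintegral_const_mul _ hh] at hmain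
  have h2 := (geom_mean_le_arith_mean_ennreal ht0 ht1 _ _).trans hmain
  rw [ENNReal.mul_rpow_of_nonneg _ _ h1.le, ENNReal.mul_rpow_of_nonneg _ _ ht0.le,
    ENNReal.inv_rpow, ENNReal.inv_rpow, mul_mul_mul_comm,
    ← ENNReal.mul_inv (.inl hFp0) (.inl hFpt)] at h2
  exact (ENNReal.mul_le_mul_iff_right (by simp [hFpt, hGpt, ENNReal.mul_eq_top])
    (by simp [hFp0, hGp0])).1 h2

theorem prekopa_leindler_one {t : ℝ} (ht0 : 0 < t) (ht1 : t < 1)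
    {f g h : ℝ → ℝ≥0∞} (hf : Measurable f) (hg : Measurable g) (hh : Measurable h)
    (H : ∀ x y, f x ^ (1 - t) * g y ^ t ≤ h ((1 - t) * x + t * y)) :
    (∫⁻ x, f x) ^ (1 - t) * (∫⁻ x, g x) ^ t ≤ ∫⁻ x, h x := by
  have h1 : 0 < 1 - t := sub_pos.2 ht1
  have key : ∀ {k : ℝ → ℝ≥0∞}, Measurable k → 
      ∫⁻ x, k x = ⨆ N : ℕ, ∫⁻ x, min (k x) N := by
    intro k hk
    rw [← lintegral_iSup (fun N => hk.min measurable_const)]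
    · congr 1; ext x
      have := inf_iSup_eq (k x) (fun N : ℕ => (N : ℝ≥0∞))
      rw [ENNReal.iSup_natCast, inf_top_eq] at this
      exact this
    · intro N M hNM x; dsimp only; gcongr
  have hb : ∀ N : ℕ, (∫⁻ x, min (f x) N) ^ (1 - t) * (∫⁻ x, min (g x) N) ^ t ≤ ∫⁻ x, h x := by
    intro N
    refine prekopa_leindler_one_bdd ht0 ht1 (hf.min measurable_const) (hg.min measurable_const) hh
      (ne_top_of_le_ne_top (ENNReal.natCast_ne_top N) (iSup_le fun x => min_le_right _ _))
      (ne_top_of_le_ne_top (ENNReal.natCast_ne_top N) (iSup_le fun x => min_le_right _ _)) ?_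
    intro x y
    refine le_trans ?_ (H x y)
    gcongr <;> exact min_le_left _ _
  by_cases hf0 : ∫⁻ x, f x = 0
  · simp [hf0, h1]
  by_cases hg0 : ∫⁻ x, g x = 0
  · simp [hg0, ht0]
  have hmono : ∀ k : ℝ → ℝ≥0∞, Monotone fun N : ℕ => ∫⁻ x, min (k x) N := by
    intro k N M hNM; dsimp only; gcongr
  have hlim : Filter.Tendsto (fun N : ℕ => (∫⁻ x, min (f x) N) ^ (1 - t) *
      (∫⁻ x, min (g x) N) ^ t) Filter.atTop
      (nhds ((∫⁻ x, f x) ^ (1 - t) * (∫⁻ x, g x) ^ t)) := by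
    refine ENNReal.Tendsto.mul ?_ (.inl ?_) ?_ (.inl ?_)
    · refine (ENNReal.continuous_rpow_const.tendsto _).comp ?_
      rw [key hf]; exact tendsto_atTop_iSup (hmono f)
    · simp [hf0, h1.not_gt]
    · refine (ENNReal.continuous_rpow_const.tendsto _).comp ?_
      rw [key hg]; exact tendsto_atTop_iSup (hmono g)
    · simp [hg0, ht0.not_gt]
  exact le_of_tendsto' hlim hb

theorem prekopa_leindler_pi {t : ℝ} (ht0 : 0 < t) (ht1 : t < 1) : ∀ (n : ℕ)
    {f g h : (Fin n → ℝ) → ℝ≥0∞} (_ : Measurable f) (_ : Measurable g) (_ : Measurable h)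
    (_ : ∀ x y, f x ^ (1 - t) * g y ^ t ≤ h ((1 - t) • x + t • y)),
    (∫⁻ x, f x) ^ (1 - t) * (∫⁻ x, g x) ^ t ≤ ∫⁻ x, h x
  | 0, f, g, h, _, _, _, H => by
    have h0 : ∀ k : (Fin 0 → ℝ) → ℝ≥0∞, ∫⁻ x, k x = k default := fun k => by
      rw [lintegral_unique]; simp only [volume_pi, Measure.pi_empty_univ, mul_one]
      exact congrArg k (Subsingleton.elim _ _)
    rw [h0, h0, h0]
    refine (H default default).trans (le_of_eq (congrArg h (Subsingleton.elim _ _)))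
  | n + 1, f, g, h, hf, hg, hh, H => by
    have key : ∀ {k : (Fin (n + 1) → ℝ) → ℝ≥0∞}, Measurable k →
        ∫⁻ x, k x = ∫⁻ s : ℝ, ∫⁻ y : Fin n → ℝ, k (Fin.cons s y) ∧
        Measurable (fun p : ℝ × (Fin n → ℝ) => k (Fin.cons p.1 p.2)) := by
      intro k hk
      have e := volume_preserving_piFinSuccAbove (fun _ : Fin (n + 1) => ℝ) 0
      have hm : Measurable (fun p : ℝ × (Fin n → ℝ) => k (Fin.cons p.1 p.2)) := by
        have := hk.comp (MeasurableEquiv.piFinSuccAbove (fun _ : Fin (n + 1) => ℝ) 0).symm.measurable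
        convert this using 2 with p
        simp [MeasurableEquiv.piFinSuccAbove]
        rfl
      refine ⟨?_, hm⟩
      have h2 := lintegral_prod (μ := (volume : Measure ℝ))
        (ν := (volume : Measure (Fin n → ℝ))) _ hm.aemeasurable
      rw [← h2]
      have h3 := e.lintegral_comp hm
      rw [Measure.volume_eq_prod] at h3
      rw [← h3]
      congr 1; ext x
      congr 1
      exact (Fin.cons_self_tail x).symm
    obtain ⟨ef, mf⟩ := key hf
    obtain ⟨eg, mg⟩ := key hg
    obtain ⟨eh, mh⟩ := key hh
    rw [ef, eg, eh]
    refine prekopa_leindler_one ht0 ht1 mf.lintegral_prod_right' mg.lintegral_prod_right'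
      mh.lintegral_prod_right' fun x y => ?_
    refine prekopa_leindler_pi ht0 ht1 n (mf.comp measurable_prodMk_left)
      (mg.comp measurable_prodMk_left) (mh.comp measurable_prodMk_left) fun u v => ?_
    refine (H _ _).trans (le_of_eq ?_)
    refine congrArg h ?_
    ext i
    refine Fin.cases ?_ (fun i => ?_) i <;> simp

/-- Multiplicative Brunn–Minkowski inequality in Euclidean space. -/
theorem volume_rpow_mul_le {n : ℕ} {t : ℝ} (ht0 : 0 < t) (ht1 : t < 1)
    {A B C : Set (EuclideanSpace ℝ (Fin n))} (hA : MeasurableSet A) (hB : MeasurableSet B)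
    (hC : MeasurableSet C) (H : ∀ a ∈ A, ∀ b ∈ B, (1 - t) • a + t • b ∈ C) :
    volume A ^ (1 - t) * volume B ^ t ≤ volume C := by
  have h1 : 0 < 1 - t := sub_pos.2 ht1
  have e := EuclideanSpace.volume_preserving_symm_measurableEquiv_toLp (Fin n)
  have key : ∀ {S : Set (EuclideanSpace ℝ (Fin n))}, MeasurableSet S →
      volume S = ∫⁻ x : Fin n → ℝ, (WithLp.toLp 2 ⁻¹' S).indicator 1 x ∧
      MeasurableSet (WithLp.toLp 2 ⁻¹' S : Set (Fin n → ℝ)) := by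
    intro S hS
    have hm : MeasurableSet (WithLp.toLp 2 ⁻¹' S : Set (Fin n → ℝ)) :=
      (MeasurableEquiv.toLp 2 (Fin n → ℝ)).measurable hS
    refine ⟨?_, hm⟩
    rw [lintegral_indicator_one hm, ← e.measure_preimage hm.nullMeasurableSet]
    rfl
  rw [(key hA).1, (key hB).1, (key hC).1]
  refine prekopa_leindler_pi ht0 ht1 n (measurable_const.indicator (key hA).2)
    (measurable_const.indicator (key hB).2) (measurable_const.indicator (key hC).2) fun x y => ?_
  by_cases hx : x ∈ (WithLp.toLp 2 ⁻¹' A : Set (Fin n → ℝ))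
  · by_cases hy : y ∈ (WithLp.toLp 2 ⁻¹' B : Set (Fin n → ℝ))
    · have : (1 - t) • x + t • y ∈ (WithLp.toLp 2 ⁻¹' C : Set (Fin n → ℝ)) := H _ hx _ hy
      simp [Set.indicator_of_mem hx, Set.indicator_of_mem hy, Set.indicator_of_mem this]
    · simp [Set.indicator_of_notMem hy, ht0]
  · simp [Set.indicator_of_notMem hx, h1]

end BrunnMinkowski

namespace Waist

/-- A closed convex cone, as a predicate on sets. -/
structure IsClosedCone {n : ℕ} (K : Set (EuclideanSpace ℝ (Fin n))) : Prop where
  isClosed : IsClosed K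
  add_mem : ∀ {x y}, x ∈ K → y ∈ K → x + y ∈ K
  smul_mem : ∀ {a : ℝ} {x}, 0 ≤ a → x ∈ K → a • x ∈ K

/-- The volume of the part of `K` at distance at most `r` from `x`. -/
noncomputable def locVol {n : ℕ} (K : Set (EuclideanSpace ℝ (Fin n))) (r : ℝ)
    (x : EuclideanSpace ℝ (Fin n)) : ℝ :=
  volume.real (K ∩ Metric.closedBall x r)

/-- A maximizer over the unit ball of the local volume times a strictly log-concave weight. -/
def IsCenter {n : ℕ} (K : Set (EuclideanSpace ℝ (Fin n))) (r : ℝ)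
    (c : EuclideanSpace ℝ (Fin n)) : Prop :=
  ‖c‖ ≤ 1 ∧ ∀ x, ‖x‖ ≤ 1 → locVol K r x * (1 - ‖x‖ ^ 2) ≤ locVol K r c * (1 - ‖c‖ ^ 2)

variable {n : ℕ} {K : Set (EuclideanSpace ℝ (Fin n))} {r : ℝ} {c : EuclideanSpace ℝ (Fin n)}

theorem locVol_nonneg (K : Set (EuclideanSpace ℝ (Fin n))) (r : ℝ)
    (x : EuclideanSpace ℝ (Fin n)) : 0 ≤ locVol K r x := measureReal_nonneg

theorem volume_inter_closedBall_ne_top (K : Set (EuclideanSpace ℝ (Fin n))) (r : ℝ)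
    (x : EuclideanSpace ℝ (Fin n)) : volume (K ∩ Metric.closedBall x r) ≠ ⊤ :=
  ne_top_of_le_ne_top (measure_closedBall_lt_top).ne (measure_mono Set.inter_subset_right)

theorem locVol_mono {r' : ℝ} {x x' : EuclideanSpace ℝ (Fin n)}
    (h : K ∩ Metric.closedBall x r ⊆ K ∩ Metric.closedBall x' r') :
    locVol K r x ≤ locVol K r' x' :=
  measureReal_mono h (volume_inter_closedBall_ne_top _ _ _)

theorem IsClosedCone.locVol_rpow_mul_le (hK : IsClosedCone K) {t : ℝ} (ht0 : 0 < t) (ht1 : t < 1)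
    (x y : EuclideanSpace ℝ (Fin n)) :
    locVol K r x ^ (1 - t) * locVol K r y ^ t ≤ locVol K r ((1 - t) • x + t • y) := by
  have h1 : 0 < 1 - t := sub_pos.2 ht1
  have hm : ∀ x, MeasurableSet (K ∩ Metric.closedBall x r) := fun x =>
    hK.isClosed.measurableSet.inter Metric.isClosed_closedBall.measurableSet
  have := BrunnMinkowski.volume_rpow_mul_le ht0 ht1 (hm x) (hm y) (hm ((1 - t) • x + t • y)) (by
    rintro a ⟨haK, ha⟩ b ⟨hbK, hb⟩
    refine ⟨hK.add_mem (hK.smul_mem h1.le haK) (hK.smul_mem ht0.le hbK), ?_⟩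
    rw [mem_closedBall_iff_norm] at *
    calc ‖(1 - t) • a + t • b - ((1 - t) • x + t • y)‖
        = ‖(1 - t) • (a - x) + t • (b - y)‖ := by congr 1; module
      _ ≤ (1 - t) * ‖a - x‖ + t * ‖b - y‖ := by
          refine (norm_add_le _ _).trans ?_
          rw [norm_smul, norm_smul, Real.norm_of_nonneg h1.le, Real.norm_of_nonneg ht0.le]
      _ ≤ (1 - t) * r + t * r := by gcongr
      _ = r := by ring)
  have h2 := ENNReal.toReal_mono (volume_inter_closedBall_ne_top K r _) this
  rwa [ENNReal.toReal_mul, ← ENNReal.toReal_rpow, ← ENNReal.toReal_rpow] at h2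

theorem IsClosedCone.locVol_add_mem (hK : IsClosedCone K) {y : EuclideanSpace ℝ (Fin n)}
    (hy : y ∈ K) (x : EuclideanSpace ℝ (Fin n)) : locVol K r x ≤ locVol K r (x + y) := by
  have h : (fun z => y + z) '' (K ∩ Metric.closedBall x r) ⊆ K ∩ Metric.closedBall (x + y) r := by
    rintro _ ⟨z, ⟨hzK, hz⟩, rfl⟩
    refine ⟨hK.add_mem hy hzK, ?_⟩
    rw [mem_closedBall_iff_norm] at *
    rwa [show y + z - (x + y) = z - x by abel]
  have h2 := measureReal_mono (μ := volume) h (volume_inter_closedBall_ne_top _ _ _)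
  rw [Set.image_add_left, measureReal_def, measure_preimage_add] at h2
  exact h2

theorem IsCenter.locVol_pos (hc : IsCenter K r c) (h0 : 0 < locVol K r 0) :
    0 < locVol K r c ∧ 0 < 1 - ‖c‖ ^ 2 := by
  have h1 := hc.2 0 (by simp)
  simp only [norm_zero] at h1
  have h2 : 0 < locVol K r c * (1 - ‖c‖ ^ 2) := lt_of_lt_of_le (by simpa using h0) h1
  have h3 := locVol_nonneg K r c
  have h4 : 0 < locVol K r c := lt_of_le_of_ne h3 fun h => by simp [← h] at h2
  exact ⟨h4, pos_of_mul_pos_right h2 h3⟩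

theorem IsCenter.locVol_mul_le (hc : IsCenter K r c) (x : EuclideanSpace ℝ (Fin n)) :
    locVol K r x * (1 - ‖x‖ ^ 2) ≤ locVol K r c * (1 - ‖c‖ ^ 2) := by
  by_cases hx : ‖x‖ ≤ 1
  · exact hc.2 x hx
  · have h1 := locVol_nonneg K r x
    have h2 := locVol_nonneg K r c
    have h3 := hc.1
    have h4 := norm_nonneg c
    have : 1 - ‖x‖ ^ 2 ≤ 0 := by nlinarith
    have : 0 ≤ 1 - ‖c‖ ^ 2 := by nlinarith
    exact (mul_nonpos_of_nonneg_of_nonpos h1 ‹_›).trans (mul_nonneg h2 ‹_›)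

theorem IsCenter.eq (hK : IsClosedCone K) {c' : EuclideanSpace ℝ (Fin n)} (hc : IsCenter K r c)
    (hc' : IsCenter K r c') (h0 : 0 < locVol K r 0) : c = c' := by
  by_contra hne
  have hd : 0 < ‖c - c'‖ ^ 2 := by
    have := norm_pos_iff.2 (sub_ne_zero.2 hne); positivity
  have p1 := hc.locVol_pos h0
  have p2 := hc'.locVol_pos h0
  have e : locVol K r c * (1 - ‖c‖ ^ 2) = locVol K r c' * (1 - ‖c'‖ ^ 2) :=
    le_antisymm (hc'.2 c hc.1) (hc.2 c' hc'.1)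
  have bm := hK.locVol_rpow_mul_le (r := r) (t := 1 / 2) (by norm_num) (by norm_num) c c'
  set p := (1 - 1 / 2 : ℝ) • c + (1 / 2 : ℝ) • c' with hp
  have hpn : ‖p‖ ^ 2 = (‖c‖ ^ 2 + ‖c'‖ ^ 2) / 2 - ‖c - c'‖ ^ 2 / 4 := by
    have e1 : p = (1 / 2 : ℝ) • (c + c') := by rw [hp]; module
    have := parallelogram_law_with_norm ℝ c c'
    rw [e1, norm_smul, mul_pow, Real.norm_of_nonneg (by norm_num)]
    nlinarith
  have hle := hc.locVol_mul_le p
  have bm2 : locVol K r c * locVol K r c' ≤ locVol K r p ^ 2 := by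
    have h3 := pow_le_pow_left₀ (mul_nonneg (Real.rpow_nonneg p1.1.le _)
      (Real.rpow_nonneg p2.1.le _)) bm 2
    rwa [mul_pow, ← Real.rpow_natCast, ← Real.rpow_natCast, ← Real.rpow_mul p1.1.le,
      ← Real.rpow_mul p2.1.le, show (1 - 1 / 2 : ℝ) * (2 : ℕ) = 1 by norm_num,
      show (1 / 2 : ℝ) * (2 : ℕ) = 1 by norm_num, Real.rpow_one, Real.rpow_one] at h3
  set a := locVol K r c
  set a' := locVol K r c'
  set b := locVol K r p
  have hb0 : 0 ≤ b := locVol_nonneg _ _ _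
  set w := 1 - ‖c‖ ^ 2 with hw
  set w' := 1 - ‖c'‖ ^ 2 with hw'
  have hwp : 1 - ‖p‖ ^ 2 = (w + w') / 2 + ‖c - c'‖ ^ 2 / 4 := by rw [hpn, hw, hw']; ring
  rw [hwp] at hle
  have hb : 0 < b := by
    refine lt_of_le_of_ne hb0 fun h => ?_
    rw [← h] at bm2
    nlinarith [mul_pos p1.1 p2.1]
  have h5 : b * ((w + w') / 2) < a * w := by nlinarith [mul_pos hb hd]
  have h6 : (b * ((w + w') / 2)) ^ 2 < (a * w) ^ 2 := by
    have h0 : 0 ≤ b * ((w + w') / 2) := mul_nonneg hb0 (by linarith [p1.2, p2.2])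
    gcongr
  have h7 : (a * w) ^ 2 = (a * a') * (w * w') := by
    rw [sq]; nth_rewrite 2 [e]; ring
  have h8 : w * w' ≤ ((w + w') / 2) ^ 2 := by nlinarith [sq_nonneg (w - w')]
  have h9 : (a * a') * (w * w') ≤ b ^ 2 * ((w + w') / 2) ^ 2 :=
    mul_le_mul bm2 h8 (mul_pos p1.2 p2.2).le (sq_nonneg _)
  nlinarith

theorem IsCenter.inner_nonneg (hK : IsClosedCone K) (hc : IsCenter K r c)
    (h0 : 0 < locVol K r 0) {y : EuclideanSpace ℝ (Fin n)} (hy : y ∈ K) : 0 ≤ ⟪c, y⟫ := by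
  have p1 := hc.locVol_pos h0
  have key : ∀ s : ℝ, 0 < s → 0 ≤ 2 * ⟪c, y⟫ + s * ‖y‖ ^ 2 := by
    intro s hs
    have h1 := hc.locVol_mul_le (c + s • y)
    have h2 : locVol K r c ≤ locVol K r (c + s • y) := hK.locVol_add_mem (hK.smul_mem hs.le hy) c
    have h3 : ‖c + s • y‖ ^ 2 = ‖c‖ ^ 2 + s * (2 * ⟪c, y⟫ + s * ‖y‖ ^ 2) := by
      rw [norm_add_sq_real, inner_smul_right, norm_smul, mul_pow, Real.norm_of_nonneg hs.le]; ring
    by_contra hneg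
    push Not at hneg
    have h4 : 1 - ‖c‖ ^ 2 < 1 - ‖c + s • y‖ ^ 2 := by
      rw [h3]; nlinarith
    have h5 : 0 < locVol K r (c + s • y) := p1.1.trans_le h2
    nlinarith [mul_lt_mul_of_pos_left h4 h5, mul_le_mul_of_nonneg_right h2 p1.2.le]
  have hl : Filter.Tendsto (fun s : ℝ => 2 * ⟪c, y⟫ + s * ‖y‖ ^ 2) (nhdsWithin 0 (Set.Ioi 0))
      (nhds (2 * ⟪c, y⟫ + 0 * ‖y‖ ^ 2)) := by
    refine Filter.Tendsto.mono_left (Continuous.tendsto ?_ 0) nhdsWithin_le_nhds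
    fun_prop
  have := ge_of_tendsto hl (Filter.eventually_of_mem self_mem_nhdsWithin fun s hs => key s hs)
  linarith

theorem IsCenter.locVol_add_le (hK : IsClosedCone K) (hc : IsCenter K r c)
    (h0 : 0 < locVol K r 0) {v : EuclideanSpace ℝ (Fin n)} (hv : ⟪c, v⟫ = 0) :
    locVol K r (c + v) ≤ locVol K r c := by
  obtain ⟨p1, p2⟩ := hc.locVol_pos h0
  by_contra hlt
  push Not at hlt
  set a := locVol K r c with ha
  set w := 1 - ‖c‖ ^ 2 with hw
  set q := locVol K r (c + v) / a with hq
  have hq1 : 1 < q := (one_lt_div p1).2 hlt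
  have hlog : 0 < Real.log q := Real.log_pos hq1
  set b := ‖v‖ ^ 2 / w with hb
  have hb0 : 0 ≤ b := by positivity
  have key : ∀ s : ℝ, 0 < s → s < 1 → Real.log q ≤ s * b + s ^ 2 * b * Real.log q := by
    intro s hs0 hs1
    have h1 := hK.locVol_rpow_mul_le (r := r) hs0 hs1 c (c + v)
    have h2 := hc.locVol_mul_le (c + s • v)
    rw [show (1 - s) • c + s • (c + v) = c + s • v by module] at h1
    have h3 : ‖c + s • v‖ ^ 2 = ‖c‖ ^ 2 + s ^ 2 * ‖v‖ ^ 2 := by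
      rw [norm_add_sq_real, inner_smul_right, hv, norm_smul, mul_pow, Real.norm_of_nonneg hs0.le]
      ring
    have h4 : a ^ (1 - s) * locVol K r (c + v) ^ s = a * q ^ s := by
      rw [hq, Real.div_rpow (locVol_nonneg _ _ _) p1.le, Real.rpow_sub p1, Real.rpow_one]
      ring
    have h5 : 1 + s * Real.log q ≤ q ^ s := by
      rw [Real.rpow_def_of_pos (by linarith), mul_comm s]
      linarith [Real.add_one_le_exp (Real.log q * s)]
    rw [← ha, h4] at h1
    have h6 : a * (1 + s * Real.log q) ≤ locVol K r (c + s • v) :=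
      (mul_le_mul_of_nonneg_left h5 p1.le).trans h1
    have h7 : 1 - ‖c + s • v‖ ^ 2 = w * (1 - s ^ 2 * b) := by
      rw [h3, hb, mul_sub]
      field_simp
      rw [hw]; ring
    rw [h7] at h2
    by_cases h8 : 0 ≤ 1 - s ^ 2 * b
    · have h9 : a * (1 + s * Real.log q) * (w * (1 - s ^ 2 * b)) ≤ a * w :=
        (mul_le_mul_of_nonneg_right h6 (mul_nonneg p2.le h8)).trans h2
      have h10 : (1 + s * Real.log q) * (1 - s ^ 2 * b) ≤ 1 := by
        have : a * w * ((1 + s * Real.log q) * (1 - s ^ 2 * b)) ≤ a * w * 1 := by linarith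
        exact le_of_mul_le_mul_left this (by positivity)
      have h11 : s * Real.log q ≤ s * (s * b + s ^ 2 * b * Real.log q) := by nlinarith
      exact le_of_mul_le_mul_left h11 hs0
    · push Not at h8
      nlinarith [mul_nonneg hs0.le hb0]
  have hl : Filter.Tendsto (fun s : ℝ => s * b + s ^ 2 * b * Real.log q)
      (nhdsWithin 0 (Set.Ioi 0)) (nhds (0 * b + 0 ^ 2 * b * Real.log q)) := by
    refine Filter.Tendsto.mono_left (Continuous.tendsto ?_ 0) nhdsWithin_le_nhds
    fun_prop
  have := ge_of_tendsto hl (Filter.eventually_of_mem (Ioo_mem_nhdsGT one_pos)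
    fun s hs => key s hs.1 hs.2)
  linarith

theorem IsCenter.locVol_add_smul_ge (hK : IsClosedCone K) (hc : IsCenter K r c)
    (h0 : 0 < locVol K r 0) {v : EuclideanSpace ℝ (Fin n)} (hv : ⟪c, v⟫ = 0) {s : ℝ}
    (hs0 : 0 ≤ s) (hs1 : s ≤ 1) : locVol K r (c + v) ≤ locVol K r (c + s • v) := by
  rcases hs0.eq_or_lt with rfl | hs0
  · simpa using hc.locVol_add_le hK h0 hv
  rcases hs1.eq_or_lt with rfl | hs1
  · simp
  have h1 := hK.locVol_rpow_mul_le (r := r) hs0 hs1 c (c + v)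
  rw [show (1 - s) • c + s • (c + v) = c + s • v by module] at h1
  refine le_trans ?_ h1
  have h2 := hc.locVol_add_le hK h0 hv
  have h3 := locVol_nonneg K r (c + v)
  calc locVol K r (c + v) = locVol K r (c + v) ^ (1 - s) * locVol K r (c + v) ^ s := by
        rw [← Real.rpow_add_of_nonneg h3 (by linarith) hs0.le]; simp
    _ ≤ _ := by
        gcongr

theorem IsCenter.mem (hK : IsClosedCone K) (hne : K.Nonempty) (hc : IsCenter K r c)
    (h0 : 0 < locVol K r 0) : c ∈ K := by
  have hconv : Convex ℝ K := fun x hx y hy a b ha hb _ =>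
    hK.add_mem (hK.smul_mem ha hx) (hK.smul_mem hb hy)
  obtain ⟨p, hp, hpe⟩ := exists_norm_eq_iInf_of_complete_convex hne hK.isClosed.isComplete hconv c
  have hpi := (norm_eq_iInf_iff_real_inner_le_zero hconv hp).1 hpe
  have hz : ⟪c - p, p⟫ = 0 := by
    have h1 := hpi ((2 : ℝ) • p) (hK.smul_mem (by norm_num) hp)
    have h2 := hpi ((0 : ℝ) • p) (hK.smul_mem le_rfl hp)
    rw [show (2 : ℝ) • p - p = p by module] at h1
    rw [zero_smul, zero_sub, inner_neg_right] at h2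
    linarith
  by_contra hcK
  have hne' : 0 < ‖c - p‖ := norm_pos_iff.2 (sub_ne_zero.2 fun h => hcK (h ▸ hp))
  have hn : ‖c‖ ^ 2 = ‖c - p‖ ^ 2 + ‖p‖ ^ 2 := by
    have := norm_add_sq_real (c - p) p
    rw [hz] at this
    simpa using this
  obtain ⟨p1, p2⟩ := hc.locVol_pos h0
  have h3 : locVol K r c ≤ locVol K r p := by
    refine locVol_mono fun y hy => ⟨hy.1, ?_⟩
    have hy2 := hy.2
    rw [mem_closedBall_iff_norm] at *
    refine le_trans ?_ hy2
    have h4 := hpi y hy.1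
    have h5 : ‖y - c‖ ^ 2 = ‖y - p‖ ^ 2 + ‖c - p‖ ^ 2 - 2 * ⟪c - p, y - p⟫ := by
      have := norm_sub_sq_real (y - p) (c - p)
      rw [show y - p - (c - p) = y - c by abel, real_inner_comm] at this
      linarith
    refine le_of_sq_le_sq ?_ (norm_nonneg _) |>.trans le_rfl
    nlinarith [sq_nonneg ‖c - p‖]
  have h6 := hc.locVol_mul_le p
  have h7 : 1 - ‖c‖ ^ 2 < 1 - ‖p‖ ^ 2 := by nlinarith
  nlinarith [mul_lt_mul_of_pos_left h7 p1, mul_le_mul_of_nonneg_right h3 (p2.trans h7).le]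

end Waist

namespace Waist

/-- The polyhedral cone cut out by the half-spaces with inner normals `u j`. -/
def polyCone {n : ℕ} {J : Type*} (u : J → EuclideanSpace ℝ (Fin n)) :
    Set (EuclideanSpace ℝ (Fin n)) :=
  {y | ∀ j, 0 ≤ ⟪u j, y⟫}

/-- A center of `K` at scale `r`. -/
noncomputable def center {n : ℕ} (K : Set (EuclideanSpace ℝ (Fin n))) (r : ℝ) :
    EuclideanSpace ℝ (Fin n) :=
  Classical.epsilon (IsCenter K r)

section
variable {n : ℕ} {J : Type*}

theorem isClosedCone_polyCone (u : J → EuclideanSpace ℝ (Fin n)) : IsClosedCone (polyCone u) where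
  isClosed := by
    simp only [polyCone, Set.ofPred_forall]
    exact isClosed_iInter fun j => isClosed_le continuous_const (by fun_prop)
  add_mem := fun hx hy j => by rw [inner_add_right]; exact add_nonneg (hx j) (hy j)
  smul_mem := fun ha hx j => by rw [inner_smul_right]; exact mul_nonneg ha (hx j)

theorem volume_inner_eq_zero {u : EuclideanSpace ℝ (Fin n)} (hu : u ≠ 0) :
    volume {y : EuclideanSpace ℝ (Fin n) | ⟪u, y⟫ = 0} = 0 := by
  have h := Measure.addHaar_submodule (volume : Measure (EuclideanSpace ℝ (Fin n))) (ℝ ∙ u)ᗮ (by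
    intro h
    have : u ∈ (ℝ ∙ u)ᗮ := h ▸ Submodule.mem_top
    rw [Submodule.mem_orthogonal_singleton_iff_inner_right, inner_self_eq_zero] at this
    exact hu this)
  convert h using 2
  ext y
  simp [Submodule.mem_orthogonal_singleton_iff_inner_right]

theorem continuousAt_locVol [Finite J] {r : ℝ} (hr : 0 < r)
    {u₀ : J → EuclideanSpace ℝ (Fin n)} {x₀ : EuclideanSpace ℝ (Fin n)} (hu : ∀ j, u₀ j ≠ 0) :
    ContinuousAt (fun p : (J → EuclideanSpace ℝ (Fin n)) × EuclideanSpace ℝ (Fin n) =>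
      locVol (polyCone p.1) r p.2) (u₀, x₀) := by
  have hms : ∀ p : (J → EuclideanSpace ℝ (Fin n)) × EuclideanSpace ℝ (Fin n),
      MeasurableSet (polyCone p.1 ∩ Metric.closedBall p.2 r) := fun p =>
    (isClosedCone_polyCone p.1).isClosed.measurableSet.inter Metric.isClosed_closedBall.measurableSet
  have h1 : Filter.Tendsto (fun p : (J → EuclideanSpace ℝ (Fin n)) × EuclideanSpace ℝ (Fin n) =>
      volume (polyCone p.1 ∩ Metric.closedBall p.2 r)) (nhds (u₀, x₀))
      (nhds (volume (polyCone u₀ ∩ Metric.closedBall x₀ r))) := by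
    refine tendsto_measure_of_ae_tendsto_indicator (nhds (u₀, x₀)) (hms (u₀, x₀)) hms
      (B := Metric.closedBall x₀ (r + 1)) Metric.isClosed_closedBall.measurableSet
      measure_closedBall_lt_top.ne ?_ ?_
    · have : ∀ᶠ p : (J → EuclideanSpace ℝ (Fin n)) × EuclideanSpace ℝ (Fin n) in nhds (u₀, x₀),
          dist p.2 x₀ < 1 := by
        have : ContinuousAt (fun p : (J → EuclideanSpace ℝ (Fin n)) × EuclideanSpace ℝ (Fin n) =>
          dist p.2 x₀) (u₀, x₀) := by fun_prop
        exact this.eventually_lt continuousAt_const (by simp)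
      filter_upwards [this] with p hp y hy
      have := hy.2
      simp only [Metric.mem_closedBall] at *
      linarith [dist_triangle y p.2 x₀]
    · have hsph : ∀ᵐ y : EuclideanSpace ℝ (Fin n), y ∉ Metric.sphere x₀ r := by
        exact measure_eq_zero_iff_ae_notMem.1
          (Measure.addHaar_sphere_of_ne_zero volume x₀ hr.ne')
      have hpl : ∀ᵐ y : EuclideanSpace ℝ (Fin n), ∀ j, ⟪u₀ j, y⟫ ≠ 0 := by
        rw [ae_all_iff]
        intro j
        exact measure_eq_zero_iff_ae_notMem.1 (volume_inner_eq_zero (hu j))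
      filter_upwards [hsph, hpl] with y hy1 hy2
      have c1 : ∀ j, ContinuousAt (fun p : (J → EuclideanSpace ℝ (Fin n)) ×
          EuclideanSpace ℝ (Fin n) => ⟪p.1 j, y⟫) (u₀, x₀) := fun j => by fun_prop
      have c2 : ContinuousAt (fun p : (J → EuclideanSpace ℝ (Fin n)) ×
          EuclideanSpace ℝ (Fin n) => dist y p.2) (u₀, x₀) := by fun_prop
      have e1 : ∀ᶠ p : (J → EuclideanSpace ℝ (Fin n)) × EuclideanSpace ℝ (Fin n) in nhds (u₀, x₀),
          ∀ j, (0 ≤ ⟪p.1 j, y⟫ ↔ 0 ≤ ⟪u₀ j, y⟫) := by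
        rw [Filter.eventually_all]
        intro j
        rcases lt_or_gt_of_ne (hy2 j) with h | h
        · filter_upwards [(c1 j).eventually_lt continuousAt_const h] with p hp
          simp [hp.not_ge, h.not_ge]
        · filter_upwards [continuousAt_const.eventually_lt (c1 j) h] with p hp
          simp [hp.le, h.le]
      have e2 : ∀ᶠ p : (J → EuclideanSpace ℝ (Fin n)) × EuclideanSpace ℝ (Fin n) in nhds (u₀, x₀),
          (dist y p.2 ≤ r ↔ dist y x₀ ≤ r) := by
        rcases lt_or_gt_of_ne (show dist y x₀ ≠ r from hy1) with h | h
        · filter_upwards [c2.eventually_lt continuousAt_const h] with p hp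
          simp [hp.le, h.le]
        · filter_upwards [continuousAt_const.eventually_lt c2 h] with p hp
          simp [hp.not_ge, h.not_ge]
      filter_upwards [e1, e2] with p hp1 hp2
      simp only [polyCone, Set.mem_inter_iff, Set.mem_ofPred_eq, Metric.mem_closedBall, hp1, hp2]
  exact (ENNReal.tendsto_toReal (volume_inter_closedBall_ne_top _ _ _)).comp h1

theorem tendsto_locVol [Finite J] {X : Type*} {l : Filter X} {r : ℝ} (hr : 0 < r)
    {u₀ : J → EuclideanSpace ℝ (Fin n)} {x₀ : EuclideanSpace ℝ (Fin n)} (hu : ∀ j, u₀ j ≠ 0)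
    {u : X → J → EuclideanSpace ℝ (Fin n)} {x : X → EuclideanSpace ℝ (Fin n)}
    (h1 : Filter.Tendsto u l (nhds u₀)) (h2 : Filter.Tendsto x l (nhds x₀)) :
    Filter.Tendsto (fun a => locVol (polyCone (u a)) r (x a)) l
      (nhds (locVol (polyCone u₀) r x₀)) :=
  Filter.Tendsto.comp (y := nhds (u₀, x₀)) (g := fun p : (J → EuclideanSpace ℝ (Fin n)) ×
    EuclideanSpace ℝ (Fin n) => locVol (polyCone p.1) r p.2) (f := fun a => (u a, x a))
    (continuousAt_locVol hr hu) (h1.prodMk_nhds h2)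

theorem isCenter_center [Finite J] {r : ℝ} (hr : 0 < r)
    {u : J → EuclideanSpace ℝ (Fin n)} (hu : ∀ j, u j ≠ 0) :
    IsCenter (polyCone u) r (center (polyCone u) r) := by
  refine Classical.epsilon_spec (p := IsCenter (polyCone u) r) ?_
  have hc : ContinuousOn (fun x => locVol (polyCone u) r x * (1 - ‖x‖ ^ 2))
      (Metric.closedBall 0 1) := by
    intro x _
    have h1 : ContinuousAt (fun x => locVol (polyCone u) r x) x :=
      tendsto_locVol hr hu tendsto_const_nhds Filter.tendsto_id
    exact (h1.mul (by fun_prop)).continuousWithinAt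
  obtain ⟨c, hc1, hc2⟩ := (isCompact_closedBall (0 : EuclideanSpace ℝ (Fin n)) 1).exists_isMaxOn
    ⟨0, by simp⟩ hc
  exact ⟨c, by simpa using hc1, fun x hx => hc2 (by simpa using hx)⟩

theorem continuousAt_center [Finite J] {r : ℝ} (hr : 0 < r)
    {u₀ : J → EuclideanSpace ℝ (Fin n)} (hu : ∀ j, u₀ j ≠ 0)
    (h0 : 0 < locVol (polyCone u₀) r 0) :
    ContinuousAt (fun u : J → EuclideanSpace ℝ (Fin n) => center (polyCone u) r) u₀ := by
  have hne : ∀ᶠ u : J → EuclideanSpace ℝ (Fin n) in nhds u₀, ∀ j, u j ≠ 0 := by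
    rw [Filter.eventually_all]
    exact fun j => (continuous_apply j).continuousAt.eventually_ne (hu j)
  refine (isCompact_closedBall (0 : EuclideanSpace ℝ (Fin n)) 1).tendsto_nhds_of_unique_mapClusterPt
    ?_ ?_
  · filter_upwards [hne] with u hu'
    simpa using (isCenter_center hr hu').1
  · intro y hy hcl
    obtain ⟨U, hU, hUy⟩ := mapClusterPt_iff_ultrafilter.1 hcl
    refine IsCenter.eq (isClosedCone_polyCone u₀) (r := r) ⟨by simpa using hy, fun x hx => ?_⟩
      (isCenter_center hr hu) h0
    have h1 : Filter.Tendsto (fun u : J → EuclideanSpace ℝ (Fin n) =>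
        locVol (polyCone u) r x * (1 - ‖x‖ ^ 2)) U
        (nhds (locVol (polyCone u₀) r x * (1 - ‖x‖ ^ 2))) := by
      exact (tendsto_locVol hr hu (Filter.tendsto_id.mono_left hU) tendsto_const_nhds).mul_const _
    have h2 : Filter.Tendsto (fun u : J → EuclideanSpace ℝ (Fin n) =>
        locVol (polyCone u) r (center (polyCone u) r) * (1 - ‖center (polyCone u) r‖ ^ 2)) U
        (nhds (locVol (polyCone u₀) r y * (1 - ‖y‖ ^ 2))) := by
      refine Filter.Tendsto.mul ?_ (tendsto_const_nhds.sub (hUy.norm.pow 2))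
      exact tendsto_locVol hr hu (Filter.tendsto_id.mono_left hU) hUy
    refine le_of_tendsto_of_tendsto h1 h2 (hU ?_)
    filter_upwards [hne] with u hu'
    exact (isCenter_center hr hu').2 x hx

end
end Waist

namespace Waist

/-- A unit vector of `ℝⁿ` together with an isometric copy of `ℝᵐ` orthogonal to it. -/
structure Frame (n m : ℕ) where
  e : EuclideanSpace ℝ (Fin n)
  ι : EuclideanSpace ℝ (Fin m) →ₗᵢ[ℝ] EuclideanSpace ℝ (Fin n)
  norm_e : ‖e‖ = 1
  inner_e_ι : ∀ v, ⟪e, ι v⟫ = 0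

namespace Frame
variable {n m : ℕ} (T : Frame n m)

/-- The coordinate along the unit vector. -/
noncomputable def t (y : EuclideanSpace ℝ (Fin n)) : ℝ := ⟪T.e, y⟫

/-- The coordinates in the copy of `ℝᵐ`. -/
noncomputable def π : EuclideanSpace ℝ (Fin n) →L[ℝ] EuclideanSpace ℝ (Fin m) :=
  ContinuousLinearMap.adjoint T.ι.toContinuousLinearMap

/-- The component orthogonal to the frame. -/
noncomputable def rem (y : EuclideanSpace ℝ (Fin n)) : EuclideanSpace ℝ (Fin n) :=
  y - T.t y • T.e - T.ι (T.π y)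

theorem inner_π (y : EuclideanSpace ℝ (Fin n)) (v : EuclideanSpace ℝ (Fin m)) :
    ⟪T.π y, v⟫ = ⟪y, T.ι v⟫ :=
  ContinuousLinearMap.adjoint_inner_left _ _ _

@[fun_prop]
theorem continuous_t : Continuous T.t := by unfold t; fun_prop

@[fun_prop]
theorem continuous_π : Continuous T.π := T.π.continuous

theorem inner_e_rem (y : EuclideanSpace ℝ (Fin n)) : ⟪T.e, T.rem y⟫ = 0 := by
  simp [rem, inner_sub_right, inner_smul_right, T.inner_e_ι, T.norm_e, t]

theorem inner_ι_rem (v : EuclideanSpace ℝ (Fin m)) (y : EuclideanSpace ℝ (Fin n)) :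
    ⟪T.ι v, T.rem y⟫ = 0 := by
  have h : ⟪T.ι v, T.e⟫ = 0 := by rw [real_inner_comm]; exact T.inner_e_ι v
  simp only [rem, inner_sub_right, inner_smul_right, h, T.ι.inner_map_map, mul_zero]
  rw [real_inner_comm (T.π y) v, T.inner_π, real_inner_comm]; simp

theorem norm_sub_sq (y : EuclideanSpace ℝ (Fin n)) (a : ℝ) (v : EuclideanSpace ℝ (Fin m)) :
    ‖y - a • T.e - T.ι v‖ ^ 2 = (T.t y - a) ^ 2 + ‖T.π y - v‖ ^ 2 + ‖T.rem y‖ ^ 2 := by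
  have h : y - a • T.e - T.ι v = ((T.t y - a) • T.e + T.ι (T.π y - v)) + T.rem y := by
    rw [rem, map_sub]; module
  rw [h, norm_add_sq_real, norm_add_sq_real, inner_add_left, real_inner_smul_left,
    real_inner_smul_left, T.inner_e_rem, T.inner_ι_rem, T.inner_e_ι, norm_smul, T.norm_e,
    T.ι.norm_map]
  simp

theorem norm_sq (y : EuclideanSpace ℝ (Fin n)) :
    ‖y‖ ^ 2 = T.t y ^ 2 + ‖T.π y‖ ^ 2 + ‖T.rem y‖ ^ 2 := by
  simpa using T.norm_sub_sq y 0 0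

theorem norm_comb_sq (a : ℝ) (v : EuclideanSpace ℝ (Fin m)) :
    ‖a • T.e + T.ι v‖ ^ 2 = a ^ 2 + ‖v‖ ^ 2 := by
  rw [norm_add_sq_real, inner_smul_left, T.inner_e_ι, norm_smul, T.norm_e, T.ι.norm_map]
  simp

end Frame

open scoped ENNReal

variable {n m : ℕ} {K : Set (EuclideanSpace ℝ (Fin n))} {r : ℝ} {c : EuclideanSpace ℝ (Fin n)}

/-- All but a proportion `δ` of each vector of `K` lies in the span of the frame. -/
def Frame.IsThin (T : Frame n m) (K : Set (EuclideanSpace ℝ (Fin n))) (δ : ℝ) : Prop :=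
  ∀ y ∈ K, ‖T.rem y‖ ≤ δ * ‖y‖

theorem lintegral_volume_inter_closedBall {Z : Type*} [MeasurableSpace Z] (ν : Measure Z) [SFinite ν]
    {g : Z → EuclideanSpace ℝ (Fin n)} (hg : Measurable g) (K : Set (EuclideanSpace ℝ (Fin n)))
    (r : ℝ) :
    ∫⁻ z, volume (K ∩ Metric.closedBall (g z) r) ∂ν =
      ∫⁻ y in K, ν {z | dist y (g z) ≤ r} := by
  have hS : MeasurableSet {p : Z × EuclideanSpace ℝ (Fin n) | dist p.2 (g p.1) ≤ r} :=
    measurableSet_le (by fun_prop) measurable_const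
  have h1 := Measure.prod_apply (μ := ν) (ν := volume.restrict K) hS
  have h2 := Measure.prod_apply_symm (μ := ν) (ν := volume.restrict K) hS
  rw [h1] at h2
  refine Eq.trans ?_ h2
  refine lintegral_congr fun z => ?_
  rw [Measure.restrict_apply (measurable_prodMk_left hS), Set.inter_comm]
  rfl

theorem IsClosedCone.volume_inter_smul_ball (hK : IsClosedCone K) {s : ℝ} (hs : 0 < s) :
    volume (K ∩ Metric.closedBall 0 s) =
      ENNReal.ofReal (s ^ n) * volume (K ∩ Metric.closedBall 0 1) := by
  have h := Measure.addHaar_smul (volume : Measure (EuclideanSpace ℝ (Fin n))) s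
    (K ∩ Metric.closedBall 0 1)
  rw [finrank_euclideanSpace_fin, abs_of_pos (by positivity)] at h
  rw [← h]
  congr 1
  ext y
  rw [Set.mem_smul_set_iff_inv_smul_mem₀ hs.ne']
  simp only [Set.mem_inter_iff, mem_closedBall_zero_iff, norm_smul, norm_inv,
    Real.norm_of_nonneg hs.le]
  refine and_congr ⟨fun h => hK.smul_mem (by positivity) h, fun h => ?_⟩ ?_
  · simpa [smul_smul, hs.ne'] using hK.smul_mem hs.le h
  · rw [inv_mul_le_iff₀ hs, mul_one]

theorem IsCenter.le_norm_add_pow (hK : IsClosedCone K) (hc : IsCenter K r c) (hr : 0 < r)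
    (hr4 : r ≤ 1 / 4) (hV : 0 < locVol K 1 0) (T : Frame n m) {δ : ℝ} (hT : T.IsThin K δ)
    (hδ0 : 0 ≤ δ) (hδ : δ ≤ r / 2) : r ^ (m + 1) ≤ (8 * (‖c‖ + r)) ^ n := by
  have hup : ∀ x, ‖x‖ ≤ 1 / 2 → locVol K r x ≤ 4 / 3 * locVol K r c := by
    intro x hx
    have h1 := hc.2 x (by linarith)
    have h2 := locVol_nonneg K r x
    have h3 := locVol_nonneg K r c
    have h4 := norm_nonneg x
    have h5 : ‖x‖ ^ 2 ≤ 1 / 4 := by nlinarith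
    nlinarith [mul_le_mul_of_nonneg_left h5 h2, mul_nonneg h3 (sq_nonneg ‖c‖)]
  have hup2 : volume (K ∩ Metric.closedBall c r) ≤
      ENNReal.ofReal ((‖c‖ + r) ^ n) * volume (K ∩ Metric.closedBall 0 1) := by
    rw [← hK.volume_inter_smul_ball (by positivity)]
    refine measure_mono fun y hy => ⟨hy.1, ?_⟩
    have := hy.2
    rw [mem_closedBall_iff_norm] at this
    rw [mem_closedBall_zero_iff]
    linarith [norm_le_norm_add_norm_sub c y, norm_sub_rev c y]
  have hup3 : ∀ x, ‖x‖ ≤ 1 / 2 → volume (K ∩ Metric.closedBall x r) ≤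
      2 * (ENNReal.ofReal ((‖c‖ + r) ^ n) * volume (K ∩ Metric.closedBall 0 1)) := by
    intro x hx
    refine le_trans ?_ (mul_le_mul_right hup2 2)
    have := hup x hx
    have h3 := locVol_nonneg K r c
    rw [← ENNReal.toReal_le_toReal (volume_inter_closedBall_ne_top _ _ _)
      (ENNReal.mul_ne_top (by simp) (volume_inter_closedBall_ne_top _ _ _)), ENNReal.toReal_mul]
    simp only [ENNReal.toReal_ofNat]
    change locVol K r x ≤ 2 * locVol K r c
    linarith
  set X := EuclideanSpace ℝ (Fin m)
  set Q : Set (ℝ × X) := Metric.closedBall 0 (1 / 4) ×ˢ Metric.closedBall 0 (1 / 4) with hQ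
  set g : ℝ × X → EuclideanSpace ℝ (Fin n) := fun z => z.1 • T.e + T.ι z.2 with hg
  have hgm : Measurable g := by
    have : Continuous g := by
      have := T.ι.continuous
      fun_prop
    exact this.measurable
  have hQm : MeasurableSet Q :=
    Metric.isClosed_closedBall.measurableSet.prod Metric.isClosed_closedBall.measurableSet
  have ton := lintegral_volume_inter_closedBall ((volume : Measure (ℝ × X)).restrict Q) hgm K r
  have hω : volume (Metric.closedBall (0 : X) 1) ≠ 0 := (Metric.measure_closedBall_pos _ _ one_pos).ne'
  have hω' : volume (Metric.closedBall (0 : X) 1) ≠ ⊤ := measure_closedBall_lt_top.ne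
  set ω := volume (Metric.closedBall (0 : X) 1)
  have hball : ∀ (x : X) {s : ℝ}, 0 ≤ s → volume (Metric.closedBall x s) =
      ENNReal.ofReal (s ^ m) * ω := by
    intro x s hs
    rw [Measure.addHaar_closedBall' _ _ hs, finrank_euclideanSpace_fin]
  have hle : ∫⁻ z in Q, volume (K ∩ Metric.closedBall (g z) r) ≤
      2 * (ENNReal.ofReal ((‖c‖ + r) ^ n) * volume (K ∩ Metric.closedBall 0 1)) *
        (ENNReal.ofReal ((1 / 4) ^ m / 2) * ω) := by
    have hvQ : volume Q = ENNReal.ofReal ((1 / 4) ^ m / 2) * ω := by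
      rw [hQ, Measure.volume_eq_prod, Measure.prod_prod, hball _ (by norm_num),
        Real.volume_closedBall, ← mul_assoc, ← ENNReal.ofReal_mul (by norm_num)]
      congr 2; ring
    rw [← hvQ]
    rw [← setLIntegral_const]
    refine setLIntegral_mono' hQm fun z hz => hup3 _ ?_
    have h1 : |z.1| ≤ 1 / 4 := by simpa using hz.1
    have h2 : ‖z.2‖ ≤ 1 / 4 := by simpa using hz.2
    refine le_of_sq_le_sq ?_ (by norm_num)
    rw [hg, T.norm_comb_sq, ← sq_abs]
    nlinarith [abs_nonneg z.1, norm_nonneg z.2]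
  have hge : volume (K ∩ Metric.closedBall 0 1) * ENNReal.ofReal ((1 / 8) ^ n) *
      (ENNReal.ofReal (r * (r / 2) ^ m) * ω) ≤
      ∫⁻ y in K, (volume.restrict Q) {z | dist y (g z) ≤ r} := by
    rw [mul_comm (volume _), ← hK.volume_inter_smul_ball (by norm_num)]
    calc _ = ∫⁻ y in K ∩ Metric.closedBall 0 (1 / 8), (ENNReal.ofReal (r * (r / 2) ^ m) * ω) := by
          rw [setLIntegral_const, mul_comm]
      _ ≤ ∫⁻ y in K ∩ Metric.closedBall 0 (1 / 8), (volume.restrict Q) {z | dist y (g z) ≤ r} := by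
          refine setLIntegral_mono' (hK.isClosed.measurableSet.inter
            Metric.isClosed_closedBall.measurableSet) fun y hy => ?_
          have hy1 : ‖y‖ ≤ 1 / 8 := by simpa using hy.2
          have hy0 := norm_nonneg y
          have hn := T.norm_sq y
          have hyt : |T.t y| ≤ 1 / 8 := by
            refine abs_le_of_sq_le_sq ?_ (by norm_num)
            nlinarith [sq_nonneg ‖T.π y‖, sq_nonneg ‖T.rem y‖]
          have hyπ : ‖T.π y‖ ≤ 1 / 8 := by
            refine (abs_of_nonneg (norm_nonneg _)).symm.le.trans (abs_le_of_sq_le_sq ?_ (by norm_num))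
            nlinarith [sq_nonneg (T.t y), sq_nonneg ‖T.rem y‖]
          have hrem : ‖T.rem y‖ ≤ r / 2 := (hT y hy.1).trans (by nlinarith)
          have hsub : Metric.closedBall (T.t y) (r / 2) ×ˢ Metric.closedBall (T.π y) (r / 2) ⊆
              {z | dist y (g z) ≤ r} ∩ Q := by
            rintro ⟨a, v⟩ ⟨ha, hv⟩
            simp only [mem_closedBall_iff_norm, Real.norm_eq_abs] at ha hv
            refine ⟨?_, ?_, ?_⟩
            · have h1 := T.norm_sub_sq y a v
              have h2 : dist y (g (a, v)) = ‖y - a • T.e - T.ι v‖ := by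
                rw [dist_eq_norm, hg]; congr 1; simp only [sub_sub]
              rw [Set.mem_ofPred_eq, h2]
              refine le_of_sq_le_sq ?_ hr.le
              rw [h1]
              have h3 : (T.t y - a) ^ 2 ≤ (r / 2) ^ 2 := by
                rw [abs_sub_comm] at ha
                exact sq_le_sq' (by linarith [neg_abs_le (T.t y - a)]) ((le_abs_self _).trans ha)
              have h4 : ‖T.π y - v‖ ^ 2 ≤ (r / 2) ^ 2 := by
                rw [norm_sub_rev] at hv; gcongr
              have h5 : ‖T.rem y‖ ^ 2 ≤ (r / 2) ^ 2 := by gcongr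
              nlinarith [sq_nonneg r]
            · rw [mem_closedBall_zero_iff, Real.norm_eq_abs]
              have := abs_add_le (a - T.t y) (T.t y)
              rw [sub_add_cancel] at this
              linarith
            · rw [mem_closedBall_zero_iff]
              have := norm_add_le (v - T.π y) (T.π y)
              rw [sub_add_cancel] at this
              linarith
          refine le_trans (le_of_eq ?_) ((measure_mono hsub).trans (Measure.le_restrict_apply _ _))
          rw [Measure.volume_eq_prod, Measure.prod_prod, hball _ (by positivity),
            Real.volume_closedBall, ← mul_assoc, ← ENNReal.ofReal_mul (by positivity)]
          congr 2; ring
      _ ≤ _ := lintegral_mono' (Measure.restrict_mono Set.inter_subset_left le_rfl) le_rfl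
  have hfin := (hge.trans ton.symm.le).trans hle
  set Vb := volume (K ∩ Metric.closedBall 0 1) with hVb
  have hVt : Vb ≠ ⊤ := volume_inter_closedBall_ne_top K 1 0
  have hfin2 := ENNReal.toReal_mono (by finiteness) hfin
  simp only [ENNReal.toReal_mul] at hfin2
  have hV1 : 0 < Vb.toReal := hV
  have hω1 : 0 < ω.toReal := ENNReal.toReal_pos hω hω'
  rw [ENNReal.toReal_ofReal (by positivity), ENNReal.toReal_ofReal (by positivity),
    ENNReal.toReal_ofReal (by positivity), ENNReal.toReal_ofReal (by positivity)] at hfin2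
  simp only [ENNReal.toReal_ofNat] at hfin2
  have h1 : (Vb.toReal * ω.toReal) * ((1 / 8) ^ n * (r * (r / 2) ^ m)) ≤
      (Vb.toReal * ω.toReal) * ((‖c‖ + r) ^ n * (1 / 4) ^ m) := by nlinarith
  have h2 := le_of_mul_le_mul_left h1 (by positivity)
  have h3 : r ^ (m + 1) * (1 / 2) ^ m ≤ (8 * (‖c‖ + r)) ^ n * (1 / 4) ^ m := by
    have := mul_le_mul_of_nonneg_left h2 (show (0:ℝ) ≤ 8 ^ n by positivity)
    calc r ^ (m + 1) * (1 / 2) ^ m = 8 ^ n * ((1 / 8) ^ n * (r * (r / 2) ^ m)) := by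
          rw [← mul_assoc, ← mul_pow, div_pow, div_pow, pow_succ]; norm_num; ring
      _ ≤ _ := this
      _ = _ := by rw [mul_pow]; ring
  have h4 : (8 * (‖c‖ + r)) ^ n * (1 / 4) ^ m ≤ (8 * (‖c‖ + r)) ^ n * (1 / 2) ^ m := by
    gcongr; norm_num
  exact le_of_mul_le_mul_right (h3.trans h4) (by positivity)

end Waist

namespace Waist
open scoped ENNReal

theorem lintegral_polar {E : Type*} [NormedAddCommGroup E] [NormedSpace ℝ E] [Nontrivial E]
    [FiniteDimensional ℝ E] [MeasurableSpace E] [BorelSpace E] (μ : Measure E)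
    [μ.IsAddHaarMeasure] (f : E → ℝ≥0∞) :
    ∫⁻ x, f x ∂μ = ∫⁻ p : Metric.sphere (0 : E) 1 × Set.Ioi (0 : ℝ), f (p.2.1 • p.1.1)
      ∂(μ.toSphere.prod (Measure.volumeIoiPow (Module.finrank ℝ E - 1))) := by
  have h1 := μ.measurePreserving_homeomorphUnitSphereProd.lintegral_comp_emb
    (Homeomorph.measurableEmbedding _) (fun p => f (p.2.1 • p.1.1))
  rw [← h1]
  have h2 := lintegral_subtype_comap (μ := μ) (s := ({0}ᶜ : Set E))
    (measurableSet_singleton _).compl f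
  rw [restrict_compl_singleton] at h2
  rw [← h2]
  refine lintegral_congr fun x => ?_
  congr 1
  have h3 : ‖(x : E)‖ ≠ 0 := norm_ne_zero_iff.2 x.2
  rw [homeomorphUnitSphereProd_apply_snd_coe, homeomorphUnitSphereProd_apply_fst_coe, smul_smul,
    mul_inv_cancel₀ h3, one_smul]

theorem antitone_chebyshev {R : Type*} [LinearOrder R] [MeasurableSpace R] [TopologicalSpace R]
    [OrderTopology R] [OpensMeasurableSpace R] (μ : Measure R) {φ : R → ℝ≥0∞}
    (hφ : Antitone φ) (k : R → ℝ≥0∞) (hk : Measurable k) {a b : R} (hab : a ≤ b) :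
    (∫⁻ x in Set.Iic a, k x ∂μ) * ∫⁻ x in Set.Iic b, k x * φ x ∂μ ≤
      (∫⁻ x in Set.Iic b, k x ∂μ) * ∫⁻ x in Set.Iic a, k x * φ x ∂μ := by
  have hd : Disjoint (Set.Iic a) (Set.Ioc a b) := Set.Iic_disjoint_Ioc le_rfl
  rw [← Set.Iic_union_Ioc_eq_Iic hab, lintegral_union measurableSet_Ioc hd,
    lintegral_union measurableSet_Ioc hd, mul_add, add_mul]
  refine add_le_add le_rfl ?_
  have h1 : ∫⁻ x in Set.Ioc a b, k x * φ x ∂μ ≤ φ a * ∫⁻ x in Set.Ioc a b, k x ∂μ := by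
    rw [← lintegral_const_mul _ hk]
    exact setLIntegral_mono' measurableSet_Ioc fun x hx => by
      rw [mul_comm]; gcongr; exact hφ hx.1.le
  have h2 : φ a * ∫⁻ x in Set.Iic a, k x ∂μ ≤ ∫⁻ x in Set.Iic a, k x * φ x ∂μ := by
    rw [← lintegral_const_mul _ hk]
    exact setLIntegral_mono' measurableSet_Iic fun x hx => by
      rw [mul_comm]; gcongr; exact hφ hx
  calc _ ≤ (∫⁻ x in Set.Iic a, k x ∂μ) * (φ a * ∫⁻ x in Set.Ioc a b, k x ∂μ) := by gcongr
    _ = (∫⁻ x in Set.Ioc a b, k x ∂μ) * (φ a * ∫⁻ x in Set.Iic a, k x ∂μ) := by ring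
    _ ≤ _ := by gcongr

theorem radial_chebyshev {E : Type*} [NormedAddCommGroup E] [NormedSpace ℝ E] [Nontrivial E]
    [FiniteDimensional ℝ E] [MeasurableSpace E] [BorelSpace E] (μ : Measure E)
    [μ.IsAddHaarMeasure] {h : E → ℝ≥0∞} (hm : Measurable h)
    (hh : ∀ v, ∀ s : ℝ, 0 ≤ s → s ≤ 1 → h v ≤ h (s • v)) {k : ℝ → ℝ≥0∞} (hk : Measurable k)
    {a b : ℝ} (ha : 0 < a) (hab : a ≤ b) :
    (∫⁻ v in Metric.closedBall 0 a, k ‖v‖ ∂μ) * ∫⁻ v in Metric.closedBall 0 b, k ‖v‖ * h v ∂μ ≤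
      (∫⁻ v in Metric.closedBall 0 b, k ‖v‖ ∂μ) *
        ∫⁻ v in Metric.closedBall 0 a, k ‖v‖ * h v ∂μ := by
  set ν : Measure (Set.Ioi (0 : ℝ)) := Measure.volumeIoiPow (Module.finrank ℝ E - 1)
  have key : ∀ {c : ℝ} (hc : 0 < c) {g : E → ℝ≥0∞}, Measurable g →
      ∫⁻ v in Metric.closedBall 0 c, k ‖v‖ * g v ∂μ =
        ∫⁻ θ, ∫⁻ x in Set.Iic ⟨c, hc⟩, k x * g (x.1 • θ.1) ∂ν ∂μ.toSphere := by
    intro c hc g hg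
    rw [← lintegral_indicator Metric.isClosed_closedBall.measurableSet, lintegral_polar,
      lintegral_prod]
    · refine lintegral_congr fun θ => ?_
      rw [← lintegral_indicator measurableSet_Iic]
      refine lintegral_congr fun x => ?_
      have h1 : ‖x.1 • θ.1‖ = x.1 := by
        have : ‖θ.1‖ = 1 := by simp
        rw [norm_smul, this, mul_one, Real.norm_of_nonneg (le_of_lt x.2)]
      by_cases hx : x ≤ ⟨c, hc⟩
      · rw [Set.indicator_of_mem, Set.indicator_of_mem (by exact hx), h1]
        rw [mem_closedBall_zero_iff, h1]; exact hx
      · rw [Set.indicator_of_notMem, Set.indicator_of_notMem (by exact hx)]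
        rw [mem_closedBall_zero_iff, h1]; exact hx
    · refine Measurable.aemeasurable ?_
      refine Measurable.comp (g := (Metric.closedBall (0 : E) c).indicator fun v => k ‖v‖ * g v) ?_
        (by fun_prop)
      exact (by fun_prop : Measurable fun v => k ‖v‖ * g v).indicator
        Metric.isClosed_closedBall.measurableSet
  have key1 : ∀ {c : ℝ} (hc : 0 < c), ∫⁻ v in Metric.closedBall 0 c, k ‖v‖ ∂μ =
      μ.toSphere Set.univ * ∫⁻ x in Set.Iic (⟨c, hc⟩ : Set.Ioi (0 : ℝ)), k x ∂ν := by
    intro c hc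
    have := key hc (g := fun _ => 1) measurable_const
    simp only [mul_one, lintegral_const] at this
    rw [this, mul_comm]
  have hb := ha.trans_le hab
  have hmeas : ∀ c : Set.Ioi (0 : ℝ), Measurable fun θ : Metric.sphere (0 : E) 1 =>
      ∫⁻ x in Set.Iic c, k x * h (x.1 • θ.1) ∂ν := by
    intro c
    refine Measurable.lintegral_prod_right' (f := fun p : Metric.sphere (0 : E) 1 ×
      Set.Ioi (0 : ℝ) => k p.2 * h (p.2.1 • p.1.1)) ?_
    fun_prop
  rw [key1 ha, key1 hb, key ha hm, key hb hm, mul_assoc, mul_assoc]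
  gcongr 1
  rw [← lintegral_const_mul _ (hmeas _), ← lintegral_const_mul _ (hmeas _)]
  refine lintegral_mono fun θ => ?_
  refine antitone_chebyshev ν (φ := fun x => h (x.1 • θ.1)) (fun x y hxy => ?_) _ (by fun_prop)
    (show (⟨a, ha⟩ : Set.Ioi (0 : ℝ)) ≤ ⟨b, hb⟩ from hab)
  have hx : 0 < x.1 := x.2
  have hy : 0 < y.1 := y.2
  have hxy' : x.1 ≤ y.1 := hxy
  have := hh (y.1 • θ.1) (x.1 / y.1) (by positivity) ((div_le_one hy).2 hxy')
  rwa [smul_smul, div_mul_cancel₀ _ hy.ne'] at this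

theorem lintegral_comp_smul_cone {E : Type*} [NormedAddCommGroup E] [NormedSpace ℝ E]
    [FiniteDimensional ℝ E] [MeasurableSpace E] [BorelSpace E] (μ : Measure E)
    [μ.IsAddHaarMeasure] {A : Set E} (hA : MeasurableSet A) {s : ℝ} (hs : 0 < s)
    (hAs : ∀ y, s • y ∈ A ↔ y ∈ A) (F : E → ℝ≥0∞) :
    ∫⁻ y in A, F (s • y) ∂μ = ENNReal.ofReal ((s ^ Module.finrank ℝ E)⁻¹) * ∫⁻ y in A, F y ∂μ := by
  rw [← lintegral_indicator hA, ← lintegral_indicator hA]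
  have h1 : (A.indicator fun y => F (s • y)) = fun y => A.indicator F (s • y) := by
    ext y
    by_cases hy : y ∈ A
    · rw [Set.indicator_of_mem hy, Set.indicator_of_mem ((hAs y).2 hy)]
    · rw [Set.indicator_of_notMem hy, Set.indicator_of_notMem (mt (hAs y).1 hy)]
  have h2 := (Homeomorph.smulOfNeZero s hs.ne').measurableEmbedding.lintegral_map
    (μ := μ) (A.indicator F)
  rw [h1]
  refine Eq.trans h2.symm ?_
  have h3 := Measure.map_addHaar_smul μ hs.ne'
  change ∫⁻ y, A.indicator F y ∂(Measure.map (s • ·) μ) = _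
  rw [h3, lintegral_smul_measure, abs_of_pos (by positivity)]
  rfl

theorem lintegral_Ici_inv_pow {n : ℕ} (hn : 0 < n) {p : ℝ} (hp : 0 < p) :
    ∫⁻ s in Set.Ici p, ENNReal.ofReal ((s ^ (n + 1))⁻¹) = ENNReal.ofReal ((p ^ n)⁻¹ / n) := by
  have hn' : (0 : ℝ) < n := by exact_mod_cast hn
  have hlt : (-((n : ℝ) + 1)) < -1 := by linarith
  have h1 := integral_Ioi_rpow_of_lt hlt hp
  have h2 := integrableOn_Ioi_rpow_of_lt hlt hp
  rw [setLIntegral_congr Ioi_ae_eq_Ici.symm]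
  have h3 : ∀ s ∈ Set.Ioi p, (s ^ (n + 1))⁻¹ = s ^ (-((n : ℝ) + 1)) := by
    intro s hs
    have : 0 < s := hp.trans hs
    rw [Real.rpow_neg this.le]
    norm_cast
  rw [setLIntegral_congr_fun measurableSet_Ioi (fun s hs => by rw [h3 s hs]),
    ← ofReal_integral_eq_lintegral_ofReal h2
      (ae_restrict_of_forall_mem measurableSet_Ioi fun s hs => Real.rpow_nonneg (hp.trans hs).le _),
    h1]
  congr 1
  rw [show -((n : ℝ) + 1) + 1 = -n by ring, Real.rpow_neg hp.le, Real.rpow_natCast, neg_div_neg_eq]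

theorem lintegral_cone_homogeneous {n : ℕ} (hn : 0 < n) {A : Set (EuclideanSpace ℝ (Fin n))}
    (hA : MeasurableSet A) (hAs : ∀ s : ℝ, 0 < s → ∀ y, s • y ∈ A ↔ y ∈ A)
    {p q : EuclideanSpace ℝ (Fin n) → ℝ} (hp : Measurable p) (hq : Measurable q)
    (hp0 : ∀ y ∈ A, 0 < p y) (hq0 : ∀ y ∈ A, 0 < q y)
    (hps : ∀ s : ℝ, 0 < s → ∀ y, p (s • y) = s * p y)
    (hqs : ∀ s : ℝ, 0 < s → ∀ y, q (s • y) = s * q y) {β : ℝ → ℝ≥0∞} (hβ : Measurable β) :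
    (∫⁻ s in Set.Ioi 0, β s * ENNReal.ofReal (s ^ (n - 1))) * volume (A ∩ {y | p y ≤ 1}) * n =
      ∫⁻ y in A, β (q y) * ENNReal.ofReal ((q y / p y) ^ n) := by
  have hmp : MeasurableSet {y | p y ≤ 1} := measurableSet_le hp measurable_const
  obtain ⟨n, rfl⟩ : ∃ k, n = k + 1 := ⟨n - 1, by omega⟩
  set χ : EuclideanSpace ℝ (Fin (n + 1)) → ℝ → ℝ≥0∞ := fun y s => if p y ≤ s then 1 else 0 with hχ
  have hχm : Measurable (fun z : EuclideanSpace ℝ (Fin (n + 1)) × ℝ => χ z.1 z.2) := by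
    refine Measurable.ite (measurableSet_le (by fun_prop) (by fun_prop)) measurable_const
      measurable_const
  have step1 : (∫⁻ s in Set.Ioi 0, β s * ENNReal.ofReal (s ^ n)) * volume (A ∩ {y | p y ≤ 1}) =
      ∫⁻ y in A, ∫⁻ s in Set.Ioi 0, χ y 1 * (β (s * q y) *
        ENNReal.ofReal (s ^ n * q y ^ (n + 1))) := by
    have e1 : ∀ y ∈ A, ∫⁻ s in Set.Ioi 0, χ y 1 * (β (s * q y) *
        ENNReal.ofReal (s ^ n * q y ^ (n + 1))) =
        χ y 1 * ∫⁻ s in Set.Ioi 0, β s * ENNReal.ofReal (s ^ n) := by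
      intro y hy
      have hqy := hq0 y hy
      rw [lintegral_const_mul _ (by fun_prop)]
      congr 1
      have h := lintegral_comp_smul_cone (volume : Measure ℝ) measurableSet_Ioi hqy
        (A := Set.Ioi 0) (fun s => by simp [hqy]) (fun s => β s * ENNReal.ofReal (s ^ n))
      rw [Module.finrank_self, pow_one] at h
      have h' : ∀ s : ℝ, β (s * q y) * ENNReal.ofReal (s ^ n * q y ^ (n + 1)) =
          ENNReal.ofReal (q y) * (β (q y • s) * ENNReal.ofReal ((q y • s) ^ n)) := by
        intro s
        rw [smul_eq_mul, mul_left_comm, ← ENNReal.ofReal_mul hqy.le, mul_comm s]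
        congr 2; ring
      simp only [h']
      rw [lintegral_const_mul _ (by fun_prop), h, ← mul_assoc, ← ENNReal.ofReal_mul hqy.le,
        mul_inv_cancel₀ hqy.ne']
      simp
    rw [setLIntegral_congr_fun hA e1, lintegral_mul_const _ (by
      exact hχm.comp (measurable_id.prodMk measurable_const)), mul_comm]
    congr 1
    have : (fun y => χ y 1) = {y | p y ≤ 1}.indicator 1 := by
      ext y; simp [hχ, Set.indicator]
    rw [this, lintegral_indicator_one hmp, Measure.restrict_apply hmp, Set.inter_comm]
  have step2 : ∫⁻ y in A, ∫⁻ s in Set.Ioi 0, χ y 1 * (β (s * q y) *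
        ENNReal.ofReal (s ^ n * q y ^ (n + 1))) =
      ∫⁻ s in Set.Ioi (0 : ℝ), ∫⁻ y in A, χ y s * (β (q y) *
        ENNReal.ofReal (q y ^ (n + 1)) * ENNReal.ofReal ((s ^ (n + 1 + 1))⁻¹)) := by
    rw [lintegral_lintegral_swap (by
      refine Measurable.aemeasurable (Measurable.mul ?_ ?_)
      · exact hχm.comp (measurable_fst.prodMk measurable_const)
      · fun_prop)]
    refine setLIntegral_congr_fun measurableSet_Ioi fun s hs => ?_
    have hs : 0 < s := hs
    have h := lintegral_comp_smul_cone (volume : Measure (EuclideanSpace ℝ (Fin (n + 1)))) hA hs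
      (hAs s hs) (fun y => χ y s * (β (q y) * ENNReal.ofReal (q y ^ (n + 1)) *
        ENNReal.ofReal (s⁻¹)))
    rw [finrank_euclideanSpace_fin] at h
    have e1 : ∀ y ∈ A, χ y 1 * (β (s * q y) * ENNReal.ofReal (s ^ n * q y ^ (n + 1))) =
        χ (s • y) s * (β (q (s • y)) * ENNReal.ofReal (q (s • y) ^ (n + 1)) *
        ENNReal.ofReal (s⁻¹)) := by
      intro y hy
      have hqy := hq0 y hy
      have e2 : χ (s • y) s = χ y 1 := by
        simp only [hχ, hps s hs, mul_le_iff_le_one_right hs]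
      rw [e2, hqs s hs, mul_assoc, ← ENNReal.ofReal_mul (by positivity)]
      congr 3
      field_simp
      ring
    rw [setLIntegral_congr_fun hA e1, h, ← lintegral_const_mul _ (by
      refine Measurable.mul ?_ (by fun_prop)
      exact hχm.comp (measurable_id.prodMk measurable_const))]
    refine setLIntegral_congr_fun hA fun y hy => ?_
    rw [mul_left_comm, mul_left_comm (ENNReal.ofReal _), ← ENNReal.ofReal_mul (by positivity)]
    congr 4
    rw [← mul_inv, ← pow_succ]
  have step3 : ∫⁻ s in Set.Ioi (0 : ℝ), ∫⁻ y in A, χ y s * (β (q y) *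
        ENNReal.ofReal (q y ^ (n + 1)) * ENNReal.ofReal ((s ^ (n + 1 + 1))⁻¹)) =
      ∫⁻ y in A, β (q y) * ENNReal.ofReal ((q y / p y) ^ (n + 1)) / (n + 1 : ℕ) := by
    rw [← lintegral_lintegral_swap (by
      refine Measurable.aemeasurable (Measurable.mul ?_ ?_)
      · exact hχm
      · fun_prop)]
    refine setLIntegral_congr_fun hA fun y hy => ?_
    have hpy := hp0 y hy
    have hqy := hq0 y hy
    have e1 : ∀ s, χ y s * (β (q y) * ENNReal.ofReal (q y ^ (n + 1)) *
        ENNReal.ofReal ((s ^ (n + 1 + 1))⁻¹)) = β (q y) * ENNReal.ofReal (q y ^ (n + 1)) *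
        (Set.Ici (p y)).indicator (fun s => ENNReal.ofReal ((s ^ (n + 1 + 1))⁻¹)) s := by
      intro s
      by_cases h : p y ≤ s <;> simp [hχ, Set.indicator, h]
    simp only [e1]
    rw [lintegral_const_mul _ (Measurable.indicator (by fun_prop) measurableSet_Ici),
      lintegral_indicator measurableSet_Ici, Measure.restrict_restrict measurableSet_Ici,
      Set.inter_eq_left.2 (show Set.Ici (p y) ⊆ Set.Ioi 0 from fun s hs => hpy.trans_le hs),
      lintegral_Ici_inv_pow (Nat.succ_pos n) hpy, mul_assoc, mul_div_assoc,
      ← ENNReal.ofReal_mul (by positivity), ← ENNReal.ofReal_natCast,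
      ← ENNReal.ofReal_div_of_pos (by positivity)]
    congr 2
    rw [div_pow]; field_simp
  rw [Nat.add_sub_cancel, step1, step2, step3, ← lintegral_mul_const _ (by fun_prop)]
  refine lintegral_congr fun y => ?_
  rw [ENNReal.div_mul_cancel (by simp) (by finiteness)]

end Waist

namespace Waist
open scoped ENNReal

/-- The density on `ℝᵐ` of the cone measure in gnomonic coordinates. -/
noncomputable def kern (n : ℕ) (x : ℝ) : ℝ≥0∞ := ENNReal.ofReal ((√(1 + x ^ 2))⁻¹ ^ n)

@[fun_prop]
theorem measurable_kern (n : ℕ) : Measurable (kern n) := by unfold kern; fun_prop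

theorem sqrt_one_add_norm_sq_le {E : Type*} [NormedAddCommGroup E] (u w : E) :
    √(1 + ‖u‖ ^ 2) ≤ √(1 + ‖w‖ ^ 2) + ‖u - w‖ := by
  have h1 := norm_nonneg u
  have h2 := norm_nonneg w
  have h3 := norm_nonneg (u - w)
  have h4 : ‖u‖ ≤ ‖w‖ + ‖u - w‖ := by
    have := norm_add_le w (u - w)
    rwa [add_sub_cancel] at this
  have h5 : ‖w‖ ≤ √(1 + ‖w‖ ^ 2) := Real.le_sqrt_of_sq_le (by linarith)
  have h6 : 0 ≤ 1 + ‖w‖ ^ 2 := by positivity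
  refine Real.sqrt_le_iff.2 ⟨by positivity, ?_⟩
  have h7 := Real.sq_sqrt h6
  nlinarith [mul_le_mul_of_nonneg_right h5 h3, mul_self_le_mul_self h1 h4]

theorem kern_compare {E : Type*} [NormedAddCommGroup E] (n : ℕ) {u w : E} {a : ℝ} (ha : 0 ≤ a)
    (ha' : a < 1 / 2) (h : ‖u - w‖ ≤ a * (1 + ‖u‖)) :
    ENNReal.ofReal ((1 - 2 * a) ^ n) * kern n ‖w‖ ≤ kern n ‖u‖ ∧
      kern n ‖u‖ ≤ ENNReal.ofReal ((1 + 2 * a) ^ n) * kern n ‖w‖ := by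
  have pu : 0 < √(1 + ‖u‖ ^ 2) := by positivity
  have pw : 0 < √(1 + ‖w‖ ^ 2) := by positivity
  have h1 : 1 ≤ √(1 + ‖u‖ ^ 2) := Real.le_sqrt_of_sq_le (by nlinarith [norm_nonneg u])
  have h2 : ‖u‖ ≤ √(1 + ‖u‖ ^ 2) := Real.le_sqrt_of_sq_le (by linarith)
  have h3 : ‖u - w‖ ≤ 2 * a * √(1 + ‖u‖ ^ 2) := by nlinarith
  have h4 := sqrt_one_add_norm_sq_le u w
  have h5 := sqrt_one_add_norm_sq_le w u
  rw [norm_sub_rev] at h5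
  have h6 : 0 < 1 - 2 * a := by linarith
  unfold kern
  rw [← ENNReal.ofReal_mul (by positivity), ← ENNReal.ofReal_mul (by positivity), ← mul_pow,
    ← mul_pow]
  constructor
  · gcongr
    rw [← div_eq_mul_inv, div_le_iff₀ pw, inv_mul_eq_div, le_div_iff₀ pu]
    linarith
  · gcongr
    rw [← div_eq_mul_inv, le_div_iff₀ pw, inv_mul_eq_div, div_le_iff₀ pu]
    linarith

/-- The volume of a slice of the ellipsoid `(s - L)² + L²‖w‖² ≤ q²`. -/
noncomputable def slice (m : ℕ) (L q s : ℝ) : ℝ≥0∞ :=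
  volume {w : EuclideanSpace ℝ (Fin m) | (s - L) ^ 2 + ‖L • w‖ ^ 2 ≤ q ^ 2}

/-- A radial moment of the ellipsoid `(s - L)² + L²‖w‖² ≤ q²`. -/
noncomputable def moment (n m : ℕ) (L q : ℝ) : ℝ≥0∞ :=
  ∫⁻ s in Set.Ioi 0, slice m L q s * ENNReal.ofReal (s ^ (n - 1))

@[fun_prop]
theorem measurable_slice (m : ℕ) (L q : ℝ) : Measurable (slice m L q) := by
  have hS : MeasurableSet {p : ℝ × EuclideanSpace ℝ (Fin m) |
      (p.1 - L) ^ 2 + ‖L • p.2‖ ^ 2 ≤ q ^ 2} :=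
    measurableSet_le (by fun_prop) measurable_const
  exact measurable_measure_prodMk_left hS

theorem slice_eq_zero {m : ℕ} {L q s : ℝ} (hq : 0 ≤ q) (h : q < |s - L|) : slice m L q s = 0 := by
  have : {w : EuclideanSpace ℝ (Fin m) | (s - L) ^ 2 + ‖L • w‖ ^ 2 ≤ q ^ 2} = ∅ := by
    ext w
    simp only [Set.mem_ofPred_eq, Set.mem_empty_iff_false, iff_false, not_le]
    nlinarith [sq_nonneg ‖L • w‖, sq_abs (s - L)]
  rw [slice, this, measure_empty]

theorem lintegral_slice (m : ℕ) {L q : ℝ} :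
    ∫⁻ s, slice m L q s = volume {p : ℝ × EuclideanSpace ℝ (Fin m) |
      p.1 ^ 2 + ‖L • p.2‖ ^ 2 ≤ q ^ 2} := by
  have hS : MeasurableSet {p : ℝ × EuclideanSpace ℝ (Fin m) |
      p.1 ^ 2 + ‖L • p.2‖ ^ 2 ≤ q ^ 2} :=
    measurableSet_le (by fun_prop) measurable_const
  rw [Measure.volume_eq_prod, Measure.prod_apply hS]
  exact lintegral_sub_right_eq_self (μ := volume) (fun s => volume {w : EuclideanSpace ℝ (Fin m) |
      s ^ 2 + ‖L • w‖ ^ 2 ≤ q ^ 2}) L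

theorem volume_ellipsoid_smul (m : ℕ) {L q l : ℝ} (hl : 0 < l) :
    volume {p : ℝ × EuclideanSpace ℝ (Fin m) | p.1 ^ 2 + ‖L • p.2‖ ^ 2 ≤ (l * q) ^ 2} =
      ENNReal.ofReal (l ^ (m + 1)) * volume {p : ℝ × EuclideanSpace ℝ (Fin m) |
        p.1 ^ 2 + ‖L • p.2‖ ^ 2 ≤ q ^ 2} := by
  have h := Measure.addHaar_smul
    ((volume : Measure ℝ).prod (volume : Measure (EuclideanSpace ℝ (Fin m)))) l
    {p | p.1 ^ 2 + ‖L • p.2‖ ^ 2 ≤ q ^ 2}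
  rw [Module.finrank_prod, Module.finrank_self, finrank_euclideanSpace_fin,
    abs_of_pos (by positivity), add_comm 1 m] at h
  rw [Measure.volume_eq_prod, ← h]
  congr 1
  ext p
  rw [Set.mem_smul_set_iff_inv_smul_mem₀ hl.ne']
  simp only [Set.mem_ofPred_eq, Prod.smul_fst, Prod.smul_snd, smul_comm L, norm_smul _ (L • p.2),
    norm_inv, Real.norm_of_nonneg hl.le, smul_eq_mul]
  rw [mul_pow, mul_pow, mul_pow, inv_pow, ← mul_add, inv_mul_le_iff₀ (by positivity)]

theorem moment_scale {n m : ℕ} {L r l : ℝ} (hr : 0 < r) (hL : r < L) (hl : 0 < l) (hl1 : l ≤ 1) :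
    ENNReal.ofReal ((L - r) ^ (n - 1) * l ^ (m + 1)) * moment n m L r ≤
      ENNReal.ofReal ((L + r) ^ (n - 1)) * moment n m L (l * r) := by
  have hlr : l * r ≤ r := by nlinarith
  have h1 : moment n m L r ≤ ENNReal.ofReal ((L + r) ^ (n - 1)) * ∫⁻ s, slice m L r s := by
    rw [← lintegral_const_mul _ (by fun_prop)]
    refine le_trans (lintegral_mono fun s => ?_) (setLIntegral_le_lintegral _ _)
    rcases lt_or_ge r |s - L| with h | h
    · simp [slice_eq_zero hr.le h]
    · rw [mul_comm]
      have h3 := abs_le.1 h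
      have h4 : 0 ≤ s := by linarith
      gcongr; linarith
  have h2 : ENNReal.ofReal ((L - r) ^ (n - 1)) * (∫⁻ s, slice m L (l * r) s) ≤
      moment n m L (l * r) := by
    rw [← lintegral_const_mul _ (by fun_prop), moment, ← lintegral_indicator measurableSet_Ioi]
    refine lintegral_mono fun s => ?_
    rcases lt_or_ge (l * r) |s - L| with h | h
    · simp [slice_eq_zero (by positivity) h]
    · have h3 := abs_le.1 h
      have h4 : L - r ≤ s := by linarith
      rw [Set.indicator_of_mem (by simp; linarith), mul_comm]
      have : 0 ≤ L - r := by linarith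
      gcongr
  have h5 : ∫⁻ s, slice m L (l * r) s = ENNReal.ofReal (l ^ (m + 1)) * ∫⁻ s, slice m L r s := by
    rw [lintegral_slice, lintegral_slice, volume_ellipsoid_smul m hl]
  have hp : 0 ≤ (L - r) ^ (n - 1) := pow_nonneg (by linarith) _
  rw [h5] at h2
  rw [ENNReal.ofReal_mul hp]
  calc _ ≤ ENNReal.ofReal ((L - r) ^ (n - 1)) * ENNReal.ofReal (l ^ (m + 1)) *
        (ENNReal.ofReal ((L + r) ^ (n - 1)) * ∫⁻ s, slice m L r s) := by gcongr
    _ = ENNReal.ofReal ((L + r) ^ (n - 1)) * (ENNReal.ofReal ((L - r) ^ (n - 1)) *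
        (ENNReal.ofReal (l ^ (m + 1)) * ∫⁻ s, slice m L r s)) := by ring
    _ ≤ _ := by gcongr

theorem moment_pos {n m : ℕ} {L r : ℝ} (hr : 0 < r) (hL : r < L) : moment n m L r ≠ 0 := by
  have hS : 0 < volume {p : ℝ × EuclideanSpace ℝ (Fin m) |
      p.1 ^ 2 + ‖L • p.2‖ ^ 2 ≤ r ^ 2} := by
    refine lt_of_lt_of_le ?_ (measure_mono (s := {p : ℝ × EuclideanSpace ℝ (Fin m) |
      p.1 ^ 2 + ‖L • p.2‖ ^ 2 < r ^ 2}) fun p hp => le_of_lt hp)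
    refine IsOpen.measure_pos _ (isOpen_lt (by fun_prop) (by fun_prop)) ⟨0, ?_⟩
    simp; positivity
  intro h0
  rw [← lintegral_slice] at hS
  rw [moment, lintegral_eq_zero_iff (by fun_prop)] at h0
  have h1 : ∀ᵐ s, slice m L r s = 0 := by
    have h2 := (ae_restrict_iff' measurableSet_Ioi).1 h0
    filter_upwards [h2] with s hs
    by_cases h3 : 0 < s
    · have := hs h3
      simp only [Pi.zero_apply, mul_eq_zero, ENNReal.ofReal_eq_zero] at this
      exact this.resolve_right (not_le.2 (by positivity))
    · refine slice_eq_zero hr.le ?_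
      rw [lt_abs]; right; push Not at h3; linarith
  rw [lintegral_congr_ae h1, lintegral_zero] at hS
  exact lt_irrefl _ hS

theorem moment_ne_top {n m : ℕ} {L r : ℝ} (hr : 0 < r) (hL : r < L) : moment n m L r ≠ ⊤ := by
  have h1 : moment n m L r ≤ ∫⁻ s in Set.Icc 0 (L + r), slice m L r s *
      ENNReal.ofReal ((L + r) ^ (n - 1)) := by
    rw [moment, ← lintegral_indicator measurableSet_Ioi, ← lintegral_indicator measurableSet_Icc]
    refine lintegral_mono fun s => ?_
    rcases lt_or_ge r |s - L| with h | h
    · simp only [Set.indicator, slice_eq_zero hr.le h]; simp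
    · have h3 := abs_le.1 h
      rw [Set.indicator_of_mem (by simp; linarith), Set.indicator_of_mem (by
        constructor <;> linarith)]
      have : 0 ≤ s := by linarith
      gcongr; linarith
  have hL0 : 0 < L := hr.trans hL
  have h2 : ∀ s, slice m L r s ≤ volume (Metric.closedBall (0 : EuclideanSpace ℝ (Fin m)) (r / L)) := by
    intro s
    refine measure_mono fun w hw => ?_
    rw [mem_closedBall_zero_iff, le_div_iff₀ hL0]
    have : ‖L • w‖ ^ 2 ≤ r ^ 2 := by
      have : (s - L) ^ 2 + ‖L • w‖ ^ 2 ≤ r ^ 2 := hw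
      nlinarith [sq_nonneg (s - L)]
    have := abs_le_of_sq_le_sq this hr.le
    rw [norm_smul, Real.norm_of_nonneg hL0.le] at this
    linarith [le_abs_self (L * ‖w‖)]
  refine ne_top_of_le_ne_top ?_ (h1.trans (lintegral_mono fun s => mul_le_mul_left (h2 s) _))
  rw [lintegral_const]
  have := measure_closedBall_lt_top (x := (0 : EuclideanSpace ℝ (Fin m))) (r := r / L) (μ := volume)
  have h4 : volume (Metric.closedBall (0 : EuclideanSpace ℝ (Fin m)) (r / L)) ≠ ⊤ := this.ne
  finiteness

end Waist

namespace Waist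
open scoped ENNReal

variable {n m : ℕ} {K : Set (EuclideanSpace ℝ (Fin n))} {r L : ℝ}

theorem measurable_volume_inter_closedBall {Z : Type*} [MeasurableSpace Z]
    {g : Z → EuclideanSpace ℝ (Fin n)} (hg : Measurable g) (K : Set (EuclideanSpace ℝ (Fin n)))
    (r : ℝ) : Measurable fun z => volume (K ∩ Metric.closedBall (g z) r) := by
  have h2 : MeasurableSet {p : Z × EuclideanSpace ℝ (Fin n) | dist p.2 (g p.1) ≤ r} :=
    measurableSet_le (by fun_prop) measurable_const
  have h3 := measurable_measure_prodMk_left (ν := (volume : Measure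
    (EuclideanSpace ℝ (Fin n))).restrict K) h2
  have h4 : (fun z => volume (K ∩ Metric.closedBall (g z) r)) = fun z =>
      volume.restrict K (Prod.mk z ⁻¹' {p | dist p.2 (g p.1) ≤ r}) := by
    ext z
    rw [Measure.restrict_apply (measurable_prodMk_left h2), Set.inter_comm]
    rfl
  rw [h4]
  exact h3

namespace Frame
variable (T : Frame n m)

/-- The norm of the component in the span of the frame. -/
noncomputable def p (y : EuclideanSpace ℝ (Fin n)) : ℝ := √(T.t y ^ 2 + ‖T.π y‖ ^ 2)

@[fun_prop]
theorem continuous_p : Continuous T.p := by unfold p; fun_prop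

theorem kern_π {y : EuclideanSpace ℝ (Fin n)} (h : 0 < T.t y) :
    kern n ‖(T.t y)⁻¹ • T.π y‖ = ENNReal.ofReal ((T.t y / T.p y) ^ n) := by
  have hp : 0 < T.p y := Real.sqrt_pos.2 (by positivity)
  have : √(1 + ‖(T.t y)⁻¹ • T.π y‖ ^ 2) = T.p y / T.t y := by
    rw [norm_smul, norm_inv, Real.norm_of_nonneg h.le, p, eq_div_iff h.ne']
    rw [← Real.sqrt_sq h.le, ← Real.sqrt_mul (by positivity), Real.sqrt_sq h.le]
    congr 1
    field_simp
  rw [kern, this, inv_div]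

theorem p_sq (y : EuclideanSpace ℝ (Fin n)) : T.p y ^ 2 = T.t y ^ 2 + ‖T.π y‖ ^ 2 :=
  Real.sq_sqrt (by positivity)

theorem p_nonneg (y : EuclideanSpace ℝ (Fin n)) : 0 ≤ T.p y := Real.sqrt_nonneg _

theorem t_smul (s : ℝ) (y : EuclideanSpace ℝ (Fin n)) : T.t (s • y) = s * T.t y := by
  simp [t, real_inner_smul_right]

theorem p_smul {s : ℝ} (hs : 0 < s) (y : EuclideanSpace ℝ (Fin n)) : T.p (s • y) = s * T.p y := by
  rw [p, p, T.t_smul, map_smul, norm_smul, Real.norm_of_nonneg hs.le, mul_pow, mul_pow, ← mul_add,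
    Real.sqrt_mul (by positivity), Real.sqrt_sq hs.le]

/-- The part of `K` of slope at most `ρ` with respect to the frame. -/
def wedge (K : Set (EuclideanSpace ℝ (Fin n))) (ρ : ℝ) : Set (EuclideanSpace ℝ (Fin n)) :=
  {y | y ∈ K ∧ 0 < T.t y ∧ ‖T.π y‖ ≤ ρ * T.t y}

theorem measurableSet_wedge (hK : IsClosedCone K) (ρ : ℝ) : MeasurableSet (T.wedge K ρ) :=
  hK.isClosed.measurableSet.inter ((isOpen_lt continuous_const T.continuous_t).measurableSet.inter
    (isClosed_le T.continuous_π.norm (T.continuous_t.const_mul ρ)).measurableSet)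

theorem smul_mem_wedge (hK : IsClosedCone K) (ρ : ℝ) {s : ℝ} (hs : 0 < s)
    (y : EuclideanSpace ℝ (Fin n)) : s • y ∈ T.wedge K ρ ↔ y ∈ T.wedge K ρ := by
  have aux : ∀ s : ℝ, 0 < s → ∀ y, y ∈ T.wedge K ρ → s • y ∈ T.wedge K ρ := by
    rintro s hs y ⟨h1, h2, h3⟩
    refine ⟨hK.smul_mem hs.le h1, ?_, ?_⟩
    · rw [T.t_smul]; positivity
    · rw [T.t_smul, map_smul, norm_smul, Real.norm_of_nonneg hs.le]
      nlinarith
  refine ⟨fun h => ?_, aux s hs y⟩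
  have := aux s⁻¹ (by positivity) _ h
  rwa [smul_smul, inv_mul_cancel₀ hs.ne', one_smul] at this

theorem moment_mul_volume (hn : 0 < n) (hK : IsClosedCone K) (ρ q : ℝ) :
    moment n m L q * volume (T.wedge K ρ ∩ {y | T.p y ≤ 1}) * n =
      ∫⁻ y in T.wedge K ρ, slice m L q (T.t y) * ENNReal.ofReal ((T.t y / T.p y) ^ n) := by
  refine lintegral_cone_homogeneous hn (T.measurableSet_wedge hK ρ)
    (fun s hs y => T.smul_mem_wedge hK ρ hs y) T.continuous_p.measurable
    T.continuous_t.measurable (fun y hy => Real.sqrt_pos.2 ?_) (fun y hy => hy.2.1)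
    (fun s hs y => T.p_smul hs y) (fun s _ y => T.t_smul s y) (by fun_prop)
  have := hy.2.1
  positivity

theorem volume_eq_slice (hL : 0 < L) (q : ℝ) (y : EuclideanSpace ℝ (Fin n)) :
    volume {w | (T.t y - L) ^ 2 + ‖T.π y - L • w‖ ^ 2 ≤ q ^ 2} = slice m L q (T.t y) := by
  have h := (Measure.measurePreserving_sub_left (volume : Measure (EuclideanSpace ℝ (Fin m)))
    (L⁻¹ • T.π y)).measure_preimage_equiv (f := MeasurableEquiv.subLeft (L⁻¹ • T.π y))
    {w | (T.t y - L) ^ 2 + ‖L • w‖ ^ 2 ≤ q ^ 2}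
  rw [slice, ← h]
  congr 1
  ext w
  change _ ↔ (T.t y - L) ^ 2 + ‖L • (L⁻¹ • T.π y - w)‖ ^ 2 ≤ q ^ 2
  simp [smul_sub, smul_smul, hL.ne']

/-- The weighted integral of the local volumes of `K` along a ball of directions. -/
noncomputable def avg (K : Set (EuclideanSpace ℝ (Fin n))) (L r ρ : ℝ) : ℝ≥0∞ :=
  ∫⁻ w in Metric.closedBall 0 ρ, kern n ‖w‖ *
    volume (K ∩ Metric.closedBall (L • T.e + T.ι (L • w)) r)

theorem avg_eq (K : Set (EuclideanSpace ℝ (Fin n))) (L r ρ : ℝ) : T.avg K L r ρ =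
    ∫⁻ y in K, ∫⁻ w in {w | dist y (L • T.e + T.ι (L • w)) ≤ r} ∩ Metric.closedBall 0 ρ,
      kern n ‖w‖ := by
  have hg : Continuous fun w => L • T.e + T.ι (L • w) := by
    have := T.ι.continuous
    fun_prop
  have h := lintegral_volume_inter_closedBall
    (((volume : Measure (EuclideanSpace ℝ (Fin m))).restrict (Metric.closedBall 0 ρ)).withDensity
      fun w => kern n ‖w‖) hg.measurable K r
  have hm : ∀ y, MeasurableSet {w | dist y (L • T.e + T.ι (L • w)) ≤ r} := fun y =>
    measurableSet_le (by have := hg.measurable; fun_prop) measurable_const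
  have hf := measurable_volume_inter_closedBall hg.measurable K r
  rw [lintegral_withDensity_eq_lintegral_mul _ (by fun_prop) hf] at h
  refine Eq.trans ?_ (h.trans ?_)
  · rfl
  · refine lintegral_congr fun y => ?_
    rw [withDensity_apply _ (hm y), Measure.restrict_restrict (hm y)]

theorem dist_le_iff (hr : 0 ≤ r) (y : EuclideanSpace ℝ (Fin n)) (w : EuclideanSpace ℝ (Fin m)) :
    dist y (L • T.e + T.ι (L • w)) ≤ r ↔
      (T.t y - L) ^ 2 + ‖T.π y - L • w‖ ^ 2 + ‖T.rem y‖ ^ 2 ≤ r ^ 2 := by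
  rw [← T.norm_sub_sq, dist_eq_norm, ← sub_sub]
  exact (sq_le_sq₀ (norm_nonneg _) hr).symm

theorem slope_close {y : EuclideanSpace ℝ (Fin n)} {w : EuclideanSpace ℝ (Fin m)} (hL : 0 < L)
    (hr : 0 ≤ r) (ht : 0 < T.t y)
    (h : (T.t y - L) ^ 2 + ‖T.π y - L • w‖ ^ 2 ≤ r ^ 2) :
    ‖(T.t y)⁻¹ • T.π y - w‖ ≤ r / L * (1 + ‖(T.t y)⁻¹ • T.π y‖) := by
  set u := (T.t y)⁻¹ • T.π y with hu
  have hπ : T.π y = T.t y • u := by rw [hu, smul_smul, mul_inv_cancel₀ ht.ne', one_smul]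
  have h1 := abs_le_of_sq_le_sq (a := T.t y - L) (by nlinarith [sq_nonneg ‖T.π y - L • w‖]) hr
  have h2 : ‖T.π y - L • w‖ ≤ r :=
    abs_le_of_sq_le_sq' (by nlinarith [sq_nonneg (T.t y - L)]) hr |>.2
  have h3 : L • (u - w) = (T.π y - L • w) - (T.t y - L) • u := by rw [hπ]; module
  have h4 : L * ‖u - w‖ ≤ r + r * ‖u‖ := by
    rw [← Real.norm_of_nonneg hL.le, ← norm_smul, h3]
    refine (norm_sub_le _ _).trans ?_
    rw [norm_smul]
    gcongr
    exact h1
  rw [div_mul_eq_mul_div, le_div_iff₀ hL]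
  linarith

theorem avg_le (hn : 0 < n) (hK : IsClosedCone K) (hr : 0 < r) (hrL : r / L < 1 / 2) (hL : 0 < L)
    {ρ ρ' : ℝ} (hρ : ρ * L + r ≤ ρ' * (L - r)) (hρ0 : 0 ≤ ρ') :
    ENNReal.ofReal ((1 - 2 * (r / L)) ^ n) * T.avg K L r ρ ≤
      moment n m L r * volume (T.wedge K ρ' ∩ {y | T.p y ≤ 1}) * n := by
  have hrL' : r < L / 2 := by rw [div_lt_iff₀ hL] at hrL; linarith
  rw [T.moment_mul_volume hn hK, T.avg_eq, ← lintegral_const_mul' _ _ (by simp),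
    ← lintegral_indicator hK.isClosed.measurableSet,
    ← lintegral_indicator (T.measurableSet_wedge hK ρ')]
  refine lintegral_mono fun y => ?_
  by_cases hy : y ∈ T.wedge K ρ'
  · rw [Set.indicator_of_mem hy, Set.indicator_of_mem hy.1, ← T.kern_π hy.2.1,
      ← T.volume_eq_slice hL, ← lintegral_const_mul' _ _ (by simp), mul_comm (volume _),
      ← setLIntegral_const]
    set D := {w | (T.t y - L) ^ 2 + ‖T.π y - L • w‖ ^ 2 ≤ r ^ 2}
    have hD : MeasurableSet D := measurableSet_le (by fun_prop) (by fun_prop)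
    have hsub : {w | dist y (L • T.e + T.ι (L • w)) ≤ r} ∩ Metric.closedBall 0 ρ ⊆ D := by
      rintro w ⟨hw, -⟩
      have hw := (T.dist_le_iff hr.le y w).1 hw
      change (T.t y - L) ^ 2 + ‖T.π y - L • w‖ ^ 2 ≤ r ^ 2
      nlinarith [sq_nonneg ‖T.rem y‖]
    refine (lintegral_mono_set hsub).trans (setLIntegral_mono' hD fun w hw => ?_)
    exact (kern_compare n (by positivity) hrL (T.slope_close hL hr.le hy.2.1 hw)).1
  · rw [Set.indicator_of_notMem hy]
    by_cases hyK : y ∈ K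
    · rw [Set.indicator_of_mem hyK]
      have : {w | dist y (L • T.e + T.ι (L • w)) ≤ r} ∩ Metric.closedBall 0 ρ = ∅ := by
        by_contra hne
        obtain ⟨w, hw, hwρ⟩ := Set.nonempty_iff_ne_empty.2 hne
        have hw := (T.dist_le_iff hr.le y w).1 hw
        rw [mem_closedBall_zero_iff] at hwρ
        have h1 := abs_le_of_sq_le_sq' (a := T.t y - L)
          (by nlinarith [sq_nonneg ‖T.π y - L • w‖, sq_nonneg ‖T.rem y‖]) hr.le
        have h2 : ‖T.π y - L • w‖ ≤ r := abs_le_of_sq_le_sq'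
          (by nlinarith [sq_nonneg (T.t y - L), sq_nonneg ‖T.rem y‖]) hr.le |>.2
        refine hy ⟨hyK, by linarith, ?_⟩
        have h3 : ‖T.π y‖ ≤ r + ‖L • w‖ := by
          have := norm_add_le (T.π y - L • w) (L • w)
          rw [sub_add_cancel] at this
          linarith
        rw [norm_smul, Real.norm_of_nonneg hL.le] at h3
        nlinarith
      rw [this]; simp
    · rw [Set.indicator_of_notMem hyK]

theorem le_avg (hn : 0 < n) (hK : IsClosedCone K) (hr : 0 < r) (hrL : r / L < 1 / 2) (hL : 0 < L)
    (hL1 : L ≤ 1) {δ l ρ ρ' : ℝ} (hδ0 : 0 ≤ δ) (hδ1 : δ ≤ 1 / 2) (hT : T.IsThin K δ)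
    (hl : 0 < l) (hl1 : l ≤ 1)
    (hρ0 : 0 ≤ ρ) (hlδ : (l * r) ^ 2 + (δ * (4 * (1 + ρ))) ^ 2 ≤ r ^ 2)
    (hρ : ρ * (L + r) + r ≤ ρ' * L) :
    moment n m L (l * r) * volume (T.wedge K ρ ∩ {y | T.p y ≤ 1}) * n ≤
      ENNReal.ofReal ((1 + 2 * (r / L)) ^ n) * T.avg K L r ρ' := by
  have hrL' : r < L / 2 := by rw [div_lt_iff₀ hL] at hrL; linarith
  have hlr : l * r ≤ r := by nlinarith
  rw [T.moment_mul_volume hn hK, T.avg_eq, ← lintegral_const_mul' _ _ (by simp),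
    ← lintegral_indicator hK.isClosed.measurableSet,
    ← lintegral_indicator (T.measurableSet_wedge hK ρ)]
  refine lintegral_mono fun y => ?_
  by_cases hy : y ∈ T.wedge K ρ
  · rw [Set.indicator_of_mem hy, Set.indicator_of_mem hy.1, ← T.kern_π hy.2.1,
      ← T.volume_eq_slice hL, ← lintegral_const_mul' _ _ (by simp), mul_comm (volume _),
      ← setLIntegral_const]
    set D := {w | (T.t y - L) ^ 2 + ‖T.π y - L • w‖ ^ 2 ≤ (l * r) ^ 2}
    have hD : MeasurableSet D := measurableSet_le (by fun_prop) (by fun_prop)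
    have hsub : D ⊆ {w | dist y (L • T.e + T.ι (L • w)) ≤ r} ∩ Metric.closedBall 0 ρ' := by
      intro w hw
      have hw : (T.t y - L) ^ 2 + ‖T.π y - L • w‖ ^ 2 ≤ (l * r) ^ 2 := hw
      have hlr0 : 0 ≤ l * r := by positivity
      have h1 := abs_le_of_sq_le_sq' (a := T.t y - L)
          (by nlinarith [sq_nonneg ‖T.π y - L • w‖]) hlr0
      have h2 : ‖T.π y - L • w‖ ≤ l * r := abs_le_of_sq_le_sq'
          (by nlinarith [sq_nonneg (T.t y - L)]) hlr0 |>.2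
      have h3 : ‖T.π y‖ ≤ ρ * T.t y := hy.2.2
      have h4 : T.t y ≤ L + r := by linarith
      have h8 : ‖T.rem y‖ ≤ δ * (4 * (1 + ρ)) := by
        have h5 := hT y hy.1
        have h6 : ‖y‖ ≤ T.t y + ‖T.π y‖ + ‖T.rem y‖ := by
          have := T.norm_sq y
          refine abs_le_of_sq_le_sq' ?_ (by have := hy.2.1; positivity) |>.2
          have a1 := hy.2.1
          have a2 := norm_nonneg (T.π y)
          have a3 := norm_nonneg (T.rem y)
          nlinarith [mul_nonneg a1.le a2, mul_nonneg a1.le a3, mul_nonneg a2 a3]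
        have h7 : ‖y‖ ≤ 4 * (1 + ρ) := by
          have : ρ * T.t y ≤ ρ * (3 / 2) := by gcongr; linarith
          nlinarith [norm_nonneg y]
        exact h5.trans (by gcongr)
      refine ⟨(T.dist_le_iff hr.le y w).2 ?_, ?_⟩
      · have : ‖T.rem y‖ ^ 2 ≤ (δ * (4 * (1 + ρ))) ^ 2 := by gcongr
        linarith
      · rw [mem_closedBall_zero_iff]
        have h9 : ‖L • w‖ ≤ ‖T.π y‖ + ‖T.π y - L • w‖ := by
          have := norm_sub_le (T.π y) (T.π y - L • w)
          rwa [sub_sub_cancel] at this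
        rw [norm_smul, Real.norm_of_nonneg hL.le] at h9
        have : ρ * T.t y ≤ ρ * (L + r) := by gcongr
        refine le_of_mul_le_mul_right ?_ hL
        nlinarith
    refine le_trans (setLIntegral_mono' hD fun w hw => ?_) (lintegral_mono_set hsub)
    refine (kern_compare n (by positivity) hrL (T.slope_close hL hr.le hy.2.1 ?_)).2
    exact le_trans hw (by gcongr)
  · rw [Set.indicator_of_notMem hy]
    exact zero_le

end Frame
end Waist

namespace Waist
open scoped ENNReal

variable {n m : ℕ} {K : Set (EuclideanSpace ℝ (Fin n))} {r L : ℝ}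

theorem IsClosedCone.mul_volume_slab_le (hK : IsClosedCone K) {e : EuclideanSpace ℝ (Fin n)}
    (he : e ∈ K) (he1 : ‖e‖ = 1) (hpos : ∀ y ∈ K, 0 ≤ ⟪e, y⟫) {N : ℕ} (hN : 0 < N) :
    N * volume (K ∩ Metric.closedBall 0 1 ∩ {y | ⟪e, y⟫ ≤ 1 / (2 * N)}) ≤
      ENNReal.ofReal (2 ^ n) * volume (K ∩ Metric.closedBall 0 1) := by
  have hN' : (0 : ℝ) < N := by exact_mod_cast hN
  set S := K ∩ Metric.closedBall 0 1 ∩ {y | ⟪e, y⟫ ≤ 1 / (2 * N)} with hS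
  have hSm : MeasurableSet S :=
    ((hK.isClosed.inter Metric.isClosed_closedBall).inter
      (isClosed_le (by fun_prop) continuous_const)).measurableSet
  rw [← hK.volume_inter_smul_ball (by norm_num : (0 : ℝ) < 2)]
  set S' : ℕ → Set (EuclideanSpace ℝ (Fin n)) := fun j => (fun y => -((j / N : ℝ) • e) + y) ⁻¹' S
  have hin : ∀ j y, y ∈ S' j → (j / N : ℝ) ≤ ⟪e, y⟫ ∧ ⟪e, y⟫ ≤ (j / N : ℝ) + 1 / (2 * N) := by
    intro j y hy
    have h1 := hpos _ hy.1.1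
    have h2 : ⟪e, -((j / N : ℝ) • e) + y⟫ ≤ 1 / (2 * N) := hy.2
    rw [inner_add_right, inner_neg_right, real_inner_smul_right, real_inner_self_eq_norm_sq,
      he1] at h1 h2
    constructor <;> linarith
  have hdisj : Set.PairwiseDisjoint (↑(Finset.range N)) S' := by
    have key : ∀ j k : ℕ, j < k → Disjoint (S' j) (S' k) := by
      intro j k hjk
      rw [Set.disjoint_left]
      intro y hj hk
      have h1 := (hin j y hj).2
      have h2 := (hin k y hk).1
      have h3 : (j : ℝ) + 1 ≤ k := by exact_mod_cast hjk
      have h4 : ((j : ℝ) + 1) / N ≤ k / N := by gcongr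
      have h5 : 1 / (2 * N : ℝ) < 1 / N := by
        apply one_div_lt_one_div_of_lt hN'; linarith
      rw [add_div] at h4
      linarith
    intro j _ k _ hjk
    rcases lt_or_gt_of_ne hjk with h | h
    · exact key j k h
    · exact (key k j h).symm
  have hsum := measure_biUnion_finset (μ := volume) hdisj
    (fun j _ => (measurable_const_add _) hSm)
  have heq : ∀ j ∈ Finset.range N, volume (S' j) = volume S := fun j _ =>
    measure_preimage_add volume _ S
  rw [Finset.sum_congr rfl heq, Finset.sum_const, Finset.card_range, nsmul_eq_mul] at hsum
  rw [← hsum]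
  refine measure_mono fun y hy => ?_
  simp only [Set.mem_iUnion, Finset.mem_range] at hy
  obtain ⟨j, hj, hy⟩ := hy
  have h0 : (0 : ℝ) ≤ j / N := by positivity
  have h1 : (j / N : ℝ) ≤ 1 := by
    rw [div_le_one hN']; exact_mod_cast hj.le
  have hyK := hK.add_mem (hK.smul_mem h0 he) hy.1.1
  rw [add_neg_cancel_left] at hyK
  refine ⟨hyK, ?_⟩
  have h2 := hy.1.2
  rw [mem_closedBall_zero_iff] at h2 ⊢
  have h3 := norm_add_le ((j / N : ℝ) • e) (-((j / N : ℝ) • e) + y)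
  rw [add_neg_cancel_left, norm_smul, he1, Real.norm_of_nonneg h0] at h3
  linarith

/-- The mass of a ball for the cone measure in gnomonic coordinates. -/
noncomputable def gnom (n m : ℕ) (ρ : ℝ) : ℝ≥0∞ :=
  ∫⁻ w in Metric.closedBall (0 : EuclideanSpace ℝ (Fin m)) ρ, kern n ‖w‖

/-- The total mass of the cone measure in gnomonic coordinates. -/
noncomputable def gnomTotal (n m : ℕ) : ℝ≥0∞ := ∫⁻ w : EuclideanSpace ℝ (Fin m), kern n ‖w‖

/-- The circular cone of slope `ρ` around `e`. -/
def cap (ρ : ℝ) (e : EuclideanSpace ℝ (Fin n)) : Set (EuclideanSpace ℝ (Fin n)) :=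
  {y | ‖y - ⟪e, y⟫ • e‖ ≤ ρ * ⟪e, y⟫}

theorem isClosedCone_cap (ρ : ℝ) (e : EuclideanSpace ℝ (Fin n)) : IsClosedCone (cap ρ e) where
  isClosed := isClosed_le (by fun_prop) (by fun_prop)
  add_mem := by
    intro x y hx hy
    change ‖x + y - ⟪e, x + y⟫ • e‖ ≤ ρ * ⟪e, x + y⟫
    rw [inner_add_right, show x + y - (⟪e, x⟫ + ⟪e, y⟫) • e =
      (x - ⟪e, x⟫ • e) + (y - ⟪e, y⟫ • e) by module, mul_add]
    exact (norm_add_le _ _).trans (add_le_add hx hy)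
  smul_mem := by
    intro a x ha hx
    change ‖a • x - ⟪e, a • x⟫ • e‖ ≤ ρ * ⟪e, a • x⟫
    rw [real_inner_smul_right, show a • x - (a * ⟪e, x⟫) • e = a • (x - ⟪e, x⟫ • e) by module,
      norm_smul, Real.norm_of_nonneg ha, mul_left_comm]
    exact mul_le_mul_of_nonneg_left hx ha

theorem IsClosedCone.inter {K' : Set (EuclideanSpace ℝ (Fin n))} (hK : IsClosedCone K)
    (hK' : IsClosedCone K') : IsClosedCone (K ∩ K') where
  isClosed := hK.isClosed.inter hK'.isClosed
  add_mem hx hy := ⟨hK.add_mem hx.1 hy.1, hK'.add_mem hx.2 hy.2⟩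
  smul_mem ha hx := ⟨hK.smul_mem ha hx.1, hK'.smul_mem ha hx.2⟩

namespace Frame
variable (T : Frame n m)

theorem mul_volume_le_wedge (hK : IsClosedCone K) (he : T.e ∈ K) (hpos : ∀ y ∈ K, 0 ≤ ⟪T.e, y⟫)
    {N : ℕ} (hN : 0 < N) :
    N * volume (K ∩ Metric.closedBall 0 1) ≤
      ENNReal.ofReal (2 ^ n) * volume (K ∩ Metric.closedBall 0 1) +
      N * volume (T.wedge K (2 * N) ∩ {y | T.p y ≤ 1}) := by
  have hN' : (0 : ℝ) < N := by exact_mod_cast hN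
  refine le_trans ?_ (add_le_add_left (hK.mul_volume_slab_le he T.norm_e hpos hN) _)
  rw [← mul_add]
  refine mul_le_mul_right (le_trans (measure_mono ?_) (measure_union_le _ _)) _
  intro y hy
  by_cases h : ⟪T.e, y⟫ ≤ 1 / (2 * N)
  · exact Or.inl ⟨hy, h⟩
  · right
    push Not at h
    have hy1 := hy.2
    rw [mem_closedBall_zero_iff] at hy1
    have h1 := T.norm_sq y
    have h2 : T.t y ^ 2 + ‖T.π y‖ ^ 2 ≤ 1 := by nlinarith [norm_nonneg y, sq_nonneg ‖T.rem y‖]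
    have h3 : 0 < 1 / (2 * N : ℝ) := by positivity
    refine ⟨⟨hy.1, lt_trans h3 h, ?_⟩, ?_⟩
    · have h4 : ‖T.π y‖ ≤ 1 := by nlinarith [sq_nonneg (T.t y), norm_nonneg (T.π y)]
      refine h4.trans ?_
      rw [div_lt_iff₀ (by positivity)] at h
      change 1 ≤ 2 * N * ⟪T.e, y⟫
      linarith
    · change T.p y ≤ 1
      exact (Real.sqrt_le_sqrt h2).trans_eq Real.sqrt_one

theorem volume_wedge_le (hK : IsClosedCone K) {δ ρ ρ₂ : ℝ} (hδ0 : 0 ≤ δ) (hδ1 : δ ≤ 1 / 2)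
    (hT : T.IsThin K δ) (hρ : 0 ≤ ρ) (h : ρ + 2 * δ * (1 + ρ) ≤ ρ₂) :
    ENNReal.ofReal ((1 - δ) ^ n) * volume (T.wedge K ρ ∩ {y | T.p y ≤ 1}) ≤
      volume (K ∩ cap ρ₂ T.e ∩ Metric.closedBall 0 1) := by
  have h1δ : 0 < 1 - δ := by linarith
  have hs := (hK.inter (isClosedCone_cap ρ₂ T.e)).volume_inter_smul_ball (inv_pos.2 h1δ)
  have h1 : volume (T.wedge K ρ ∩ {y | T.p y ≤ 1}) ≤
      volume (K ∩ cap ρ₂ T.e ∩ Metric.closedBall 0 (1 - δ)⁻¹) := by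
    refine measure_mono ?_
    rintro y ⟨⟨hyK, hy0, hyρ⟩, hyp⟩
    have hyp : T.p y ≤ 1 := hyp
    have a0 := hT y hyK
    have a1 : ‖y‖ ≤ T.p y + ‖T.rem y‖ := by
      have := T.norm_sq y
      rw [← T.p_sq] at this
      refine abs_le_of_sq_le_sq' ?_ (by have := T.p_nonneg y; positivity) |>.2
      nlinarith [mul_nonneg (T.p_nonneg y) (norm_nonneg (T.rem y))]
    have a2 : ‖y‖ * (1 - δ) ≤ T.p y := by linarith
    have a3 : T.p y ≤ (1 + ρ) * T.t y := by
      have := T.p_sq y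
      refine abs_le_of_sq_le_sq' ?_ (by positivity) |>.2
      nlinarith [norm_nonneg (T.π y), mul_nonneg hρ hy0.le, mul_nonneg (mul_nonneg hρ hy0.le) hy0.le]
    refine ⟨⟨hyK, ?_⟩, ?_⟩
    · have e1 : y - ⟪T.e, y⟫ • T.e = T.ι (T.π y) + T.rem y := by
        rw [Frame.rem, t]; abel
      change ‖y - ⟪T.e, y⟫ • T.e‖ ≤ ρ₂ * T.t y
      rw [e1]
      refine (norm_add_le _ _).trans ?_
      rw [T.ι.norm_map]
      have a4 : ‖y‖ ≤ 2 * ((1 + ρ) * T.t y) := by nlinarith [norm_nonneg y]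
      calc ‖T.π y‖ + ‖T.rem y‖ ≤ ρ * T.t y + δ * (2 * ((1 + ρ) * T.t y)) := by gcongr; exact a0.trans (by gcongr)
        _ = (ρ + 2 * δ * (1 + ρ)) * T.t y := by ring
        _ ≤ _ := by gcongr
    · rw [mem_closedBall_zero_iff, ← one_div, le_div_iff₀ h1δ]
      linarith
  refine (mul_le_mul_right h1 _).trans ?_
  rw [hs, ← mul_assoc, ← ENNReal.ofReal_mul (by positivity), ← mul_pow, mul_inv_cancel₀ h1δ.ne']
  simp

theorem wedge_compare (hm : 0 < m) (hn : 0 < n) (hK : IsClosedCone K) {c : EuclideanSpace ℝ (Fin n)}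
    (hr : 0 < r) (hc : IsCenter K r c) (h0 : 0 < locVol K r 0) {η : ℝ} (hη0 : 0 < η) (hη : η ≤ 1 / 4) (hL : 0 < L)
    (hcL : c = L • T.e) (hLr : r ≤ η * L)
    {δ ρ R : ℝ} (hδ0 : 0 ≤ δ) (hδ1 : δ * (4 * (1 + R)) ≤ η * r) (hT : T.IsThin K δ)
    (hρ0 : 0 < ρ) (hρR : ρ ≤ R) :
    ENNReal.ofReal ((1 - 2 * η) ^ n * ((1 - η) ^ (n - 1) * (1 - η) ^ (m + 1))) * gnom n m ρ *
      volume (T.wedge K R ∩ {y | T.p y ≤ 1}) ≤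
    ENNReal.ofReal ((1 + 2 * η) ^ n * (1 + η) ^ (n - 1)) * gnomTotal n m *
      volume (T.wedge K ((ρ + η) / (1 - η)) ∩ {y | T.p y ≤ 1}) := by
  have : Nonempty (Fin m) := ⟨⟨0, hm⟩⟩
  have hL1 : L ≤ 1 := by
    have := hc.1
    rwa [hcL, norm_smul, T.norm_e, mul_one, Real.norm_of_nonneg hL.le] at this
  have ha : r / L ≤ η := (div_le_iff₀ hL).2 hLr
  have ha0 : 0 < r / L := by positivity
  have hrL : r < L := by nlinarith
  have h1η : 0 < 1 - η := by linarith
  have hr1 : r ≤ 1 := hrL.le.trans hL1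
  have hB := T.avg_le hn hK hr (by linarith) hL (ρ := ρ) (ρ' := (ρ + η) / (1 - η))
    (by rw [div_mul_eq_mul_div, le_div_iff₀ h1η]; nlinarith [mul_nonneg hρ0.le hL.le]) (by positivity)
  have hC := T.le_avg hn hK hr (by linarith) hL hL1 (l := 1 - η) (ρ := R)
    (ρ' := (R * (L + r) + r) / L) hδ0 (by nlinarith) hT h1η (by linarith) (by linarith)
    (by
      have : (δ * (4 * (1 + R))) ^ 2 ≤ (η * r) ^ 2 := by
        have : 0 ≤ R := by linarith
        gcongr
      nlinarith [sq_nonneg r, mul_nonneg hη0.le (sq_nonneg r)]) (by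
      rw [div_mul_cancel₀ _ hL.ne'])
  have hD := moment_scale (n := n) (m := m) hr hrL h1η (by linarith)
  have hD' : ENNReal.ofReal ((1 - η) ^ (n - 1) * (1 - η) ^ (m + 1)) * moment n m L r ≤
      ENNReal.ofReal ((1 + η) ^ (n - 1)) * moment n m L ((1 - η) * r) := by
    have hLp : ENNReal.ofReal (L ^ (n - 1)) ≠ 0 := by
      rw [Ne, ENNReal.ofReal_eq_zero]; push Not; positivity
    rw [← ENNReal.mul_le_mul_iff_right hLp (by simp), ← mul_assoc, ← mul_assoc,
      ← ENNReal.ofReal_mul (by positivity), ← ENNReal.ofReal_mul (by positivity)]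
    refine le_trans (mul_le_mul_left (ENNReal.ofReal_le_ofReal ?_) _)
      (hD.trans (mul_le_mul_left (ENNReal.ofReal_le_ofReal ?_) _))
    · rw [← mul_assoc, ← mul_pow]
      gcongr
      nlinarith
    · rw [← mul_pow]
      gcongr
      nlinarith
  have hR : ρ ≤ (R * (L + r) + r) / L := by
    rw [le_div_iff₀ hL]
    nlinarith [mul_nonneg hρ0.le hr.le, mul_le_mul_of_nonneg_right hρR hL.le]
  have hh : Continuous fun w => L • T.e + T.ι (L • w) := by
    have := T.ι.continuous
    fun_prop
  have hA : gnom n m ρ * T.avg K L r ((R * (L + r) + r) / L) ≤ gnomTotal n m * T.avg K L r ρ := by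
    refine le_trans (radial_chebyshev volume (k := kern n) (h := fun w =>
      volume (K ∩ Metric.closedBall (L • T.e + T.ι (L • w)) r)) ?_ ?_ (by fun_prop) hρ0 hR) ?_
    · exact measurable_volume_inter_closedBall hh.measurable K r
    · intro v s hs0 hs1
      have h3 := hc.locVol_add_smul_ge hK h0 (v := T.ι (L • v)) (by
        rw [hcL, real_inner_smul_left, T.inner_e_ι, mul_zero]) hs0 hs1
      rw [hcL, ← map_smul, smul_comm s L] at h3
      exact (ENNReal.toReal_le_toReal (volume_inter_closedBall_ne_top _ _ _)
        (volume_inter_closedBall_ne_top _ _ _)).1 h3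
    · exact mul_le_mul_left (setLIntegral_le_lintegral _ _) _
  have hM := moment_pos (n := n) (m := m) hr hrL
  have hMt := moment_ne_top (n := n) (m := m) hr hrL
  set V := volume (T.wedge K R ∩ {y | T.p y ≤ 1})
  set V' := volume (T.wedge K ((ρ + η) / (1 - η)) ∩ {y | T.p y ≤ 1})
  have hB' : ENNReal.ofReal ((1 - 2 * η) ^ n) * T.avg K L r ρ ≤ moment n m L r * V' * n := by
    refine le_trans (mul_le_mul_left (ENNReal.ofReal_le_ofReal ?_) _) hB
    gcongr
    linarith
  have hC' : moment n m L ((1 - η) * r) * V * n ≤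
      ENNReal.ofReal ((1 + 2 * η) ^ n) * T.avg K L r ((R * (L + r) + r) / L) := by
    refine le_trans hC (mul_le_mul_left (ENNReal.ofReal_le_ofReal ?_) _)
    gcongr
  have hn0 : (n : ℝ≥0∞) ≠ 0 := by exact_mod_cast hn.ne'
  have hp1 : 0 ≤ (1 - 2 * η) ^ n := pow_nonneg (by linarith) _
  rw [ENNReal.ofReal_mul hp1, ENNReal.ofReal_mul (p := (1 + 2 * η) ^ n) (by positivity)]
  have hMn : moment n m L r * n ≠ 0 := mul_ne_zero hM hn0
  rw [← ENNReal.mul_le_mul_iff_right hMn (by finiteness)]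
  generalize T.avg K L r ((R * (L + r) + r) / L) = I' at *
  generalize T.avg K L r ρ = I at *
  generalize ENNReal.ofReal ((1 - 2 * η) ^ n) = α at *
  generalize ENNReal.ofReal ((1 + 2 * η) ^ n) = β at *
  generalize ENNReal.ofReal ((1 - η) ^ (n - 1) * (1 - η) ^ (m + 1)) = σ at *
  generalize ENNReal.ofReal ((1 + η) ^ (n - 1)) = τ at *
  generalize moment n m L r = M at *
  generalize moment n m L ((1 - η) * r) = M' at *
  calc M * n * (α * σ * gnom n m ρ * V) = (σ * M) * (α * gnom n m ρ * V * n) := by ring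
    _ ≤ (τ * M') * (α * gnom n m ρ * V * n) := by gcongr
    _ = (M' * V * n) * (τ * α * gnom n m ρ) := by ring
    _ ≤ (β * I') * (τ * α * gnom n m ρ) := by gcongr
    _ = (gnom n m ρ * I') * (τ * α * β) := by ring
    _ ≤ (gnomTotal n m * I) * (τ * α * β) := by gcongr
    _ = (α * I) * (gnomTotal n m * τ * β) := by ring
    _ ≤ (M * V' * n) * (gnomTotal n m * τ * β) := by gcongr
    _ = _ := by ring

end Frame
end Waist

namespace Waist
open scoped ENNReal
open Filter Topology

variable {n m : ℕ} {K : Set (EuclideanSpace ℝ (Fin n))} {r L : ℝ}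

/-- Near every unit vector of `K`, the set `K` is close to an `(m + 1)`-dimensional subspace. -/
def IsThinAround (m : ℕ) (K : Set (EuclideanSpace ℝ (Fin n))) (δ : ℝ) : Prop :=
  ∀ p ∈ K, ‖p‖ = 1 → ∃ T : Frame n m, T.e = p ∧ T.IsThin K δ

theorem exists_slope_constants (n m : ℕ) {ρ ρ₂ θ : ℝ} (hρ : ρ < ρ₂) (hθ0 : 0 < θ) :
    ∃ η : ℝ, 0 < η ∧ η ≤ 1 / 4 ∧
      (ρ + η) / (1 - η) + 2 * η * (1 + (ρ + η) / (1 - η)) ≤ ρ₂ ∧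
      (1 - θ) * ((1 + 2 * η) ^ n * (1 + η) ^ (n - 1)) ≤
        (1 - η) ^ n * ((1 - 2 * η) ^ n * ((1 - η) ^ (n - 1) * (1 - η) ^ (m + 1))) * (1 - η) := by
  have h1 : ContinuousAt (fun η : ℝ => (ρ + η) / (1 - η) + 2 * η * (1 + (ρ + η) / (1 - η))) 0 := by
    have : ContinuousAt (fun η : ℝ => (ρ + η) / (1 - η)) 0 :=
      ContinuousAt.div (by fun_prop) (by fun_prop) (by norm_num)
    fun_prop
  have h2 : ContinuousAt (fun η : ℝ => (1 - θ) * ((1 + 2 * η) ^ n * (1 + η) ^ (n - 1)) -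
      (1 - η) ^ n * ((1 - 2 * η) ^ n * ((1 - η) ^ (n - 1) * (1 - η) ^ (m + 1))) * (1 - η)) 0 := by
    fun_prop
  have e1 := h1.eventually (gt_mem_nhds (show _ < ρ₂ by simpa using hρ))
  have e2 := h2.eventually (gt_mem_nhds (show _ < (0 : ℝ) by simpa using hθ0))
  have e3 : ∀ᶠ η : ℝ in 𝓝 0, η < 1 / 4 := gt_mem_nhds (by norm_num)
  have e4 : ∀ᶠ η : ℝ in 𝓝[>] 0, 0 < η := eventually_mem_nhdsWithin
  obtain ⟨η, ⟨⟨a1, a2⟩, a3⟩, a4⟩ := ((((e1.and e2).and e3).filter_mono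
    nhdsWithin_le_nhds).and e4).exists
  exact ⟨η, a4, a3.le, a1.le, by linarith⟩

theorem locVol_pos_of_volume_pos (hK : IsClosedCone K) (hV : 0 < locVol K 1 0) (hr : 0 < r) :
    0 < locVol K r 0 := by
  unfold locVol Measure.real at *
  rw [hK.volume_inter_smul_ball hr, ENNReal.toReal_mul]
  refine mul_pos ?_ hV
  rw [ENNReal.toReal_ofReal (by positivity)]
  positivity

theorem ratio_chain {c₁ c₂ t h h' g G A V V' D : ℝ≥0∞} (hcoef : t * c₂ ≤ h' * c₁ * h)
    (hV : h * A ≤ V) (hcmp : c₁ * g * V ≤ c₂ * G * V') (hD : h' * V' ≤ D) :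
    c₂ * (t * g * A) ≤ c₂ * (G * D) :=
  calc c₂ * (t * g * A) = (t * c₂) * (g * A) := by ring
    _ ≤ (h' * c₁ * h) * (g * A) := mul_le_mul_left hcoef _
    _ = h' * (c₁ * g * (h * A)) := by ring
    _ ≤ h' * (c₁ * g * V) := by gcongr
    _ ≤ h' * (c₂ * G * V') := mul_le_mul_right hcmp _
    _ = c₂ * G * (h' * V') := by ring
    _ ≤ c₂ * G * D := mul_le_mul_right hD _
    _ = _ := by ring

/-- A thin cone has, around the direction of its center, at least the proportion of volume given by
the model distribution. -/
theorem gnom_mul_volume_le (hm : 0 < m) (hn : m + 2 ≤ n) {ρ ρ₂ θ : ℝ} (hρ0 : 0 < ρ) (hρ : ρ < ρ₂)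
    (hθ0 : 0 < θ) (hθ1 : θ < 1) :
    ∃ r₀ > 0, ∀ r, 0 < r → r < r₀ → ∃ δ > 0, ∀ K : Set (EuclideanSpace ℝ (Fin n)),
      IsClosedCone K → 0 < locVol K 1 0 → IsThinAround m K δ → ∀ c, IsCenter K r c →
      r ≤ ‖c‖ ∧ ENNReal.ofReal (1 - θ) * gnom n m ρ * volume (K ∩ Metric.closedBall 0 1) ≤
        gnomTotal n m * volume (K ∩ cap ρ₂ (‖c‖⁻¹ • c) ∩ Metric.closedBall 0 1) := by
  obtain ⟨η, hη0, hη, hηρ, hηθ⟩ := exists_slope_constants n m hρ hθ0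
  obtain ⟨N, hN⟩ := exists_nat_gt (max (2 ^ n / η) ρ)
  have hN1 := (le_max_left _ _).trans_lt hN
  have hN2 := (le_max_right _ _).trans_lt hN
  have hN0' : (0 : ℝ) < N := lt_of_le_of_lt (by positivity) hN1
  have hN0 : 0 < N := by exact_mod_cast hN0'
  have hC : 0 < 8 * (1 / η + 1) := by positivity
  refine ⟨min (1 / 4) (((8 * (1 / η + 1)) ^ n)⁻¹), by positivity, fun r hr hrr => ?_⟩
  have hr4 : r < 1 / 4 := lt_of_lt_of_le hrr (min_le_left _ _)
  have hrC : r < ((8 * (1 / η + 1)) ^ n)⁻¹ := lt_of_lt_of_le hrr (min_le_right _ _)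
  set δ := η * r / (4 * (1 + 2 * N)) with hδ
  have hδ0 : 0 < δ := by positivity
  have hδeq : δ * (4 * (1 + 2 * N)) = η * r := by rw [hδ]; field_simp
  have hδr : δ ≤ η * r := by
    rw [← hδeq]
    nlinarith [mul_pos hδ0 hN0']
  refine ⟨δ, hδ0, fun K hK hV hthin c hc => ?_⟩
  have h0 := locVol_pos_of_volume_pos hK hV hr
  have hne : K.Nonempty := by
    by_contra h
    rw [Set.not_nonempty_iff_eq_empty] at h
    simp [locVol, h] at hV
  have hcK := hc.mem hK hne h0
  obtain ⟨p, hpK, hp1⟩ : ∃ p ∈ K, ‖p‖ = 1 := by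
    by_contra! h
    have hK0 : K ⊆ {0} := by
      intro y hy
      by_contra hy0
      have hy0 : y ≠ 0 := hy0
      refine h (‖y‖⁻¹ • y) (hK.smul_mem (by positivity) hy) ?_
      rw [norm_smul, norm_inv, norm_norm, inv_mul_cancel₀ (norm_ne_zero_iff.2 hy0)]
    have : Nonempty (Fin n) := ⟨⟨0, by omega⟩⟩
    have h1 : volume (K ∩ Metric.closedBall 0 1) = 0 :=
      measure_mono_null (Set.inter_subset_left.trans hK0) (by simp)
    simp [locVol, Measure.real, h1] at hV
  obtain ⟨T₀, -, hT₀⟩ := hthin p hpK hp1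
  have hLr : r ≤ η * ‖c‖ := by
    by_contra! hlt
    have h1 := hc.le_norm_add_pow hK hr hr4.le hV T₀ hT₀ hδ0.le (by nlinarith)
    have h2 : 8 * (‖c‖ + r) ≤ 8 * (1 / η + 1) * r := by
      have : ‖c‖ ≤ 1 / η * r := by
        rw [one_div, inv_mul_eq_div, le_div_iff₀ hη0]; linarith
      nlinarith
    have h3 : r ^ (m + 1) ≤ (8 * (1 / η + 1)) ^ n * r ^ n := by
      rw [← mul_pow]
      exact h1.trans (by gcongr)
    have h4 : r ^ n ≤ r ^ (m + 2) := pow_le_pow_of_le_one hr.le (by linarith) hn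
    have h5 : r ^ (m + 1) ≤ (8 * (1 / η + 1)) ^ n * r * r ^ (m + 1) := by
      calc _ ≤ _ := h3
        _ ≤ (8 * (1 / η + 1)) ^ n * r ^ (m + 2) := by gcongr
        _ = _ := by ring
    have h6 : (8 * (1 / η + 1)) ^ n * r < 1 := by
      rw [lt_inv_comm₀ hr (by positivity), ← one_div, lt_div_iff₀ hr] at hrC
      exact hrC
    nlinarith [pow_pos hr (m + 1)]
  have hc0 : 0 < ‖c‖ := by nlinarith
  refine ⟨by nlinarith, ?_⟩
  have heK : ‖c‖⁻¹ • c ∈ K := hK.smul_mem (by positivity) hcK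
  obtain ⟨T, hTe, hT⟩ := hthin _ heK (by
    rw [norm_smul, norm_inv, norm_norm, inv_mul_cancel₀ hc0.ne'])
  have hpos : ∀ y ∈ K, 0 ≤ ⟪T.e, y⟫ := by
    intro y hy
    rw [hTe, real_inner_smul_left]
    exact mul_nonneg (by positivity) (hc.inner_nonneg hK h0 hy)
  have hcmp := T.wedge_compare hm (by omega) hK hr hc h0 hη0 hη hc0
    (by rw [hTe, smul_smul, mul_inv_cancel₀ hc0.ne', one_smul]) hLr hδ0.le (R := 2 * N) hδeq.le hT hρ0
    (by linarith)
  have hδη : δ ≤ η := by nlinarith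
  have h1η : 0 < 1 - η := by linarith
  have hρη : 0 ≤ (ρ + η) / (1 - η) := by positivity
  have hvw := T.volume_wedge_le hK hδ0.le (by linarith) hT hρη (ρ₂ := ρ₂)
    (le_trans (by gcongr) hηρ)
  have hmw := T.mul_volume_le_wedge hK (hTe ▸ heK) hpos hN0
  rw [← hTe]
  set A := volume (K ∩ Metric.closedBall 0 1)
  set V := volume (T.wedge K (2 * N) ∩ {y | T.p y ≤ 1})
  set V' := volume (T.wedge K ((ρ + η) / (1 - η)) ∩ {y | T.p y ≤ 1})
  have hA : A ≠ ⊤ := volume_inter_closedBall_ne_top _ _ _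
  have hmw' : ENNReal.ofReal (1 - η) * A ≤ V := by
    have h1 : ENNReal.ofReal (2 ^ n) ≤ N * ENNReal.ofReal η := by
      rw [← ENNReal.ofReal_natCast, ← ENNReal.ofReal_mul hN0'.le]
      refine ENNReal.ofReal_le_ofReal ?_
      rw [div_lt_iff₀ hη0] at hN1
      exact hN1.le
    have h2 : (N : ℝ≥0∞) * A ≤ N * (ENNReal.ofReal η * A + V) := by
      refine hmw.trans ?_
      rw [mul_add, ← mul_assoc]
      gcongr
    rw [ENNReal.mul_le_mul_iff_right (by exact_mod_cast hN0.ne') (by simp)] at h2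
    have h3 : A = ENNReal.ofReal η * A + ENNReal.ofReal (1 - η) * A := by
      rw [← add_mul, ← ENNReal.ofReal_add hη0.le h1η.le]
      simp
    rw [h3, ← h3] at h2
    have h4 : ENNReal.ofReal η * A + ENNReal.ofReal (1 - η) * A ≤ ENNReal.ofReal η * A + V :=
      h3 ▸ h2
    exact (ENNReal.add_le_add_iff_left (by finiteness)).1 h4
  have hvw' : ENNReal.ofReal ((1 - η) ^ n) * V' ≤
      volume (K ∩ cap ρ₂ T.e ∩ Metric.closedBall 0 1) := by
    refine le_trans (mul_le_mul_left (ENNReal.ofReal_le_ofReal ?_) _) hvw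
    gcongr
  have h2η : 0 ≤ 1 - 2 * η := by linarith
  set C₁ := (1 - 2 * η) ^ n * ((1 - η) ^ (n - 1) * (1 - η) ^ (m + 1)) with hC₁
  set C₂ := (1 + 2 * η) ^ n * (1 + η) ^ (n - 1) with hC₂
  have hC₁0 : 0 ≤ C₁ := by positivity
  have hC₂0 : 0 < C₂ := by positivity
  have hC₂' : ENNReal.ofReal C₂ ≠ 0 := by
    rw [Ne, ENNReal.ofReal_eq_zero]; push Not; exact hC₂0
  have hcoef : ENNReal.ofReal (1 - θ) * ENNReal.ofReal C₂ ≤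
      ENNReal.ofReal ((1 - η) ^ n) * ENNReal.ofReal C₁ * ENNReal.ofReal (1 - η) := by
    rw [← ENNReal.ofReal_mul (by linarith), ← ENNReal.ofReal_mul (by positivity),
      ← ENNReal.ofReal_mul (by positivity)]
    exact ENNReal.ofReal_le_ofReal hηθ
  rw [← ENNReal.mul_le_mul_iff_right hC₂' (by simp)]
  set D := volume (K ∩ cap ρ₂ T.e ∩ Metric.closedBall 0 1)
  exact ratio_chain hcoef hmw' hcmp hvw'

end Waist

namespace Waist
open scoped ENNReal Pointwise

variable {n k m : ℕ}

/-- The points of the unit ball of `ℝᵏ × ℝᵐ` whose gnomonic coordinate lies in `D`. -/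
def gnomonicSector (k : ℕ) (D : Set (EuclideanSpace ℝ (Fin m))) :
    Set (EuclideanSpace ℝ (Fin k) × EuclideanSpace ℝ (Fin m)) :=
  {p | ‖p.1‖⁻¹ • p.2 ∈ D ∧ ‖p.1‖ ^ 2 + ‖p.2‖ ^ 2 ≤ 1}

/-- The radial moment appearing in gnomonic coordinates. -/
noncomputable def ballMoment (k m : ℕ) : ℝ≥0∞ :=
  ∫⁻ y in Metric.closedBall (0 : EuclideanSpace ℝ (Fin k)) 1, ENNReal.ofReal (‖y‖ ^ m)

theorem measurableSet_gnomonicSector {D : Set (EuclideanSpace ℝ (Fin m))} (hD : MeasurableSet D) :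
    MeasurableSet (gnomonicSector k D) := by
  have h : Measurable fun p : EuclideanSpace ℝ (Fin k) × EuclideanSpace ℝ (Fin m) =>
    ‖p.1‖⁻¹ • p.2 := by fun_prop
  have h2 : IsClosed {p : EuclideanSpace ℝ (Fin k) × EuclideanSpace ℝ (Fin m) |
      ‖p.1‖ ^ 2 + ‖p.2‖ ^ 2 ≤ 1} := isClosed_le (by fun_prop) continuous_const
  exact (h hD).inter h2.measurableSet

theorem volume_gnomonicSector (hk : 0 < k) {D : Set (EuclideanSpace ℝ (Fin m))}
    (hD : MeasurableSet D) :
    volume (gnomonicSector k D) = ballMoment k m * ∫⁻ w in D, kern (k + m) ‖w‖ := by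
  have : Nonempty (Fin k) := ⟨⟨0, hk⟩⟩
  set F : EuclideanSpace ℝ (Fin k) → ℝ≥0∞ := fun y => if ‖y‖ ≤ 1 then ENNReal.ofReal (‖y‖ ^ m) else 0
    with hF
  have hFm : Measurable F := Measurable.ite (measurableSet_le (by fun_prop) measurable_const)
    (by fun_prop) measurable_const
  set G : EuclideanSpace ℝ (Fin k) → EuclideanSpace ℝ (Fin m) → ℝ≥0∞ := fun y w =>
    ENNReal.ofReal ((√(1 + ‖w‖ ^ 2))⁻¹ ^ m) * F (√(1 + ‖w‖ ^ 2) • y)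
  have hGm : Measurable (Function.uncurry G) := by
    refine Measurable.mul (by fun_prop) (hFm.comp ?_)
    fun_prop
  have h1 : ∀ y : EuclideanSpace ℝ (Fin k), y ≠ 0 →
      volume (Prod.mk y ⁻¹' gnomonicSector k D) = ∫⁻ w in D, G y w := by
    intro y hy
    have hy0 : 0 < ‖y‖ := norm_pos_iff.2 hy
    set E := D ∩ {w | ‖y‖ ^ 2 * (1 + ‖w‖ ^ 2) ≤ 1} with hE
    have hEm : MeasurableSet {w : EuclideanSpace ℝ (Fin m) | ‖y‖ ^ 2 * (1 + ‖w‖ ^ 2) ≤ 1} :=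
      measurableSet_le (by fun_prop) measurable_const
    have e1 : Prod.mk y ⁻¹' gnomonicSector k D = ‖y‖ • E := by
      ext z
      rw [Set.mem_smul_set_iff_inv_smul_mem₀ hy0.ne']
      refine and_congr Iff.rfl ?_
      change _ ↔ ‖y‖ ^ 2 * (1 + ‖(‖y‖⁻¹ • z)‖ ^ 2) ≤ 1
      rw [norm_smul, norm_inv, norm_norm]
      have : ‖y‖ ^ 2 * (1 + (‖y‖⁻¹ * ‖z‖) ^ 2) = ‖y‖ ^ 2 + ‖z‖ ^ 2 := by field_simp
      rw [this]
    rw [e1, Measure.addHaar_smul, finrank_euclideanSpace_fin, abs_of_pos (by positivity), hE,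
      Set.inter_comm, ← Measure.restrict_apply hEm, ← lintegral_indicator_one hEm,
      ← lintegral_const_mul _ (measurable_one.indicator hEm)]
    refine lintegral_congr fun w => ?_
    have hs : 0 < √(1 + ‖w‖ ^ 2) := by positivity
    have h2 : ‖√(1 + ‖w‖ ^ 2) • y‖ ≤ 1 ↔ ‖y‖ ^ 2 * (1 + ‖w‖ ^ 2) ≤ 1 := by
      rw [norm_smul, Real.norm_of_nonneg hs.le, ← sq_le_one_iff₀ (by positivity), mul_pow,
        Real.sq_sqrt (by positivity), mul_comm]
    by_cases h : ‖y‖ ^ 2 * (1 + ‖w‖ ^ 2) ≤ 1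
    · rw [Set.indicator_of_mem (by exact h)]
      simp only [G, hF, if_pos (h2.2 h)]
      rw [← ENNReal.ofReal_mul (by positivity), norm_smul, Real.norm_of_nonneg hs.le, mul_pow,
        ← mul_assoc, ← mul_pow, inv_mul_cancel₀ hs.ne']
      simp
    · rw [Set.indicator_of_notMem (by exact h)]
      simp only [G, hF, if_neg (mt h2.1 h), mul_zero]
  have h0 : ∀ᵐ y : EuclideanSpace ℝ (Fin k), y ≠ 0 := by simp [ae_iff]
  rw [Measure.volume_eq_prod, Measure.prod_apply (measurableSet_gnomonicSector hD),
    lintegral_congr_ae (h0.mono h1), lintegral_lintegral_swap hGm.aemeasurable,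
    ← lintegral_const_mul _ (by fun_prop)]
  refine lintegral_congr fun w => ?_
  have hs : 0 < √(1 + ‖w‖ ^ 2) := by positivity
  have h3 := lintegral_comp_smul_cone (volume : Measure (EuclideanSpace ℝ (Fin k)))
    MeasurableSet.univ hs (fun y => by simp) F
  rw [Measure.restrict_univ, finrank_euclideanSpace_fin] at h3
  simp only [G]
  rw [lintegral_const_mul _ (by fun_prop), h3, ← mul_assoc, ← ENNReal.ofReal_mul (by positivity),
    mul_comm, kern, pow_add, ← inv_pow, mul_comm ((√(1 + ‖w‖ ^ 2))⁻¹ ^ m)]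
  congr 1
  rw [ballMoment, ← lintegral_indicator Metric.isClosed_closedBall.measurableSet]
  refine lintegral_congr fun y => ?_
  simp [hF, Set.indicator]

theorem volume_gnomonicSector_univ_ne (k m : ℕ) :
    volume (gnomonicSector k (Set.univ : Set (EuclideanSpace ℝ (Fin m)))) ≠ 0 ∧
    volume (gnomonicSector k (Set.univ : Set (EuclideanSpace ℝ (Fin m)))) ≠ ⊤ := by
  constructor
  · have hsub : {p : EuclideanSpace ℝ (Fin k) × EuclideanSpace ℝ (Fin m) |
        ‖p.1‖ ^ 2 + ‖p.2‖ ^ 2 < 1} ⊆ gnomonicSector k Set.univ :=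
      fun p hp => ⟨trivial, le_of_lt hp⟩
    refine (lt_of_lt_of_le ?_ (measure_mono hsub)).ne'
    exact IsOpen.measure_pos _ (isOpen_lt (by fun_prop) (by fun_prop)) ⟨0, by simp⟩
  · refine ((measure_mono (t := Metric.closedBall 0 1) ?_).trans_lt measure_closedBall_lt_top).ne
    rintro p ⟨-, hp⟩
    rw [mem_closedBall_zero_iff, Prod.norm_def, max_le_iff]
    constructor <;> nlinarith [sq_nonneg ‖p.1‖, sq_nonneg ‖p.2‖]

theorem gnomTotal_ne (hk : 0 < k) (m : ℕ) : gnomTotal (k + m) m ≠ 0 ∧ gnomTotal (k + m) m ≠ ⊤ := by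
  obtain ⟨h1, h2⟩ := volume_gnomonicSector_univ_ne k m
  rw [volume_gnomonicSector hk MeasurableSet.univ, Measure.restrict_univ] at h1 h2
  have h3 := left_ne_zero_of_mul h1
  refine ⟨right_ne_zero_of_mul h1, fun h => h2 ?_⟩
  change ballMoment k m * gnomTotal (k + m) m = ⊤
  rw [h, ENNReal.mul_top h3]

/-- In the model distribution, the proportion of the ball of slope at most `ρ` is the normalized
gnomonic mass. -/
theorem gnomTotal_mul_volume_slope (hk : 0 < k) (hn : n = k + m)
    (Φ : EuclideanSpace ℝ (Fin n) ≃L[ℝ] EuclideanSpace ℝ (Fin k) × EuclideanSpace ℝ (Fin m))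
    (hΦ : ∀ x, ‖x‖ ^ 2 = ‖(Φ x).1‖ ^ 2 + ‖(Φ x).2‖ ^ 2) (ρ : ℝ) :
    gnomTotal n m * volume ({x | ‖(Φ x).2‖ ≤ ρ * ‖(Φ x).1‖} ∩ Metric.closedBall 0 1) =
      gnom n m ρ * volume (Metric.closedBall (0 : EuclideanSpace ℝ (Fin n)) 1) := by
  subst hn
  have : Nonempty (Fin k) := ⟨⟨0, hk⟩⟩
  set ν : Measure (EuclideanSpace ℝ (Fin k) × EuclideanSpace ℝ (Fin m)) :=
    (volume : Measure (EuclideanSpace ℝ (Fin k))).prod volume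
  have hmap : (volume.map Φ).IsAddHaarMeasure := Φ.isAddHaarMeasure_map volume
  obtain ⟨a, ha⟩ : ∃ a : ℝ≥0∞, volume.map Φ = a • ν :=
    ⟨_, Measure.isAddLeftInvariant_eq_smul (volume.map Φ) ν⟩
  have hpre : ∀ S, MeasurableSet S → volume (Φ ⁻¹' S) = a * volume S := by
    intro S hS
    rw [← Measure.map_apply Φ.continuous.measurable hS, ha]
    rfl
  have hnull : volume {x | (Φ x).1 = 0} = 0 := by
    have h1 := hpre ({0} ×ˢ Set.univ) ((measurableSet_singleton _).prod MeasurableSet.univ)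
    rw [Measure.volume_eq_prod, Measure.prod_prod, measure_singleton, zero_mul, mul_zero] at h1
    rw [← h1]
    congr 1
    ext x
    simp
  have hball : Φ ⁻¹' gnomonicSector k Set.univ = Metric.closedBall 0 1 := by
    ext x
    rw [mem_closedBall_zero_iff, ← sq_le_one_iff₀ (norm_nonneg x), hΦ]
    simp [gnomonicSector]
  have hae : ({x | ‖(Φ x).2‖ ≤ ρ * ‖(Φ x).1‖} ∩ Metric.closedBall 0 1 : Set _) =ᵐ[volume]
      Φ ⁻¹' gnomonicSector k (Metric.closedBall 0 ρ) := by
    rw [ae_eq_set]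
    constructor <;>
    · refine measure_mono_null ?_ hnull
      rintro x ⟨h1, h2⟩
      by_contra h0
      have h0' : 0 < ‖(Φ x).1‖ := norm_pos_iff.2 h0
      apply h2
      have h3 : ‖x‖ ≤ 1 ↔ ‖(Φ x).1‖ ^ 2 + ‖(Φ x).2‖ ^ 2 ≤ 1 := by
        rw [← sq_le_one_iff₀ (norm_nonneg x), hΦ]
      simp only [gnomonicSector, Set.mem_preimage, Set.mem_ofPred_eq, mem_closedBall_zero_iff,
        Set.mem_inter_iff, norm_smul, norm_inv, norm_norm, inv_mul_le_iff₀ h0', h3,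
        mul_comm ρ] at h1 ⊢
      exact h1
  rw [measure_congr hae, hpre _ (measurableSet_gnomonicSector
    Metric.isClosed_closedBall.measurableSet), ← hball,
    hpre _ (measurableSet_gnomonicSector MeasurableSet.univ),
    volume_gnomonicSector hk Metric.isClosed_closedBall.measurableSet,
    volume_gnomonicSector hk MeasurableSet.univ, Measure.restrict_univ, gnomTotal, gnom]
  ring

end Waist

namespace Waist

/-- A quantitative form of linear independence for a sequence of unit vectors. -/
def IsSpread {V : Type*} [NormedAddCommGroup V] [Module ℝ V] (δ : ℝ) {k : ℕ} (p : Fin k → V) :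
    Prop :=
  (∀ j, ‖p j‖ = 1) ∧
    ∀ x : Fin k → ℝ, ∀ j, (∀ i, j < i → x i = 0) → δ * |x j| ≤ ‖∑ i, x i • p i‖

section
variable {V : Type*} [NormedAddCommGroup V] [InnerProductSpace ℝ V]

theorem IsSpread.snoc {δ : ℝ} {k : ℕ} {q : Fin k → V} (hq : IsSpread δ q) {y : V} (hy : y ≠ 0)
    (h : ∀ e ∈ Submodule.span ℝ (Set.range q), δ * ‖y‖ ≤ ‖y - e‖) :
    IsSpread δ (Fin.snoc q (‖y‖⁻¹ • y) : Fin (k + 1) → V) := by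
  have hy0 : 0 < ‖y‖ := norm_pos_iff.2 hy
  refine ⟨fun j => ?_, fun x j hx => ?_⟩
  · induction j using Fin.lastCases with
    | last => rw [Fin.snoc_last, norm_smul, norm_inv, norm_norm, inv_mul_cancel₀ hy0.ne']
    | cast j => rw [Fin.snoc_castSucc]; exact hq.1 j
  · rw [Fin.sum_univ_castSucc]
    simp only [Fin.snoc_castSucc, Fin.snoc_last]
    induction j using Fin.lastCases with
    | cast j =>
      rw [hx _ (Fin.castSucc_lt_last j), zero_smul, add_zero]
      exact hq.2 (fun i => x i.castSucc) j fun i hi => hx _ (Fin.castSucc_lt_castSucc_iff.2 hi)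
    | last =>
      set s := ∑ i : Fin k, x i.castSucc • q i
      have hs : s ∈ Submodule.span ℝ (Set.range q) := Submodule.sum_mem _ fun i _ =>
        Submodule.smul_mem _ _ (Submodule.subset_span ⟨i, rfl⟩)
      by_cases hx0 : x (Fin.last k) = 0
      · simp [hx0]
      have h1 := h (-((‖y‖ / x (Fin.last k)) • s)) (Submodule.neg_mem _ (Submodule.smul_mem _ _ hs))
      have h2 : s + x (Fin.last k) • ‖y‖⁻¹ • y =
          (x (Fin.last k) * ‖y‖⁻¹) • (y - -((‖y‖ / x (Fin.last k)) • s)) := by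
        rw [sub_neg_eq_add, smul_add, smul_smul, smul_smul, add_comm]
        congr 1
        rw [show x (Fin.last k) * ‖y‖⁻¹ * (‖y‖ / x (Fin.last k)) = 1 by field_simp, one_smul]
      rw [h2, norm_smul, norm_mul, norm_inv, norm_norm, Real.norm_eq_abs]
      calc δ * |x (Fin.last k)| = |x (Fin.last k)| * ‖y‖⁻¹ * (δ * ‖y‖) := by field_simp
        _ ≤ _ := by gcongr

theorem IsSpread.sum_ne_zero {δ : ℝ} (hδ : 0 < δ) {k : ℕ} {p : Fin k → V} (hp : IsSpread δ p)
    {x : Fin k → ℝ} (hx : x ≠ 0) : ∑ i, x i • p i ≠ 0 := by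
  obtain ⟨i, hi⟩ := Function.ne_iff.1 hx
  have hne : (Finset.univ.filter fun i => x i ≠ 0).Nonempty := ⟨i, by simpa using hi⟩
  obtain ⟨j, hj, hmax⟩ := Finset.exists_max_image _ id hne
  have h1 := hp.2 x j fun i hij => by
    by_contra h
    exact absurd (hmax i (by simpa using h)) (not_le.2 hij)
  intro h
  rw [h, norm_zero] at h1
  have h2 : 0 < |x j| := abs_pos.2 (by simpa using hj)
  nlinarith

theorem exists_subspace_or_isSpread {K : Set V} (hK : ∀ y ∈ K, ∀ a : ℝ, 0 ≤ a → a • y ∈ K)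
    {p : V} (hp : p ∈ K) (hp1 : ‖p‖ = 1) {δ : ℝ} (hδ1 : δ ≤ 1) (k : ℕ) :
    (∃ E : Submodule ℝ V, p ∈ E ∧ Module.finrank ℝ E ≤ k ∧
      ∀ y ∈ K, ∃ e ∈ E, ‖y - e‖ ≤ δ * ‖y‖) ∨
    ∃ q : Fin (k + 1) → V, (∀ j, q j ∈ K) ∧ IsSpread δ q ∧ q 0 = p := by
  induction k with
  | zero =>
    refine Or.inr ⟨fun _ => p, fun _ => hp, ⟨fun _ => hp1, fun x j _ => ?_⟩, rfl⟩
    rw [Fin.sum_univ_one, norm_smul, hp1, mul_one, Real.norm_eq_abs, show j = 0 from Fin.fin_one_eq_zero j]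
    nlinarith [abs_nonneg (x 0)]
  | succ k ih =>
    rcases ih with ⟨E, h1, h2, h3⟩ | ⟨q, h1, h2, h3⟩
    · exact Or.inl ⟨E, h1, h2.trans k.le_succ, h3⟩
    by_cases h : ∀ y ∈ K, ∃ e ∈ Submodule.span ℝ (Set.range q), ‖y - e‖ ≤ δ * ‖y‖
    · refine Or.inl ⟨Submodule.span ℝ (Set.range q), Submodule.subset_span ⟨0, h3⟩, ?_, h⟩
      have h4 := finrank_range_le_card (R := ℝ) q
      rwa [Fintype.card_fin] at h4
    push Not at h
    obtain ⟨y, hy, h⟩ := h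
    have hy0 : y ≠ 0 := by
      rintro rfl
      simpa using h 0 (Submodule.zero_mem _)
    refine Or.inr ⟨Fin.snoc q (‖y‖⁻¹ • y), fun j => ?_, h2.snoc hy0 fun e he => (h e he).le, ?_⟩
    · induction j using Fin.lastCases with
      | last => rw [Fin.snoc_last]; exact hK y hy _ (by positivity)
      | cast j => rw [Fin.snoc_castSucc]; exact h1 j
    · rw [← Fin.castSucc_zero, Fin.snoc_castSucc, h3]

theorem exists_le_finrank_eq [FiniteDimensional ℝ V] (E : Submodule ℝ V) {k : ℕ}
    (h1 : Module.finrank ℝ E ≤ k) (h2 : k ≤ Module.finrank ℝ V) :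
    ∃ E', E ≤ E' ∧ Module.finrank ℝ E' = k := by
  induction k, h1 using Nat.le_induction with
  | base => exact ⟨E, le_rfl, rfl⟩
  | succ k hk ih =>
    obtain ⟨E', hE, hE'⟩ := ih (by omega)
    have hne : E' ≠ ⊤ := by
      rintro rfl
      rw [finrank_top] at hE'
      omega
    obtain ⟨v, hv⟩ : ∃ v, v ∉ E' := by
      by_contra! h
      exact hne (eq_top_iff.2 fun v _ => h v)
    refine ⟨E' ⊔ ℝ ∙ v, hE.trans le_sup_left, ?_⟩
    have h3 := Submodule.finrank_lt_finrank_of_lt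
      (lt_of_le_of_ne (le_sup_left : E' ≤ E' ⊔ ℝ ∙ v) fun h => hv (h ▸
        Submodule.mem_sup_right (Submodule.mem_span_singleton_self v)))
    have h4 := Submodule.finrank_add_le_finrank_add_finrank E' (ℝ ∙ v)
    have h5 : Module.finrank ℝ (ℝ ∙ v) ≤ 1 := by
      simpa using finrank_span_le_card (R := ℝ) ({v} : Set V)
    omega

end

variable {n m : ℕ}

theorem exists_frame_of_subspace (hn : m + 1 ≤ n) {E : Submodule ℝ (EuclideanSpace ℝ (Fin n))}
    {p : EuclideanSpace ℝ (Fin n)} (hp : p ∈ E) (hp1 : ‖p‖ = 1)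
    (hE : Module.finrank ℝ E ≤ m + 1) :
    ∃ T : Frame n m, T.e = p ∧ ∀ e ∈ E, ∃ (a : ℝ) (v : _), e = a • T.e + T.ι v := by
  obtain ⟨E', hEE', hE'⟩ := exists_le_finrank_eq E hE (by simpa using hn)
  have hp0 : p ≠ 0 := by rintro rfl; simp at hp1
  have h1 : ℝ ∙ p ≤ E' := (Submodule.span_singleton_le_iff_mem _ _).2 (hEE' hp)
  have h2 := Submodule.finrank_add_inf_finrank_orthogonal' h1 (n := m)
    (by rw [finrank_span_singleton hp0, hE', add_comm])
  set F := (ℝ ∙ p)ᗮ ⊓ E' with hF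
  set φ : EuclideanSpace ℝ (Fin m) ≃ₗᵢ[ℝ] F := ((stdOrthonormalBasis ℝ F).reindex
    (finCongr h2)).repr.symm
  refine ⟨⟨p, F.subtypeₗᵢ.comp φ.toLinearIsometry, hp1, fun v => ?_⟩, rfl, fun e he => ?_⟩
  · exact Submodule.mem_orthogonal_singleton_iff_inner_right.1 (φ v).2.1
  · have h3 : e - ⟪p, e⟫ • p ∈ F := by
      refine ⟨?_, E'.sub_mem (hEE' he) (E'.smul_mem _ (hEE' hp))⟩
      change _ ∈ (ℝ ∙ p)ᗮ
      rw [Submodule.mem_orthogonal_singleton_iff_inner_right, inner_sub_right,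
        real_inner_smul_right, real_inner_self_eq_norm_sq, hp1]
      ring
    refine ⟨⟪p, e⟫, φ.symm ⟨_, h3⟩, ?_⟩
    simp

/-- Without an `(m + 2)`-tuple of well-spread vectors, a cone is thin around its points. -/
theorem isThinAround_of_forall_not_isSpread (hn : m + 1 ≤ n)
    {K : Set (EuclideanSpace ℝ (Fin n))} (hK : IsClosedCone K) {δ : ℝ}
    (hδ1 : δ ≤ 1)
    (h : ∀ q : Fin (m + 2) → EuclideanSpace ℝ (Fin n), (∀ j, q j ∈ K) → ¬ IsSpread δ q) :
    IsThinAround m K δ := by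
  intro p hp hp1
  rcases exists_subspace_or_isSpread (fun y hy a ha => hK.smul_mem ha hy) hp hp1 hδ1 (m + 1) with
    ⟨E, h1, h2, h3⟩ | ⟨q, h1, h2, -⟩
  · obtain ⟨T, hT, hTE⟩ := exists_frame_of_subspace hn h1 hp1 h2
    refine ⟨T, hT, fun y hy => ?_⟩
    obtain ⟨e, he, hye⟩ := h3 y hy
    obtain ⟨a, v, rfl⟩ := hTE e he
    refine le_trans ?_ hye
    have h4 := T.norm_sub_sq y a v
    rw [sub_sub] at h4
    refine abs_le_of_sq_le_sq' ?_ (norm_nonneg _) |>.2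
    rw [h4]
    nlinarith [sq_nonneg (T.t y - a), sq_nonneg ‖T.π y - v‖]
  · exact absurd h2 (h q h1)

end Waist

namespace Waist

section
variable {V : Type*} [NormedAddCommGroup V] [InnerProductSpace ℝ V]

/-- The linear combination of the vectors `p` with coefficients `x`. -/
def comb {k : ℕ} (p : Fin k → V) (x : Fin k → ℝ) : V := ∑ i, x i • p i

@[fun_prop]
theorem continuous_comb {k : ℕ} : Continuous fun a : (Fin k → V) × (Fin k → ℝ) =>
    comb a.1 a.2 := by
  unfold comb; fun_prop

theorem comb_smul {k : ℕ} (p : Fin k → V) (a : ℝ) (x : Fin k → ℝ) :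
    comb p (a • x) = a • comb p x := by
  simp [comb, Finset.smul_sum, smul_smul]

theorem IsSpread.comb_ne_zero {δ : ℝ} (hδ : 0 < δ) {k : ℕ} {p : Fin k → V} (hp : IsSpread δ p)
    {x : Fin k → ℝ} (hx : ‖x‖ = 1) : comb p x ≠ 0 :=
  hp.sum_ne_zero hδ (by rintro rfl; simp at hx)

theorem IsSpread.norm_comb_le {δ : ℝ} {k : ℕ} {p : Fin k → V} (hp : IsSpread δ p)
    {x : Fin k → ℝ} (hx : ‖x‖ = 1) : ‖comb p x‖ ≤ k := by
  refine (norm_sum_le _ _).trans ?_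
  calc ∑ i, ‖x i • p i‖ ≤ ∑ _i : Fin k, (1 : ℝ) := Finset.sum_le_sum fun i _ => by
        rw [norm_smul, hp.1 i, mul_one]; exact hx ▸ norm_le_pi_norm x i
    _ = k := by simp

theorem isCompact_isSpread [FiniteDimensional ℝ V] (δ : ℝ) (k : ℕ) :
    IsCompact {p : Fin k → V | IsSpread δ p} := by
  have : ProperSpace V := FiniteDimensional.proper ℝ V
  refine (isCompact_closedBall (0 : Fin k → V) 1).of_isClosed_subset ?_ fun p hp => ?_
  · have : {p : Fin k → V | IsSpread δ p} = (⋂ j, {p | ‖p j‖ = 1}) ∩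
        ⋂ (x : Fin k → ℝ) (j) (_ : ∀ i, j < i → x i = 0), {p | δ * |x j| ≤ ‖∑ i, x i • p i‖} := by
      ext p
      simp [IsSpread]
    rw [this]
    refine (isClosed_iInter fun j => isClosed_eq (by fun_prop) continuous_const).inter ?_
    exact isClosed_iInter fun x => isClosed_iInter fun j => isClosed_iInter fun _ =>
      isClosed_le continuous_const (by fun_prop)
  · rw [mem_closedBall_zero_iff, pi_norm_le_iff_of_nonneg zero_le_one]
    exact fun j => (hp.1 j).le

/-- Finitely many spread tuples suffice to detect all spread tuples. -/
theorem exists_finite_detecting [FiniteDimensional ℝ V] {δ : ℝ} (hδ : 0 < δ) (k : ℕ) :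
    ∃ t : Set (Fin k → V), t.Finite ∧ (∀ p ∈ t, IsSpread δ p) ∧ ∃ τ > 0,
      ∀ q : Fin k → V, IsSpread δ q → ∃ p ∈ t, ∀ x : Fin k → ℝ, ‖x‖ = 1 → ∃ j, τ ≤ |⟪comb p x, q j⟫| := by
  have hA := isCompact_isSpread (V := V) δ k
  have hAS := hA.prod (isCompact_sphere (0 : Fin k → ℝ) 1)
  have hcont : Continuous fun a : (Fin k → V) × (Fin k → ℝ) =>
      ‖fun j => (⟪comb a.1 a.2, a.1 j⟫ : ℝ)‖ := by fun_prop
  obtain ⟨c, hc0, hc⟩ := hAS.exists_forall_le' hcont.continuousOn (a := 0) (by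
    rintro ⟨p, x⟩ ⟨hp, hx⟩
    rw [mem_sphere_zero_iff_norm] at hx
    refine norm_pos_iff.2 fun h => hp.comb_ne_zero hδ hx ?_
    rw [← inner_self_eq_zero (𝕜 := ℝ)]
    nth_rw 2 [comb]
    rw [inner_sum]
    refine Finset.sum_eq_zero fun j _ => ?_
    rw [real_inner_smul_right, show ⟪comb p x, p j⟫ = 0 from congrFun h j, mul_zero])
  have hη : 0 < c / (2 * (k + 1)) := by positivity
  obtain ⟨t, htA, ht, hcov⟩ := hA.finite_cover_balls hη
  refine ⟨t, ht, fun p hp => htA hp, c / 2, by positivity, fun q hq => ?_⟩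
  obtain ⟨p, hp, hqp⟩ := Set.mem_iUnion₂.1 (hcov hq)
  refine ⟨p, hp, fun x hx => ?_⟩
  have h1 : c ≤ ‖fun j => (⟪comb p x, p j⟫ : ℝ)‖ :=
    hc (p, x) ⟨htA hp, mem_sphere_zero_iff_norm.2 hx⟩
  by_contra! h2
  refine absurd h1 (not_le.2 ((pi_norm_lt_iff hc0).2 fun j => ?_))
  have h3 : ‖q j - p j‖ ≤ c / (2 * (k + 1)) := by
    rw [Metric.mem_ball, dist_eq_norm] at hqp
    exact (norm_le_pi_norm (q - p) j).trans hqp.le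
  have h4 := abs_real_inner_le_norm (comb p x) (q j - p j)
  have h5 : ‖comb p x‖ * ‖q j - p j‖ ≤ (k + 1) * (c / (2 * (k + 1))) := by
    have := (htA hp).norm_comb_le hx
    gcongr
    linarith
  have h6 : (k + 1) * (c / (2 * (k + 1))) = c / 2 := by field_simp
  rw [inner_sub_right] at h4
  have h7 := abs_le.1 (h4.trans (h5.trans_eq h6))
  have h8 := abs_lt.1 (h2 j)
  rw [Real.norm_eq_abs, abs_lt]
  constructor <;> linarith [h7.1, h7.2, h8.1, h8.2]

theorem exists_packing_bound {V : Type*} [NormedAddCommGroup V] [ProperSpace V] {ε : ℝ} (hε : 0 < ε) :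
    ∃ N : ℕ, ∀ q : ℕ → V, (∀ s ≤ N, ‖q s‖ ≤ 1) → ∃ s s', s < s' ∧ s' ≤ N ∧ ‖q s - q s'‖ < ε := by
  obtain ⟨t, -, ht, hcov⟩ := (isCompact_closedBall (0 : V) 1).finite_cover_balls (half_pos hε)
  refine ⟨ht.toFinset.card, fun q hq => ?_⟩
  have h1 : ∀ s : ℕ, ∃ c, s ≤ ht.toFinset.card → c ∈ t ∧ ‖q s - c‖ < ε / 2 := by
    intro s
    by_cases hs : s ≤ ht.toFinset.card
    · obtain ⟨c, hc, hqc⟩ := Set.mem_iUnion₂.1 (hcov (mem_closedBall_zero_iff.2 (hq s hs)))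
      exact ⟨c, fun _ => ⟨hc, by rwa [Metric.mem_ball, dist_eq_norm] at hqc⟩⟩
    · exact ⟨0, fun h => absurd h hs⟩
  choose c hc using h1
  obtain ⟨s, hs, s', hs', hne, heq⟩ := Finset.exists_ne_map_eq_of_card_lt_of_maps_to
    (s := Finset.range (ht.toFinset.card + 1)) (t := ht.toFinset) (f := c) (by simp)
    (fun s hs => by simpa using (hc s (by simpa [Nat.lt_succ_iff] using hs)).1)
  rw [Finset.mem_range, Nat.lt_succ_iff] at hs hs'
  have h2 : ‖q s - q s'‖ < ε := by
    have := norm_sub_le (q s - c s) (q s' - c s')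
    rw [← heq, sub_sub_sub_cancel_right] at this
    have h3 := (hc s hs).2
    have h4 := (hc s' hs').2
    rw [← heq] at h4
    linarith
  rcases hne.lt_or_gt with h | h
  · exact ⟨s, s', h, hs', h2⟩
  · exact ⟨s', s, h, hs, by rwa [norm_sub_rev]⟩

end

variable {n m : ℕ}

/-- If the half of a cone where `⟪u, ·⟫` is nonnegative contains at most half of the volume, the
other half goes deep. -/
theorem IsClosedCone.exists_inner_lt {K : Set (EuclideanSpace ℝ (Fin n))} (hK : IsClosedCone K)
    {u p : EuclideanSpace ℝ (Fin n)} {l τ : ℝ} (hl0 : 0 < l) (hl1 : l < 1)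
    (hl : 1 / 2 < (1 - l) ^ n) (hp : p ∈ K) (hp1 : ‖p‖ ≤ 1) (hτ : 0 ≤ τ) (hup : τ ≤ ⟪u, p⟫)
    (h0 : volume (K ∩ Metric.closedBall 0 1) ≠ 0)
    (h : 2 * volume (K ∩ {y | 0 ≤ ⟪u, y⟫} ∩ Metric.closedBall 0 1) =
      volume (K ∩ Metric.closedBall 0 1)) :
    ∃ q ∈ K, ‖q‖ ≤ 1 ∧ ⟪u, q⟫ < -(l * τ) := by
  by_contra! hcon
  have hsub : AffineMap.homothety p (1 - l) '' (K ∩ Metric.closedBall 0 1) ⊆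
      K ∩ {y | 0 ≤ ⟪u, y⟫} ∩ Metric.closedBall 0 1 := by
    rintro _ ⟨y, ⟨hy, hy1⟩, rfl⟩
    rw [mem_closedBall_zero_iff] at hy1
    have e : AffineMap.homothety p (1 - l) y = (1 - l) • y + l • p := by
      rw [AffineMap.homothety_apply, vsub_eq_sub, vadd_eq_add]; module
    rw [e]
    refine ⟨⟨hK.add_mem (hK.smul_mem (by linarith) hy) (hK.smul_mem hl0.le hp), ?_⟩, ?_⟩
    · change 0 ≤ ⟪u, (1 - l) • y + l • p⟫
      rw [inner_add_right, real_inner_smul_right, real_inner_smul_right]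
      have h1 := mul_le_mul_of_nonneg_left (hcon y hy hy1) (by linarith : 0 ≤ 1 - l)
      have h2 := mul_le_mul_of_nonneg_left hup hl0.le
      nlinarith [mul_nonneg (mul_nonneg hl0.le hl0.le) hτ]
    · rw [mem_closedBall_zero_iff]
      refine (norm_add_le _ _).trans ?_
      rw [norm_smul, norm_smul, Real.norm_of_nonneg (by linarith : 0 ≤ 1 - l),
        Real.norm_of_nonneg hl0.le]
      nlinarith
  have h1 := measure_mono (μ := volume) hsub
  rw [Measure.addHaar_image_homothety, finrank_euclideanSpace_fin, abs_of_pos (by positivity)] at h1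
  have hfin := volume_inter_closedBall_ne_top K 1 0
  have h2 : ENNReal.ofReal (2 * (1 - l) ^ n) * volume (K ∩ Metric.closedBall 0 1) ≤
      1 * volume (K ∩ Metric.closedBall 0 1) := by
    rw [ENNReal.ofReal_mul zero_le_two, mul_assoc, one_mul, ← h, ENNReal.ofReal_ofNat]
    exact mul_le_mul_right (h1.trans_eq rfl |>.trans' (by rw [h])) _
  rw [ENNReal.mul_le_mul_iff_left h0 hfin, ENNReal.ofReal_le_one] at h2
  linarith

/-- Repeated halving of the space along a suitable finite sequence of `(m + 2)`-dimensional families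
of normals destroys all spread `(m + 2)`-tuples. -/
theorem exists_levels (n k : ℕ) {δ : ℝ} (hδ : 0 < δ) :
    ∃ (i : ℕ) (P : ℕ → Fin k → EuclideanSpace ℝ (Fin n)), (∀ t, t < i → IsSpread δ (P t)) ∧
      ∀ (K : ℕ → Set (EuclideanSpace ℝ (Fin n))) (x : ℕ → Fin k → ℝ),
        (∀ t < i, ‖x t‖ = 1) → (∀ t ≤ i, IsClosedCone (K t)) →
        (∀ t < i, K (t + 1) = K t ∩ {y | 0 ≤ ⟪comb (P t) (x t), y⟫}) →
        (∀ t < i, 2 * volume (K (t + 1) ∩ Metric.closedBall 0 1) =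
          volume (K t ∩ Metric.closedBall 0 1)) →
        volume (K 0 ∩ Metric.closedBall 0 1) ≠ 0 →
        ∀ q : Fin k → EuclideanSpace ℝ (Fin n), (∀ j, q j ∈ K i) → ¬ IsSpread δ q := by
  obtain ⟨A, hA, hAs, τ, hτ, hdet⟩ := exists_finite_detecting (V := EuclideanSpace ℝ (Fin n)) hδ k
  obtain ⟨l, hl0, hl1, hl⟩ : ∃ l : ℝ, 0 < l ∧ l < 1 ∧ 1 / 2 < (1 - l) ^ n := by
    have h1 : Filter.Tendsto (fun l : ℝ => (1 - l) ^ n) (nhds 0) (nhds ((1 - 0) ^ n)) :=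
      Continuous.tendsto (by fun_prop) 0
    have h2 := (h1.eventually (lt_mem_nhds (show (1 / 2 : ℝ) < (1 - 0) ^ n by norm_num))).and
      (gt_mem_nhds (show (0 : ℝ) < 1 by norm_num))
    obtain ⟨l, ⟨h3, h4⟩, h5⟩ := ((h2.filter_mono nhdsWithin_le_nhds).and
      (self_mem_nhdsWithin (s := Set.Ioi (0 : ℝ)))).exists
    exact ⟨l, h5, h4, h3⟩
  obtain ⟨N, hN⟩ := exists_packing_bound (V := EuclideanSpace ℝ (Fin n))
    (ε := l * τ / (k + 1)) (by positivity)
  set L := hA.toFinset.toList with hL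
  rcases Nat.eq_zero_or_pos L.length with hlen | hlen
  · refine ⟨0, fun _ _ => 0, fun t ht => absurd ht (Nat.not_lt_zero t), ?_⟩
    intro K x _ _ _ _ _ q _ hq
    obtain ⟨p, hp, -⟩ := hdet q hq
    have : p ∈ L := by simpa [hL] using hp
    rw [List.length_eq_zero_iff.1 hlen] at this
    simp at this
  set P : ℕ → Fin k → EuclideanSpace ℝ (Fin n) := fun t => L.get ⟨t % L.length, Nat.mod_lt _ hlen⟩
  have hPA : ∀ t, P t ∈ A := fun t => by
    have : P t ∈ L := List.get_mem _ _
    simpa [hL] using this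
  refine ⟨L.length * (N + 1), P, fun t _ => hAs _ (hPA t), ?_⟩
  intro K x hx hK hcut hvol hvol0 q hq hqs
  set i := L.length * (N + 1)
  have hpos : ∀ t ≤ i, volume (K t ∩ Metric.closedBall 0 1) ≠ 0 := by
    intro t
    induction t with
    | zero => exact fun _ => hvol0
    | succ t ih =>
      intro ht h
      have := hvol t ht
      rw [h, mul_zero] at this
      exact ih (by omega) this.symm
  have hanti : ∀ s t, s ≤ t → t ≤ i → K t ⊆ K s := by
    intro s t hst
    induction t, hst using Nat.le_induction with
    | base => exact fun _ => subset_rfl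
    | succ t _ ih =>
      intro ht
      rw [hcut t ht]
      exact Set.inter_subset_left.trans (ih (by omega))
  obtain ⟨p, hpA, hp⟩ := hdet q hqs
  obtain ⟨a, ha⟩ : ∃ a : Fin L.length, L.get a = p := List.get_of_mem (by simpa [hL] using hpA)
  have hlev : ∀ s, s ≤ N → a.1 + L.length * s < i := fun s hs => by
    have h1 : L.length * (s + 1) ≤ i := Nat.mul_le_mul_left _ (by omega)
    rw [mul_add] at h1
    have := a.2
    omega
  have hPs : ∀ s, P (a.1 + L.length * s) = p := fun s => by
    rw [← ha]
    change L.get _ = L.get _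
    congr 1
    ext
    simp [Nat.add_mul_mod_self_left, Nat.mod_eq_of_lt a.2]
  have hex : ∀ s, ∃ y, s ≤ N → y ∈ K (a.1 + L.length * s) ∧ ‖y‖ ≤ 1 ∧
      ⟪comb p (x (a.1 + L.length * s)), y⟫ < -(l * τ) := by
    intro s
    by_cases hs : s ≤ N
    · have h1 := hlev s hs
      obtain ⟨j, hj⟩ := hp _ (hx _ h1)
      have h2 : q j ∈ K (a.1 + L.length * s + 1) := hanti _ _ h1 le_rfl (hq j)
      have h3 := hcut _ h1
      rw [hPs] at h3
      rw [h3] at h2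
      rw [abs_of_nonneg h2.2] at hj
      have h4 := hvol _ h1
      rw [h3] at h4
      obtain ⟨y, hy⟩ := (hK _ h1.le).exists_inner_lt hl0 hl1 hl h2.1 (hqs.1 j).le hτ.le hj
        (hpos _ h1.le) h4
      exact ⟨y, fun _ => hy⟩
    · exact ⟨0, fun h => absurd h hs⟩
  choose y hy using hex
  obtain ⟨s, s', hss, hs', hlt⟩ := hN y fun s hs => (hy s hs).2.1
  have hs : s ≤ N := by omega
  have h1 := hlev s hs
  have h2 : a.1 + L.length * s + 1 ≤ a.1 + L.length * s' := by
    have h3 : L.length * (s + 1) ≤ L.length * s' := Nat.mul_le_mul_left _ hss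
    rw [mul_add] at h3
    omega
  have h3 := hanti _ _ h2 (hlev s' hs').le (hy s' hs').1
  rw [hcut _ h1, hPs] at h3
  have h4 : 0 ≤ ⟪comb p (x (a.1 + L.length * s)), y s'⟫ := h3.2
  have h5 := (hy s hs).2.2
  have h6 := real_inner_le_norm (comb p (x (a.1 + L.length * s))) (y s' - y s)
  rw [inner_sub_right, norm_sub_rev] at h6
  have h7 := (hAs p hpA).norm_comb_le (hx _ h1)
  have h8 : ‖comb p (x (a.1 + L.length * s))‖ * ‖y s - y s'‖ ≤ (k + 1) * (l * τ / (k + 1)) := by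
    gcongr
    linarith
  have h9 : (k + 1) * (l * τ / (k + 1)) = l * τ := by field_simp
  linarith

end Waist

namespace Waist
open scoped ENNReal

variable {n m k i : ℕ}

/-- The normal vector of the cut leading to a word, the most recent letter choosing its sign. -/
noncomputable def treeNormal (P : ℕ → Fin k → EuclideanSpace ℝ (Fin n))
    (x : TreeNode i → Fin k → ℝ) : List ℤˣ → EuclideanSpace ℝ (Fin n)
  | [] => 0
  | b :: t => ((b : ℤ) : ℝ) • comb (P t.length) (if h : t.length < i then x ⟨t, h⟩ else 0)

/-- The cone of the partition of space attached to a word. -/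
noncomputable def treeCone (P : ℕ → Fin k → EuclideanSpace ℝ (Fin n))
    (x : TreeNode i → Fin k → ℝ) : List ℤˣ → Set (EuclideanSpace ℝ (Fin n))
  | [] => Set.univ
  | b :: t => treeCone P x t ∩ {y | 0 ≤ ⟪treeNormal P x (b :: t), y⟫}

variable {P : ℕ → Fin k → EuclideanSpace ℝ (Fin n)} {x : TreeNode i → Fin k → ℝ}

theorem treeCone_eq_polyCone (v : List ℤˣ) :
    treeCone P x v = polyCone fun j : Fin v.length => treeNormal P x (v.drop j) := by
  induction v with
  | nil => ext y; simp [treeCone, polyCone]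
  | cons b t ih =>
    rw [treeCone, ih]
    ext y
    change (∀ j : Fin t.length, _) ∧ _ ↔ ∀ j : Fin (t.length + 1), _
    rw [Fin.forall_fin_succ, and_comm]
    rfl

theorem isClosedCone_treeCone (v : List ℤˣ) : IsClosedCone (treeCone P x v) :=
  treeCone_eq_polyCone (P := P) (x := x) v ▸ isClosedCone_polyCone _

theorem continuous_treeNormal (v : List ℤˣ) :
    Continuous fun x : TreeNode i → Fin k → ℝ => treeNormal P x v := by
  cases v with
  | nil => exact continuous_const
  | cons b t =>
    have h : Continuous fun x : TreeNode i → Fin k → ℝ =>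
        (if h : t.length < i then x ⟨t, h⟩ else 0 : Fin k → ℝ) := by
      split_ifs with h
      · fun_prop
      · exact continuous_const
    have h2 : Continuous fun x : TreeNode i → Fin k → ℝ =>
        comb (P t.length) (if h : t.length < i then x ⟨t, h⟩ else 0 : Fin k → ℝ) :=
      continuous_comb.comp (continuous_const.prodMk h)
    exact Continuous.smul (continuous_const (y := ((b : ℤ) : ℝ))) h2

theorem treeNormal_ne_zero {δ : ℝ} (hδ : 0 < δ) (hP : ∀ t < i, IsSpread δ (P t))
    (hx : x ∈ SignCocycle.cubeSpheres (TreeNode i) k) (b : ℤˣ) {t : List ℤˣ} (ht : t.length < i) :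
    treeNormal P x (b :: t) ≠ 0 := by
  rw [treeNormal, dif_pos ht]
  refine smul_ne_zero ?_ ((hP _ ht).comb_ne_zero hδ (hx _))
  exact_mod_cast b.ne_zero

theorem treeNormal_drop_ne_zero {δ : ℝ} (hδ : 0 < δ) (hP : ∀ t < i, IsSpread δ (P t))
    (hx : x ∈ SignCocycle.cubeSpheres (TreeNode i) k) {v : List ℤˣ} (hv : v.length ≤ i)
    (j : Fin v.length) : treeNormal P x (v.drop j) ≠ 0 := by
  rw [List.drop_eq_getElem_cons j.2]
  refine treeNormal_ne_zero hδ hP hx _ ?_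
  have := j.2
  rw [List.length_drop]
  omega

theorem treeNormal_act (s : TreeSign i) (b : ℤˣ) {t : List ℤˣ} (ht : t.length < i) :
    treeNormal P (SignCocycle.act s x) (b :: t) = treeNormal P x (flipWord s.1 (b :: t)) := by
  have h : SignCocycle.act s x ⟨t, ht⟩ =
      (((s.1 t : ℤˣ) : ℤ) : ℝ) • x ⟨flipWord s.1 t, by simpa using ht⟩ := by
    simp only [SignCocycle.act, TreeSign.sgn_def]
    have : s⁻¹ • (⟨t, ht⟩ : TreeNode i) = ⟨flipWord s.1 t, by simpa using ht⟩ :=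
      Subtype.ext (TreeSign.inv_smul_val s _)
    rw [this]
    rcases Int.units_eq_one_or (s.1 t) with h | h <;> rw [h] <;> simp
  have ht' : (flipWord s.1 t).length < i := by simpa using ht
  rw [flipWord, treeNormal, treeNormal, dif_pos ht, dif_pos ht', h, comb_smul, smul_smul,
    show P (flipWord s.1 t).length = P t.length by rw [length_flipWord], Units.val_mul,
    Int.cast_mul]

theorem treeCone_act (s : TreeSign i) {v : List ℤˣ} (hv : v.length ≤ i) :
    treeCone P (SignCocycle.act s x) v = treeCone P x (flipWord s.1 v) := by
  induction v with
  | nil => rfl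
  | cons b t ih =>
    rw [treeCone, ih (Nat.le_of_succ_le hv), treeNormal_act s b hv, flipWord]
    rfl

theorem volume_treeCone_inter {δ : ℝ} (hδ : 0 < δ) (hP : ∀ t < i, IsSpread δ (P t))
    (hx : x ∈ SignCocycle.cubeSpheres (TreeNode i) k) {t : List ℤˣ} (ht : t.length < i)
    {S : Set (EuclideanSpace ℝ (Fin n))} (hS : MeasurableSet S) :
    volume (treeCone P x t ∩ S) =
      volume (treeCone P x (1 :: t) ∩ S) + volume (treeCone P x (-1 :: t) ∩ S) := by
  have h0 := treeNormal_ne_zero hδ hP hx 1 ht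
  have hneg : treeNormal P x (-1 :: t) = -treeNormal P x (1 :: t) := by
    simp [treeNormal]
  set u := treeNormal P x (1 :: t) with hu
  have e1 : treeCone P x t ∩ S = (treeCone P x (1 :: t) ∩ S) ∪ (treeCone P x (-1 :: t) ∩ S) := by
    ext y
    simp only [treeCone, hneg, ← hu, inner_neg_left, Set.mem_inter_iff, Set.mem_union,
      Set.mem_ofPred_eq, Left.nonneg_neg_iff]
    have := le_total 0 ⟪u, y⟫
    tauto
  rw [e1]
  refine measure_union₀ ((isClosedCone_treeCone _).isClosed.measurableSet.inter hS).nullMeasurableSet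
    ?_
  refine measure_mono_null ?_ (volume_inner_eq_zero h0)
  rintro y ⟨⟨⟨-, h1⟩, -⟩, ⟨⟨-, h2⟩, -⟩⟩
  have h1' : 0 ≤ ⟪u, y⟫ := h1
  have h2' : 0 ≤ ⟪treeNormal P x (-1 :: t), y⟫ := h2
  rw [hneg, inner_neg_left] at h2'
  exact le_antisymm (by linarith) h1'

theorem subtreeSum_volume {δ : ℝ} (hδ : 0 < δ) (hP : ∀ t < i, IsSpread δ (P t))
    (hx : x ∈ SignCocycle.cubeSpheres (TreeNode i) k) (r : ℕ) (v : List ℤˣ) (hv : v.length + r = i) :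
    subtreeSum (fun w => locVol (treeCone P x w) 1 0) r v = locVol (treeCone P x v) 1 0 := by
  induction r generalizing v with
  | zero => rfl
  | succ r ih =>
    rw [subtreeSum, ih _ (by simp; omega), ih _ (by simp; omega)]
    unfold locVol Measure.real
    rw [volume_treeCone_inter hδ hP hx (t := v) (by omega)
      Metric.isClosed_closedBall.measurableSet, ENNReal.toReal_add]
    · exact volume_inter_closedBall_ne_top _ _ _
    · exact volume_inter_closedBall_ne_top _ _ _

/-- Comparison of volumes over a partition follows from comparison on the leaves. -/
theorem mul_volume_le_of_leaves {δ : ℝ} (hδ : 0 < δ) (hP : ∀ t < i, IsSpread δ (P t))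
    (hx : x ∈ SignCocycle.cubeSpheres (TreeNode i) k) {S S' : Set (EuclideanSpace ℝ (Fin n))}
    (hS : MeasurableSet S) (hS' : MeasurableSet S') {a b : ℝ≥0∞}
    (h : ∀ v : List ℤˣ, v.length = i →
      a * volume (treeCone P x v ∩ S) ≤ b * volume (treeCone P x v ∩ S'))
    (r : ℕ) (v : List ℤˣ) (hv : v.length + r = i) :
    a * volume (treeCone P x v ∩ S) ≤ b * volume (treeCone P x v ∩ S') := by
  induction r generalizing v with
  | zero => exact h v hv
  | succ r ih =>
    rw [volume_treeCone_inter hδ hP hx (by omega) hS, volume_treeCone_inter hδ hP hx (by omega) hS',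
      mul_add, mul_add]
    exact add_le_add (ih _ (by simp; omega)) (ih _ (by simp; omega))

/-- The volume of a leaf, and its product with the value of `F` at the center. -/
noncomputable def leafValue (P : ℕ → Fin k → EuclideanSpace ℝ (Fin n)) (r : ℝ)
    (F : EuclideanSpace ℝ (Fin n) → Fin m → ℝ) (x : TreeNode i → Fin k → ℝ) (v : List ℤˣ) :
    Fin (m + 1) → ℝ :=
  Fin.cons (locVol (treeCone P x v) 1 0)
    (locVol (treeCone P x v) 1 0 • F (center (treeCone P x v) r))

theorem continuousOn_leafValue {δ : ℝ} (hδ : 0 < δ) (hP : ∀ t < i, IsSpread δ (P t)) {r : ℝ}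
    (hr : 0 < r) {F : EuclideanSpace ℝ (Fin n) → Fin m → ℝ} (hF : Continuous F) {v : List ℤˣ}
    (hv : v.length = i) : ContinuousOn (fun x => leafValue P r F x v)
      (SignCocycle.cubeSpheres (TreeNode i) k) := by
  intro x₀ hx₀
  have hne := fun x (hx : x ∈ SignCocycle.cubeSpheres (TreeNode i) k) =>
    treeNormal_drop_ne_zero hδ hP hx hv.le
  set u : (TreeNode i → Fin k → ℝ) → Fin v.length → EuclideanSpace ℝ (Fin n) :=
    fun x j => treeNormal P x (v.drop j) with hu
  have hut : Filter.Tendsto u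
      (nhdsWithin x₀ (SignCocycle.cubeSpheres (TreeNode i) k)) (nhds (u x₀)) :=
    ((continuous_pi fun j => continuous_treeNormal _).tendsto x₀).mono_left nhdsWithin_le_nhds
  have hV := tendsto_locVol one_pos (hne x₀ hx₀) hut
    (tendsto_const_nhds (x := (0 : EuclideanSpace ℝ (Fin n))))
  have hprod : Filter.Tendsto
      (fun x => locVol (polyCone (u x)) 1 0 • F (center (polyCone (u x)) r))
      (nhdsWithin x₀ (SignCocycle.cubeSpheres (TreeNode i) k))
      (nhds (locVol (polyCone (u x₀)) 1 0 • F (center (polyCone (u x₀)) r))) := by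
    rcases (locVol_nonneg (polyCone (u x₀)) 1 0).eq_or_lt with h0 | h0
    · rw [← h0, zero_smul]
      obtain ⟨M, hM⟩ := (isCompact_closedBall (0 : EuclideanSpace ℝ (Fin n)) 1).exists_bound_of_continuousOn
        hF.continuousOn
      have hlim := hV.mul_const M
      rw [← h0, zero_mul] at hlim
      refine squeeze_zero_norm' ?_ hlim
      filter_upwards [self_mem_nhdsWithin] with x hx
      rw [norm_smul, Real.norm_of_nonneg (locVol_nonneg _ _ _)]
      exact mul_le_mul_of_nonneg_left (hM _ (mem_closedBall_zero_iff.2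
        (isCenter_center hr (hne x hx)).1)) (locVol_nonneg _ _ _)
    · have h1 := locVol_pos_of_volume_pos (isClosedCone_polyCone _) h0 hr
      have h2 := (continuousAt_center hr (hne x₀ hx₀) h1).tendsto.comp hut
      exact hV.smul ((hF.tendsto _).comp h2)
  have e : ∀ x : TreeNode i → Fin k → ℝ, leafValue P r F x v =
      Fin.cons (locVol (polyCone (u x)) 1 0)
        (locVol (polyCone (u x)) 1 0 • F (center (polyCone (u x)) r)) := fun x => by
    rw [leafValue, treeCone_eq_polyCone]
  rw [ContinuousWithinAt, e]
  simp only [e]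
  rw [tendsto_pi_nhds] at hprod ⊢
  intro j
  induction j using Fin.cases with
  | zero => exact hV
  | succ j => exact hprod j

/-- The waist partition: space can be divided into convex cones containing no spread
`(m + 2)`-tuple, whose centers all have the same image. -/
theorem exists_partition {δ r : ℝ} (hδ : 0 < δ) (hr : 0 < r)
    {F : EuclideanSpace ℝ (Fin n) → Fin m → ℝ} (hF : Continuous F) :
    ∃ z : Fin m → ℝ, ∀ (S : Set (EuclideanSpace ℝ (Fin n))) (a b : ℝ≥0∞), MeasurableSet S →
      (∀ K : Set (EuclideanSpace ℝ (Fin n)), IsClosedCone K → 0 < locVol K 1 0 →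
        (∀ q : Fin (m + 2) → EuclideanSpace ℝ (Fin n), (∀ j, q j ∈ K) → ¬ IsSpread δ q) →
        ∀ c, IsCenter K r c → F c = z →
        a * volume (K ∩ Metric.closedBall 0 1) ≤ b * volume (K ∩ S)) →
      a * volume (Metric.closedBall (0 : EuclideanSpace ℝ (Fin n)) 1) ≤ b * volume S := by
  obtain ⟨i, P, hP, hcut⟩ := exists_levels n (m + 2) hδ
  obtain ⟨x, hx, hbal⟩ := exists_balanced i (m + 1) (leafValue P r F)
    (fun v hv => continuousOn_leafValue hδ hP hr hF hv)
    (fun s x hx v hv => by simp only [leafValue, treeCone_act s hv.le])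
  have hcoord : ∀ (r' : ℕ) (v : List ℤˣ) (j : Fin (m + 1)),
      subtreeSum (leafValue P r F x) r' v j = subtreeSum (fun w => leafValue P r F x w j) r' v := by
    intro r'
    induction r' with
    | zero => exact fun v j => rfl
    | succ r' ih => intro v j; rw [subtreeSum, subtreeSum, Pi.add_apply, ih, ih]
  have hvol : ∀ (r' : ℕ) (v : List ℤˣ), v.length + r' = i →
      2 ^ v.length * locVol (treeCone P x v) 1 0 = locVol (Set.univ : Set (EuclideanSpace ℝ (Fin n))) 1 0 := by
    intro r' v hv
    have h1 := congrFun (hbal v r' hv) 0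
    rw [Pi.smul_apply, hcoord, hcoord, smul_eq_mul] at h1
    change 2 ^ v.length * subtreeSum (fun w => locVol (treeCone P x w) 1 0) r' v =
      subtreeSum (fun w => locVol (treeCone P x w) 1 0) i [] at h1
    rwa [subtreeSum_volume hδ hP hx r' v hv, subtreeSum_volume hδ hP hx i [] (by simp)] at h1
  have hV0 : 0 < locVol (Set.univ : Set (EuclideanSpace ℝ (Fin n))) 1 0 := by
    unfold locVol Measure.real
    rw [Set.univ_inter]
    exact ENNReal.toReal_pos (Metric.measure_closedBall_pos _ _ one_pos).ne'
      measure_closedBall_lt_top.ne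
  set V := locVol (Set.univ : Set (EuclideanSpace ℝ (Fin n))) 1 0
  refine ⟨fun j => V⁻¹ * subtreeSum (leafValue P r F x) i [] j.succ, fun S a b hS hleaf => ?_⟩
  have hpos : ∀ (r' : ℕ) (v : List ℤˣ), v.length + r' = i → 0 < locVol (treeCone P x v) 1 0 := by
    intro r' v hv
    have h1 := hvol r' v hv
    by_contra h2
    rw [le_antisymm (not_lt.1 h2) (locVol_nonneg _ _ _), mul_zero] at h1
    exact hV0.ne h1
  have hfin := mul_volume_le_of_leaves hδ hP hx (S := Metric.closedBall 0 1) (S' := S)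
    (a := a) (b := b) Metric.isClosed_closedBall.measurableSet hS (fun v hv => ?_) i [] (by simp)
  · simpa [treeCone] using hfin
  have hK := isClosedCone_treeCone (P := P) (x := x) v
  have hp := hpos 0 v hv
  have hc : IsCenter (treeCone P x v) r (center (treeCone P x v) r) := by
    rw [treeCone_eq_polyCone]
    exact isCenter_center hr (treeNormal_drop_ne_zero hδ hP hx hv.le)
  refine hleaf _ hK hp ?_ _ hc ?_
  · have hlen : ∀ t ≤ i, (v.drop (i - t)).length = t := fun t ht => by
      rw [List.length_drop]; omega
    have hdrop : ∀ t < i, ∃ b : ℤˣ, v.drop (i - (t + 1)) = b :: v.drop (i - t) := fun t ht => by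
      have h1 : i - (t + 1) < v.length := by omega
      refine ⟨v[i - (t + 1)], ?_⟩
      rw [List.drop_eq_getElem_cons h1]
      congr 2
      omega
    choose! bs hbs using hdrop
    have hxt : ∀ t < i, ∃ y : Fin (m + 2) → ℝ, ‖y‖ = 1 ∧
        treeNormal P x (v.drop (i - (t + 1))) = comb (P t) y := by
      intro t ht
      have h1 := hlen t ht.le
      refine ⟨((bs t : ℤ) : ℝ) • x ⟨v.drop (i - t), by omega⟩, ?_, ?_⟩
      · rw [norm_smul, hx]
        rcases Int.units_eq_one_or (bs t) with h | h <;> rw [h] <;> simp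
      · rw [hbs t ht, treeNormal, dif_pos (by omega), comb_smul,
          show P (v.drop (i - t)).length = P t by rw [h1]]
    choose! y hy1 hy2 using hxt
    have := hcut (fun t => treeCone P x (v.drop (i - t))) y hy1
      (fun t _ => isClosedCone_treeCone _) (fun t ht => ?_) (fun t ht => ?_) ?_
    · simpa using this
    · rw [← hy2 t ht, hbs t ht, treeCone]
    · have h1 := hvol (i - t) (v.drop (i - t)) (by rw [hlen t ht.le]; omega)
      have h2 := hvol (i - (t + 1)) (v.drop (i - (t + 1))) (by rw [hlen (t + 1) ht]; omega)
      rw [hlen t ht.le] at h1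
      rw [hlen (t + 1) ht, ← h1, pow_succ, mul_assoc, mul_right_inj' (by positivity)] at h2
      unfold locVol Measure.real at h2
      rw [← ENNReal.toReal_ofNat, ← ENNReal.toReal_mul,
        ENNReal.toReal_eq_toReal_iff' (ENNReal.mul_ne_top (by simp)
          (volume_inter_closedBall_ne_top _ _ _)) (volume_inter_closedBall_ne_top _ _ _)] at h2
      exact h2
    · have h1 := hpos i [] (by simp)
      beta_reduce
      rw [Nat.sub_zero, List.drop_of_length_le hv.le]
      intro h2
      rw [locVol, Measure.real, h2] at h1
      simp at h1
  · funext j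
    have h1 := congrFun (hbal v 0 hv) j.succ
    rw [← h1, Pi.smul_apply, subtreeSum, smul_eq_mul]
    change _ = V⁻¹ * (2 ^ v.length * (locVol (treeCone P x v) 1 0 * F (center (treeCone P x v) r) j))
    rw [← hvol 0 v hv]
    field_simp

end Waist

namespace Waist
open scoped ENNReal

variable {n m : ℕ}

/-- The homogeneous extension of a map on the sphere, cut off at radius `r`. -/
noncomputable def radialExtension (f : EuclideanSpace ℝ (Fin n) → Fin m → ℝ) (r : ℝ)
    (x : EuclideanSpace ℝ (Fin n)) : Fin m → ℝ :=
  min 1 (‖x‖ / r) • f (‖x‖⁻¹ • x)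

theorem radialExtension_of_le {f : EuclideanSpace ℝ (Fin n) → Fin m → ℝ} {r : ℝ} (hr : 0 < r)
    {x : EuclideanSpace ℝ (Fin n)} (hx : r ≤ ‖x‖) : radialExtension f r x = f (‖x‖⁻¹ • x) := by
  rw [radialExtension, min_eq_left ((one_le_div hr).2 hx), one_smul]

theorem norm_inv_smul_self {x : EuclideanSpace ℝ (Fin n)} (hx : x ≠ 0) : ‖‖x‖⁻¹ • x‖ = 1 := by
  rw [norm_smul, norm_inv, norm_norm, inv_mul_cancel₀ (norm_ne_zero_iff.2 hx)]

theorem continuous_radialExtension {f : EuclideanSpace ℝ (Fin n) → Fin m → ℝ}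
    (hf : ContinuousOn f (Metric.sphere 0 1)) {r : ℝ} (hr : 0 < r) :
    Continuous (radialExtension f r) := by
  rw [continuous_iff_continuousAt]
  intro x
  by_cases hx : x = 0
  · subst hx
    obtain ⟨M, hM⟩ := (isCompact_sphere (0 : EuclideanSpace ℝ (Fin n)) 1).exists_bound_of_continuousOn hf
    have h0 : radialExtension f r 0 = 0 := by simp [radialExtension]
    rw [ContinuousAt, h0]
    have hlim : Filter.Tendsto (fun y : EuclideanSpace ℝ (Fin n) => ‖y‖ / r * M) (nhds 0)
        (nhds (‖(0 : EuclideanSpace ℝ (Fin n))‖ / r * M)) := Continuous.tendsto (by fun_prop) _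
    rw [norm_zero, zero_div, zero_mul] at hlim
    refine squeeze_zero_norm (fun y => ?_) hlim
    by_cases hy : y = 0
    · simp [hy, radialExtension]
    · have h1 := hM _ (mem_sphere_zero_iff_norm.2 (norm_inv_smul_self hy))
      rw [radialExtension, norm_smul, Real.norm_of_nonneg (by positivity)]
      exact mul_le_mul (min_le_right _ _) h1 (norm_nonneg _) (by positivity)
  · have h1 : Filter.Tendsto (fun y : EuclideanSpace ℝ (Fin n) => ‖y‖⁻¹ • y) (nhds x)
        (nhdsWithin (‖x‖⁻¹ • x) (Metric.sphere 0 1)) := by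
      refine tendsto_nhdsWithin_iff.2 ⟨?_, ?_⟩
      · exact (continuous_norm.tendsto x).inv₀ (norm_ne_zero_iff.2 hx) |>.smul Filter.tendsto_id
      · filter_upwards [isOpen_ne.mem_nhds hx] with y hy
        exact mem_sphere_zero_iff_norm.2 (norm_inv_smul_self hy)
    have h2 := (hf _ (mem_sphere_zero_iff_norm.2 (norm_inv_smul_self hx))).tendsto.comp h1
    have h3 : Filter.Tendsto (fun y : EuclideanSpace ℝ (Fin n) => min 1 (‖y‖ / r)) (nhds x)
        (nhds (min 1 (‖x‖ / r))) := Continuous.tendsto (by fun_prop) _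
    exact h3.smul h2

/-- The union of the caps of slope `ρ` around the points of a fiber. -/
def fiberCap (f : EuclideanSpace ℝ (Fin n) → Fin m → ℝ) (z : Fin m → ℝ) (ρ : ℝ) :
    Set (EuclideanSpace ℝ (Fin n)) :=
  {y | ∃ p, ‖p‖ = 1 ∧ f p = z ∧ y ∈ cap ρ p}

theorem isClosed_setOf_mem_fiberCap {f : EuclideanSpace ℝ (Fin n) → Fin m → ℝ}
    (hf : ContinuousOn f (Metric.sphere 0 1)) :
    IsClosed {a : (Fin m → ℝ) × ℝ × EuclideanSpace ℝ (Fin n) | a.2.2 ∈ fiberCap f a.1 a.2.1} := by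
  set S := Metric.sphere (0 : EuclideanSpace ℝ (Fin n)) 1
  have : CompactSpace S := isCompact_iff_compactSpace.1 (isCompact_sphere _ _)
  have hf' : Continuous fun p : S => f p := continuousOn_iff_continuous_domRestrict.1 hf
  have h : IsClosed {b : S × (Fin m → ℝ) × ℝ × EuclideanSpace ℝ (Fin n) |
      f b.1 = b.2.1 ∧ ‖b.2.2.2 - ⟪(b.1 : EuclideanSpace ℝ (Fin n)), b.2.2.2⟫ • b.1.1‖ ≤
        b.2.2.1 * ⟪(b.1 : EuclideanSpace ℝ (Fin n)), b.2.2.2⟫} := by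
    have h1 : IsClosed {b : S × (Fin m → ℝ) × ℝ × EuclideanSpace ℝ (Fin n) | f b.1 = b.2.1} :=
      isClosed_eq (hf'.comp continuous_fst) (by fun_prop)
    have h2 : IsClosed {b : S × (Fin m → ℝ) × ℝ × EuclideanSpace ℝ (Fin n) |
        ‖b.2.2.2 - ⟪(b.1 : EuclideanSpace ℝ (Fin n)), b.2.2.2⟫ • b.1.1‖ ≤
          b.2.2.1 * ⟪(b.1 : EuclideanSpace ℝ (Fin n)), b.2.2.2⟫} :=
      isClosed_le (by fun_prop) (by fun_prop)
    exact h1.inter h2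
  convert isClosedMap_snd_of_compactSpace _ h using 1
  ext ⟨z, ρ, y⟩
  constructor
  · rintro ⟨p, hp, hz, hy⟩
    exact ⟨(⟨p, mem_sphere_zero_iff_norm.2 hp⟩, (z, ρ, y)), ⟨hz, hy⟩, rfl⟩
  · rintro ⟨⟨p, w⟩, ⟨hz, hy⟩, rfl⟩
    exact ⟨p.1, mem_sphere_zero_iff_norm.1 p.2, hz, hy⟩

theorem isClosed_fiberCap {f : EuclideanSpace ℝ (Fin n) → Fin m → ℝ}
    (hf : ContinuousOn f (Metric.sphere 0 1)) (z : Fin m → ℝ) (ρ : ℝ) :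
    IsClosed (fiberCap f z ρ) :=
  (isClosed_setOf_mem_fiberCap hf).preimage
    (show Continuous fun y : EuclideanSpace ℝ (Fin n) => (z, ρ, y) by fun_prop)

theorem le_mul_volume_of_tendsto {T : ℕ → Set (EuclideanSpace ℝ (Fin n))}
    {T' : Set (EuclideanSpace ℝ (Fin n))} (hT : ∀ k, MeasurableSet (T k))
    (hB : ∀ k, T k ⊆ Metric.closedBall 0 1)
    (hT' : ∀ y, (∃ᶠ k in Filter.atTop, y ∈ T k) → y ∈ T') {c : ℕ → ℝ≥0∞} {c' b : ℝ≥0∞} (hb : b ≠ ⊤)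
    (hc : Filter.Tendsto c Filter.atTop (nhds c')) (h : ∀ᶠ k in Filter.atTop, c k ≤ b * volume (T k)) :
    c' ≤ b * volume T' := by
  set W : ℕ → Set (EuclideanSpace ℝ (Fin n)) := fun k => ⋃ j ≥ k, T j
  have hWB : ∀ k, W k ⊆ Metric.closedBall 0 1 := fun k => Set.iUnion₂_subset fun j _ => hB j
  have hW : Filter.Tendsto (fun k => volume (W k)) Filter.atTop (nhds (volume (⋂ k, W k))) := by
    refine tendsto_measure_iInter_atTop
      (fun k => (MeasurableSet.iUnion fun j => MeasurableSet.iUnion fun _ => hT j).nullMeasurableSet)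
      (fun k l hkl => ?_) ⟨0, ne_top_of_le_ne_top measure_closedBall_lt_top.ne (measure_mono (hWB 0))⟩
    exact Set.iUnion₂_subset fun j hj => Set.subset_iUnion₂_of_subset j (hkl.trans hj) subset_rfl
  have h1 := le_of_tendsto_of_tendsto hc (ENNReal.Tendsto.const_mul hW (Or.inr hb))
    (h.mono fun k hk => hk.trans (mul_le_mul_right (measure_mono
      (Set.subset_iUnion₂_of_subset k le_rfl subset_rfl)) _))
  refine h1.trans (mul_le_mul_right (measure_mono fun y hy => hT' y ?_) _)
  rw [Filter.frequently_atTop]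
  intro k
  obtain ⟨j, hj, hyj⟩ := Set.mem_iUnion₂.1 (Set.mem_iInter.1 hy k)
  exact ⟨j, hj, hyj⟩

theorem IsThinAround.mono {K : Set (EuclideanSpace ℝ (Fin n))} {δ δ' : ℝ} (h : IsThinAround m K δ)
    (hδ : δ ≤ δ') : IsThinAround m K δ' := fun p hp hp1 => by
  obtain ⟨T, hT, hTK⟩ := h p hp hp1
  exact ⟨T, hT, fun y hy => (hTK y hy).trans (mul_le_mul_of_nonneg_right hδ (norm_nonneg y))⟩

theorem exists_fiber_finite (hm : 0 < m) (hn : m + 2 ≤ n)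
    {f : EuclideanSpace ℝ (Fin n) → Fin m → ℝ} (hf : ContinuousOn f (Metric.sphere 0 1))
    {ρ ρ₂ : ℕ → ℝ} (hρ0 : ∀ j, 0 < ρ j) (hρ : ∀ j, ρ j < ρ₂ j) {θ : ℝ} (hθ0 : 0 < θ) (hθ1 : θ < 1)
    (N : ℕ) : ∃ z ∈ f '' Metric.sphere 0 1, ∀ j ≤ N,
      ENNReal.ofReal (1 - θ) * gnom n m (ρ j) *
        volume (Metric.closedBall (0 : EuclideanSpace ℝ (Fin n)) 1) ≤
      gnomTotal n m * volume (fiberCap f z (ρ₂ j) ∩ Metric.closedBall 0 1) := by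
  have h1 : ∀ j ∈ Finset.range (N + 1), ∀ᶠ r in nhdsWithin (0 : ℝ) (Set.Ioi 0),
      ∀ᶠ δ in nhdsWithin (0 : ℝ) (Set.Ioi 0), ∀ K : Set (EuclideanSpace ℝ (Fin n)),
      IsClosedCone K → 0 < locVol K 1 0 → IsThinAround m K δ → ∀ c, IsCenter K r c →
      r ≤ ‖c‖ ∧ ENNReal.ofReal (1 - θ) * gnom n m (ρ j) * volume (K ∩ Metric.closedBall 0 1) ≤
        gnomTotal n m * volume (K ∩ cap (ρ₂ j) (‖c‖⁻¹ • c) ∩ Metric.closedBall 0 1) := by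
    intro j _
    obtain ⟨r₀, hr₀, h⟩ := gnom_mul_volume_le hm hn (hρ0 j) (hρ j) hθ0 hθ1
    filter_upwards [Ioo_mem_nhdsGT hr₀] with r hr
    obtain ⟨δ₀, hδ₀, h⟩ := h r hr.1 hr.2
    filter_upwards [Ioo_mem_nhdsGT hδ₀] with δ hδ K hK hV hT
    exact h K hK hV (hT.mono hδ.2.le)
  rw [← Filter.eventually_all_finset] at h1
  obtain ⟨r, h2, hr⟩ := (h1.and self_mem_nhdsWithin).exists
  rw [← Filter.eventually_all_finset] at h2
  obtain ⟨δ, ⟨h3, hδ⟩, hδ1⟩ := ((h2.and self_mem_nhdsWithin).and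
    (Ioo_mem_nhdsGT (show (0 : ℝ) < 1 by norm_num))).exists
  obtain ⟨z, hz⟩ := exists_partition (n := n) (m := m) (δ := δ) (r := r) hδ hr
    (continuous_radialExtension hf hr)
  have hthin : ∀ K : Set (EuclideanSpace ℝ (Fin n)), IsClosedCone K →
      (∀ q : Fin (m + 2) → EuclideanSpace ℝ (Fin n), (∀ j, q j ∈ K) → ¬ IsSpread δ q) →
      IsThinAround m K δ := fun K hK hq =>
    isThinAround_of_forall_not_isSpread (by omega) hK hδ1.2.le hq
  have hval : ∀ c : EuclideanSpace ℝ (Fin n), radialExtension f r c = z → r ≤ ‖c‖ →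
      ‖‖c‖⁻¹ • c‖ = 1 ∧ f (‖c‖⁻¹ • c) = z := fun c hc hrc =>
    ⟨norm_inv_smul_self (norm_pos_iff.1 (lt_of_lt_of_le hr hrc)),
      by rwa [radialExtension_of_le hr hrc] at hc⟩
  refine ⟨z, ?_, fun j hj => ?_⟩
  · by_contra hcon
    have h4 := hz ∅ 1 0 MeasurableSet.empty fun K hK hV hq c hc hFc => by
      obtain ⟨h5, -⟩ := h3 0 (by simp) K hK hV (hthin K hK hq) c hc
      obtain ⟨h6, h7⟩ := hval c hFc h5
      exact absurd ⟨_, mem_sphere_zero_iff_norm.2 h6, h7⟩ hcon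
    rw [one_mul, zero_mul] at h4
    exact (Metric.measure_closedBall_pos volume (0 : EuclideanSpace ℝ (Fin n)) one_pos).not_ge h4
  · refine hz _ _ _ ((isClosed_fiberCap hf _ _).inter Metric.isClosed_closedBall).measurableSet
      fun K hK hV hq c hc hFc => ?_
    obtain ⟨h5, h6⟩ := h3 j (by simpa [Nat.lt_succ_iff] using hj) K hK hV (hthin K hK hq) c hc
    obtain ⟨h7, h8⟩ := hval c hFc h5
    refine h6.trans (mul_le_mul_right (measure_mono ?_) _)
    rintro y ⟨⟨hy, hyc⟩, hyB⟩
    exact ⟨hy, ⟨_, h7, h8, hyc⟩, hyB⟩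

theorem gnom_mono {ρ ρ' : ℝ} (h : ρ ≤ ρ') : gnom n m ρ ≤ gnom n m ρ' :=
  lintegral_mono_set (Metric.closedBall_subset_closedBall h)

/-- The waist inequality in terms of volumes of cones. -/
theorem exists_fiber (hm : 0 < m) (hn : m + 2 ≤ n)
    {f : EuclideanSpace ℝ (Fin n) → Fin m → ℝ} (hf : ContinuousOn f (Metric.sphere 0 1)) :
    ∃ z ∈ f '' Metric.sphere 0 1, ∀ ρ : ℝ, 0 < ρ →
      gnom n m ρ * volume (Metric.closedBall (0 : EuclideanSpace ℝ (Fin n)) 1) ≤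
      gnomTotal n m * volume (fiberCap f z ρ ∩ Metric.closedBall 0 1) := by
  have htop : gnomTotal n m ≠ ⊤ := by
    have := (gnomTotal_ne (k := n - m) (by omega) m).2
    rwa [Nat.sub_add_cancel (by omega)] at this
  set B := volume (Metric.closedBall (0 : EuclideanSpace ℝ (Fin n)) 1)
  have hne : Nonempty {q : ℚ // 0 < q} := ⟨⟨1, one_pos⟩⟩
  obtain ⟨e, he⟩ := exists_surjective_nat {q : ℚ // 0 < q}
  set ρ : ℕ → ℝ := fun j => ((e j).1 : ℝ) with hρ
  have hρ0 : ∀ j, 0 < ρ j := fun j => Rat.cast_pos.2 (e j).2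
  have hstage := fun N : ℕ => exists_fiber_finite hm hn hf (ρ := ρ)
    (ρ₂ := fun j => ρ j + 1 / ((N : ℝ) + 1)) hρ0 (fun j => lt_add_of_pos_right _ (by positivity))
    (θ := 1 / ((N : ℝ) + 2)) (by positivity)
    ((div_lt_one (by positivity)).2 (by have : (0 : ℝ) ≤ N := N.cast_nonneg; linarith)) N
  choose z hz hineq using hstage
  obtain ⟨z', hz', φ, hφ, hlim⟩ := ((isCompact_sphere _ _).image_of_continuousOn hf).tendsto_subseq hz
  have hinv : Filter.Tendsto (fun k => 1 / (((φ k : ℕ) : ℝ) + 1)) Filter.atTop (nhds 0) :=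
    tendsto_one_div_add_atTop_nhds_zero_nat.comp hφ.tendsto_atTop
  have hinv2 : Filter.Tendsto (fun k => 1 / (((φ k : ℕ) : ℝ) + 2)) Filter.atTop (nhds 0) := by
    refine squeeze_zero (fun k => by positivity) (fun k => ?_) hinv
    gcongr
    norm_num
  have hrat : ∀ j, gnom n m (ρ j) * B ≤
      gnomTotal n m * volume (fiberCap f z' (ρ j) ∩ Metric.closedBall 0 1) := by
    intro j
    refine le_mul_volume_of_tendsto
      (T := fun k => fiberCap f (z (φ k)) (ρ j + 1 / ((φ k : ℝ) + 1)) ∩ Metric.closedBall 0 1)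
      (c := fun k => ENNReal.ofReal (1 - 1 / ((φ k : ℝ) + 2)) * (gnom n m (ρ j) * B))
      (fun k => ((isClosed_fiberCap hf _ _).inter Metric.isClosed_closedBall).measurableSet)
      (fun k => Set.inter_subset_right) (fun y hy => ?_) htop ?_ ?_
    · obtain ⟨k, -, hyB⟩ := hy.exists
      refine ⟨?_, hyB⟩
      have h1 : Filter.Tendsto (fun k => (z (φ k), ρ j + 1 / ((φ k : ℝ) + 1), y)) Filter.atTop
          (nhds (z', ρ j + 0, y)) :=
        hlim.prodMk_nhds ((tendsto_const_nhds.add hinv).prodMk_nhds tendsto_const_nhds)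
      rw [add_zero] at h1
      exact (isClosed_setOf_mem_fiberCap hf).mem_of_frequently_of_tendsto
        (hy.mono fun k hk => hk.1) h1
    · have h1 : Filter.Tendsto (fun k => ENNReal.ofReal (1 - 1 / ((φ k : ℝ) + 2))) Filter.atTop
          (nhds (ENNReal.ofReal (1 - 0))) := ENNReal.tendsto_ofReal (tendsto_const_nhds.sub hinv2)
      rw [sub_zero, ENNReal.ofReal_one] at h1
      simpa using ENNReal.Tendsto.mul_const h1 (Or.inl one_ne_zero) (b := gnom n m (ρ j) * B)
    · filter_upwards [hφ.tendsto_atTop.eventually_ge_atTop j] with k hk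
      rw [← mul_assoc]
      exact hineq (φ k) j hk
  refine ⟨z', hz', fun s hs => ?_⟩
  have hq : ∀ k : ℕ, ∃ j, s < ρ j ∧ ρ j < s + 1 / ((k : ℝ) + 1) := fun k => by
    obtain ⟨q, h1, h2⟩ := exists_rat_btwn (lt_add_of_pos_right s (show 0 < 1 / ((k : ℝ) + 1) by positivity))
    obtain ⟨j, hj⟩ := he ⟨q, by exact_mod_cast hs.trans h1⟩
    exact ⟨j, by simpa [hρ, hj] using h1, by simpa [hρ, hj] using h2⟩
  choose j hj1 hj2 using hq
  have hjlim : Filter.Tendsto (fun k => ρ (j k)) Filter.atTop (nhds s) := by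
    have h1 : Filter.Tendsto (fun k : ℕ => s + 1 / ((k : ℝ) + 1)) Filter.atTop (nhds (s + 0)) :=
      tendsto_const_nhds.add tendsto_one_div_add_atTop_nhds_zero_nat
    rw [add_zero] at h1
    exact tendsto_of_tendsto_of_tendsto_of_le_of_le tendsto_const_nhds h1 (fun k => (hj1 k).le)
      fun k => (hj2 k).le
  refine le_mul_volume_of_tendsto
    (T := fun k => fiberCap f z' (ρ (j k)) ∩ Metric.closedBall 0 1) (c := fun _ => gnom n m s * B)
    (fun k => ((isClosed_fiberCap hf _ _).inter Metric.isClosed_closedBall).measurableSet)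
    (fun k => Set.inter_subset_right) (fun y hy => ?_) htop tendsto_const_nhds
    (Filter.Eventually.of_forall fun k => ?_)
  · obtain ⟨k, -, hyB⟩ := hy.exists
    refine ⟨?_, hyB⟩
    have h1 : Filter.Tendsto (fun k => (z', ρ (j k), y)) Filter.atTop (nhds (z', s, y)) :=
      tendsto_const_nhds.prodMk_nhds (hjlim.prodMk_nhds tendsto_const_nhds)
    exact (isClosed_setOf_mem_fiberCap hf).mem_of_frequently_of_tendsto
      (hy.mono fun k hk => hk.1) h1
  · exact (mul_le_mul_left (gnom_mono (hj1 k).le) _).trans (hrat (j k))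

end Waist

namespace Waist
open scoped ENNReal

theorem measure_le_mul_of_tendsto {X : Type*} [MetricSpace X] [SecondCountableTopology X]
    [MeasurableSpace X] [BorelSpace X] (μ ν : Measure X) [IsFiniteMeasure μ] [IsFiniteMeasure ν]
    {r : ℕ → ℝ} (hr : Filter.Tendsto r Filter.atTop (nhds 0)) {a b : ℕ → ℝ≥0∞}
    (ha : ∀ k, ∀ᵐ y ∂ν, μ (Metric.ball y (r k)) = a k)
    (hb : ∀ k, ∀ᵐ x ∂μ, ν (Metric.ball x (r k)) = b k) (hb0 : ∀ k, b k ≠ 0) {c : ℝ≥0∞}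
    (hc : Filter.Tendsto (fun k => a k / b k) Filter.atTop (nhds c)) {U : Set X} (hU : IsOpen U) :
    μ U ≤ c * ν U := by
  by_cases hμ : μ = 0
  · simp [hμ]
  have hbt : ∀ k, b k ≠ ⊤ := fun k => by
    have : NeZero μ := ⟨hμ⟩
    obtain ⟨x, hx⟩ := (hb k).exists
    exact hx ▸ measure_ne_top ν _
  have hmeas : ∀ k, MeasurableSet {p : X × X | dist p.2 p.1 < r k} := fun k =>
    (isOpen_lt (by fun_prop) continuous_const).measurableSet
  have hset : ∀ k (x : X), Prod.mk x ⁻¹' {p : X × X | dist p.2 p.1 < r k} = Metric.ball x (r k) :=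
    fun k x => rfl
  have hswap : ∀ k, ∫⁻ x in U, ν (U ∩ Metric.ball x (r k)) ∂μ =
      ∫⁻ y in U, μ (U ∩ Metric.ball y (r k)) ∂ν := by
    intro k
    have h1 := Measure.prod_apply (μ := μ.restrict U) (ν := ν.restrict U) (hmeas k)
    have h2 := Measure.prod_apply_symm (μ := μ.restrict U) (ν := ν.restrict U) (hmeas k)
    rw [h1] at h2
    convert h2 using 1
    · refine lintegral_congr fun x => ?_
      rw [hset, Measure.restrict_apply Metric.isOpen_ball.measurableSet, Set.inter_comm]
    · refine lintegral_congr fun y => ?_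
      have : (fun x => (x, y)) ⁻¹' {p : X × X | dist p.2 p.1 < r k} = Metric.ball y (r k) := by
        ext x; simp [dist_comm]
      rw [this, Measure.restrict_apply Metric.isOpen_ball.measurableSet, Set.inter_comm]
  have hle : ∀ k, ∫⁻ x in U, ν (U ∩ Metric.ball x (r k)) / b k ∂μ ≤ a k / b k * ν U := by
    intro k
    simp only [div_eq_mul_inv]
    rw [lintegral_mul_const' _ _ (ENNReal.inv_ne_top.2 (hb0 k)), hswap k, mul_right_comm]
    refine mul_le_mul_left ?_ _
    calc ∫⁻ y in U, μ (U ∩ Metric.ball y (r k)) ∂ν ≤ ∫⁻ _ in U, a k ∂ν := by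
          refine lintegral_mono_ae ((ae_restrict_of_ae (ha k)).mono fun y hy => ?_)
          exact (measure_mono Set.inter_subset_right).trans hy.le
      _ = a k * ν U := by rw [setLIntegral_const]
  have hfatou : μ U ≤ ∫⁻ x in U, Filter.liminf (fun k => ν (U ∩ Metric.ball x (r k)) / b k)
      Filter.atTop ∂μ := by
    rw [← setLIntegral_one]
    refine lintegral_mono_ae ?_
    filter_upwards [ae_restrict_mem hU.measurableSet, ae_restrict_of_ae (ae_all_iff.2 hb)] with x hx hbx
    refine Filter.le_liminf_of_le (by isBoundedDefault) ?_
    obtain ⟨s, hs, hsU⟩ := Metric.isOpen_iff.1 hU x hx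
    filter_upwards [hr.eventually (gt_mem_nhds hs)] with k hk
    rw [Set.inter_eq_right.2 ((Metric.ball_subset_ball hk.le).trans hsU), hbx k,
      ENNReal.div_self (hb0 k) (hbt k)]
  refine hfatou.trans ((lintegral_liminf_le' fun k => ?_).trans ?_)
  · have := measurable_measure_prodMk_left (ν := ν.restrict U) (hmeas k)
    refine Measurable.aemeasurable ?_
    refine Measurable.div_const ?_ _
    convert this using 2 with x
    rw [hset, Measure.restrict_apply Metric.isOpen_ball.measurableSet, Set.inter_comm]
  · have h1 : Filter.Tendsto (fun k => a k / b k * ν U) Filter.atTop (nhds (c * ν U)) :=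
      ENNReal.Tendsto.mul_const hc (Or.inr (measure_ne_top ν U))
    rw [← h1.liminf_eq]
    exact Filter.liminf_le_liminf (Filter.Eventually.of_forall hle)

variable {n : ℕ}

/-- A measure on the sphere that is invariant under linear isometries. -/
structure IsSphereMeasure (μ : Measure (EuclideanSpace ℝ (Fin n))) : Prop where
  compl_sphere : μ (Metric.sphere 0 1)ᶜ = 0
  preimage : ∀ (T : EuclideanSpace ℝ (Fin n) ≃ₗᵢ[ℝ] EuclideanSpace ℝ (Fin n))
    (A : Set (EuclideanSpace ℝ (Fin n))), MeasurableSet A → μ (T ⁻¹' A) = μ A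

theorem exists_isometry_apply_eq {x y : EuclideanSpace ℝ (Fin n)} (h : ‖x‖ = ‖y‖) :
    ∃ T : EuclideanSpace ℝ (Fin n) ≃ₗᵢ[ℝ] EuclideanSpace ℝ (Fin n), T x = y :=
  ⟨_, Submodule.reflection_sub h⟩

theorem IsSphereMeasure.measure_ball {μ : Measure (EuclideanSpace ℝ (Fin n))}
    (h : IsSphereMeasure μ) {x y : EuclideanSpace ℝ (Fin n)} (hxy : ‖x‖ = ‖y‖) (r : ℝ) :
    μ (Metric.ball x r) = μ (Metric.ball y r) := by
  obtain ⟨T, rfl⟩ := exists_isometry_apply_eq hxy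
  have h1 := h.preimage T (Metric.ball (T x) r) Metric.isOpen_ball.measurableSet
  rwa [T.isometry.preimage_ball] at h1

theorem IsSphereMeasure.ae_mem {μ : Measure (EuclideanSpace ℝ (Fin n))}
    (h : IsSphereMeasure μ) : ∀ᵐ x ∂μ, ‖x‖ = 1 := by
  have : ∀ᵐ x ∂μ, x ∈ Metric.sphere 0 1 := h.compl_sphere
  filter_upwards [this] with x hx using mem_sphere_zero_iff_norm.1 hx

theorem IsSphereMeasure.measure_ball_ne_zero {μ : Measure (EuclideanSpace ℝ (Fin n))}
    (h : IsSphereMeasure μ) (hμ : μ ≠ 0) {x : EuclideanSpace ℝ (Fin n)} (hx : ‖x‖ = 1) {r : ℝ}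
    (hr : 0 < r) : μ (Metric.ball x r) ≠ 0 := by
  intro h0
  have h1 : μ (Metric.sphere 0 1) = 0 := by
    refine (isCompact_sphere _ _).measure_zero_of_nhdsWithin fun y hy =>
      ⟨_, mem_nhdsWithin_of_mem_nhds (Metric.ball_mem_nhds y hr), ?_⟩
    rw [← h0]
    exact h.measure_ball ((mem_sphere_zero_iff_norm.1 hy).trans hx.symm) r
  refine hμ (Measure.measure_univ_eq_zero.1 ?_)
  rw [← Set.union_compl_self (Metric.sphere (0 : EuclideanSpace ℝ (Fin n)) 1)]
  exact measure_union_null h1 h.compl_sphere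

theorem IsSphereMeasure.measure_ball_eq_top {μ : Measure (EuclideanSpace ℝ (Fin n))}
    (h : IsSphereMeasure μ) (hμ : μ (Metric.sphere 0 1) = ⊤) {x : EuclideanSpace ℝ (Fin n)}
    (hx : ‖x‖ = 1) {r : ℝ} (hr : 0 < r) : μ (Metric.ball x r) = ⊤ := by
  by_contra h0
  refine ((isCompact_sphere _ _).measure_lt_top_of_nhdsWithin fun y hy =>
      ⟨_, mem_nhdsWithin_of_mem_nhds (Metric.ball_mem_nhds y hr), ?_⟩).ne hμ
  rw [h.measure_ball ((mem_sphere_zero_iff_norm.1 hy).trans hx.symm) r]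
  exact Ne.lt_top h0

theorem IsSphereMeasure.exists_eq_smul {μ ν : Measure (EuclideanSpace ℝ (Fin n))}
    [IsFiniteMeasure μ] [IsFiniteMeasure ν] (hμ : IsSphereMeasure μ) (hν : IsSphereMeasure ν)
    (hν0 : ν ≠ 0) : ∃ c : ℝ≥0∞, μ = c • ν := by
  by_cases hμ0 : μ = 0
  · exact ⟨0, by simp [hμ0]⟩
  obtain ⟨x, hx⟩ : ∃ x : EuclideanSpace ℝ (Fin n), ‖x‖ = 1 := by
    have : NeZero ν := ⟨hν0⟩
    exact hν.ae_mem.exists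
  obtain ⟨c, φ, hφ, hc⟩ := CompactSpace.tendsto_subseq fun k : ℕ =>
    μ (Metric.ball x (1 / ((k : ℝ) + 1))) / ν (Metric.ball x (1 / ((k : ℝ) + 1)))
  set r : ℕ → ℝ := fun k => 1 / ((φ k : ℝ) + 1)
  have hr0 : ∀ k, 0 < r k := fun k => Nat.one_div_pos_of_nat
  have hr : Filter.Tendsto r Filter.atTop (nhds 0) :=
    tendsto_one_div_add_atTop_nhds_zero_nat.comp hφ.tendsto_atTop
  have key : ∀ {μ ν : Measure (EuclideanSpace ℝ (Fin n))} [IsFiniteMeasure μ] [IsFiniteMeasure ν]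
      (_ : IsSphereMeasure μ) (_ : IsSphereMeasure ν) (_ : ν ≠ 0) {c : ℝ≥0∞}
      (_ : Filter.Tendsto (fun k => μ (Metric.ball x (r k)) / ν (Metric.ball x (r k))) Filter.atTop
        (nhds c)) {U : Set (EuclideanSpace ℝ (Fin n))} (_ : IsOpen U), μ U ≤ c * ν U :=
    fun {μ ν} _ _ hμ hν hν0 _ hc _ hU => measure_le_mul_of_tendsto μ ν hr
      (fun k => hν.ae_mem.mono fun y hy => hμ.measure_ball (hy.trans hx.symm) _)
      (fun k => hμ.ae_mem.mono fun y hy => hν.measure_ball (hy.trans hx.symm) _)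
      (fun k => hν.measure_ball_ne_zero hν0 hx (hr0 k)) hc hU
  have h1 : ∀ U : Set (EuclideanSpace ℝ (Fin n)), IsOpen U → μ U ≤ c * ν U := fun U hU =>
    key hμ hν hν0 hc hU
  have h2 : ∀ U : Set (EuclideanSpace ℝ (Fin n)), IsOpen U → ν U ≤ c⁻¹ * μ U := fun U hU => by
    refine key hν hμ hμ0 ?_ hU
    have := tendsto_inv_iff.2 hc
    refine this.congr fun k => ?_
    exact ENNReal.inv_div (Or.inl (measure_ne_top _ _))
      (Or.inl (hν.measure_ball_ne_zero hν0 hx (hr0 k)))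
  have hc0 : c ≠ 0 := fun h => hμ0 (Measure.measure_univ_eq_zero.1
    (le_antisymm ((h1 _ isOpen_univ).trans (by simp [h])) bot_le))
  have hct : c ≠ ⊤ := fun h => hν0 (Measure.measure_univ_eq_zero.1
    (le_antisymm ((h2 _ isOpen_univ).trans (by simp [h])) bot_le))
  have h3 : ∀ U : Set (EuclideanSpace ℝ (Fin n)), IsOpen U → μ U = (c • ν) U := fun U hU => by
    refine le_antisymm (h1 U hU) ?_
    calc c * ν U ≤ c * (c⁻¹ * μ U) := mul_le_mul_right (h2 U hU) _
      _ = μ U := by rw [← mul_assoc, ENNReal.mul_inv_cancel hc0 hct, one_mul]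
  refine ⟨c, ext_of_generate_finite {U | IsOpen U} ?_ isPiSystem_isOpen (fun U hU => h3 U hU)
    (h3 _ isOpen_univ)⟩
  exact BorelSpace.measurable_eq

/-- The cone measure on the unit sphere. -/
noncomputable def coneMeasure (n : ℕ) : Measure (EuclideanSpace ℝ (Fin n)) :=
  (volume.restrict (Metric.closedBall 0 1)).map fun x => ‖x‖⁻¹ • x

theorem measurable_inv_norm_smul :
    Measurable fun x : EuclideanSpace ℝ (Fin n) => ‖x‖⁻¹ • x :=
  measurable_norm.inv.smul measurable_id

theorem coneMeasure_apply {A : Set (EuclideanSpace ℝ (Fin n))} (hA : MeasurableSet A) :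
    coneMeasure n A =
      volume ({x : EuclideanSpace ℝ (Fin n) | ‖x‖⁻¹ • x ∈ A} ∩ Metric.closedBall 0 1) := by
  rw [coneMeasure, Measure.map_apply measurable_inv_norm_smul hA,
    Measure.restrict_apply (measurable_inv_norm_smul hA)]
  rfl

instance : IsFiniteMeasure (coneMeasure n) := by
  have : IsFiniteMeasure ((volume : Measure (EuclideanSpace ℝ (Fin n))).restrict
      (Metric.closedBall 0 1)) := ⟨by
    rw [Measure.restrict_apply_univ]; exact measure_closedBall_lt_top⟩
  exact Measure.isFiniteMeasure_map _ _

theorem isSphereMeasure_coneMeasure (hn : 0 < n) : IsSphereMeasure (coneMeasure n) where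
  compl_sphere := by
    have : NeZero n := ⟨hn.ne'⟩
    rw [coneMeasure_apply Metric.isClosed_sphere.measurableSet.compl]
    refine measure_mono_null (t := {0}) (fun x hx => ?_) (measure_singleton _)
    by_contra h0
    exact hx.1 (mem_sphere_zero_iff_norm.2 (norm_inv_smul_self h0))
  preimage T A hA := by
    rw [coneMeasure_apply hA, coneMeasure_apply (T.continuous.measurable hA)]
    have h1 := ((measurable_inv_norm_smul hA).inter
      (Metric.isClosed_closedBall (x := 0) (ε := 1)).measurableSet).nullMeasurableSet (μ := volume)
    refine Eq.trans ?_ (T.measurePreserving.measure_preimage h1)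
    congr 1
    ext x
    simp

theorem coneMeasure_ne_zero : coneMeasure n ≠ 0 := by
  intro h
  have h1 := coneMeasure_apply (n := n) MeasurableSet.univ
  rw [h] at h1
  simp only [Set.mem_univ, Set.ofPred_true, Set.univ_inter, Measure.coe_zero, Pi.zero_apply] at h1
  exact (Metric.measure_closedBall_pos volume (0 : EuclideanSpace ℝ (Fin n)) one_pos).ne h1

theorem coneMeasure_inter_sphere (hn : 0 < n) {C : Set (EuclideanSpace ℝ (Fin n))}
    (hC : MeasurableSet C) (hcone : ∀ x ∈ C, ∀ t : ℝ, 0 < t → t • x ∈ C) :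
    coneMeasure n (C ∩ Metric.sphere 0 1) = volume (C ∩ Metric.closedBall 0 1) := by
  have : NeZero n := ⟨hn.ne'⟩
  rw [coneMeasure_apply (hC.inter Metric.isClosed_sphere.measurableSet)]
  refine measure_congr ?_
  have h0 : ∀ᵐ x : EuclideanSpace ℝ (Fin n), x ≠ 0 := Measure.ae_ne volume 0
  filter_upwards [h0] with x hx
  have hpos := norm_pos_iff.2 hx
  refine propext (and_congr_left fun _ => ⟨fun h => ?_, fun h => ?_⟩)
  · have := hcone _ h.1 ‖x‖ hpos
    rwa [smul_smul, mul_inv_cancel₀ hpos.ne', one_smul] at this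
  · exact ⟨hcone _ h _ (inv_pos.2 hpos), mem_sphere_zero_iff_norm.2 (norm_inv_smul_self hx)⟩

theorem isSphereMeasure_hausdorff (d : ℝ) :
    IsSphereMeasure ((μH[d] : Measure (EuclideanSpace ℝ (Fin n))).restrict (Metric.sphere 0 1)) where
  compl_sphere := by
    rw [Measure.restrict_apply Metric.isClosed_sphere.measurableSet.compl]
    simp
  preimage T A hA := by
    rw [Measure.restrict_apply hA, Measure.restrict_apply (T.continuous.measurable hA),
      ← T.toIsometryEquiv.hausdorffMeasure_preimage d (A ∩ Metric.sphere 0 1)]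
    congr 1
    ext x
    simp

end Waist

namespace Waist
open scoped ENNReal

theorem exists_splitting {N k m : ℕ} (hN : N = k + m) :
    ∃ Φ : EuclideanSpace ℝ (Fin N) ≃L[ℝ] EuclideanSpace ℝ (Fin k) × EuclideanSpace ℝ (Fin m),
      (∀ x, ‖x‖ ^ 2 = ‖(Φ x).1‖ ^ 2 + ‖(Φ x).2‖ ^ 2) ∧
      ∀ x, (∀ i : Fin N, k ≤ (i : ℕ) → x i = 0) → (Φ x).2 = 0 := by
  subst hN
  refine ⟨EuclideanSpace.finAddEquivProd, fun x => ?_, fun x hx => ?_⟩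
  · have h1 := WithLp.prod_norm_sq_eq_of_L2 (PiLp.sumPiLpEquivProdLpPiLp (𝕜 := ℝ) 2 (fun _ : Fin k ⊕ Fin m => ℝ)
      (LinearIsometryEquiv.piLpCongrLeft 2 ℝ ℝ (finSumFinEquiv (m := k) (n := m)).symm x))
    rw [LinearIsometryEquiv.norm_map, LinearIsometryEquiv.norm_map] at h1
    exact h1
  · ext j
    exact hx (Fin.natAdd k j) (Nat.le_add_right _ _)

variable {d m k : ℕ}

theorem geodesicNbhd_subset_slope {Φ : EuclideanSpace ℝ (Fin (d + 1)) ≃L[ℝ]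
      EuclideanSpace ℝ (Fin k) × EuclideanSpace ℝ (Fin m)}
    (hΦ : ∀ x, ‖x‖ ^ 2 = ‖(Φ x).1‖ ^ 2 + ‖(Φ x).2‖ ^ 2) {A : Set (EuclideanSpace ℝ (Fin (d + 1)))}
    (hA : ∀ x ∈ A, ‖x‖ = 1 ∧ (Φ x).2 = 0) {ε : ℝ} (hε0 : 0 < ε) (hε : ε < Real.pi / 2) :
    geodesicNbhd A ε ⊆ {x | ‖(Φ x).2‖ ≤ Real.tan ε * ‖(Φ x).1‖} ∩ Metric.sphere 0 1 := by
  rintro y ⟨hy, x, hx, hxy⟩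
  refine ⟨?_, hy⟩
  obtain ⟨hx1, hx2⟩ := hA x hx
  have hy1 := mem_sphere_zero_iff_norm.1 hy
  have hcos : Real.cos ε ≤ ⟪x, y⟫ := by
    have h1 := abs_le.1 (abs_real_inner_le_norm x y)
    rw [hx1, hy1, one_mul] at h1
    have h2 := Real.cos_le_cos_of_nonneg_of_le_pi (Real.arccos_nonneg _) (by linarith) hxy
    rwa [Real.cos_arccos h1.1 h1.2] at h2
  have hx3 : ‖(Φ x).1‖ = 1 := by
    have h1 := hΦ x
    rw [hx1, hx2, norm_zero] at h1
    nlinarith [norm_nonneg (Φ x).1]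
  have h1 : ⟪x, y⟫ ≤ ‖(Φ y).1‖ := by
    have h2 := hΦ (x - y)
    rw [map_sub, Prod.fst_sub, Prod.snd_sub, hx2, zero_sub, norm_neg, norm_sub_sq_real, hx1, hy1] at h2
    have h3 := abs_le.1 (abs_norm_sub_norm_le (Φ x).1 (Φ y).1)
    have h4 := hΦ y
    rw [hy1] at h4
    have h5 : (‖(Φ x).1‖ - ‖(Φ y).1‖) ^ 2 ≤ ‖(Φ x).1 - (Φ y).1‖ ^ 2 :=
      sq_le_sq' h3.1 h3.2
    rw [hx3] at h5
    nlinarith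
  have hc := Real.cos_pos_of_mem_Ioo ⟨by linarith [Real.pi_pos], hε⟩
  have hs := Real.sin_pos_of_pos_of_lt_pi hε0 (by linarith)
  have h2 : ‖(Φ y).2‖ ≤ Real.sin ε := by
    refine abs_le_of_sq_le_sq' ?_ hs.le |>.2
    have h4 := hΦ y
    rw [hy1] at h4
    nlinarith [Real.sin_sq_add_cos_sq ε]
  refine h2.trans ?_
  calc Real.sin ε = Real.tan ε * Real.cos ε := (Real.tan_mul_cos hc.ne').symm
    _ ≤ Real.tan ε * ‖(Φ y).1‖ :=
      mul_le_mul_of_nonneg_left (hcos.trans h1) (Real.tan_nonneg_of_nonneg_of_le_pi_div_two hε0.le hε.le)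

theorem fiberCap_subset_geodesicNbhd {f : EuclideanSpace ℝ (Fin (d + 1)) → Fin m → ℝ}
    {z : Fin m → ℝ} {ρ ε : ℝ} (hρ : 0 < ρ) (h : Real.arctan ρ ≤ ε) :
    fiberCap f z ρ ∩ Metric.sphere 0 1 ⊆
      geodesicNbhd {x | x ∈ Metric.sphere 0 1 ∧ f x = z} ε := by
  rintro y ⟨⟨p, hp, hz, hy⟩, hyS⟩
  refine ⟨hyS, p, ⟨mem_sphere_zero_iff_norm.2 hp, hz⟩, le_trans ?_ h⟩
  have hy1 := mem_sphere_zero_iff_norm.1 hyS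
  change ‖y - ⟪p, y⟫ • p‖ ≤ ρ * ⟪p, y⟫ at hy
  set t := ⟪p, y⟫ with ht
  have h0 : 0 ≤ t := nonneg_of_mul_nonneg_right ((norm_nonneg _).trans hy) hρ
  have h1 : ‖y - t • p‖ ^ 2 = 1 - t ^ 2 := by
    rw [norm_sub_sq_real, real_inner_smul_right, real_inner_comm, ← ht, norm_smul, hy1, hp,
      Real.norm_of_nonneg h0]
    ring
  have h2 : 1 - t ^ 2 ≤ (ρ * t) ^ 2 := h1 ▸ pow_le_pow_left₀ (norm_nonneg _) hy 2
  have h3 : Real.cos (Real.arctan ρ) ≤ t := by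
    rw [Real.cos_arctan, div_le_iff₀ (by positivity)]
    refine (abs_le_of_sq_le_sq' ?_ (by positivity)).2
    rw [mul_pow, Real.sq_sqrt (by positivity)]
    nlinarith
  calc Real.arccos t ≤ Real.arccos (Real.cos (Real.arctan ρ)) := Real.arccos_le_arccos h3
    _ = Real.arctan ρ := Real.arccos_cos (Real.arctan_nonneg.2 hρ.le)
      (by linarith [Real.arctan_lt_pi_div_two ρ, Real.pi_pos])

theorem exists_ball_subset_geodesicNbhd {A : Set (EuclideanSpace ℝ (Fin (d + 1)))}
    {x : EuclideanSpace ℝ (Fin (d + 1))} (hx : x ∈ A) (hx1 : ‖x‖ = 1) {ε : ℝ} (hε : 0 < ε) :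
    ∃ r > 0, Metric.ball x r ∩ Metric.sphere 0 1 ⊆ geodesicNbhd A ε := by
  have h1 : IsOpen {y : EuclideanSpace ℝ (Fin (d + 1)) | Real.arccos ⟪x, y⟫ < ε} :=
    isOpen_lt (Real.continuous_arccos.comp (by fun_prop)) continuous_const
  obtain ⟨r, hr, hsub⟩ := Metric.isOpen_iff.1 h1 x (by
    change Real.arccos ⟪x, x⟫ < ε
    rwa [real_inner_self_eq_norm_sq, hx1, one_pow, Real.arccos_one])
  exact ⟨r, hr, fun y hy => ⟨hy.2, x, hx, (hsub hy.1).le⟩⟩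

end Waist

namespace Waist
open scoped ENNReal

variable {d m : ℕ}

/-- The Borsuk–Ulam theorem. -/
theorem exists_antipodal {f : EuclideanSpace ℝ (Fin (d + 1)) → EuclideanSpace ℝ (Fin d)}
    (hf : ContinuousOn f (Metric.sphere 0 1)) : ∃ p, ‖p‖ = 1 ∧ f (-p) = f p := by
  set root : TreeNode 1 := ⟨[], by simp⟩
  set p : (TreeNode 1 → Fin (d + 1) → ℝ) → EuclideanSpace ℝ (Fin (d + 1)) := fun x =>
    ‖WithLp.toLp 2 (x root)‖⁻¹ • WithLp.toLp 2 (x root) with hp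
  have hne : ∀ x ∈ SignCocycle.cubeSpheres (TreeNode 1) (d + 1),
      WithLp.toLp 2 (x root) ≠ (0 : EuclideanSpace ℝ (Fin (d + 1))) := fun x hx h0 => by
    have h1 : x root = 0 := by simpa using congrArg WithLp.ofLp h0
    have h2 := hx root
    rw [h1, norm_zero] at h2
    exact zero_ne_one h2
  have hp1 : ∀ x ∈ SignCocycle.cubeSpheres (TreeNode 1) (d + 1), ‖p x‖ = 1 := fun x hx =>
    norm_inv_smul_self (hne x hx)
  have hpc : ContinuousOn p (SignCocycle.cubeSpheres (TreeNode 1) (d + 1)) := by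
    have h1 : Continuous fun x : TreeNode 1 → Fin (d + 1) → ℝ =>
        (WithLp.toLp 2 (x root) : EuclideanSpace ℝ (Fin (d + 1))) := by fun_prop
    exact (h1.norm.continuousOn.inv₀ fun x hx => norm_ne_zero_iff.2 (hne x hx)).smul h1.continuousOn
  have hunit : ∀ (u : ℤˣ) (y : EuclideanSpace ℝ (Fin (d + 1))), ‖y‖ = 1 →
      ‖((u : ℤ) : ℝ) • y‖ = 1 := fun u y hy => by
    rcases Int.units_eq_one_or u with rfl | rfl <;> simp [hy]
  obtain ⟨x, hx, hbal⟩ := exists_balanced 1 d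
    (fun x v => WithLp.ofLp (f ((((v.prod : ℤˣ) : ℤ) : ℝ) • p x)))
    (fun v _ => by
      have h1 : ContinuousOn (fun x => (((v.prod : ℤˣ) : ℤ) : ℝ) • p x)
          (SignCocycle.cubeSpheres (TreeNode 1) (d + 1)) :=
        (continuous_const_smul (((v.prod : ℤˣ) : ℤ) : ℝ)).comp_continuousOn hpc
      exact (PiLp.continuous_ofLp 2 _).comp_continuousOn (hf.comp h1
        fun x hx => mem_sphere_zero_iff_norm.2 (hunit _ _ (hp1 x hx))))
    (fun s x hx v hv => by
      obtain ⟨b, rfl⟩ := List.length_eq_one_iff.1 hv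
      have h1 : SignCocycle.act s x root = s.1 [] • x root := by
        rw [SignCocycle.act, TreeSign.sgn_def]
        rfl
      congr 2
      simp only [hp, h1, flipWord, List.prod_cons, List.prod_nil, mul_one]
      rcases Int.units_eq_one_or (s.1 []) with h | h <;> simp [h])
  refine ⟨p x, hp1 x hx, ?_⟩
  have h1 := hbal [1] 0 rfl
  have h2 := hbal [-1] 0 rfl
  rw [← h1] at h2
  have h3 := smul_right_injective _ (show ((2 : ℝ) ^ 1) ≠ 0 by norm_num) h2
  simpa [subtreeSum] using WithLp.ofLp_injective 2 h3

theorem waist_of_eq {f : EuclideanSpace ℝ (Fin (d + 1)) → EuclideanSpace ℝ (Fin d)}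
    (hf : ContinuousOn f (Metric.sphere 0 1)) : ∃ z, ∀ ε : ℝ, 0 < ε →
      μH[(d : ℝ)] (geodesicNbhd (equatorialSubsphere d d) ε) ≤
        μH[(d : ℝ)] (geodesicNbhd {x | x ∈ Metric.sphere 0 1 ∧ f x = z} ε) := by
  obtain ⟨p, hp1, hp⟩ := exists_antipodal hf
  obtain ⟨T, hT⟩ := exists_isometry_apply_eq
    (x := (EuclideanSpace.single 0 1 : EuclideanSpace ℝ (Fin (d + 1)))) (y := p) (by simp [hp1])
  refine ⟨f p, fun ε _ => ?_⟩
  refine le_trans (measure_mono ?_) (T.toIsometryEquiv.hausdorffMeasure_preimage _ _).le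
  rintro y ⟨hy, x, ⟨hx1, hx⟩, hxy⟩
  rw [mem_sphere_zero_iff_norm] at hx1 hy
  refine ⟨mem_sphere_zero_iff_norm.2 ((T.norm_map y).trans hy), T x,
    ⟨mem_sphere_zero_iff_norm.2 ((T.norm_map x).trans hx1), ?_⟩, ?_⟩
  · have h1 : x = x 0 • EuclideanSpace.single 0 1 := by
      ext i
      by_cases hi : i = 0
      · simp [hi]
      · rw [hx i (by have := Fin.val_ne_zero_iff.2 hi; omega)]
        simp [hi]
    have h2 : |x 0| = 1 := by
      rw [h1, norm_smul] at hx1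
      simpa using hx1
    rw [h1, map_smul, hT]
    rcases eq_or_eq_neg_of_abs_eq h2 with h | h
    · rw [h, one_smul]
    · rw [h, neg_smul, one_smul, hp]
  · exact (congrArg Real.arccos (T.inner_map_map x y)).trans_le hxy

theorem exists_fiber_coneMeasure (hm : 0 < m) (hmd : m < d)
    {Φ : EuclideanSpace ℝ (Fin (d + 1)) ≃L[ℝ]
      EuclideanSpace ℝ (Fin (d - m + 1)) × EuclideanSpace ℝ (Fin m)}
    (hΦ : ∀ x, ‖x‖ ^ 2 = ‖(Φ x).1‖ ^ 2 + ‖(Φ x).2‖ ^ 2)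
    {f : EuclideanSpace ℝ (Fin (d + 1)) → Fin m → ℝ} (hf : ContinuousOn f (Metric.sphere 0 1)) :
    ∃ z ∈ f '' Metric.sphere 0 1, ∀ ρ : ℝ, 0 < ρ →
      coneMeasure (d + 1) ({x | ‖(Φ x).2‖ ≤ ρ * ‖(Φ x).1‖} ∩ Metric.sphere 0 1) ≤
        coneMeasure (d + 1) (fiberCap f z ρ ∩ Metric.sphere 0 1) := by
  obtain ⟨z, hz, h⟩ := exists_fiber hm (by omega) hf
  refine ⟨z, hz, fun ρ hρ => ?_⟩
  have hdm : d + 1 = (d - m + 1) + m := by omega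
  obtain ⟨h0, ht⟩ := gnomTotal_ne (k := d - m + 1) (Nat.succ_pos _) m
  rw [← hdm] at h0 ht
  have hclosed : IsClosed {x | ‖(Φ x).2‖ ≤ ρ * ‖(Φ x).1‖} :=
    isClosed_le (by fun_prop) (by fun_prop)
  rw [coneMeasure_inter_sphere (Nat.succ_pos d) hclosed.measurableSet,
    coneMeasure_inter_sphere (Nat.succ_pos d) (isClosed_fiberCap hf z ρ).measurableSet]
  · have h1 := h ρ hρ
    rw [← gnomTotal_mul_volume_slope (Nat.succ_pos _) hdm Φ hΦ ρ] at h1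
    exact (ENNReal.mul_le_mul_iff_right h0 ht).1 h1
  · rintro x ⟨p, hp, hz, hx⟩ t ht
    exact ⟨p, hp, hz, (isClosedCone_cap ρ p).smul_mem ht.le hx⟩
  · intro x hx t ht
    change ‖(Φ x).2‖ ≤ ρ * ‖(Φ x).1‖ at hx
    change ‖(Φ (t • x)).2‖ ≤ ρ * ‖(Φ (t • x)).1‖
    rw [map_smul, Prod.smul_fst, Prod.smul_snd, norm_smul, norm_smul, mul_left_comm]
    exact mul_le_mul_of_nonneg_left hx (norm_nonneg t)

theorem coneMeasure_sphere_le {k : ℕ} (hk : 0 < k) {Φ : EuclideanSpace ℝ (Fin (d + 1)) ≃L[ℝ]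
      EuclideanSpace ℝ (Fin k) × EuclideanSpace ℝ (Fin m)} {b : ℝ≥0∞}
    (h : ∀ ρ : ℝ, 0 < ρ →
      coneMeasure (d + 1) ({x | ‖(Φ x).2‖ ≤ ρ * ‖(Φ x).1‖} ∩ Metric.sphere 0 1) ≤ b) :
    coneMeasure (d + 1) (Metric.sphere 0 1) ≤ b := by
  set V : Submodule ℝ (EuclideanSpace ℝ (Fin (d + 1))) :=
    LinearMap.ker ((LinearMap.fst ℝ _ _).comp Φ.toLinearEquiv.toLinearMap) with hV
  have hmem : ∀ x, x ∈ V ↔ (Φ x).1 = 0 := fun x => Iff.rfl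
  have hVtop : V ≠ ⊤ := fun htop => by
    have h1 : Φ.symm (EuclideanSpace.single ⟨0, hk⟩ 1, 0) ∈ V := htop ▸ Submodule.mem_top
    rw [hmem, Φ.apply_symm_apply] at h1
    simpa using congrArg (fun v : EuclideanSpace ℝ (Fin k) => v ⟨0, hk⟩) h1
  have hV0 : coneMeasure (d + 1) (V ∩ Metric.sphere 0 1) = 0 := by
    rw [coneMeasure_inter_sphere (Nat.succ_pos d) V.closed_of_finiteDimensional.measurableSet
      fun x hx t _ => V.smul_mem t hx]
    exact measure_mono_null Set.inter_subset_left (Measure.addHaar_submodule volume V hVtop)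
  set W : ℕ → Set (EuclideanSpace ℝ (Fin (d + 1))) := fun j =>
    {x | ‖(Φ x).2‖ ≤ ((j : ℝ) + 1) * ‖(Φ x).1‖} ∩ Metric.sphere 0 1
  have hW : Monotone W := fun i j hij x hx => by
    refine ⟨le_trans hx.1 (mul_le_mul_of_nonneg_right ?_ (norm_nonneg _)), hx.2⟩
    have : (i : ℝ) ≤ j := by exact_mod_cast hij
    linarith
  have hcov : Metric.sphere 0 1 ⊆ (⋃ j, W j) ∪ (V ∩ Metric.sphere 0 1) := fun x hx => by
    by_cases h0 : (Φ x).1 = 0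
    · exact Or.inr ⟨(hmem x).2 h0, hx⟩
    · obtain ⟨j, hj⟩ := exists_nat_ge (‖(Φ x).2‖ / ‖(Φ x).1‖)
      have hpos := norm_pos_iff.2 h0
      refine Or.inl (Set.mem_iUnion.2 ⟨j, ?_, hx⟩)
      rw [div_le_iff₀ hpos] at hj
      change ‖(Φ x).2‖ ≤ ((j : ℝ) + 1) * ‖(Φ x).1‖
      nlinarith
  calc coneMeasure (d + 1) (Metric.sphere 0 1)
      ≤ coneMeasure (d + 1) (⋃ j, W j) + coneMeasure (d + 1) (V ∩ Metric.sphere 0 1) :=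
        (measure_mono hcov).trans (measure_union_le _ _)
    _ = ⨆ j, coneMeasure (d + 1) (W j) := by rw [hV0, add_zero, hW.measure_iUnion]
    _ ≤ b := iSup_le fun j => h _ (by positivity)

theorem hausdorffMeasure_geodesicNbhd_le {k : ℕ} (hk : 0 < k)
    {Φ : EuclideanSpace ℝ (Fin (d + 1)) ≃L[ℝ]
      EuclideanSpace ℝ (Fin k) × EuclideanSpace ℝ (Fin m)}
    (hΦ : ∀ x, ‖x‖ ^ 2 = ‖(Φ x).1‖ ^ 2 + ‖(Φ x).2‖ ^ 2)
    {A : Set (EuclideanSpace ℝ (Fin (d + 1)))} (hA : ∀ x ∈ A, ‖x‖ = 1 ∧ (Φ x).2 = 0)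
    {f : EuclideanSpace ℝ (Fin (d + 1)) → Fin m → ℝ} {z : Fin m → ℝ}
    (hz : z ∈ f '' Metric.sphere 0 1)
    (h : ∀ ρ : ℝ, 0 < ρ →
      coneMeasure (d + 1) ({x | ‖(Φ x).2‖ ≤ ρ * ‖(Φ x).1‖} ∩ Metric.sphere 0 1) ≤
        coneMeasure (d + 1) (fiberCap f z ρ ∩ Metric.sphere 0 1)) {ε : ℝ} (hε : 0 < ε) (s : ℝ) :
    μH[s] (geodesicNbhd A ε) ≤
      μH[s] (geodesicNbhd {x | x ∈ Metric.sphere 0 1 ∧ f x = z} ε) := by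
  have hS := isSphereMeasure_hausdorff (n := d + 1) s
  set S := Metric.sphere (0 : EuclideanSpace ℝ (Fin (d + 1))) 1
  have hself : ∀ B ⊆ S, μH[s] B = (μH[s] : Measure _).restrict S B := fun B hB =>
    (Measure.restrict_eq_self _ hB).symm
  set G := geodesicNbhd {x | x ∈ S ∧ f x = z} ε
  have hGS : G ⊆ S := fun x hx => hx.1
  have hAS : geodesicNbhd A ε ⊆ S := fun x hx => hx.1
  by_cases htop : μH[s] S = ⊤
  · obtain ⟨x, hx, hfx⟩ := hz
    have hx1 := mem_sphere_zero_iff_norm.1 hx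
    obtain ⟨r, hr, hsub⟩ := exists_ball_subset_geodesicNbhd (ε := ε)
      (show x ∈ {x | x ∈ S ∧ f x = z} from ⟨hx, hfx⟩) hx1 hε
    have h1 := hS.measure_ball_eq_top (by rwa [Measure.restrict_apply_self]) hx1 hr
    rw [Measure.restrict_apply Metric.isOpen_ball.measurableSet] at h1
    exact le_top.trans (h1.ge.trans (measure_mono hsub))
  have hfin : IsFiniteMeasure ((μH[s] : Measure (EuclideanSpace ℝ (Fin (d + 1)))).restrict S) :=
    ⟨by rw [Measure.restrict_apply_univ]; exact Ne.lt_top htop⟩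
  obtain ⟨c, hc⟩ := hS.exists_eq_smul (isSphereMeasure_coneMeasure (Nat.succ_pos d))
    coneMeasure_ne_zero
  have hcone : ∀ B ⊆ S, μH[s] B = c * coneMeasure (d + 1) B := fun B hB => by
    rw [hself B hB, hc]
    rfl
  rw [hcone _ hAS, hcone _ hGS]
  refine mul_le_mul_right ?_ _
  by_cases hε' : ε < Real.pi / 2
  · have htan := Real.tan_pos_of_pos_of_lt_pi_div_two hε hε'
    refine (measure_mono (geodesicNbhd_subset_slope hΦ hA hε hε')).trans ((h _ htan).trans
      (measure_mono (fiberCap_subset_geodesicNbhd htan (le_of_eq ?_))))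
    exact Real.arctan_tan (by linarith) hε'
  · refine (measure_mono hAS).trans (coneMeasure_sphere_le hk (Φ := Φ) fun ρ hρ => (h ρ hρ).trans
      (measure_mono (fiberCap_subset_geodesicNbhd hρ ?_)))
    exact (Real.arctan_lt_pi_div_two ρ).le.trans (not_lt.1 hε')

end Waist

/-- Gromov–Memarian waist of the sphere theorem: for every continuous map
`f : S^d → ℝ^m` (with `1 ≤ m ≤ d`) there is a point `z ∈ ℝ^m` such that for
every `ε > 0` the `d`-dimensional volume (Hausdorff measure) of the geodesic
`ε`-neighborhood of the fiber `f⁻¹(z)` is at least that of the geodesic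
`ε`-neighborhood of the equatorial subsphere `S^(d-m)`. -/
theorem gromov_memarian_waist (d m : ℕ) (hm : 1 ≤ m) (hmd : m ≤ d)
    (f : EuclideanSpace ℝ (Fin (d + 1)) → EuclideanSpace ℝ (Fin m))
    (hf : ContinuousOn f (Metric.sphere (0 : EuclideanSpace ℝ (Fin (d + 1))) 1)) :
    ∃ z : EuclideanSpace ℝ (Fin m), ∀ ε : ℝ, 0 < ε →
      μH[(d : ℝ)] (geodesicNbhd (equatorialSubsphere d m) ε) ≤
        μH[(d : ℝ)] (geodesicNbhd
          {x | x ∈ Metric.sphere (0 : EuclideanSpace ℝ (Fin (d + 1))) 1 ∧ f x = z} ε) := by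
  rcases hmd.eq_or_lt with rfl | hlt
  · exact Waist.waist_of_eq hf
  obtain ⟨Φ, hΦ, hΦ0⟩ := Waist.exists_splitting (show d + 1 = (d - m + 1) + m by omega)
  have hf' : ContinuousOn (fun x => WithLp.ofLp (f x)) (Metric.sphere 0 1) :=
    (PiLp.continuous_ofLp 2 _).comp_continuousOn hf
  obtain ⟨z, hz, h⟩ := Waist.exists_fiber_coneMeasure hm hlt hΦ hf'
  refine ⟨WithLp.toLp 2 z, fun ε hε => ?_⟩
  have h1 := Waist.hausdorffMeasure_geodesicNbhd_le (Nat.succ_pos _) hΦ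
    (A := equatorialSubsphere d m)
    (fun x hx => ⟨mem_sphere_zero_iff_norm.1 hx.1, hΦ0 x hx.2⟩) hz h hε (d : ℝ)
  refine h1.trans (measure_mono ?_)
  rintro y ⟨hy, x, ⟨hx, hxz⟩, hxy⟩
  exact ⟨hy, x, ⟨hx, by rw [← hxz]⟩, hxy⟩
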